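/- Let α ∈ (0,2) and let c ∈ ℂ be nonzero with |arg c| < θ₀(α), where θ₀(α) is the unique zero of ρ_α in (t₀(α), min(π, πα)). Then the system of eigenfunctions of 𝓛_{c,α} is complete in L²((0,∞), ℂ). -/

import Mathlib

open MeasureTheory Set

/-- `t₀(α) = 2πα/(α+2)`. -/
noncomputable def t0 (α : ℝ) : ℝ := 2 * Real.pi * α / (α + 2)

/-- `Z₀(θ) = (sin t₀(α) / sin θ)^(1/α)`. -/
noncomputable def Z0 (α θ : ℝ) : ℝ := (Real.sin (t0 α) / Real.sin θ) ^ (1 / α)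

/-- `y` is an eigenfunction of the Dirichlet operator `𝓛_{c,α} = −d²/dx² + c·x^α` on
`L²(0,∞)` with eigenvalue `lam`. -/
def IsEigenfunction (α : ℝ) (c lam : ℂ) (y : ℝ → ℂ) : Prop :=
  ContinuousOn y (Set.Ici 0) ∧
  y 0 = 0 ∧
  (∃ x ≥ (0 : ℝ), y x ≠ 0) ∧
  (∃ y' : ℝ → ℂ,
    (∀ x ∈ Set.Ioi (0 : ℝ), HasDerivAt y (y' x) x) ∧
    (∀ x ∈ Set.Ioi (0 : ℝ), HasDerivAt y' ((c * ((x ^ α : ℝ) : ℂ) - lam) * y x) x)) ∧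
  MeasureTheory.IntegrableOn (fun x => ‖y x‖ ^ 2) (Set.Ioi 0)

/-- The system of eigenfunctions of `𝓛_{c,α}` is complete in `L²((0,∞),ℂ)`. -/
def EigenfunctionsComplete (α : ℝ) (c : ℂ) : Prop :=
  closure ((Submodule.span ℂ
      {F : MeasureTheory.Lp ℂ 2 (MeasureTheory.volume.restrict (Set.Ioi (0 : ℝ))) |
        ∃ lam : ℂ, ∃ y : ℝ → ℂ, IsEigenfunction α c lam y ∧
          ∀ᵐ x ∂(MeasureTheory.volume.restrict (Set.Ioi (0 : ℝ))), F x = y x} :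
      Submodule ℂ (MeasureTheory.Lp ℂ 2 (MeasureTheory.volume.restrict (Set.Ioi (0 : ℝ))))) :
    Set (MeasureTheory.Lp ℂ 2 (MeasureTheory.volume.restrict (Set.Ioi (0 : ℝ))))) = Set.univ

namespace PowerPotential

open Complex Filter Topology

/-- A pointwise limit of locally uniformly bounded holomorphic functions is holomorphic. -/
lemma differentiableOn_of_tendsto_of_bounded {Ω : Set ℂ} (hΩ : IsOpen Ω) {F : ℕ → ℂ → ℂ}
    {f : ℂ → ℂ} (hF : ∀ n, DifferentiableOn ℂ (F n) Ω)
    (hb : ∀ z ∈ Ω, ∃ r > 0, ∃ B : ℝ, ∀ n, ∀ w ∈ Metric.ball z r, w ∈ Ω → ‖F n w‖ ≤ B)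
    (hlim : ∀ z ∈ Ω, Tendsto (fun n => F n z) atTop (𝓝 (f z))) :
    DifferentiableOn ℂ f Ω := by
  intro z hz
  obtain ⟨r₁, hr₁, B, hB⟩ := hb z hz
  obtain ⟨r₂, hr₂, hr₂Ω⟩ := Metric.isOpen_iff.1 hΩ z hz
  set R := min r₁ r₂ / 2 with hR
  have hR0 : 0 < R := by have := lt_min hr₁ hr₂; positivity
  have hmin : R < min r₁ r₂ := by rw [hR]; linarith [lt_min hr₁ hr₂]
  have hsub : Metric.closedBall z R ⊆ Ω := fun w hw =>
    hr₂Ω (lt_of_le_of_lt (Metric.mem_closedBall.1 hw) (hmin.trans_le (min_le_right _ _)))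
  have hBR : ∀ n, ∀ w ∈ Metric.closedBall z R, ‖F n w‖ ≤ B := fun n w hw =>
    hB n w (lt_of_le_of_lt (Metric.mem_closedBall.1 hw) (hmin.trans_le (min_le_left _ _))) (hsub hw)
  have hmem : ∀ θ : ℝ, circleMap z R θ ∈ Metric.closedBall z R := fun θ =>
    circleMap_mem_closedBall z hR0.le θ
  have hcont : ∀ n, Continuous fun θ : ℝ => F n (circleMap z R θ) := fun n =>
    ((hF n).continuousOn.mono hsub).comp_continuous (continuous_circleMap z R) hmem
  have hmeas : Measurable fun θ : ℝ => f (circleMap z R θ) :=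
    measurable_of_tendsto_metrizable (fun n => (hcont n).measurable)
      (tendsto_pi_nhds.2 fun θ => hlim _ (hsub (hmem θ)))
  have hfb : ∀ w ∈ Metric.closedBall z R, ‖f w‖ ≤ B := fun w hw =>
    le_of_tendsto (hlim w (hsub hw)).norm (Eventually.of_forall fun n => hBR n w hw)
  have hci : CircleIntegrable f z R := by
    unfold CircleIntegrable
    rw [intervalIntegrable_iff, uIoc_of_le Real.two_pi_pos.le]
    exact ⟨hmeas.aestronglyMeasurable,
      HasFiniteIntegral.of_bounded (C := B) (Eventually.of_forall fun θ => hfb _ (hmem θ))⟩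
  have key : ∀ w ∈ Metric.ball z R,
      (2 * Real.pi * I : ℂ)⁻¹ • (∮ ζ in C(z, R), (ζ - w)⁻¹ • f ζ) = f w := by
    intro w hw
    have h1 : ∀ n, (2 * Real.pi * I : ℂ)⁻¹ • (∮ ζ in C(z, R), (ζ - w)⁻¹ • F n ζ) = F n w := by
      intro n
      have hd := ((hF n).mono hsub).mono (Metric.closure_ball_subset_closedBall (x := z) (ε := R))
      exact hd.diffContOnCl.two_pi_i_inv_smul_circleIntegral_sub_inv_smul hw
    refine tendsto_nhds_unique ?_ ((hlim w (hsub (Metric.ball_subset_closedBall hw))).congr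
      fun n => (h1 n).symm)
    refine Tendsto.const_smul ?_ _
    have hne : ∀ θ : ℝ, circleMap z R θ - w ≠ 0 := fun θ h0 => by
      rw [sub_eq_zero] at h0
      have h3 := circleMap_mem_sphere z hR0.le θ
      rw [h0] at h3
      exact (ne_of_lt (Metric.mem_ball.1 hw)) (Metric.mem_sphere.1 h3)
    have hlow : ∀ θ : ℝ, R - dist w z ≤ ‖circleMap z R θ - w‖ := fun θ => by
      have h3 := Metric.mem_sphere.1 (circleMap_mem_sphere z hR0.le θ)
      have h4 := dist_triangle (circleMap z R θ) w z
      rw [dist_eq_norm (circleMap z R θ) w] at h4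
      linarith
    have hpos : 0 < R - dist w z := by linarith [Metric.mem_ball.1 hw]
    unfold circleIntegral
    refine intervalIntegral.tendsto_integral_filter_of_dominated_convergence
      (fun _ => R * ((R - dist w z)⁻¹ * B)) ?_ ?_ intervalIntegrable_const ?_
    · refine Eventually.of_forall fun n => Continuous.aestronglyMeasurable ?_
      have h5 : Continuous fun θ : ℝ => (circleMap z R θ - w)⁻¹ :=
        ((continuous_circleMap z R).sub continuous_const).inv₀ hne
      have h6 : Continuous (deriv (circleMap z R)) := by
        have : deriv (circleMap z R) = fun θ => circleMap 0 R θ * I := by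
          ext θ; exact deriv_circleMap z R θ
        rw [this]; exact (continuous_circleMap 0 R).mul continuous_const
      exact h6.smul (h5.smul (hcont n))
    · refine Eventually.of_forall fun n => Eventually.of_forall fun θ _ => ?_
      rw [norm_smul, norm_smul, norm_inv, deriv_circleMap, norm_mul, norm_I, mul_one,
        norm_circleMap_zero, abs_of_pos hR0]
      gcongr
      · exact hlow θ
      · exact hBR n _ (hmem θ)
    · exact Eventually.of_forall fun θ _ => ((hlim _ (hsub (hmem θ))).const_smul _).const_smul _
  have h2 : DifferentiableAt ℂ
      (fun w => (2 * Real.pi * I : ℂ)⁻¹ • (∮ ζ in C(z, R), (ζ - w)⁻¹ • f ζ)) z := by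
    have h3 : (0 : NNReal) < R.toNNReal := Real.toNNReal_pos.2 hR0
    have h4 : ((R.toNNReal : NNReal) : ℝ) = R := Real.coe_toNNReal R hR0.le
    have := hasFPowerSeriesOn_cauchy_integral (f := f) (c := z) (R := R.toNNReal)
      (by rw [h4]; exact hci) h3
    rw [h4] at this
    exact this.differentiableOn.differentiableAt (Metric.eball_mem_nhds z (by exact_mod_cast h3))
  refine DifferentiableAt.differentiableWithinAt (h2.congr_of_eventuallyEq ?_)
  filter_upwards [Metric.ball_mem_nhds z hR0] with w hw
  exact (key w hw).symm

/-- Integrals of holomorphic functions depending on a parameter are holomorphic. -/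
lemma differentiableOn_integral_of_bounded {X : Type*} [MeasurableSpace X] {ν : Measure X}
    {Ω : Set ℂ} (hΩ : IsOpen Ω) {F : ℂ → X → ℂ}
    (hm : ∀ z ∈ Ω, AEStronglyMeasurable (F z) ν)
    (hF : ∀ᵐ x ∂ν, DifferentiableOn ℂ (fun z => F z x) Ω)
    (hb : ∀ z ∈ Ω, ∃ r > 0, ∃ g : X → ℝ, Integrable g ν ∧
      ∀ᵐ x ∂ν, ∀ w ∈ Metric.ball z r, w ∈ Ω → ‖F w x‖ ≤ g x) :
    DifferentiableOn ℂ (fun z => ∫ x, F z x ∂ν) Ω := by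
  intro z hz
  obtain ⟨r₁, hr₁, g, hg, hbg⟩ := hb z hz
  obtain ⟨r₂, hr₂, hr₂Ω⟩ := Metric.isOpen_iff.1 hΩ z hz
  set R := min r₁ r₂ / 4 with hR
  have hR0 : 0 < R := by have := lt_min hr₁ hr₂; positivity
  have hmin : 2 * R < min r₁ r₂ := by rw [hR]; linarith [lt_min hr₁ hr₂]
  have hsub : Metric.ball z (2 * R) ⊆ Ω := fun w hw =>
    hr₂Ω (lt_trans (Metric.mem_ball.1 hw) (hmin.trans_le (min_le_right _ _)))
  have hsub1 : Metric.ball z (2 * R) ⊆ Metric.ball z r₁ := Metric.ball_subset_ball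
    (hmin.trans_le (min_le_left _ _)).le
  have hder : ∀ᵐ x ∂ν, ∀ w ∈ Metric.ball z R, HasDerivAt (fun z => F z x)
      (deriv (fun z => F z x) w) w := by
    filter_upwards [hF] with x hx w hw
    refine ((hx.differentiableAt (hΩ.mem_nhds (hsub ?_)))).hasDerivAt
    exact Metric.ball_subset_ball (by linarith) hw
  have := hasDerivAt_integral_of_dominated_loc_of_deriv_le (μ := ν) (F := F) (x₀ := z)
    (F' := fun w x => deriv (fun z => F z x) w) (bound := fun x => g x / (R / 2))
    (s := Metric.ball z R) (Metric.ball_mem_nhds z hR0) ?_ ?_ ?_ ?_ (hg.div_const _) hder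
  · exact this.2.differentiableAt.differentiableWithinAt
  · filter_upwards [hΩ.mem_nhds hz] with w hw using hm w hw
  · refine hg.mono' (hm z hz) ?_
    filter_upwards [hbg] with x hx using hx z (Metric.mem_ball_self hr₁) hz
  · have hu : Tendsto (fun n : ℕ => ((R / (n + 2) : ℝ) : ℂ)) atTop (𝓝[≠] 0) := by
      rw [tendsto_nhdsWithin_iff]
      constructor
      · have h1 : Tendsto (fun n : ℕ => R / ((n : ℝ) + 2)) atTop (𝓝 0) :=
          tendsto_const_nhds.div_atTop
            (tendsto_atTop_add_const_right _ _ tendsto_natCast_atTop_atTop)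
        have h2 := (Complex.continuous_ofReal.tendsto 0).comp h1
        simpa [Function.comp_def] using h2
      · refine Eventually.of_forall fun n => ?_
        have : R / ((n : ℝ) + 2) ≠ 0 := by positivity
        simpa only [mem_compl_iff, mem_singleton_iff, Complex.ofReal_eq_zero] using this
    refine aestronglyMeasurable_of_tendsto_ae atTop
      (f := fun (n : ℕ) x => ((R / (n + 2) : ℝ) : ℂ)⁻¹ •
        (F (z + ((R / (n + 2) : ℝ) : ℂ)) x - F z x)) (fun n => ?_) ?_
    · have h0 : z + ((R / (n + 2) : ℝ) : ℂ) ∈ Ω := hsub ?_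
      · exact ((hm _ h0).sub (hm z hz)).const_smul (((R / (n + 2) : ℝ) : ℂ)⁻¹)
      rw [Metric.mem_ball, dist_eq_norm, add_sub_cancel_left, Complex.norm_real, Real.norm_eq_abs,
        abs_of_pos (by positivity)]
      calc R / ((n : ℝ) + 2) ≤ R / 1 := by
            gcongr
            have : (0 : ℝ) ≤ n := Nat.cast_nonneg n
            linarith
        _ < 2 * R := by linarith
    · filter_upwards [hder] with x hx
      exact (hasDerivAt_iff_tendsto_slope_zero.1 (hx z (Metric.mem_ball_self hR0))).comp hu
  · filter_upwards [hbg, hF] with x hx hFx w hw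
    refine Complex.norm_deriv_le_of_forall_mem_sphere_norm_le (by positivity) ?_ fun ζ hζ => ?_
    · refine (hFx.mono ?_).diffContOnCl
      refine Metric.closure_ball_subset_closedBall.trans fun ζ hζ => hsub ?_
      have h1 := Metric.mem_closedBall.1 hζ
      have h2 := Metric.mem_ball.1 hw
      have h3 := dist_triangle ζ w z
      exact Metric.mem_ball.2 (by linarith)
    · have h1 := Metric.mem_sphere.1 hζ
      have h2 := Metric.mem_ball.1 hw
      have h3 := dist_triangle ζ w z
      have h4 : ζ ∈ Metric.ball z (2 * R) := Metric.mem_ball.2 (by linarith)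
      exact hx ζ (hsub1 h4) (hsub h4)

end PowerPotential

namespace PowerPotential

open Complex Filter Topology

/-- Coefficients of the series solutions of `y'' = (z ^ α - μ) y` at the origin. -/
noncomputable def coef (α : ℝ) (e : ℕ) : ℕ → ℕ → ℝ
  | 0, 0 => 1
  | 0, _ + 1 => 0
  | n + 1, 0 => coef α e n 0 / ((2 * n + e + 1) * (2 * n + e + 2))
  | n + 1, k + 1 => (coef α e n k + coef α e n (k + 1)) /
      ((α * (k + 1) + 2 * n + e + 1) * (α * (k + 1) + 2 * n + e + 2))

/-- The `n`-th Picard iterate in the logarithmic variable `w = log z`. -/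
noncomputable def term (α : ℝ) (e : ℕ) (μ : ℂ) (n : ℕ) (w : ℂ) : ℂ :=
  ∑ k ∈ Finset.range (n + 1),
    (coef α e n k : ℂ) * (-μ) ^ (n - k) * exp ((α * k + 2 * n + e : ℝ) * w)

/-- The series solution of `y'' = (z ^ α - μ) y` behaving like `z ^ e` at the origin, in the
variable `w = log z`. -/
noncomputable def G (α : ℝ) (e : ℕ) (μ w : ℂ) : ℂ := ∑' n, term α e μ n w

/-- The derivative of `G` in the logarithmic variable. -/
noncomputable def Gd (α : ℝ) (e : ℕ) (μ w : ℂ) : ℂ := deriv (G α e μ) w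

/-- The size parameter controlling the series `G`. -/
noncomputable def size (α m ξ : ℝ) : ℝ := Real.exp ((α + 2) * ξ) + m * Real.exp (2 * ξ)

variable {α : ℝ} {e : ℕ}

lemma coef_nonneg (hα : 0 < α) (n k : ℕ) : 0 ≤ coef α e n k := by
  induction n generalizing k with
  | zero => cases k <;> simp [coef]
  | succ n ih =>
    cases k with
    | zero => simp only [coef]; have := ih 0; positivity
    | succ k => simp only [coef]; have h1 := ih k; have h2 := ih (k + 1); positivity

lemma coef_eq_zero {n k : ℕ} (h : n < k) : coef α e n k = 0 := by
  induction n generalizing k with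
  | zero => cases k with
    | zero => omega
    | succ k => simp [coef]
  | succ n ih =>
    cases k with
    | zero => omega
    | succ k => simp [coef, ih (show n < k by omega), ih (show n < k + 1 by omega)]

lemma coef_le (hα : 0 < α) (n k : ℕ) : coef α e n k ≤ n.choose k / (2 * n).factorial := by
  induction n generalizing k with
  | zero => cases k <;> simp [coef]
  | succ n ih =>
    have hf : ((2 * (n + 1)).factorial : ℝ) = (2 * n + 1) * (2 * n + 2) * (2 * n).factorial := by
      rw [show 2 * (n + 1) = 2 * n + 1 + 1 by ring, Nat.factorial_succ, Nat.factorial_succ]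
      push_cast; ring
    have key : ∀ d c : ℝ, 0 ≤ d → 0 ≤ c → c ≤ d / (2 * n).factorial → ∀ b : ℝ, 0 ≤ b →
        c / ((b + 2 * n + e + 1) * (b + 2 * n + e + 2)) ≤ d / (2 * (n + 1)).factorial := by
      intro d c hd hc hcd b hb
      rw [hf]
      have he : (0 : ℝ) ≤ e := Nat.cast_nonneg e
      calc c / ((b + 2 * n + e + 1) * (b + 2 * n + e + 2)) 
          ≤ c / ((2 * n + 1) * (2 * n + 2)) := by
            gcongr <;> linarith
        _ ≤ (d / (2 * n).factorial) / ((2 * n + 1) * (2 * n + 2)) := by gcongr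
        _ = _ := by rw [div_div, mul_comm ((2 * n).factorial : ℝ)]
    cases k with
    | zero =>
      simp only [coef]
      have := key 1 (coef α e n 0) (by norm_num) (coef_nonneg hα _ _) (by simpa using ih 0) 0 le_rfl
      simpa using this
    | succ k =>
      simp only [coef]
      refine (key ((n + 1).choose (k + 1)) (coef α e n k + coef α e n (k + 1)) (by positivity)
        (add_nonneg (coef_nonneg hα _ _) (coef_nonneg hα _ _)) ?_ (α * (k + 1)) (by positivity))
      have h1 := ih k
      have h2 := ih (k + 1)
      rw [Nat.choose_succ_succ]
      push_cast
      rw [add_div]; linarith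

lemma size_nonneg {m : ℝ} (hm : 0 ≤ m) (ξ : ℝ) : 0 ≤ size α m ξ := by
  unfold size; positivity

lemma size_mono (hα : 0 < α) {m m' ξ ξ' : ℝ} (hm : 0 ≤ m) (hmm : m ≤ m') (h : ξ ≤ ξ') :
    size α m ξ ≤ size α m' ξ' := by
  unfold size
  have : (0:ℝ) ≤ m' := hm.trans hmm
  gcongr

lemma norm_term_le (hα : 0 < α) (μ w : ℂ) (n : ℕ) :
    ‖term α e μ n w‖ ≤ Real.exp (e * w.re) * (size α ‖μ‖ w.re ^ n / (2 * n).factorial) := by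
  unfold term
  refine (norm_sum_le _ _).trans ?_
  have : Real.exp (e * w.re) * (size α ‖μ‖ w.re ^ n / (2 * n).factorial) =
      ∑ k ∈ Finset.range (n + 1), (n.choose k / (2 * n).factorial : ℝ) * ‖μ‖ ^ (n - k) *
        Real.exp ((α * k + 2 * n + e : ℝ) * w.re) := by
    unfold size
    rw [add_pow, Finset.sum_div, Finset.mul_sum]
    refine Finset.sum_congr rfl fun k hk => ?_
    have hk' : k ≤ n := by simpa [Nat.lt_succ_iff] using hk
    have : Real.exp ((α * k + 2 * n + e : ℝ) * w.re) =
        Real.exp (e * w.re) * Real.exp ((α + 2) * w.re) ^ k * Real.exp (2 * w.re) ^ (n - k) := by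
      rw [← Real.exp_nat_mul, ← Real.exp_nat_mul, ← Real.exp_add, ← Real.exp_add, Nat.cast_sub hk']
      congr 1; ring
    rw [this, mul_pow]; ring
  rw [this]
  refine Finset.sum_le_sum fun k _ => ?_
  rw [norm_mul, norm_mul, norm_pow, norm_neg, Complex.norm_exp, Complex.norm_real,
    Real.norm_of_nonneg (coef_nonneg hα n k), Complex.re_ofReal_mul]
  gcongr
  exact coef_le hα n k

lemma hasSum_size {X : ℝ} (hX : 0 ≤ X) :
    HasSum (fun n : ℕ => X ^ n / (2 * n).factorial) (Real.cosh √X) := by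
  have h := Real.hasSum_cosh √X
  simpa only [pow_mul, Real.sq_sqrt hX] using h

/-- Partial sums of the series `G`. -/
noncomputable def psum (α : ℝ) (e : ℕ) (μ : ℂ) (N : ℕ) (w : ℂ) : ℂ :=
  ∑ n ∈ Finset.range N, term α e μ n w

lemma summable_term (hα : 0 < α) (μ w : ℂ) : Summable fun n => term α e μ n w :=
  Summable.of_norm_bounded
    ((hasSum_size (size_nonneg (norm_nonneg μ) w.re)).summable.mul_left _) (norm_term_le hα μ w)

lemma norm_psum_le (hα : 0 < α) (μ w : ℂ) (N : ℕ) :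
    ‖psum α e μ N w‖ ≤ Real.exp (e * w.re) * Real.cosh √(size α ‖μ‖ w.re) := by
  have hs := hasSum_size (size_nonneg (α := α) (norm_nonneg μ) w.re)
  refine (norm_sum_le _ _).trans ?_
  refine (Finset.sum_le_sum fun n _ => norm_term_le hα μ w n).trans ?_
  rw [← Finset.mul_sum]
  gcongr
  exact sum_le_hasSum _
    (fun n _ => by have := size_nonneg (α := α) (norm_nonneg μ) w.re; positivity)
    hs

lemma tendsto_psum (hα : 0 < α) (μ w : ℂ) :
    Tendsto (fun N => psum α e μ N w) atTop (𝓝 (G α e μ w)) :=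
  (summable_term hα μ w).hasSum.tendsto_sum_nat

lemma norm_G_le (hα : 0 < α) (μ w : ℂ) :
    ‖G α e μ w‖ ≤ Real.exp (e * w.re) * Real.cosh √(size α ‖μ‖ w.re) :=
  le_of_tendsto (tendsto_psum hα μ w).norm (Eventually.of_forall (norm_psum_le hα μ w))

lemma differentiable_term (μ : ℂ) (n : ℕ) : Differentiable ℂ (term α e μ n) := by
  unfold term; fun_prop

lemma differentiable_psum (μ : ℂ) (N : ℕ) : Differentiable ℂ (psum α e μ N) := by
  unfold psum
  exact Differentiable.fun_sum fun n _ => differentiable_term μ n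

lemma cosh_sqrt_le {X Y : ℝ} (h : X ≤ Y) : Real.cosh √X ≤ Real.cosh √Y := by
  rw [Real.cosh_le_cosh, abs_of_nonneg (Real.sqrt_nonneg _), abs_of_nonneg (Real.sqrt_nonneg _)]
  exact Real.sqrt_le_sqrt h

/-- An upper bound for the partial sums that is monotone in the real part. -/
lemma norm_psum_le_of_re_le (hα : 0 < α) {m T : ℝ} {μ w : ℂ} (hμ : ‖μ‖ ≤ m) (hw : w.re ≤ T)
    (N : ℕ) : ‖psum α e μ N w‖ ≤ Real.exp (e * T) * Real.cosh √(size α m T) := by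
  refine (norm_psum_le hα μ w N).trans ?_
  have he : (0 : ℝ) ≤ e := Nat.cast_nonneg e
  have := cosh_sqrt_le (size_mono hα (norm_nonneg μ) hμ hw)
  gcongr

lemma tendstoLocallyUniformlyOn_psum (hα : 0 < α) (μ : ℂ) (T : ℝ) :
    TendstoLocallyUniformlyOn (psum α e μ) (G α e μ) atTop {w | w.re < T} := by
  refine TendstoUniformlyOn.tendstoLocallyUniformlyOn ?_
  refine tendstoUniformlyOn_tsum_nat
    ((hasSum_size (size_nonneg (α := α) (norm_nonneg μ) T)).summable.mul_left (Real.exp (e * T))) ?_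
  intro n w hw
  refine (norm_term_le hα μ w n).trans ?_
  have he : (0 : ℝ) ≤ e := Nat.cast_nonneg e
  have hw' : w.re ≤ T := le_of_lt hw
  have := size_mono hα (norm_nonneg μ) le_rfl hw'
  have := size_nonneg (α := α) (norm_nonneg μ) w.re
  gcongr

lemma isOpen_re_lt (T : ℝ) : IsOpen {w : ℂ | w.re < T} :=
  isOpen_lt Complex.continuous_re continuous_const

lemma differentiable_G (hα : 0 < α) (μ : ℂ) : Differentiable ℂ (G α e μ) := fun w =>
  ((tendstoLocallyUniformlyOn_psum hα μ (w.re + 1)).differentiableOn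
    (Eventually.of_forall fun N => (differentiable_psum μ N).differentiableOn)
    (isOpen_re_lt _)).differentiableAt ((isOpen_re_lt _).mem_nhds (by simp))

lemma hasDerivAt_G (hα : 0 < α) (μ w : ℂ) : HasDerivAt (G α e μ) (Gd α e μ w) w :=
  (differentiable_G hα μ w).hasDerivAt

lemma differentiable_Gd (hα : 0 < α) (μ : ℂ) : Differentiable ℂ (Gd α e μ) := by
  have := (differentiable_G (e := e) hα μ).contDiff (n := 2)
  exact (this.iterate_deriv' 1 1).differentiable (by norm_num)

lemma tendsto_deriv_psum (hα : 0 < α) (μ w : ℂ) :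
    Tendsto (fun N => deriv (psum α e μ N) w) atTop (𝓝 (Gd α e μ w)) :=
  ((tendstoLocallyUniformlyOn_psum hα μ (w.re + 1)).deriv
    (Eventually.of_forall fun N => (differentiable_psum μ N).differentiableOn)
    (isOpen_re_lt _)).tendsto_at (by simp)

lemma tendsto_deriv_deriv_psum (hα : 0 < α) (μ w : ℂ) :
    Tendsto (fun N => deriv (deriv (psum α e μ N)) w) atTop (𝓝 (deriv (Gd α e μ) w)) :=
  (((tendstoLocallyUniformlyOn_psum hα μ (w.re + 1)).deriv
    (Eventually.of_forall fun N => (differentiable_psum μ N).differentiableOn)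
    (isOpen_re_lt _)).deriv (Eventually.of_forall fun N => by
      have := (differentiable_psum (α := α) (e := e) μ N).contDiff (n := 2)
      exact ((this.iterate_deriv' 1 1).differentiable (by norm_num)).differentiableOn)
    (isOpen_re_lt _)).tendsto_at (by simp)

/-- The formal `w`-derivative of `term`. -/
lemma hasDerivAt_term (μ : ℂ) (n : ℕ) (w : ℂ) : HasDerivAt (term α e μ n)
    (∑ k ∈ Finset.range (n + 1), (coef α e n k : ℂ) * (-μ) ^ (n - k) *
      ((α * k + 2 * n + e : ℝ) * exp ((α * k + 2 * n + e : ℝ) * w))) w := by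
  unfold term
  refine HasDerivAt.fun_sum fun k _ => ?_
  have h := ((hasDerivAt_id w).const_mul ((α * k + 2 * n + e : ℝ) : ℂ)).cexp.const_mul
    ((coef α e n k : ℂ) * (-μ) ^ (n - k))
  refine h.congr_deriv ?_
  simp only [id]; ring

lemma hasDerivAt_deriv_term (μ : ℂ) (n : ℕ) (w : ℂ) : HasDerivAt (deriv (term α e μ n))
    (∑ k ∈ Finset.range (n + 1), (coef α e n k : ℂ) * (-μ) ^ (n - k) *
      ((α * k + 2 * n + e : ℝ) * ((α * k + 2 * n + e : ℝ) *
        exp ((α * k + 2 * n + e : ℝ) * w)))) w := by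
  have : deriv (term α e μ n) = fun w => ∑ k ∈ Finset.range (n + 1), (coef α e n k : ℂ) *
      (-μ) ^ (n - k) * ((α * k + 2 * n + e : ℝ) * exp ((α * k + 2 * n + e : ℝ) * w)) := by
    ext w; exact (hasDerivAt_term μ n w).deriv
  rw [this]
  refine HasDerivAt.fun_sum fun k _ => ?_
  have h := (((hasDerivAt_id w).const_mul ((α * k + 2 * n + e : ℝ) : ℂ)).cexp.const_mul
    ((α * k + 2 * n + e : ℝ) : ℂ)).const_mul ((coef α e n k : ℂ) * (-μ) ^ (n - k))
  refine h.congr_deriv ?_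
  simp only [id]; ring

lemma coef_succ_zero_mul (n : ℕ) :
    coef α e (n + 1) 0 * ((2 * n + e + 1) * (2 * n + e + 2)) = coef α e n 0 := by
  have : ((2 * n + e + 1) * (2 * n + e + 2) : ℝ) ≠ 0 := by positivity
  simp only [coef]; field_simp

lemma coef_succ_succ_mul (hα : 0 < α) (n k : ℕ) :
    coef α e (n + 1) (k + 1) * ((α * (k + 1) + 2 * n + e + 1) * (α * (k + 1) + 2 * n + e + 2)) =
      coef α e n k + coef α e n (k + 1) := by
  have : ((α * (k + 1) + 2 * n + e + 1) * (α * (k + 1) + 2 * n + e + 2) : ℝ) ≠ 0 := by positivity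
  simp only [coef]; field_simp

lemma deriv_deriv_term_succ (hα : 0 < α) (μ : ℂ) (n : ℕ) (w : ℂ) :
    deriv (deriv (term α e μ (n + 1))) w - deriv (term α e μ (n + 1)) w =
      exp (2 * w) * (exp (α * w) - μ) * term α e μ n w := by
  rw [(hasDerivAt_deriv_term μ (n + 1) w).deriv, (hasDerivAt_term μ (n + 1) w).deriv,
    ← Finset.sum_sub_distrib]
  set A : ℕ → ℂ := fun k => (-μ) ^ (n + 1 - k) * exp ((α * k + 2 * (n + 1 : ℕ) + e : ℝ) * w) with hA
  have hL : ∀ k, (coef α e (n + 1) k : ℂ) * (-μ) ^ (n + 1 - k) *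
      ((α * k + 2 * (n + 1 : ℕ) + e : ℝ) * ((α * k + 2 * (n + 1 : ℕ) + e : ℝ) *
        exp ((α * k + 2 * (n + 1 : ℕ) + e : ℝ) * w))) - (coef α e (n + 1) k : ℂ) *
      (-μ) ^ (n + 1 - k) * ((α * k + 2 * (n + 1 : ℕ) + e : ℝ) *
        exp ((α * k + 2 * (n + 1 : ℕ) + e : ℝ) * w)) =
      ((coef α e (n + 1) k * ((α * k + 2 * n + e + 1) * (α * k + 2 * n + e + 2)) : ℝ) : ℂ) *
        A k := by
    intro k; simp only [hA]; push_cast; ring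
  rw [Finset.sum_congr rfl fun k _ => hL k, Finset.sum_range_succ']
  have h0 : (coef α e (n + 1) 0 * ((α * (0 : ℕ) + 2 * n + e + 1) * (α * (0 : ℕ) + 2 * n + e + 2)) : ℝ)
      = coef α e n 0 := by
    rw [← coef_succ_zero_mul n]; simp
  have h1 : ∀ k : ℕ, (coef α e (n + 1) (k + 1) * ((α * (k + 1 : ℕ) + 2 * n + e + 1) *
      (α * (k + 1 : ℕ) + 2 * n + e + 2)) : ℝ) = coef α e n k + coef α e n (k + 1) := by
    intro k; rw [← coef_succ_succ_mul hα n k]; push_cast; ring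
  rw [h0]
  simp only [h1]
  have h2 : ∑ k ∈ Finset.range (n + 1), ((coef α e n (k + 1) : ℝ) : ℂ) * A (k + 1) +
      (coef α e n 0 : ℂ) * A 0 = ∑ k ∈ Finset.range (n + 1), (coef α e n k : ℂ) * A k := by
    rw [← Finset.sum_range_succ' fun k => (coef α e n k : ℂ) * A k, Finset.sum_range_succ,
      coef_eq_zero (Nat.lt_succ_self n)]
    simp
  simp only [ofReal_add, add_mul, Finset.sum_add_distrib]
  rw [add_assoc, h2, ← Finset.sum_add_distrib]
  unfold term
  rw [Finset.mul_sum]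
  refine Finset.sum_congr rfl fun k hk => ?_
  have hk' : k ≤ n := by simpa [Nat.lt_succ_iff] using hk
  have e1 : exp ((α * (k + 1 : ℕ) + 2 * (n + 1 : ℕ) + e : ℝ) * w) =
      exp (2 * w) * exp (α * w) * exp ((α * k + 2 * n + e : ℝ) * w) := by
    rw [← exp_add, ← exp_add]; congr 1; push_cast; ring
  have e2 : exp ((α * k + 2 * (n + 1 : ℕ) + e : ℝ) * w) =
      exp (2 * w) * exp ((α * k + 2 * n + e : ℝ) * w) := by
    rw [← exp_add]; congr 1; push_cast; ring
  simp only [hA, e1, e2]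
  rw [show n + 1 - (k + 1) = n - k by omega, show n + 1 - k = n - k + 1 by omega, pow_succ]
  ring

lemma deriv_deriv_term_zero (he : e = 0 ∨ e = 1) (μ w : ℂ) :
    deriv (deriv (term α e μ 0)) w - deriv (term α e μ 0) w = 0 := by
  rw [(hasDerivAt_deriv_term μ 0 w).deriv, (hasDerivAt_term μ 0 w).deriv]
  rcases he with rfl | rfl <;> simp

lemma deriv_deriv_psum_succ (hα : 0 < α) (he : e = 0 ∨ e = 1) (μ : ℂ) (N : ℕ) (w : ℂ) :
    deriv (deriv (psum α e μ (N + 1))) w - deriv (psum α e μ (N + 1)) w =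
      exp (2 * w) * (exp (α * w) - μ) * psum α e μ N w := by
  have hd : ∀ N, deriv (psum α e μ N) = fun w => ∑ n ∈ Finset.range N, deriv (term α e μ n) w := by
    intro N; ext w
    exact (HasDerivAt.fun_sum fun n _ => (differentiable_term μ n w).hasDerivAt).deriv
  have hdd : deriv (deriv (psum α e μ (N + 1))) w =
      ∑ n ∈ Finset.range (N + 1), deriv (deriv (term α e μ n)) w := by
    rw [hd]
    exact (HasDerivAt.fun_sum fun n _ =>
      (hasDerivAt_deriv_term μ n w).differentiableAt.hasDerivAt).deriv
  rw [hdd, hd, ← Finset.sum_sub_distrib, Finset.sum_range_succ', deriv_deriv_term_zero he]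
  simp only [deriv_deriv_term_succ hα, add_zero, psum, Finset.mul_sum]

/-- The differential equation in the logarithmic variable. -/
lemma hasDerivAt_Gd (hα : 0 < α) (he : e = 0 ∨ e = 1) (μ w : ℂ) :
    HasDerivAt (Gd α e μ) (Gd α e μ w + exp (2 * w) * (exp (α * w) - μ) * G α e μ w) w := by
  have h1 := (tendsto_deriv_deriv_psum (e := e) hα μ w).sub (tendsto_deriv_psum (e := e) hα μ w)
  have h2 := (tendsto_psum (e := e) hα μ w).const_mul (exp (2 * w) * (exp (α * w) - μ))
  have h3 := tendsto_nhds_unique (h1.comp (tendsto_add_atTop_nat 1))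
    (h2.congr fun N => (deriv_deriv_psum_succ hα he μ N w).symm)
  rw [← h3, add_sub_cancel]
  exact (differentiable_Gd hα μ w).hasDerivAt

lemma norm_G_sub_exp_le (hα : 0 < α) (μ w : ℂ) :
    ‖G α e μ w - exp (e * w)‖ ≤ Real.exp (e * w.re) * (Real.cosh √(size α ‖μ‖ w.re) - 1) := by
  have hs := hasSum_size (size_nonneg (α := α) (norm_nonneg μ) w.re)
  have h0 : term α e μ 0 w = exp (e * w) := by simp [term, coef]
  have h1 : G α e μ w - exp (e * w) = ∑' n, term α e μ (n + 1) w := by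
    rw [G, (summable_term hα μ w).tsum_eq_zero_add, h0, add_sub_cancel_left]
  have h2 : HasSum (fun n => size α ‖μ‖ w.re ^ (n + 1) / (2 * (n + 1)).factorial)
      (Real.cosh √(size α ‖μ‖ w.re) - 1) := by
    simpa using (hasSum_nat_add_iff' 1).2 hs
  rw [h1]
  exact tsum_of_norm_bounded (h2.mul_left _) fun n => norm_term_le hα μ w (n + 1)

lemma cosh_sqrt_sub_one_le {X : ℝ} (h0 : 0 ≤ X) (h1 : X ≤ 1) : Real.cosh √X - 1 ≤ X := by
  have h2 := Real.cosh_le_exp_half_sq √X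
  rw [Real.sq_sqrt h0] at h2
  have h3 := Real.abs_exp_sub_one_le (x := X / 2) (by rw [abs_of_nonneg] <;> linarith)
  rw [abs_of_nonneg (a := X / 2) (by linarith)] at h3
  linarith [le_abs_self (Real.exp (X / 2) - 1)]

lemma norm_G_sub_exp_le_size (hα : 0 < α) {μ w : ℂ} (h : size α ‖μ‖ w.re ≤ 1) :
    ‖G α e μ w - exp (e * w)‖ ≤ Real.exp (e * w.re) * size α ‖μ‖ w.re :=
  (norm_G_sub_exp_le hα μ w).trans (mul_le_mul_of_nonneg_left
    (cosh_sqrt_sub_one_le (size_nonneg (norm_nonneg μ) _) h) (Real.exp_nonneg _))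

lemma norm_Gd_sub_exp_le_size (hα : 0 < α) {μ w : ℂ} (h : size α ‖μ‖ (w.re + 1) ≤ 1) :
    ‖Gd α e μ w - e * exp (e * w)‖ ≤
      Real.exp (e * (w.re + 1)) * size α ‖μ‖ (w.re + 1) := by
  have hd : HasDerivAt (fun w => G α e μ w - exp (e * w)) (Gd α e μ w - e * exp (e * w)) w := by
    refine ((hasDerivAt_G hα μ w).sub ((hasDerivAt_id w).const_mul (e : ℂ)).cexp).congr_deriv ?_
    simp only [id]; ring
  rw [← hd.deriv]
  have := Complex.norm_deriv_le_of_forall_mem_sphere_norm_le (c := w) (R := 1) one_pos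
    (f := fun w => G α e μ w - exp (e * w)) (C := Real.exp (e * (w.re + 1)) *
      size α ‖μ‖ (w.re + 1)) ?_ ?_
  · simpa using this
  · have h2 := differentiable_G (e := e) hα μ
    exact Differentiable.diffContOnCl (by fun_prop)
  · intro ζ hζ
    have h1 : ζ.re ≤ w.re + 1 := by
      have h2 : ‖ζ - w‖ = 1 := by simpa [dist_eq_norm] using hζ
      have h3 := Complex.re_le_norm (ζ - w)
      rw [h2, Complex.sub_re] at h3
      linarith
    have h4 := size_mono hα (norm_nonneg μ) le_rfl h1
    refine (norm_G_sub_exp_le_size hα (h4.trans h)).trans ?_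
    have he : (0 : ℝ) ≤ e := Nat.cast_nonneg e
    have h5 := size_nonneg (α := α) (norm_nonneg μ) ζ.re
    gcongr

lemma norm_deriv_psum_le (hα : 0 < α) (μ w : ℂ) (N : ℕ) :
    ‖deriv (psum α e μ N) w‖ ≤
      Real.exp (e * (w.re + 1)) * Real.cosh √(size α ‖μ‖ (w.re + 1)) := by
  have := Complex.norm_deriv_le_of_forall_mem_sphere_norm_le (c := w) (R := 1) one_pos
    (f := psum α e μ N) (C := Real.exp (e * (w.re + 1)) *
      Real.cosh √(size α ‖μ‖ (w.re + 1))) (differentiable_psum μ N).diffContOnCl ?_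
  · simpa using this
  · intro ζ hζ
    have h2 : ‖ζ - w‖ = 1 := by simpa [dist_eq_norm] using hζ
    have h3 := Complex.re_le_norm (ζ - w)
    rw [h2, Complex.sub_re] at h3
    exact norm_psum_le_of_re_le hα le_rfl (by linarith) N

lemma norm_Gd_le (hα : 0 < α) (μ w : ℂ) :
    ‖Gd α e μ w‖ ≤ Real.exp (e * (w.re + 1)) * Real.cosh √(size α ‖μ‖ (w.re + 1)) :=
  le_of_tendsto (tendsto_deriv_psum hα μ w).norm
    (Eventually.of_forall (norm_deriv_psum_le hα μ w))

lemma differentiable_G_param (hα : 0 < α) (w : ℂ) : Differentiable ℂ fun μ => G α e μ w := by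
  rw [← differentiableOn_univ]
  refine differentiableOn_of_tendsto_of_bounded isOpen_univ (F := fun N μ => psum α e μ N w)
    (fun N => ?_) (fun μ _ => ⟨1, one_pos, Real.exp (e * w.re) *
      Real.cosh √(size α (‖μ‖ + 1) w.re), fun N ν hν _ => ?_⟩) (fun μ _ => tendsto_psum hα μ w)
  · unfold psum term; fun_prop
  · refine norm_psum_le_of_re_le hα ?_ le_rfl N
    have h1 : ‖ν - μ‖ < 1 := by simpa [dist_eq_norm] using hν
    linarith [norm_le_norm_add_norm_sub' ν μ]

lemma differentiable_Gd_param (hα : 0 < α) (w : ℂ) : Differentiable ℂ fun μ => Gd α e μ w := by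
  rw [← differentiableOn_univ]
  refine differentiableOn_of_tendsto_of_bounded isOpen_univ
    (F := fun N μ => deriv (psum α e μ N) w)
    (fun N => ?_) (fun μ _ => ⟨1, one_pos, Real.exp (e * (w.re + 1)) *
      Real.cosh √(size α (‖μ‖ + 1) (w.re + 1)), fun N ν hν _ => ?_⟩)
    (fun μ _ => tendsto_deriv_psum hα μ w)
  · have : (fun μ => deriv (psum α e μ N) w) = fun μ => ∑ n ∈ Finset.range N,
        ∑ k ∈ Finset.range (n + 1), (coef α e n k : ℂ) * (-μ) ^ (n - k) *
          ((α * k + 2 * n + e : ℝ) * exp ((α * k + 2 * n + e : ℝ) * w)) := by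
      ext μ
      exact (HasDerivAt.fun_sum fun n _ => hasDerivAt_term μ n w).deriv
    rw [this]; fun_prop
  · refine (norm_deriv_psum_le hα ν w N).trans ?_
    have h1 : ‖ν - μ‖ < 1 := by simpa [dist_eq_norm] using hν
    have h2 : ‖ν‖ ≤ ‖μ‖ + 1 := by linarith [norm_le_norm_add_norm_sub' ν μ]
    have := cosh_sqrt_le (size_mono hα (norm_nonneg ν) h2 (le_refl (w.re + 1)))
    gcongr

lemma tendsto_size_atBot (hα : 0 < α) (m : ℝ) : Tendsto (size α m) atBot (𝓝 0) := by
  have h1 : Tendsto (fun ξ : ℝ => Real.exp ((α + 2) * ξ)) atBot (𝓝 0) :=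
    Real.tendsto_exp_atBot.comp (tendsto_id.const_mul_atBot (by positivity))
  have h2 : Tendsto (fun ξ : ℝ => Real.exp (2 * ξ)) atBot (𝓝 0) :=
    Real.tendsto_exp_atBot.comp (tendsto_id.const_mul_atBot (by positivity))
  have h3 := h1.add (h2.const_mul m)
  rw [mul_zero, add_zero] at h3
  exact h3

lemma tendsto_exp_mul_G (hα : 0 < α) (μ w₀ : ℂ) :
    Tendsto (fun ξ : ℝ => exp (-(e * (ξ + w₀))) * G α e μ (ξ + w₀)) atBot (𝓝 1) := by
  have hs : Tendsto (fun ξ : ℝ => size α ‖μ‖ (ξ + w₀.re)) atBot (𝓝 0) :=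
    (tendsto_size_atBot hα _).comp (tendsto_atBot_add_const_right _ _ tendsto_id)
  rw [tendsto_iff_norm_sub_tendsto_zero]
  refine squeeze_zero' (Eventually.of_forall fun _ => norm_nonneg _) ?_ hs
  filter_upwards [hs.eventually (eventually_le_nhds one_pos)] with ξ hξ
  have hre : (ξ + w₀ : ℂ).re = ξ + w₀.re := by simp
  have h1 := norm_G_sub_exp_le_size (e := e) hα (μ := μ) (w := ξ + w₀) (by rwa [hre])
  have h2 : exp (-(e * (ξ + w₀))) * G α e μ (ξ + w₀) - 1 =
      exp (-(e * (ξ + w₀))) * (G α e μ (ξ + w₀) - exp (e * (ξ + w₀))) := by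
    rw [mul_sub, ← exp_add]; simp
  rw [hre] at h1
  rw [h2, norm_mul, norm_exp]
  calc Real.exp (-(e * (ξ + w₀))).re * ‖G α e μ (ξ + w₀) - exp (e * (ξ + w₀))‖
      ≤ Real.exp (-(e * (ξ + w₀))).re * (Real.exp (e * (ξ + w₀.re)) * size α ‖μ‖ (ξ + w₀.re)) := by
        gcongr
    _ = size α ‖μ‖ (ξ + w₀.re) := by
        rw [← mul_assoc, ← Real.exp_add]; simp

lemma tendsto_exp_mul_Gd (hα : 0 < α) (μ w₀ : ℂ) :
    Tendsto (fun ξ : ℝ => exp (-(e * (ξ + w₀))) * Gd α e μ (ξ + w₀)) atBot (𝓝 e) := by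
  have hs : Tendsto (fun ξ : ℝ => size α ‖μ‖ (ξ + w₀.re + 1)) atBot (𝓝 0) :=
    (tendsto_size_atBot hα _).comp (tendsto_atBot_add_const_right _ _
      (tendsto_atBot_add_const_right _ _ tendsto_id))
  have hs' := hs.const_mul (Real.exp e)
  rw [mul_zero] at hs'
  rw [tendsto_iff_norm_sub_tendsto_zero]
  refine squeeze_zero' (Eventually.of_forall fun _ => norm_nonneg _) ?_ hs'
  filter_upwards [hs.eventually (eventually_le_nhds one_pos)] with ξ hξ
  have hre : (ξ + w₀ : ℂ).re = ξ + w₀.re := by simp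
  have h1 := norm_Gd_sub_exp_le_size (e := e) hα (μ := μ) (w := ξ + w₀) (by rwa [hre])
  have h2 : exp (-(e * (ξ + w₀))) * Gd α e μ (ξ + w₀) - e =
      exp (-(e * (ξ + w₀))) * (Gd α e μ (ξ + w₀) - e * exp (e * (ξ + w₀))) := by
    rw [mul_sub, mul_left_comm, ← exp_add]; simp
  rw [hre] at h1
  rw [h2, norm_mul, norm_exp]
  calc Real.exp (-(e * (ξ + w₀))).re * ‖Gd α e μ (ξ + w₀) - e * exp (e * (ξ + w₀))‖
      ≤ Real.exp (-(e * (ξ + w₀))).re *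
          (Real.exp (e * (ξ + w₀.re + 1)) * size α ‖μ‖ (ξ + w₀.re + 1)) := by
        gcongr
    _ = Real.exp e * size α ‖μ‖ (ξ + w₀.re + 1) := by
        rw [← mul_assoc, ← Real.exp_add]; congr 2; simp; ring

lemma tendsto_exp_mul_Gd_zero (hα : 0 < α) (μ w₀ : ℂ) :
    Tendsto (fun ξ : ℝ => exp (-(ξ + w₀)) * Gd α 0 μ (ξ + w₀)) atBot (𝓝 0) := by
  have hs : Tendsto (fun ξ : ℝ => size α ‖μ‖ (ξ + w₀.re + 1)) atBot (𝓝 0) :=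
    (tendsto_size_atBot hα _).comp (tendsto_atBot_add_const_right _ _
      (tendsto_atBot_add_const_right _ _ tendsto_id))
  have hs' : Tendsto (fun ξ : ℝ => Real.exp 1 * (Real.exp ((α + 1) * (ξ + w₀.re + 1)) +
      ‖μ‖ * Real.exp (ξ + w₀.re + 1))) atBot (𝓝 0) := by
    have h0 : Tendsto (fun ξ : ℝ => ξ + w₀.re + 1) atBot atBot :=
      tendsto_atBot_add_const_right _ _ (tendsto_atBot_add_const_right _ _ tendsto_id)
    have h1 := Real.tendsto_exp_atBot.comp (h0.const_mul_atBot (show 0 < α + 1 by positivity))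
    have h2 := Real.tendsto_exp_atBot.comp h0
    have h3 := (h1.add (h2.const_mul ‖μ‖)).const_mul (Real.exp 1)
    rw [mul_zero, add_zero, mul_zero] at h3
    exact h3
  refine squeeze_zero_norm' ?_ hs'
  filter_upwards [hs.eventually (eventually_le_nhds one_pos)] with ξ hξ
  have hre : (ξ + w₀ : ℂ).re = ξ + w₀.re := by simp
  have h1 := norm_Gd_sub_exp_le_size (e := 0) hα (μ := μ) (w := ξ + w₀) (by rwa [hre])
  rw [hre] at h1
  simp only [Nat.cast_zero, zero_mul, sub_zero, Real.exp_zero, one_mul] at h1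
  rw [norm_mul, norm_exp]
  calc Real.exp (-(ξ + w₀ : ℂ)).re * ‖Gd α 0 μ (ξ + w₀)‖
      ≤ Real.exp (-(ξ + w₀ : ℂ)).re * size α ‖μ‖ (ξ + w₀.re + 1) := by gcongr
    _ = _ := by
        have e1 : Real.exp (-(ξ + w₀ : ℂ)).re * Real.exp ((α + 2) * (ξ + w₀.re + 1)) =
            Real.exp 1 * Real.exp ((α + 1) * (ξ + w₀.re + 1)) := by
          rw [← Real.exp_add, ← Real.exp_add]; congr 1; simp; ring
        have e2 : Real.exp (-(ξ + w₀ : ℂ)).re * Real.exp (2 * (ξ + w₀.re + 1)) =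
            Real.exp 1 * Real.exp (ξ + w₀.re + 1) := by
          rw [← Real.exp_add, ← Real.exp_add]; congr 1; simp; ring
        unfold size
        linear_combination e1 + ‖μ‖ * e2

lemma wronskian_G (hα : 0 < α) (μ w : ℂ) :
    G α 0 μ w * Gd α 1 μ w - G α 1 μ w * Gd α 0 μ w = exp w := by
  set K : ℂ → ℂ := fun w => (G α 0 μ w * Gd α 1 μ w - G α 1 μ w * Gd α 0 μ w) * exp (-w) with hK
  have hd : ∀ w, HasDerivAt K 0 w := by
    intro w
    have h := (((hasDerivAt_G (e := 0) hα μ w).mul (hasDerivAt_Gd (e := 1) hα (Or.inr rfl) μ w)).sub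
      ((hasDerivAt_G (e := 1) hα μ w).mul (hasDerivAt_Gd (e := 0) hα (Or.inl rfl) μ w))).mul
      (hasDerivAt_id w).neg.cexp
    refine h.congr_deriv ?_
    simp only [id, Pi.mul_apply, Pi.sub_apply, Pi.neg_apply]
    ring
  have hconst : ∀ ξ : ℝ, K ξ = K w := fun ξ =>
    is_const_of_deriv_eq_zero (fun w => (hd w).differentiableAt) (fun w => (hd w).deriv) _ _
  have h1 := ((tendsto_exp_mul_G (e := 0) hα μ 0).mul (tendsto_exp_mul_Gd (e := 1) hα μ 0)).sub
    ((tendsto_exp_mul_G (e := 1) hα μ 0).mul (tendsto_exp_mul_Gd (e := 0) hα μ 0))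
  have h2 : K w = 1 := by
    refine tendsto_nhds_unique (f := fun ξ : ℝ => K ξ) (l := atBot) ?_ ?_
    · simp only [hconst]; exact tendsto_const_nhds
    · simp only [Nat.cast_zero, Nat.cast_one, zero_mul, neg_zero, exp_zero, one_mul, add_zero,
        mul_zero, sub_zero, mul_one] at h1
      refine h1.congr fun ξ => ?_
      simp only [hK]; ring
  have h3 : K w * exp w = exp w := by rw [h2, one_mul]
  rw [hK] at h3
  simp only at h3
  rw [mul_assoc, ← exp_add, neg_add_cancel, exp_zero, mul_one] at h3
  exact h3

end PowerPotential

namespace PowerPotential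

open Complex Filter Topology ComplexConjugate

/-- `y` solves `y'' = Q y` with derivative `y'` on `(0, ∞)`. -/
structure Sol (Q y y' : ℝ → ℂ) : Prop where
  cont : ContinuousOn Q (Ioi 0)
  d1 : ∀ x > 0, HasDerivAt y (y' x) x
  d2 : ∀ x > 0, HasDerivAt y' (Q x * y x) x

/-- The function `y` has finite energy at infinity. -/
def Decays (Q y y' : ℝ → ℂ) : Prop :=
  ∀ a > 0, IntegrableOn (fun x => ‖y' x‖ ^ 2) (Ioi a) ∧
    IntegrableOn (fun x => (1 + ‖Q x‖) * ‖y x‖ ^ 2) (Ioi a)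

variable {Q y y' z z' : ℝ → ℂ}

namespace Sol

lemma contY (h : Sol Q y y') : ContinuousOn y (Ioi 0) :=
  fun x hx => (h.d1 x hx).continuousAt.continuousWithinAt

lemma contY' (h : Sol Q y y') : ContinuousOn y' (Ioi 0) :=
  fun x hx => (h.d2 x hx).continuousAt.continuousWithinAt

lemma lincomb (h : Sol Q y y') (h' : Sol Q z z') (a b : ℂ) :
    Sol Q (fun x => a * y x + b * z x) (fun x => a * y' x + b * z' x) :=
  ⟨h.cont, fun x hx => ((h.d1 x hx).const_mul a).add ((h'.d1 x hx).const_mul b),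
    fun x hx => (((h.d2 x hx).const_mul a).add ((h'.d2 x hx).const_mul b)).congr_deriv (by ring)⟩

lemma hasDerivAt_energy (h : Sol Q y y') {x : ℝ} (hx : 0 < x) :
    HasDerivAt (fun x => y' x * conj (y x))
      ((‖y' x‖ ^ 2 : ℝ) + Q x * (‖y x‖ ^ 2 : ℝ)) x := by
  refine ((h.d2 x hx).mul (h.d1 x hx).star).congr_deriv ?_
  have e1 : ((‖y' x‖ ^ 2 : ℝ) : ℂ) = y' x * conj (y' x) := by
    rw [Complex.mul_conj', ofReal_pow]
  have e2 : ((‖y x‖ ^ 2 : ℝ) : ℂ) = y x * conj (y x) := by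
    rw [Complex.mul_conj', ofReal_pow]
  rw [e1, e2]
  simp only [starRingEnd_apply]
  ring

lemma contDensity (h : Sol Q y y') :
    ContinuousOn (fun x => ((‖y' x‖ ^ 2 : ℝ) : ℂ) + Q x * (‖y x‖ ^ 2 : ℝ)) (Ioi 0) := by
  have h1 := h.contY
  have h2 := h.contY'
  have h3 := h.cont
  fun_prop

/-- Rotated energy identity on a bounded interval. -/
lemma re_energy_interval (h : Sol Q y y') {a b : ℝ} (ha : 0 < a) (hab : a ≤ b) (e : ℂ) :
    ∫ x in a..b, (e.re * ‖y' x‖ ^ 2 + (e * Q x).re * ‖y x‖ ^ 2) =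
      (e * (y' b * conj (y b))).re - (e * (y' a * conj (y a))).re := by
  have hsub : uIcc a b ⊆ Ioi 0 := by
    rw [uIcc_of_le hab]; exact fun x hx => lt_of_lt_of_le ha hx.1
  have h1 : ∀ x ∈ uIcc a b, HasDerivAt (fun x => (e * (y' x * conj (y x))).re)
      (e.re * ‖y' x‖ ^ 2 + (e * Q x).re * ‖y x‖ ^ 2) x := by
    intro x hx
    have h2 := ((h.hasDerivAt_energy (hsub hx)).const_mul e)
    have h3 := (Complex.reCLM.hasFDerivAt.comp_hasDerivAt x h2)
    refine h3.congr_deriv ?_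
    simp only [Complex.reCLM_apply]
    rw [mul_add, ← mul_assoc, add_re, re_mul_ofReal, re_mul_ofReal]
  refine intervalIntegral.integral_eq_sub_of_hasDerivAt h1 ?_
  refine ContinuousOn.intervalIntegrable (ContinuousOn.mono ?_ hsub)
  have h1 := h.contY
  have h2 := h.contY'
  have h3 := h.cont
  have h4 : ContinuousOn (fun x => (e * Q x).re) (Ioi 0) :=
    Complex.continuous_re.comp_continuousOn (by fun_prop)
  fun_prop

end Sol

lemma integrableOn_mul_of_sq {μ : Measure ℝ} {f g : ℝ → ℂ}
    (hf : AEStronglyMeasurable f μ) (hg : AEStronglyMeasurable g μ)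
    (hf2 : Integrable (fun x => ‖f x‖ ^ 2) μ) (hg2 : Integrable (fun x => ‖g x‖ ^ 2) μ) :
    Integrable (fun x => f x * g x) μ := by
  refine Integrable.mono' (hf2.add hg2) (hf.mul hg) (Eventually.of_forall fun x => ?_)
  rw [norm_mul]
  simp only [Pi.add_apply]
  nlinarith [sq_nonneg (‖f x‖ - ‖g x‖), sq_nonneg (‖f x‖), sq_nonneg ‖g x‖]

namespace Decays

lemma sq_integrable (h : Sol Q y y') (hd : Decays Q y y') {a : ℝ} (ha : 0 < a) :
    IntegrableOn (fun x => ‖y x‖ ^ 2) (Ioi a) := by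
  refine Integrable.mono' (hd a ha).2 ?_ (Eventually.of_forall fun x => ?_)
  · have h1 := h.contY.mono (Ioi_subset_Ioi ha.le)
    exact ContinuousOn.aestronglyMeasurable (by fun_prop) measurableSet_Ioi
  · rw [Real.norm_of_nonneg (by positivity)]
    nlinarith [mul_nonneg (norm_nonneg (Q x)) (sq_nonneg ‖y x‖)]

lemma integrable_density (h : Sol Q y y') (hd : Decays Q y y') {a : ℝ} (ha : 0 < a) :
    IntegrableOn (fun x => ((‖y' x‖ ^ 2 : ℝ) : ℂ) + Q x * (‖y x‖ ^ 2 : ℝ)) (Ioi a) := by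
  refine Integrable.mono' ((hd a ha).1.add (hd a ha).2) ?_ (Eventually.of_forall fun x => ?_)
  · exact (h.contDensity.mono (Ioi_subset_Ioi ha.le)).aestronglyMeasurable measurableSet_Ioi
  · refine (norm_add_le _ _).trans ?_
    rw [norm_mul, norm_real, norm_real, Real.norm_of_nonneg (by positivity),
      Real.norm_of_nonneg (by positivity)]
    simp only [Pi.add_apply]
    nlinarith [sq_nonneg ‖y x‖]

lemma tendsto_energy (h : Sol Q y y') (hd : Decays Q y y') :
    Tendsto (fun x => y' x * conj (y x)) atTop (𝓝 0) := by
  refine tendsto_zero_of_hasDerivAt_of_integrableOn_Ioi (a := 1)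
    (fun x hx => h.hasDerivAt_energy (lt_trans one_pos hx)) (integrable_density h hd one_pos) ?_
  have h1 := h.contY.mono (Ioi_subset_Ioi (zero_le_one' ℝ))
  have h2 := h.contY'.mono (Ioi_subset_Ioi (zero_le_one' ℝ))
  refine integrableOn_mul_of_sq (h2.aestronglyMeasurable measurableSet_Ioi)
    (ContinuousOn.aestronglyMeasurable (Complex.continuous_conj.comp_continuousOn h1)
      measurableSet_Ioi) (hd 1 one_pos).1 ?_
  simp only [RCLike.norm_conj]
  exact sq_integrable h hd one_pos

/-- Energy identity on a half-line. -/
lemma energy_tail (h : Sol Q y y') (hd : Decays Q y y') {a : ℝ} (ha : 0 < a) :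
    ∫ x in Ioi a, (((‖y' x‖ ^ 2 : ℝ) : ℂ) + Q x * (‖y x‖ ^ 2 : ℝ)) = -(y' a * conj (y a)) := by
  rw [integral_Ioi_of_hasDerivAt_of_tendsto' (fun x hx => h.hasDerivAt_energy
    (lt_of_lt_of_le ha hx)) (integrable_density h hd ha) (tendsto_energy h hd), zero_sub]

lemma re_density_integrable (h : Sol Q y y') (hd : Decays Q y y') {a : ℝ} (ha : 0 < a) (e : ℂ) :
    IntegrableOn (fun x => e.re * ‖y' x‖ ^ 2 + (e * Q x).re * ‖y x‖ ^ 2) (Ioi a) := by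
  have h1 := ((integrable_density h hd ha).const_mul e).re
  refine h1.congr (Eventually.of_forall fun x => ?_)
  simp only [RCLike.re_eq_complex_re]
  rw [mul_add, ← mul_assoc, add_re, re_mul_ofReal, re_mul_ofReal]

/-- Rotated energy identity on a half-line. -/
lemma re_energy_tail (h : Sol Q y y') (hd : Decays Q y y') {a : ℝ} (ha : 0 < a) (e : ℂ) :
    ∫ x in Ioi a, (e.re * ‖y' x‖ ^ 2 + (e * Q x).re * ‖y x‖ ^ 2) =
      -(e * (y' a * conj (y a))).re := by
  have h1 := ((integrable_density h hd ha).const_mul e)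
  have h2 := integral_re h1
  rw [integral_const_mul, energy_tail h hd ha, mul_neg] at h2
  simp only [RCLike.re_eq_complex_re, neg_re] at h2
  rw [← h2]
  refine integral_congr_ae (Eventually.of_forall fun x => ?_)
  simp only
  rw [mul_add, ← mul_assoc, add_re, re_mul_ofReal, re_mul_ofReal]

/-- Coercive energy bound on a half-line. -/
lemma energy_le (h : Sol Q y y') (hd : Decays Q y y') {a : ℝ} (ha : 0 < a) {e : ℂ} {k N : ℝ}
    (he : ‖e‖ ≤ 1) (hk : k ≤ e.re) (hN : ∀ x > a, N ≤ (e * Q x).re) :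
    k * (∫ x in Ioi a, ‖y' x‖ ^ 2) + N * (∫ x in Ioi a, ‖y x‖ ^ 2) ≤ ‖y' a‖ * ‖y a‖ := by
  have h1 := re_energy_tail h hd ha e
  have h2 : k * (∫ x in Ioi a, ‖y' x‖ ^ 2) + N * (∫ x in Ioi a, ‖y x‖ ^ 2) ≤
      ∫ x in Ioi a, (e.re * ‖y' x‖ ^ 2 + (e * Q x).re * ‖y x‖ ^ 2) := by
    rw [← integral_const_mul, ← integral_const_mul, ← integral_add ((hd a ha).1.const_mul k)
      ((sq_integrable h hd ha).const_mul N)]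
    refine setIntegral_mono_on (((hd a ha).1.const_mul k).add
      ((sq_integrable h hd ha).const_mul N)) (re_density_integrable h hd ha e)
      measurableSet_Ioi fun x hx => ?_
    have := hN x hx
    gcongr
  rw [h1] at h2
  refine h2.trans ?_
  rw [← neg_re]
  refine (re_le_norm _).trans ?_
  rw [norm_neg, norm_mul, norm_mul, RCLike.norm_conj]
  calc ‖e‖ * (‖y' a‖ * ‖y a‖) ≤ 1 * (‖y' a‖ * ‖y a‖) := by gcongr
    _ = _ := one_mul _

/-- Solutions of finite energy have vanishing Wronskian. -/
lemma wronskian_eq_zero (h : Sol Q y y') (hd : Decays Q y y') (h' : Sol Q z z')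
    (hd' : Decays Q z z') {x : ℝ} (hx : 0 < x) : y x * z' x - y' x * z x = 0 := by
  set W : ℝ → ℂ := fun x => y x * z' x - y' x * z x with hW
  have hder : ∀ x > 0, HasDerivAt W 0 x := fun x hx =>
    (((h.d1 x hx).mul (h'.d2 x hx)).sub ((h.d2 x hx).mul (h'.d1 x hx))).congr_deriv (by ring)
  have hInt : IntegrableOn W (Ioi x) := by
    have hs := Ioi_subset_Ioi hx.le
    have m1 := (h.contY.mono hs).aestronglyMeasurable (μ := volume) measurableSet_Ioi
    have m2 := (h.contY'.mono hs).aestronglyMeasurable (μ := volume) measurableSet_Ioi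
    have m3 := (h'.contY.mono hs).aestronglyMeasurable (μ := volume) measurableSet_Ioi
    have m4 := (h'.contY'.mono hs).aestronglyMeasurable (μ := volume) measurableSet_Ioi
    exact (integrableOn_mul_of_sq m1 m4 (sq_integrable h hd hx) (hd' x hx).1).sub
      (integrableOn_mul_of_sq m2 m3 (hd x hx).1 (sq_integrable h' hd' hx))
  have h0 : Tendsto W atTop (𝓝 0) := tendsto_zero_of_hasDerivAt_of_integrableOn_Ioi (a := x)
    (fun t ht => hder t (hx.trans ht)) integrableOn_zero hInt
  have h1 := integral_Ioi_of_hasDerivAt_of_tendsto' (a := x) (m := 0)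
    (fun t ht => hder t (lt_of_lt_of_le hx ht)) integrableOn_zero h0
  simp only [integral_zero, zero_sub] at h1
  exact neg_eq_zero.1 h1.symm

end Decays

lemma decays_of_integrableOn (h : Sol Q y y') {b : ℝ}
    (h1 : IntegrableOn (fun x => ‖y' x‖ ^ 2) (Ioi b))
    (h2 : IntegrableOn (fun x => (1 + ‖Q x‖) * ‖y x‖ ^ 2) (Ioi b)) : Decays Q y y' := by
  intro a ha
  have c1 := h.contY
  have c2 := h.contY'
  have c3 := h.cont
  have key : ∀ f : ℝ → ℝ, ContinuousOn f (Ioi 0) → IntegrableOn f (Ioi b) →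
      IntegrableOn f (Ioi a) := by
    intro f hf hfb
    have hsub : Icc a (max a b) ⊆ Ioi 0 := fun x hx => lt_of_lt_of_le ha hx.1
    have := (hf.mono hsub).integrableOn_Icc (μ := volume)
    refine (this.union hfb).mono_set fun x hx => ?_
    rcases le_or_gt x (max a b) with hxm | hxm
    · exact Or.inl ⟨le_of_lt hx, hxm⟩
    · exact Or.inr (lt_of_le_of_lt (le_max_right a b) hxm)
  exact ⟨key _ (by fun_prop) h1, key _ (by fun_prop) h2⟩

lemma sq_integral_le {f : ℝ → ℝ} {a b : ℝ} (hab : a < b) (hf : ContinuousOn f (Icc a b)) :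
    (∫ x in a..b, f x) ^ 2 ≤ (b - a) * ∫ x in a..b, f x ^ 2 := by
  rw [← uIcc_of_le hab.le] at hf
  set m := (∫ x in a..b, f x) / (b - a) with hm
  have hba : 0 < b - a := sub_pos.2 hab
  have h1 : 0 ≤ ∫ x in a..b, (f x - m) ^ 2 :=
    intervalIntegral.integral_nonneg hab.le fun x _ => sq_nonneg _
  have i1 : IntervalIntegrable (fun x => f x ^ 2) volume a b := (hf.pow 2).intervalIntegrable
  have i2 : IntervalIntegrable (fun x => 2 * m * f x) volume a b :=
    (hf.intervalIntegrable).const_mul _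
  have h2 : ∫ x in a..b, (f x - m) ^ 2 =
      (∫ x in a..b, f x ^ 2) - 2 * m * (∫ x in a..b, f x) + (b - a) * m ^ 2 := by
    rw [show (fun x => (f x - m) ^ 2) = fun x => (f x ^ 2 - 2 * m * f x) + m ^ 2 by ext; ring,
      intervalIntegral.integral_add (i1.sub i2) intervalIntegrable_const,
      intervalIntegral.integral_sub i1 i2, intervalIntegral.integral_const_mul,
      intervalIntegral.integral_const, smul_eq_mul]
  have h3 : (∫ x in a..b, f x) = m * (b - a) := by rw [hm]; field_simp
  rw [h2, h3] at h1
  rw [h3]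
  nlinarith

/-- A coercive energy bound controls the derivative at the left endpoint. -/
lemma Sol.norm_deriv_le (h : Sol Q y y') {a M K k : ℝ} (ha : 0 < a) (hM : 0 < M) (hK : 0 ≤ K)
    (hk : 0 < k) (hQ : ∀ x ∈ Icc a (a + 1 / √M), ‖Q x‖ ≤ K * M)
    (h1 : k * (∫ x in a..a + 1 / √M, ‖y' x‖ ^ 2) ≤ ‖y' a‖ * ‖y a‖)
    (h2 : k * M * (∫ x in a..a + 1 / √M, ‖y x‖ ^ 2) ≤ ‖y' a‖ * ‖y a‖) :
    ‖y' a‖ ≤ 2 * (1 + K ^ 2) / k * √M * ‖y a‖ := by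
  set r := √M with hr
  have hr0 : 0 < r := Real.sqrt_pos.2 hM
  have hrM : M = r ^ 2 := (Real.sq_sqrt hM.le).symm
  set ℓ := 1 / r with hℓ
  have hℓ0 : 0 < ℓ := by positivity
  have hsub : Icc a (a + ℓ) ⊆ Ioi 0 := fun x hx => lt_of_lt_of_le ha hx.1
  have c1 := h.contY.mono hsub
  have c2 := h.contY'.mono hsub
  have c3 := h.cont.mono hsub
  set J1 := ∫ x in a..a + ℓ, ‖y' x‖ ^ 2
  set J2 := ∫ x in a..a + ℓ, ‖y x‖ ^ 2
  have hcs1 := sq_integral_le (show a < a + ℓ by linarith) c2.norm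
  have hcs2 := sq_integral_le (show a < a + ℓ by linarith) c1.norm
  set I1 := ∫ x in a..a + ℓ, ‖y' x‖
  set I2 := ∫ x in a..a + ℓ, ‖y x‖
  have hI2 : 0 ≤ I2 := intervalIntegral.integral_nonneg (by linarith) fun _ _ => norm_nonneg _
  have hI1 : 0 ≤ I1 := intervalIntegral.integral_nonneg (by linarith) fun _ _ => norm_nonneg _
  have hpt : ∀ s ∈ Icc a (a + ℓ), ‖y' a‖ - K * M * I2 ≤ ‖y' s‖ := by
    intro s hs
    have hss : uIcc a s ⊆ Icc a (a + ℓ) := by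
      rw [uIcc_of_le hs.1]; exact Icc_subset_Icc_right hs.2
    have e1 : ∫ x in a..s, Q x * y x = y' s - y' a :=
      intervalIntegral.integral_eq_sub_of_hasDerivAt (fun x hx => h.d2 x (hsub (hss hx)))
        ((c3.mul c1).mono hss).intervalIntegrable
    have e2 : ‖∫ x in a..s, Q x * y x‖ ≤ K * M * I2 := by
      calc ‖∫ x in a..s, Q x * y x‖ ≤ ∫ x in a..s, ‖Q x * y x‖ :=
            intervalIntegral.norm_integral_le_integral_norm hs.1
        _ ≤ ∫ x in a..a + ℓ, ‖Q x * y x‖ := by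
            refine intervalIntegral.integral_mono_interval le_rfl hs.1 hs.2
              (Eventually.of_forall fun x => norm_nonneg _) ?_
            exact (ContinuousOn.mono (by fun_prop)
              (uIcc_of_le (by linarith)).subset).intervalIntegrable
        _ ≤ ∫ x in a..a + ℓ, K * M * ‖y x‖ := by
            refine intervalIntegral.integral_mono_on (by linarith) ?_ ?_ fun x hx => ?_
            · exact (ContinuousOn.mono (by fun_prop)
                (uIcc_of_le (by linarith)).subset).intervalIntegrable
            · exact (ContinuousOn.mono (by fun_prop)
                (uIcc_of_le (by linarith)).subset).intervalIntegrable
            · rw [norm_mul]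
              exact mul_le_mul_of_nonneg_right (hQ x hx) (norm_nonneg _)
        _ = K * M * I2 := intervalIntegral.integral_const_mul _ _
    have e3 : ‖y' a‖ ≤ ‖y' s‖ + ‖∫ x in a..s, Q x * y x‖ := by
      rw [e1]
      have := norm_sub_norm_le (y' a) (y' s)
      rw [norm_sub_rev] at this
      linarith
    linarith
  have hav : ℓ * (‖y' a‖ - K * M * I2) ≤ I1 := by
    have : ∫ _ in a..a + ℓ, (‖y' a‖ - K * M * I2) ≤ I1 :=
      intervalIntegral.integral_mono_on (by linarith) intervalIntegrable_const
        ((ContinuousOn.mono (by fun_prop) (uIcc_of_le (by linarith)).subset).intervalIntegrable) hpt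
    rwa [intervalIntegral.integral_const, add_sub_cancel_left, smul_eq_mul] at this
  simp only [add_sub_cancel_left] at hcs1 hcs2
  set A := ‖y' a‖ * ‖y a‖ with hA
  have hrl : r * ℓ = 1 := by rw [hℓ]; field_simp
  have hav2 : ‖y' a‖ ≤ r * I1 + K * M * I2 := by
    have := mul_le_mul_of_nonneg_left hav hr0.le
    rw [← mul_assoc, hrl, one_mul] at this
    linarith
  have s1 : (r * I1) ^ 2 ≤ r * (A / k) := by
    have : J1 ≤ A / k := by rw [le_div_iff₀ hk]; linarith
    calc (r * I1) ^ 2 = r ^ 2 * I1 ^ 2 := by ring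
      _ ≤ r ^ 2 * (ℓ * (A / k)) := by
        have := hcs1.trans (mul_le_mul_of_nonneg_left this hℓ0.le)
        gcongr
      _ = (r * ℓ) * (r * (A / k)) := by ring
      _ = _ := by rw [hrl, one_mul]
  have s2 : (K * M * I2) ^ 2 ≤ K ^ 2 * (r * (A / k)) := by
    have : M * J2 ≤ A / k := by rw [le_div_iff₀ hk]; linarith
    calc (K * M * I2) ^ 2 = K ^ 2 * M ^ 2 * I2 ^ 2 := by ring
      _ ≤ K ^ 2 * M ^ 2 * (ℓ * J2) := by gcongr
      _ = K ^ 2 * (M * ℓ) * (M * J2) := by ring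
      _ ≤ K ^ 2 * (M * ℓ) * (A / k) := by gcongr
      _ = K ^ 2 * ((r * ℓ) * (r * (A / k))) := by rw [hrM]; ring
      _ = _ := by rw [hrl, one_mul]
  have hA0 : 0 ≤ r * (A / k) := by positivity
  have hsq : ‖y' a‖ ^ 2 ≤ 2 * (1 + K ^ 2) * (r * (A / k)) := by
    have : 0 ≤ K * M * I2 := by positivity
    have h3 : 0 ≤ r * I1 := by positivity
    nlinarith [norm_nonneg (y' a), sq_nonneg (r * I1 - K * M * I2)]
  rcases (norm_nonneg (y' a)).eq_or_lt with h0 | h0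
  · rw [← h0]; positivity
  · refine le_of_mul_le_mul_left ?_ h0
    calc ‖y' a‖ * ‖y' a‖ = ‖y' a‖ ^ 2 := by ring
      _ ≤ _ := hsq
      _ = _ := by rw [hA]; field_simp

end PowerPotential

namespace PowerPotential

open Complex Filter Topology ComplexConjugate

/-- The energy density of a solution rotated by `e`. -/
noncomputable def density (e : ℂ) (Q y y' : ℝ → ℂ) (x : ℝ) : ℝ :=
  e.re * ‖y' x‖ ^ 2 + (e * Q x).re * ‖y x‖ ^ 2

/-- A potential which is coercive on `[1, ∞)` after a rotation by `e`, together with the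
fundamental solutions normalised at `1`. -/
structure Coercive (Q C C' S S' : ℝ → ℂ) (e : ℂ) (k K M : ℝ) : Prop where
  solC : Sol Q C C'
  solS : Sol Q S S'
  C1 : C 1 = 1
  C1' : C' 1 = 0
  S1 : S 1 = 0
  S1' : S' 1 = 1
  he : ‖e‖ ≤ 1
  hk : 0 < k
  hM : 1 ≤ M
  hK : 0 ≤ K
  re_e : k ≤ e.re
  re_norm : ∀ x ≥ 1, k * ‖Q x‖ ≤ (e * Q x).re
  re_M : ∀ x ≥ 1, k * M ≤ (e * Q x).re
  upper : ∀ x ∈ Icc (1 : ℝ) 2, ‖Q x‖ ≤ K * M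

lemma Sol.contOn_density {Q y y' : ℝ → ℂ} (h : Sol Q y y') (e : ℂ) :
    ContinuousOn (density e Q y y') (Ioi 0) := by
  have h1 := h.contY
  have h2 := h.contY'
  have h3 := h.cont
  have h4 : ContinuousOn (fun x => (e * Q x).re) (Ioi 0) :=
    Complex.continuous_re.comp_continuousOn (by fun_prop)
  unfold density
  fun_prop

namespace Coercive

variable {Q C C' S S' y y' : ℝ → ℂ} {e : ℂ} {k K M : ℝ}

lemma density_ge (h : Coercive Q C C' S S' e k K M) {x : ℝ} (hx : 1 ≤ x) :
    k * ‖y' x‖ ^ 2 + k * M * ‖y x‖ ^ 2 ≤ density e Q y y' x := by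
  have h1 := h.re_e
  have h2 := h.re_M x hx
  unfold density
  gcongr

lemma density_nonneg (h : Coercive Q C C' S S' e k K M) {x : ℝ} (hx : 1 ≤ x) :
    0 ≤ density e Q y y' x := by
  have h1 := h.hk
  have h2 := h.hM
  exact le_trans (by positivity) (h.density_ge hx)

lemma intervalIntegrable (hy : Sol Q y y') {a b : ℝ} (ha : 1 ≤ a) (hb : 1 ≤ b) :
    IntervalIntegrable (density e Q y y') volume a b :=
  ((hy.contOn_density e).mono fun _ hx => lt_of_lt_of_le one_pos
    ((le_min ha hb).trans hx.1)).intervalIntegrable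

lemma energy (hy : Sol Q y y') {T : ℝ} (hT : 1 ≤ T) :
    ∫ x in (1 : ℝ)..T, density e Q y y' x =
      (e * (y' T * conj (y T))).re - (e * (y' 1 * conj (y 1))).re :=
  hy.re_energy_interval one_pos hT e

lemma energy_S (h : Coercive Q C C' S S' e k K M) {T : ℝ} (hT : 1 ≤ T) :
    ∫ x in (1 : ℝ)..T, density e Q S S' x = (e * (S' T * conj (S T))).re := by
  rw [energy h.solS hT, h.S1]; simp

lemma energy_S_pos (h : Coercive Q C C' S S' e k K M) {T : ℝ} (hT : 1 < T) :
    0 < ∫ x in (1 : ℝ)..T, density e Q S S' x := by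
  refine intervalIntegral.integral_pos hT ((h.solS.contOn_density e).mono fun x hx =>
    lt_of_lt_of_le one_pos hx.1) (fun x hx => h.density_nonneg hx.1.le) ⟨1, ⟨le_rfl, hT.le⟩, ?_⟩
  have := h.re_e
  have := h.hk
  simp only [density, h.S1, h.S1', norm_one, norm_zero]
  norm_num
  linarith

lemma S_ne_zero (h : Coercive Q C C' S S' e k K M) {T : ℝ} (hT : 1 < T) : S T ≠ 0 := by
  intro h0
  have h1 := h.energy_S_pos hT
  rw [h.energy_S hT.le, h0] at h1
  simp at h1

/-- The solution vanishing at `T`, normalised at `1`. -/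
lemma sol_add (h : Coercive Q C C' S S' e k K M) (u : ℂ) :
    Sol Q (fun x => C x + u * S x) (fun x => C' x + u * S' x) := by
  simpa using h.solC.lincomb h.solS 1 u

lemma energy_add (h : Coercive Q C C' S S' e k K M) {T : ℝ} (hT : 1 ≤ T) (u : ℂ) :
    ∫ x in (1 : ℝ)..T, density e Q (fun x => C x + u * S x) (fun x => C' x + u * S' x) x =
      (e * ((C' T + u * S' T) * conj (C T + u * S T))).re - (e * u).re := by
  rw [energy (h.sol_add u) hT, h.C1, h.C1', h.S1, h.S1']; simp

lemma energy_truncated (h : Coercive Q C C' S S' e k K M) {T : ℝ} (hT : 1 < T) :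
    ∫ x in (1 : ℝ)..T, density e Q (fun x => C x + -(C T / S T) * S x)
      (fun x => C' x + -(C T / S T) * S' x) x ≤ ‖C T / S T‖ := by
  have h0 : C T + -(C T / S T) * S T = 0 := by
    have := h.S_ne_zero hT
    field_simp; ring
  rw [h.energy_add hT.le, h0, map_zero, mul_zero, mul_zero, zero_re, zero_sub, ← neg_re]
  refine (re_le_norm _).trans ?_
  rw [norm_neg, norm_mul, norm_neg]
  have := h.he
  calc ‖e‖ * ‖C T / S T‖ ≤ 1 * ‖C T / S T‖ := by gcongr
    _ = _ := one_mul _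

lemma integral_le_energy (h : Coercive Q C C' S S' e k K M) (hy : Sol Q y y') {b T : ℝ}
    (hb : 1 ≤ b) (hbT : b ≤ T) :
    k * (∫ x in (1 : ℝ)..b, ‖y' x‖ ^ 2) ≤ ∫ x in (1 : ℝ)..T, density e Q y y' x ∧
    k * M * (∫ x in (1 : ℝ)..b, ‖y x‖ ^ 2) ≤ ∫ x in (1 : ℝ)..T, density e Q y y' x := by
  have hk := h.hk
  have hM := h.hM
  have hmono : ∫ x in (1 : ℝ)..b, density e Q y y' x ≤ ∫ x in (1 : ℝ)..T, density e Q y y' x := by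
    rw [← intervalIntegral.integral_add_adjacent_intervals (intervalIntegrable hy le_rfl hb)
      (intervalIntegrable hy hb (hb.trans hbT))]
    have : 0 ≤ ∫ x in b..T, density e Q y y' x :=
      intervalIntegral.integral_nonneg hbT fun x hx => h.density_nonneg (hb.trans hx.1)
    linarith
  have hsub : uIcc 1 b ⊆ Ioi 0 := by
    rw [uIcc_of_le hb]; exact fun x hx => lt_of_lt_of_le one_pos hx.1
  have c1 := hy.contY.mono hsub
  have c2 := hy.contY'.mono hsub
  constructor
  · refine le_trans ?_ hmono
    rw [← intervalIntegral.integral_const_mul]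
    refine intervalIntegral.integral_mono_on hb (ContinuousOn.intervalIntegrable (by fun_prop))
      (intervalIntegrable hy le_rfl hb) fun x hx => le_trans ?_ (h.density_ge hx.1)
    have : 0 ≤ k * M * ‖y x‖ ^ 2 := by positivity
    linarith
  · refine le_trans ?_ hmono
    rw [← intervalIntegral.integral_const_mul]
    refine intervalIntegral.integral_mono_on hb (ContinuousOn.intervalIntegrable (by fun_prop))
      (intervalIntegrable hy le_rfl hb) fun x hx => le_trans ?_ (h.density_ge hx.1)
    have : 0 ≤ k * ‖y' x‖ ^ 2 := by positivity
    linarith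

lemma norm_ratio_le (h : Coercive Q C C' S S' e k K M) {T : ℝ} (hT : 2 ≤ T) :
    ‖C T / S T‖ ≤ 2 * (1 + K ^ 2) / k * √M := by
  have hM := h.hM
  have hr : 1 / √M ≤ 1 := by
    rw [div_le_one (by positivity)]; exact Real.one_le_sqrt.2 hM
  have hr0 : 0 < 1 / √M := by positivity
  have hen := h.energy_truncated (show 1 < T by linarith)
  have hsol := h.sol_add (-(C T / S T))
  have hi := h.integral_le_energy hsol (b := 1 + 1 / √M) (T := T) (by linarith) (by linarith)
  have e1 : ‖C' 1 + -(C T / S T) * S' 1‖ = ‖C T / S T‖ := by rw [h.C1', h.S1']; simp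
  have e2 : ‖C 1 + -(C T / S T) * S 1‖ = 1 := by rw [h.C1, h.S1]; simp
  have := hsol.norm_deriv_le one_pos (by linarith : (0:ℝ) < M) h.hK h.hk
    (fun x hx => h.upper x ⟨hx.1, by linarith [hx.2]⟩)
    (by rw [e1, e2, mul_one]; exact hi.1.trans hen) (by rw [e1, e2, mul_one]; exact hi.2.trans hen)
  rwa [e1, e2, mul_one] at this

lemma energy_S_ge (h : Coercive Q C C' S S' e k K M) {T : ℝ} (hT : 2 ≤ T) :
    (∫ x in (1 : ℝ)..2, density e Q S S' x) * (1 + 2 * k * (T - 2)) ≤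
      ∫ x in (1 : ℝ)..T, density e Q S S' x := by
  have hk := h.hk
  have hM := h.hM
  set E2 := ∫ x in (1 : ℝ)..2, density e Q S S' x with hE2
  have hmono : ∀ x ≥ 2, E2 ≤ ∫ x in (1 : ℝ)..x, density e Q S S' x := by
    intro x hx
    rw [← intervalIntegral.integral_add_adjacent_intervals
      (intervalIntegrable h.solS le_rfl one_le_two)
      (intervalIntegrable h.solS one_le_two (one_le_two.trans hx))]
    have : 0 ≤ ∫ x in (2 : ℝ)..x, density e Q S S' x :=
      intervalIntegral.integral_nonneg hx fun x hx => h.density_nonneg (one_le_two.trans hx.1)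
    linarith
  have hpt : ∀ x ∈ Icc 2 T, 2 * k * E2 ≤ density e Q S S' x := by
    intro x hx
    have hx1 : 1 ≤ x := one_le_two.trans hx.1
    have h1 := hmono x hx.1
    rw [h.energy_S hx1] at h1
    have h2 : (e * (S' x * conj (S x))).re ≤ ‖S' x‖ * ‖S x‖ := by
      refine (re_le_norm _).trans ?_
      rw [norm_mul, norm_mul, RCLike.norm_conj]
      have := h.he
      calc ‖e‖ * (‖S' x‖ * ‖S x‖) ≤ 1 * (‖S' x‖ * ‖S x‖) := by gcongr
        _ = _ := one_mul _
    have h3 := h.density_ge (y := S) (y' := S') hx1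
    have h4 : k * ‖S x‖ ^ 2 ≤ k * M * ‖S x‖ ^ 2 := by
      have : k ≤ k * M := by nlinarith
      gcongr
    nlinarith [sq_nonneg (‖S' x‖ - ‖S x‖), norm_nonneg (S x), norm_nonneg (S' x)]
  have h5 : ∫ _ in (2 : ℝ)..T, 2 * k * E2 ≤ ∫ x in (2 : ℝ)..T, density e Q S S' x :=
    intervalIntegral.integral_mono_on hT intervalIntegrable_const
      (intervalIntegrable h.solS one_le_two (one_le_two.trans hT)) hpt
  rw [intervalIntegral.integral_const, smul_eq_mul] at h5
  rw [← intervalIntegral.integral_add_adjacent_intervals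
      (intervalIntegrable h.solS le_rfl one_le_two)
      (intervalIntegrable h.solS one_le_two (one_le_two.trans hT)), ← hE2]
  linarith

lemma density_sub_le (h : Coercive Q C C' S S' e k K M) {x : ℝ} (hx : 1 ≤ x) (u v : ℂ) :
    ‖u - v‖ ^ 2 * density e Q S S' x ≤
      2 * density e Q (fun x => C x + u * S x) (fun x => C' x + u * S' x) x +
      2 * density e Q (fun x => C x + v * S x) (fun x => C' x + v * S' x) x := by
  have hk := h.hk
  have h1 : 0 ≤ e.re := hk.le.trans h.re_e
  have h2 : 0 ≤ (e * Q x).re := le_trans (by have := h.hM; positivity) (h.re_M x hx)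
  have key : ∀ a b : ℂ, ‖a - b‖ ^ 2 ≤ 2 * ‖a‖ ^ 2 + 2 * ‖b‖ ^ 2 := fun a b => by
    have := norm_sub_le a b
    nlinarith [sq_nonneg (‖a‖ - ‖b‖), norm_nonneg (a - b)]
  have k1 := key (C' x + u * S' x) (C' x + v * S' x)
  have k2 := key (C x + u * S x) (C x + v * S x)
  rw [show C' x + u * S' x - (C' x + v * S' x) = (u - v) * S' x by ring, norm_mul] at k1
  rw [show C x + u * S x - (C x + v * S x) = (u - v) * S x by ring, norm_mul] at k2
  unfold density
  nlinarith [mul_le_mul_of_nonneg_left k1 h1, mul_le_mul_of_nonneg_left k2 h2]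

lemma ratio_sub_sq_le (h : Coercive Q C C' S S' e k K M) {T T' : ℝ} (hT : 2 ≤ T) (hTT : T ≤ T') :
    ‖C T / S T - C T' / S T'‖ ^ 2 * (∫ x in (1 : ℝ)..T, density e Q S S' x) ≤
      4 * (2 * (1 + K ^ 2) / k * √M) := by
  have hT1 : 1 ≤ T := by linarith
  have b1 := (h.energy_truncated (show 1 < T by linarith)).trans (h.norm_ratio_le hT)
  have b2 := (h.energy_truncated (show 1 < T' by linarith)).trans (h.norm_ratio_le (hT.trans hTT))
  have s1 := h.sol_add (-(C T / S T))
  have s2 := h.sol_add (-(C T' / S T'))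
  have i1 := intervalIntegrable (e := e) s1 le_rfl hT1
  have i2 := intervalIntegrable (e := e) s2 le_rfl hT1
  have b3 : ∫ x in (1 : ℝ)..T, density e Q (fun x => C x + -(C T' / S T') * S x)
      (fun x => C' x + -(C T' / S T') * S' x) x ≤ 2 * (1 + K ^ 2) / k * √M := by
    refine le_trans ?_ b2
    rw [← intervalIntegral.integral_add_adjacent_intervals i2
      (intervalIntegrable s2 hT1 (hT1.trans hTT))]
    have := intervalIntegral.integral_nonneg (μ := volume) hTT fun x hx =>
      h.density_nonneg (y := fun x => C x + -(C T' / S T') * S x)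
        (y' := fun x => C' x + -(C T' / S T') * S' x) (hT1.trans hx.1)
    linarith
  have h6 := intervalIntegral.integral_mono_on hT1
    ((intervalIntegrable (e := e) h.solS le_rfl hT1).const_mul _)
    ((i1.const_mul 2).add (i2.const_mul 2))
    (fun x hx => h.density_sub_le hx.1 (-(C T / S T)) (-(C T' / S T')))
  rw [intervalIntegral.integral_const_mul, intervalIntegral.integral_add (i1.const_mul 2)
    (i2.const_mul 2), intervalIntegral.integral_const_mul, intervalIntegral.integral_const_mul,
    show -(C T / S T) - -(C T' / S T') = -(C T / S T - C T' / S T') by ring, norm_neg] at h6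
  linarith

/-- Convergence of the truncated solutions to a solution of finite energy. -/
theorem exists_limit (h : Coercive Q C C' S S' e k K M) {T : ℕ → ℝ} (hT : ∀ n, 2 ≤ T n)
    (hmono : Monotone T) (hlim : Tendsto T atTop atTop) :
    ∃ u : ℂ, Tendsto (fun n => -(C (T n) / S (T n))) atTop (𝓝 u) ∧
      Decays Q (fun x => C x + u * S x) (fun x => C' x + u * S' x) ∧
      ‖u‖ ≤ 2 * (1 + K ^ 2) / k * √M := by
  have hk := h.hk
  have hM := h.hM
  set B := 2 * (1 + K ^ 2) / k * √M with hB
  have hB0 : 0 ≤ B := by positivity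
  set E2 := ∫ x in (1 : ℝ)..2, density e Q S S' x with hE2
  have hE2pos : 0 < E2 := h.energy_S_pos one_lt_two
  set b : ℕ → ℝ := fun n => √(4 * B / (E2 * (1 + 2 * k * (T n - 2)))) with hb
  have hden : ∀ n, 0 < E2 * (1 + 2 * k * (T n - 2)) := fun n => by
    have := hT n
    have : 0 ≤ 2 * k * (T n - 2) := mul_nonneg (by positivity) (by linarith)
    positivity
  have hb0 : Tendsto b atTop (𝓝 0) := by
    rw [← Real.sqrt_zero]
    refine (Real.continuous_sqrt.tendsto 0).comp ?_
    refine tendsto_const_nhds.div_atTop ?_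
    refine Tendsto.const_mul_atTop hE2pos (tendsto_atTop_add_const_left _ _ ?_)
    exact Tendsto.const_mul_atTop (by positivity) (tendsto_atTop_add_const_right _ _ hlim)
  have hcauchy : CauchySeq fun n => -(C (T n) / S (T n)) := by
    refine cauchySeq_of_le_tendsto_0' b (fun n m hnm => ?_) hb0
    have h1 := h.ratio_sub_sq_le (hT n) (hmono hnm)
    have h2 := h.energy_S_ge (hT n)
    rw [dist_eq_norm, neg_sub_neg, norm_sub_rev]
    refine Real.le_sqrt_of_sq_le ?_
    rw [le_div_iff₀ (hden n)]
    refine le_trans ?_ h1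
    gcongr
  obtain ⟨u, hu⟩ := cauchySeq_tendsto_of_complete hcauchy
  refine ⟨u, hu, ?_, ?_⟩
  swap
  · refine le_of_tendsto hu.norm (Eventually.of_forall fun n => ?_)
    rw [norm_neg]
    exact h.norm_ratio_le (hT n)
  have hsol := h.sol_add u
  have hbound : ∀ X ≥ 1, ∫ x in (1 : ℝ)..X, density e Q (fun x => C x + u * S x)
      (fun x => C' x + u * S' x) x ≤ B := by
    intro X hX
    rw [h.energy_add hX]
    have hc : Tendsto (fun n => (e * ((C' X + -(C (T n) / S (T n)) * S' X) *
        conj (C X + -(C (T n) / S (T n)) * S X))).re - (e * -(C (T n) / S (T n))).re) atTop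
        (𝓝 ((e * ((C' X + u * S' X) * conj (C X + u * S X))).re - (e * u).re)) := by
      have hcont : Continuous fun v : ℂ => (e * ((C' X + v * S' X) * conj (C X + v * S X))).re -
          (e * v).re := by
        have := Complex.continuous_conj
        have := Complex.continuous_re
        fun_prop
      exact (hcont.tendsto u).comp hu
    refine le_of_tendsto hc ?_
    filter_upwards [hlim.eventually_ge_atTop X] with n hn
    rw [← h.energy_add hX]
    refine le_trans ?_ ((h.energy_truncated (show 1 < T n by linarith [hT n])).trans
      (h.norm_ratio_le (hT n)))
    have s1 := h.sol_add (-(C (T n) / S (T n)))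
    rw [← intervalIntegral.integral_add_adjacent_intervals (intervalIntegrable s1 le_rfl hX)
      (intervalIntegrable s1 hX (hX.trans hn))]
    have := intervalIntegral.integral_nonneg (μ := volume) hn fun x hx =>
      h.density_nonneg (y := fun x => C x + -(C (T n) / S (T n)) * S x)
        (y' := fun x => C' x + -(C (T n) / S (T n)) * S' x) (hX.trans hx.1)
    linarith
  have key : ∀ f : ℝ → ℝ, ContinuousOn f (Ioi 0) → (∀ x, 0 ≤ f x) →
      (∀ x ≥ 1, f x ≤ 2 / k * density e Q (fun x => C x + u * S x) (fun x => C' x + u * S' x) x) →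
      IntegrableOn f (Ioi 1) := by
    intro f hf hf0 hfd
    refine integrableOn_Ioi_of_intervalIntegral_norm_bounded (2 / k * B) (1 : ℝ)
      (b := fun n : ℕ => (n : ℝ) + 1) (l := atTop) (fun n => ?_)
      (tendsto_atTop_add_const_right _ _ tendsto_natCast_atTop_atTop)
      (Eventually.of_forall fun n => ?_)
    · exact ((hf.mono fun x hx => lt_of_lt_of_le one_pos hx.1).integrableOn_Icc).mono_set
        Ioc_subset_Icc_self
    · have hn : (1 : ℝ) ≤ n + 1 := by have := Nat.cast_nonneg (α := ℝ) n; linarith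
      have i3 := intervalIntegrable (e := e) hsol le_rfl hn
      calc ∫ x in (1 : ℝ)..(n + 1), ‖f x‖ = ∫ x in (1 : ℝ)..(n + 1), f x := by
            simp only [Real.norm_of_nonneg (hf0 _)]
        _ ≤ ∫ x in (1 : ℝ)..(n + 1), 2 / k * density e Q (fun x => C x + u * S x)
              (fun x => C' x + u * S' x) x := by
            refine intervalIntegral.integral_mono_on hn ?_ (i3.const_mul _) fun x hx => hfd x hx.1
            exact (hf.mono fun x hx => lt_of_lt_of_le one_pos
              (by rw [uIcc_of_le hn] at hx; exact hx.1)).intervalIntegrable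
        _ ≤ 2 / k * B := by
            rw [intervalIntegral.integral_const_mul]
            have := hbound _ hn
            gcongr
  have c1 := hsol.contY
  have c2 := hsol.contY'
  have c3 := hsol.cont
  refine decays_of_integrableOn hsol (key _ (by fun_prop) (fun x => by positivity) fun x hx => ?_)
    (key _ (by fun_prop) (fun x => by positivity) fun x hx => ?_)
  · have h1 := h.density_ge (y := fun x => C x + u * S x) (y' := fun x => C' x + u * S' x) hx
    have h2 : 0 ≤ k * M * ‖C x + u * S x‖ ^ 2 := by positivity
    rw [div_mul_eq_mul_div, le_div_iff₀ hk]
    nlinarith [sq_nonneg ‖C' x + u * S' x‖]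
  · have h1 := h.re_e
    have h2 := h.re_M x hx
    have h3 := h.re_norm x hx
    rw [div_mul_eq_mul_div, le_div_iff₀ hk]
    unfold density
    have h4 : 0 ≤ e.re * ‖C' x + u * S' x‖ ^ 2 := by
      have : 0 ≤ e.re := hk.le.trans h1
      positivity
    have h5 : (1 + ‖Q x‖) * k ≤ 2 * (e * Q x).re := by nlinarith
    have h6 := mul_le_mul_of_nonneg_right h5 (sq_nonneg ‖C x + u * S x‖)
    linarith

end Coercive

end PowerPotential

namespace PowerPotential

open Complex Filter Topology ComplexConjugate

variable {α : ℝ}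

/-- The potential `c x ^ α - lam`. -/
noncomputable def pot (α : ℝ) (c lam : ℂ) (x : ℝ) : ℂ := c * ((x ^ α : ℝ) : ℂ) - lam

/-- The combination `p G₀ + q G₁` of the series solutions. -/
noncomputable def Y (α : ℝ) (μ p q w : ℂ) : ℂ := p * G α 0 μ w + q * G α 1 μ w

/-- The logarithmic derivative in `w` of `Y`. -/
noncomputable def Yd (α : ℝ) (μ p q w : ℂ) : ℂ := p * Gd α 0 μ w + q * Gd α 1 μ w

/-- Restriction of a function of `w = log z` to the ray through `exp w₀`. -/
noncomputable def ray (F : ℂ → ℂ) (w₀ : ℂ) (x : ℝ) : ℂ := F (Real.log x + w₀)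

/-- Derivative along a ray, given the logarithmic derivative. -/
noncomputable def rayd (F : ℂ → ℂ) (w₀ : ℂ) (x : ℝ) : ℂ := (x : ℂ)⁻¹ * F (Real.log x + w₀)

/-- The potential along the ray through `exp w₀`. -/
noncomputable def rayPot (α : ℝ) (μ w₀ : ℂ) : ℝ → ℂ :=
  pot α (exp ((α + 2) * w₀)) (exp (2 * w₀) * μ)

lemma hasDerivAt_Y (hα : 0 < α) (μ p q w : ℂ) : HasDerivAt (Y α μ p q) (Yd α μ p q w) w :=
  ((hasDerivAt_G hα μ w).const_mul p).add ((hasDerivAt_G hα μ w).const_mul q)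

lemma hasDerivAt_Yd (hα : 0 < α) (μ p q w : ℂ) :
    HasDerivAt (Yd α μ p q) (Yd α μ p q w + exp (2 * w) * (exp (α * w) - μ) * Y α μ p q w) w :=
  (((hasDerivAt_Gd hα (Or.inl rfl) μ w).const_mul p).add
    ((hasDerivAt_Gd hα (Or.inr rfl) μ w).const_mul q)).congr_deriv (by unfold Y Yd; ring)

lemma continuousOn_pot (c lam : ℂ) : ContinuousOn (pot α c lam) (Ioi 0) := by
  have : ContinuousOn (fun x : ℝ => x ^ α) (Ioi 0) := fun x hx =>
    (Real.continuousAt_rpow_const x α (Or.inl (ne_of_gt hx))).continuousWithinAt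
  unfold pot
  fun_prop

lemma hasDerivAt_ray {F : ℂ → ℂ} {F' w₀ : ℂ} {x : ℝ} (hx : 0 < x)
    (h : HasDerivAt F F' (Real.log x + w₀)) : HasDerivAt (ray F w₀) ((x : ℂ)⁻¹ * F') x := by
  have h1 : HasDerivAt (fun x : ℝ => ((Real.log x : ℝ) : ℂ) + w₀) ((x⁻¹ : ℝ) : ℂ) x :=
    ((Real.hasDerivAt_log hx.ne').ofReal_comp).add_const w₀
  have := h.comp x h1
  refine this.congr_deriv ?_
  push_cast; ring

lemma exp_log_add {x : ℝ} (hx : 0 < x) (a : ℝ) (w₀ : ℂ) :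
    exp (a * (Real.log x + w₀)) = ((x ^ a : ℝ) : ℂ) * exp (a * w₀) := by
  rw [mul_add, Complex.exp_add, Real.rpow_def_of_pos hx]
  push_cast
  rw [mul_comm (a : ℂ) _]

lemma sol_ray (hα : 0 < α) (μ p q w₀ : ℂ) :
    Sol (rayPot α μ w₀) (ray (Y α μ p q) w₀) (rayd (Yd α μ p q) w₀) := by
  refine ⟨continuousOn_pot _ _, fun x hx => hasDerivAt_ray hx (hasDerivAt_Y hα μ p q _), ?_⟩
  intro x hx
  have h1 := hasDerivAt_ray hx (hasDerivAt_Yd hα μ p q (Real.log x + w₀))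
  have hx0 : (x : ℂ) ≠ 0 := by exact_mod_cast hx.ne'
  have h2 : HasDerivAt (fun x : ℝ => (x : ℂ)⁻¹) (-(x ^ 2 : ℂ)⁻¹) x := by
    have := (hasDerivAt_inv hx0).comp_ofReal
    simpa using this
  refine (h2.mul h1).congr_deriv ?_
  have e1 := exp_log_add hx α w₀
  have e2 := exp_log_add hx 2 w₀
  simp only [ray, rayPot, pot]
  push_cast at e2
  rw [e1, e2, add_mul, Complex.exp_add]
  simp only [Real.rpow_ofNat]
  push_cast
  field_simp
  ring

lemma tendsto_ray_Y (hα : 0 < α) (μ p q w₀ : ℂ) :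
    Tendsto (ray (Y α μ p q) w₀) (𝓝[>] 0) (𝓝 p) := by
  have h0 := tendsto_exp_mul_G (e := 0) hα μ w₀
  have h1 := tendsto_exp_mul_G (e := 1) hα μ w₀
  have h2 : Tendsto (fun ξ : ℝ => exp ((ξ : ℂ) + w₀)) atBot (𝓝 0) := by
    rw [tendsto_zero_iff_norm_tendsto_zero]
    simp only [Complex.norm_exp, add_re, ofReal_re]
    exact Real.tendsto_exp_atBot.comp (tendsto_atBot_add_const_right _ _ tendsto_id)
  have h3 := (h0.const_mul p).add ((h2.mul h1).const_mul q)
  have h4 : Tendsto (fun ξ : ℝ => Y α μ p q (ξ + w₀)) atBot (𝓝 p) := by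
    simp only [mul_one, mul_zero, add_zero] at h3
    refine h3.congr fun ξ => ?_
    simp only [Y, Nat.cast_zero, Nat.cast_one, zero_mul, one_mul, neg_zero, Complex.exp_zero]
    rw [← mul_assoc (exp _), ← Complex.exp_add]
    simp
  exact h4.comp Real.tendsto_log_nhdsGT_zero

lemma tendsto_rayd_Yd (hα : 0 < α) (μ p q w₀ : ℂ) :
    Tendsto (rayd (Yd α μ p q) w₀) (𝓝[>] 0) (𝓝 (q * exp w₀)) := by
  have h0 := tendsto_exp_mul_Gd_zero hα μ w₀
  have h1 := tendsto_exp_mul_Gd (e := 1) hα μ w₀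
  have h3 := ((h0.const_mul p).add (h1.const_mul q)).mul_const (exp w₀)
  have h4 : Tendsto (fun ξ : ℝ => exp (-(ξ : ℂ)) * Yd α μ p q (ξ + w₀)) atBot
      (𝓝 (q * exp w₀)) := by
    simp only [mul_one, mul_zero, zero_add, Nat.cast_one] at h3
    refine h3.congr fun ξ => ?_
    have : exp (-(ξ : ℂ)) = exp (-(ξ + w₀)) * exp w₀ := by
      rw [← Complex.exp_add]; congr 1; ring
    simp only [Yd, one_mul, this]
    ring
  refine (h4.comp Real.tendsto_log_nhdsGT_zero).congr' ?_
  filter_upwards [self_mem_nhdsWithin] with x hx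
  have : exp (-((Real.log x : ℝ) : ℂ)) = (x : ℂ)⁻¹ := by
    rw [Complex.exp_neg, ← ofReal_exp, Real.exp_log hx]
  simp only [rayd, Function.comp, this]

lemma wronskian_Y (hα : 0 < α) (μ p q p' q' w : ℂ) :
    Y α μ p q w * Yd α μ p' q' w - Yd α μ p q w * Y α μ p' q' w = (p * q' - q * p') * exp w := by
  have := wronskian_G hα μ w
  unfold Y Yd
  linear_combination (p * q' - q * p') * this

lemma ray_one (F : ℂ → ℂ) (w₀ : ℂ) : ray F w₀ 1 = F w₀ := by simp [ray]
lemma rayd_one (F : ℂ → ℂ) (w₀ : ℂ) : rayd F w₀ 1 = F w₀ := by simp [rayd]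

/-- `Y` has finite energy along the ray through `exp w₀`. -/
def DecRay (α : ℝ) (μ p q w₀ : ℂ) : Prop :=
  Decays (rayPot α μ w₀) (ray (Y α μ p q) w₀) (rayd (Yd α μ p q) w₀)

lemma ray_add_real (F : ℂ → ℂ) (w₀ : ℂ) {t x : ℝ} (ht : 0 < t) (hx : 0 < x) :
    ray F (w₀ + Real.log t) x = ray F w₀ (t * x) := by
  unfold ray
  rw [Real.log_mul ht.ne' hx.ne']
  push_cast; ring_nf

lemma rayPot_add_real (μ w₀ : ℂ) {t x : ℝ} (ht : 0 < t) (hx : 0 < x) :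
    rayPot α μ (w₀ + Real.log t) x = (t : ℂ) ^ 2 * rayPot α μ w₀ (t * x) := by
  unfold rayPot pot
  have e1 := exp_log_add ht (α + 2) w₀
  have e2 := exp_log_add ht 2 w₀
  push_cast at e1 e2
  rw [add_comm _ w₀] at e1 e2
  rw [e1, e2, Real.mul_rpow ht.le hx.le, Real.rpow_add ht]
  simp only [Real.rpow_ofNat]
  push_cast
  ring

lemma DecRay.add_real (hα : 0 < α) {μ p q w₀ : ℂ} (h : DecRay α μ p q w₀) {t : ℝ} (ht : 0 < t) :
    DecRay α μ p q (w₀ + Real.log t) := by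
  obtain ⟨h1, h2⟩ := h (t * 1) (by positivity)
  refine decays_of_integrableOn (b := 1) (sol_ray hα μ p q _) ?_ ?_
  · have h3 := ((integrableOn_Ioi_comp_mul_left_iff
      (fun x => ‖rayd (Yd α μ p q) w₀ x‖ ^ 2) 1 ht).2 h1).const_mul (t ^ 2)
    refine IntegrableOn.congr_fun h3 (fun x hx => ?_) measurableSet_Ioi
    have hx0 : (0 : ℝ) < x := lt_trans one_pos hx
    have := ray_add_real (Yd α μ p q) w₀ ht hx0
    unfold ray at this
    simp only [rayd, this, norm_mul, norm_inv, Complex.norm_real, Real.norm_eq_abs, abs_of_pos ht,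
      abs_of_pos hx0, ofReal_mul]
    field_simp
  · have h3 := ((integrableOn_Ioi_comp_mul_left_iff
      (fun x => (1 + ‖rayPot α μ w₀ x‖) * ‖ray (Y α μ p q) w₀ x‖ ^ 2) 1 ht).2 h2).const_mul
        (1 + t ^ 2)
    refine Integrable.mono' h3 ?_ ?_
    · have hs := sol_ray hα μ p q (w₀ + Real.log t)
      have c1 := hs.contY
      have c2 := hs.cont
      have : ContinuousOn (fun x => (1 + ‖rayPot α μ (w₀ + Real.log t) x‖) *
        ‖ray (Y α μ p q) (w₀ + Real.log t) x‖ ^ 2) (Ioi 1) := by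
        have := c1.mono (Ioi_subset_Ioi zero_le_one)
        have := c2.mono (Ioi_subset_Ioi zero_le_one)
        fun_prop
      exact this.aestronglyMeasurable measurableSet_Ioi
    · refine (ae_restrict_iff' measurableSet_Ioi).2 (ae_of_all _ fun x hx => ?_)
      have hx0 : (0 : ℝ) < x := lt_trans one_pos hx
      rw [ray_add_real _ _ ht hx0, rayPot_add_real _ _ ht hx0, Real.norm_of_nonneg (by positivity),
        norm_mul, norm_pow, Complex.norm_real, Real.norm_of_nonneg ht.le, ← mul_assoc]
      have := norm_nonneg (rayPot α μ w₀ (t * x))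
      gcongr
      nlinarith [sq_nonneg t]

end PowerPotential

namespace PowerPotential

open Complex Filter Topology ComplexConjugate

variable {α φ : ℝ}

/-- The coercivity constant of the sector of half opening `φ`. -/
noncomputable def kap (α φ : ℝ) : ℝ := Real.cos ((α + 2) * φ / 2)

/-- The set of `w` at which the potential `z ^ α - μ` is coercive along the outgoing ray. -/
def wedge (α φ : ℝ) (μ : ℂ) : Set ℂ :=
  {w | |w.im| < φ ∧ 0 < w.re ∧ ‖μ‖ < kap α φ / 2 * Real.exp (α * w.re)}

/-- Admissible half openings. -/
structure Adm (α φ : ℝ) : Prop where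
  pos : 0 < α
  lt_two : α < 2
  phi_pos : 0 < φ
  phi_lt : (α + 2) * φ < Real.pi

/-- Solution data at the origin for Cauchy data `(1, u)` at `w`. -/
noncomputable def valZ (α : ℝ) (μ w u : ℂ) : ℂ := exp (-w) * (Gd α 1 μ w - u * G α 1 μ w)

/-- Solution data at the origin for Cauchy data `(1, u)` at `w`. -/
noncomputable def derZ (α : ℝ) (μ w u : ℂ) : ℂ := exp (-w) * (u * G α 0 μ w - Gd α 0 μ w)

lemma Adm.kap_pos (h : Adm α φ) : 0 < kap α φ := by
  have := h.pos; have := h.phi_pos; have := h.phi_lt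
  refine Real.cos_pos_of_mem_Ioo ⟨?_, by linarith⟩
  have : 0 < (α + 2) * φ / 2 := by positivity
  linarith [Real.pi_pos]

lemma kap_le_one : kap α φ ≤ 1 := Real.cos_le_one _

lemma Adm.kap_le_cos (h : Adm α φ) {ψ : ℝ} (hψ : |ψ| ≤ φ) :
    kap α φ ≤ Real.cos ((α + 2) * ψ / 2) := by
  have := h.pos; have := h.phi_pos; have := h.phi_lt
  rw [← Real.cos_abs ((α + 2) * ψ / 2)]
  have e : |(α + 2) * ψ / 2| = (α + 2) * |ψ| / 2 := by
    rw [abs_div, abs_mul, abs_of_pos (by linarith : 0 < α + 2), abs_two]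
  rw [e]
  exact Real.cos_le_cos_of_nonneg_of_le_pi (by positivity) (by nlinarith) (by gcongr)

lemma isOpen_wedge (μ : ℂ) : IsOpen (wedge α φ μ) := by
  have c1 : Continuous fun w : ℂ => |w.im| := by fun_prop
  have c2 : Continuous fun w : ℂ => kap α φ / 2 * Real.exp (α * w.re) := by fun_prop
  exact (isOpen_lt c1 continuous_const).inter
    ((isOpen_lt continuous_const Complex.continuous_re).inter (isOpen_lt continuous_const c2))

lemma Adm.coercive (h : Adm α φ) {μ w : ℂ} (hw : w ∈ wedge α φ μ) :
    Coercive (rayPot α μ w)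
      (ray (Y α μ (valZ α μ w 0) (derZ α μ w 0)) w) (rayd (Yd α μ (valZ α μ w 0) (derZ α μ w 0)) w)
      (ray (Y α μ (-(exp (-w) * G α 1 μ w)) (exp (-w) * G α 0 μ w)) w)
      (rayd (Yd α μ (-(exp (-w) * G α 1 μ w)) (exp (-w) * G α 0 μ w)) w)
      (exp (-((α + 2) * w.im / 2 : ℝ) * I)) (kap α φ / 4) 8 (Real.exp ((α + 2) * w.re)) := by
  obtain ⟨h1, h2, h3⟩ := hw
  have hk := h.kap_pos
  have hα := h.pos
  have hα2 := h.lt_two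
  have hW := wronskian_G hα μ w
  have hE : exp (-w) * exp w = 1 := by rw [← Complex.exp_add]; simp
  set M := Real.exp ((α + 2) * w.re) with hM
  have hM0 : 0 < M := Real.exp_pos _
  have hcos := h.kap_le_cos h1.le
  have hk1 : kap α φ ≤ 1 := kap_le_one
  have hc : ‖exp ((α + 2) * w)‖ = M := by
    rw [Complex.norm_exp, hM]; congr 1
    rw [show ((α : ℂ) + 2) = ((α + 2 : ℝ) : ℂ) by push_cast; rfl, re_ofReal_mul]
  have hl : ‖exp (2 * w) * μ‖ ≤ kap α φ / 2 * M := by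
    rw [norm_mul, Complex.norm_exp]
    have e : M = Real.exp (2 * w.re) * Real.exp (α * w.re) := by
      rw [hM, ← Real.exp_add]; congr 1; ring
    rw [e, show (2 * w).re = 2 * w.re by simp]
    nlinarith [Real.exp_pos (2 * w.re)]
  have hec : (exp (-((α + 2) * w.im / 2 : ℝ) * I) * exp ((α + 2) * w)).re =
      M * Real.cos ((α + 2) * w.im / 2) := by
    rw [← Complex.exp_add, Complex.exp_re, hM]
    congr 2
    · simp
    · simp; ring
  have hene : ‖exp (-((α + 2) * w.im / 2 : ℝ) * I)‖ = 1 := by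
    rw [← ofReal_neg, Complex.norm_exp_ofReal_mul_I]
  have hs : ∀ x : ℝ, 1 ≤ x → 1 ≤ x ^ α := fun x hx => Real.one_le_rpow hx hα.le
  have hre : ∀ x : ℝ, 1 ≤ x → kap α φ / 2 * M * x ^ α ≤
      (exp (-((α + 2) * w.im / 2 : ℝ) * I) * rayPot α μ w x).re := by
    intro x hx
    have h5 : |(exp (-((α + 2) * w.im / 2 : ℝ) * I) * (exp (2 * w) * μ)).re| ≤
        kap α φ / 2 * M :=
      (abs_re_le_norm _).trans (by rw [norm_mul, hene, one_mul]; exact hl)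
    have h6 := (abs_le.1 h5).2
    have e : (exp (-((α + 2) * w.im / 2 : ℝ) * I) * rayPot α μ w x).re =
        M * Real.cos ((α + 2) * w.im / 2) * x ^ α -
          (exp (-((α + 2) * w.im / 2 : ℝ) * I) * (exp (2 * w) * μ)).re := by
      rw [← hec, ← re_mul_ofReal, ← sub_re]; unfold rayPot pot; congr 1; ring_nf
    rw [e]
    have h7 : kap α φ * (M * x ^ α) ≤ Real.cos ((α + 2) * w.im / 2) * (M * x ^ α) := by
      have := hs x hx
      gcongr
    have h8 : kap α φ / 2 * M * 1 ≤ kap α φ / 2 * M * x ^ α := by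
      have := hs x hx
      gcongr
    linarith
  have hup : ∀ x : ℝ, 1 ≤ x → ‖rayPot α μ w x‖ ≤ 2 * M * x ^ α := by
    intro x hx
    have h9 := hs x hx
    unfold rayPot pot
    refine (norm_sub_le _ _).trans ?_
    rw [norm_mul, hc, Complex.norm_real, Real.norm_of_nonneg (by linarith)]
    have : kap α φ / 2 * M ≤ M * x ^ α := by nlinarith
    linarith
  refine ⟨sol_ray hα _ _ _ _, sol_ray hα _ _ _ _, ?_, ?_, ?_, ?_, hene.le, by positivity,
    Real.one_le_exp (by positivity), by norm_num, ?_, ?_, ?_, ?_⟩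
  · simp only [ray_one, Y, valZ, derZ]
    linear_combination exp (-w) * hW + hE
  · simp only [rayd_one, Yd, valZ, derZ]
    ring
  · simp only [ray_one, Y]
    ring
  · simp only [rayd_one, Yd]
    linear_combination exp (-w) * hW + hE
  · rw [← ofReal_neg, exp_ofReal_mul_I_re, Real.cos_neg]
    linarith
  · intro x hx
    have := hup x hx
    have := hre x hx
    nlinarith
  · intro x hx
    have := hs x hx
    have := hre x hx
    have : kap α φ / 4 * M * 1 ≤ kap α φ / 2 * M * x ^ α := by gcongr <;> linarith
    linarith
  · intro x hx
    refine (hup x hx.1).trans ?_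
    have h4 : x ^ α ≤ 4 := by
      calc x ^ α ≤ 2 ^ α := Real.rpow_le_rpow (by linarith [hx.1]) hx.2 hα.le
        _ ≤ 2 ^ (2 : ℝ) := Real.rpow_le_rpow_of_exponent_le (by norm_num) hα2.le
        _ = 4 := by norm_num
    nlinarith

/-- Approximations of the Weyl function. -/
noncomputable def weylSeq (α : ℝ) (n : ℕ) (μ w : ℂ) : ℂ :=
  (Gd α 0 μ w * G α 1 μ (w + (n + 1)) - Gd α 1 μ w * G α 0 μ (w + (n + 1))) /
    (G α 0 μ w * G α 1 μ (w + (n + 1)) - G α 1 μ w * G α 0 μ (w + (n + 1)))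

/-- The logarithmic derivative of the solution decaying at infinity. -/
noncomputable def weyl (α : ℝ) (μ w : ℂ) : ℂ := limUnder atTop fun n => weylSeq α n μ w

lemma weylSeq_eq (n : ℕ) (μ w : ℂ) : weylSeq α n μ w =
    -(ray (Y α μ (valZ α μ w 0) (derZ α μ w 0)) w (Real.exp (n + 1)) /
      ray (Y α μ (-(exp (-w) * G α 1 μ w)) (exp (-w) * G α 0 μ w)) w (Real.exp (n + 1))) := by
  unfold weylSeq ray Y valZ derZ
  rw [Real.log_exp, ← neg_div, add_comm _ w]
  rw [← mul_div_mul_left _ _ (exp_ne_zero (-w))]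
  push_cast
  congr 1 <;> ring

lemma two_le_exp (n : ℕ) : 2 ≤ Real.exp (n + 1) := by
  have := Real.add_one_le_exp ((n : ℝ) + 1)
  have : (0 : ℝ) ≤ n := Nat.cast_nonneg n
  linarith

lemma Adm.weylSeq_den_ne (h : Adm α φ) {μ w : ℂ} (hw : w ∈ wedge α φ μ) (n : ℕ) :
    G α 0 μ w * G α 1 μ (w + (n + 1)) - G α 1 μ w * G α 0 μ (w + (n + 1)) ≠ 0 := by
  intro h0
  refine (h.coercive hw).S_ne_zero (T := Real.exp (n + 1)) (by linarith [two_le_exp n]) ?_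
  unfold ray Y
  rw [Real.log_exp, add_comm _ w]
  push_cast
  linear_combination exp (-w) * h0

/-- The bound for the Weyl function. -/
noncomputable def weylBound (α φ : ℝ) (x : ℝ) : ℝ :=
  520 / kap α φ * Real.exp ((α + 2) * x / 2)

lemma weylBound_eq (x : ℝ) : 2 * (1 + (8 : ℝ) ^ 2) / (kap α φ / 4) * √(Real.exp ((α + 2) * x)) =
    weylBound α φ x := by
  rw [weylBound, ← Real.exp_half]
  field_simp; norm_num

lemma Adm.norm_weylSeq_le (h : Adm α φ) {μ w : ℂ} (hw : w ∈ wedge α φ μ) (n : ℕ) :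
    ‖weylSeq α n μ w‖ ≤ weylBound α φ w.re := by
  rw [weylSeq_eq, norm_neg, ← weylBound_eq]
  exact (h.coercive hw).norm_ratio_le (two_le_exp n)

lemma Adm.weyl_spec (h : Adm α φ) {μ w : ℂ} (hw : w ∈ wedge α φ μ) :
    Tendsto (fun n => weylSeq α n μ w) atTop (𝓝 (weyl α μ w)) ∧
      DecRay α μ (valZ α μ w (weyl α μ w)) (derZ α μ w (weyl α μ w)) w ∧
      ‖weyl α μ w‖ ≤ weylBound α φ w.re := by
  obtain ⟨u, hu1, hu2, hu3⟩ := (h.coercive hw).exists_limit (T := fun n => Real.exp (n + 1))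
    two_le_exp (fun m n hmn => by
      have : (m : ℝ) ≤ n := by exact_mod_cast hmn
      simpa using this)
    (Real.tendsto_exp_atTop.comp
      (tendsto_atTop_add_const_right _ _ tendsto_natCast_atTop_atTop))
  have hlim : Tendsto (fun n => weylSeq α n μ w) atTop (𝓝 u) := by
    simpa only [weylSeq_eq] using hu1
  have e : weyl α μ w = u := hlim.limUnder_eq
  rw [e]
  refine ⟨hlim, ?_, by rwa [← weylBound_eq]⟩
  unfold DecRay
  convert hu2 using 2 with x x
  · simp only [ray, Y, valZ, derZ]; ring
  · simp only [rayd, Yd, valZ, derZ]; ring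

lemma Adm.differentiableOn_weyl (h : Adm α φ) (μ : ℂ) :
    DifferentiableOn ℂ (weyl α μ) (wedge α φ μ) := by
  refine differentiableOn_of_tendsto_of_bounded (isOpen_wedge μ)
    (F := fun n w => weylSeq α n μ w) (fun n => ?_) (fun z hz => ?_) fun z hz => (h.weyl_spec hz).1
  · have d0 := differentiable_G (e := 0) h.pos μ
    have d1 := differentiable_G (e := 1) h.pos μ
    have d2 := differentiable_Gd (e := 0) h.pos μ
    have d3 := differentiable_Gd (e := 1) h.pos μ
    intro w hw
    refine DifferentiableAt.differentiableWithinAt (DifferentiableAt.div (by fun_prop)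
      (by fun_prop) (h.weylSeq_den_ne hw n))
  · refine ⟨1, one_pos, weylBound α φ (z.re + 1), fun n w hw hwΩ =>
      (h.norm_weylSeq_le hwΩ n).trans ?_⟩
    have hre : w.re ≤ z.re + 1 := by
      have := (abs_re_le_norm (w - z)).trans (mem_ball_iff_norm.1 hw).le
      rw [sub_re] at this
      linarith [(abs_le.1 this).2]
    have := h.kap_pos
    have := h.pos
    unfold weylBound
    gcongr

lemma Adm.differentiableOn_weyl_param (h : Adm α φ) {w : ℂ} (h1 : |w.im| < φ) (h2 : 0 < w.re) :
    DifferentiableOn ℂ (fun μ => weyl α μ w)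
      (Metric.ball 0 (kap α φ / 2 * Real.exp (α * w.re))) := by
  have hm : ∀ μ ∈ Metric.ball (0 : ℂ) (kap α φ / 2 * Real.exp (α * w.re)), w ∈ wedge α φ μ :=
    fun μ hμ => ⟨h1, h2, by simpa using hμ⟩
  refine differentiableOn_of_tendsto_of_bounded Metric.isOpen_ball
    (F := fun n μ => weylSeq α n μ w) (fun n => ?_) (fun z hz => ?_)
    fun z hz => (h.weyl_spec (hm z hz)).1
  · have d0 := fun w => differentiable_G_param (e := 0) h.pos w
    have d1 := fun w => differentiable_G_param (e := 1) h.pos w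
    have d2 := fun w => differentiable_Gd_param (e := 0) h.pos w
    have d3 := fun w => differentiable_Gd_param (e := 1) h.pos w
    intro μ hμ
    refine DifferentiableAt.differentiableWithinAt (DifferentiableAt.div ?_ ?_
      (h.weylSeq_den_ne (hm μ hμ) n))
    · exact ((d2 _).mul (d1 _)).differentiableAt.sub ((d3 _).mul (d0 _)).differentiableAt
    · exact ((d0 _).mul (d1 _)).differentiableAt.sub ((d1 _).mul (d0 _)).differentiableAt
  · exact ⟨1, one_pos, weylBound α φ w.re, fun n μ _ hμ => h.norm_weylSeq_le (hm μ hμ) n⟩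

end PowerPotential

namespace PowerPotential

open Complex Filter Topology ComplexConjugate

variable {α φ : ℝ} {μ p q p' q' m w w₀ : ℂ}

lemma Y_smul (s : ℂ) : Y α μ (s * p) (s * q) w = s * Y α μ p q w := by unfold Y; ring

lemma Yd_smul (s : ℂ) : Yd α μ (s * p) (s * q) w = s * Yd α μ p q w := by unfold Yd; ring

lemma DecRay.smul (h : DecRay α μ p q w₀) (s : ℂ) : DecRay α μ (s * p) (s * q) w₀ := by
  intro a ha
  obtain ⟨h1, h2⟩ := h a ha
  refine ⟨(h1.const_mul (‖s‖ ^ 2)).congr (ae_of_all _ fun x => ?_),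
    (h2.const_mul (‖s‖ ^ 2)).congr (ae_of_all _ fun x => ?_)⟩
  · simp only [rayd, Yd_smul, norm_mul]; ring
  · simp only [ray, Y_smul, norm_mul]; ring

lemma DecRay.unique (hα : 0 < α) (h : DecRay α μ p q w) (h' : DecRay α μ p' q' w) :
    p * q' = q * p' := by
  have h1 := Decays.wronskian_eq_zero (sol_ray hα μ p q w) h (sol_ray hα μ p' q' w) h' one_pos
  rw [ray_one, ray_one, rayd_one, rayd_one, wronskian_Y hα] at h1
  have := (mul_eq_zero.1 h1).resolve_right (exp_ne_zero w)
  linear_combination this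

lemma Y_valZ (hα : 0 < α) (u : ℂ) : Y α μ (valZ α μ w u) (derZ α μ w u) w = 1 := by
  have hE : exp (-w) * exp w = 1 := by rw [← Complex.exp_add]; simp
  unfold Y valZ derZ
  linear_combination exp (-w) * wronskian_G hα μ w + hE

lemma Yd_valZ (hα : 0 < α) (u : ℂ) : Yd α μ (valZ α μ w u) (derZ α μ w u) w = u := by
  have hE : exp (-w) * exp w = 1 := by rw [← Complex.exp_add]; simp
  unfold Yd valZ derZ
  linear_combination u * exp (-w) * wronskian_G hα μ w + u * hE

lemma valZ_mul_sub (hα : 0 < α) (u : ℂ) :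
    (valZ α μ w u * m - derZ α μ w u) * exp w = Yd α μ 1 m w - u * Y α μ 1 m w := by
  have := wronskian_Y hα μ (valZ α μ w u) (derZ α μ w u) 1 m w
  rw [Y_valZ hα, Yd_valZ hα] at this
  linear_combination -this

lemma Adm.decRay_iff (h : Adm α φ) (hw : w ∈ wedge α φ μ) :
    DecRay α μ 1 m w ↔ Yd α μ 1 m w = weyl α μ w * Y α μ 1 m w := by
  have hd := (h.weyl_spec hw).2.1
  set u := weyl α μ w
  have key := valZ_mul_sub (μ := μ) (w := w) (m := m) h.pos u
  constructor
  · intro hY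
    have h1 := hd.unique h.pos hY
    rw [h1, mul_one, sub_self, zero_mul] at key
    linear_combination -key
  · intro hY
    rw [hY, sub_self] at key
    have h1 : derZ α μ w u = valZ α μ w u * m := by
      have := (mul_eq_zero.1 key).resolve_right (exp_ne_zero w)
      linear_combination -this
    have h2 := Y_valZ (μ := μ) (w := w) h.pos u
    have h3 : valZ α μ w u ≠ 0 := by
      intro h0
      rw [h1, h0] at h2
      simp [Y] at h2
    have := hd.smul (valZ α μ w u)⁻¹
    rwa [h1, ← mul_assoc, inv_mul_cancel₀ h3, one_mul] at this

/-- The `Im` identity on the real ray. -/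
lemma DecRay.im_identity (hα : 0 < α) {r : ℝ} (h : DecRay α μ p q r) {a : ℝ} (ha : 0 < a) :
    (Real.exp (2 * r) * μ.im) * ∫ x in Ioi a, ‖ray (Y α μ p q) r x‖ ^ 2 =
      (rayd (Yd α μ p q) r a * conj (ray (Y α μ p q) r a)).im := by
  have h1 := Decays.re_energy_tail (sol_ray hα μ p q r) h ha I
  have h2 : ∀ x : ℝ, (I * rayPot α μ r x).re = Real.exp (2 * r) * μ.im := by
    intro x
    have e1 : exp (((α : ℂ) + 2) * (r : ℂ)) = ((Real.exp ((α + 2) * r) : ℝ) : ℂ) := by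
      push_cast; rfl
    have e2 : exp (2 * (r : ℂ)) = ((Real.exp (2 * r) : ℝ) : ℂ) := by
      push_cast; rfl
    rw [I_mul_re]
    unfold rayPot pot
    rw [e1, e2, ← ofReal_mul, sub_im, ofReal_im, im_ofReal_mul]
    ring
  simp only [h2, I_re, zero_mul, zero_add] at h1
  rw [integral_const_mul, I_mul_re] at h1
  linarith

lemma DecRay.ne_zero (hα : 0 < α) {r : ℝ} (h : DecRay α μ p q r) (hμ : μ.im ≠ 0)
    (h1 : Y α μ p q r ≠ 0) : p ≠ 0 := by
  intro hp
  have hs := sol_ray hα μ p q r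
  have hI : ∀ a > 0, IntegrableOn (fun x => ‖ray (Y α μ p q) r x‖ ^ 2) (Ioi a) :=
    fun a ha => Decays.sq_integrable hs h ha
  have hpos : 0 < ∫ x in Ioi (1 / 2 : ℝ), ‖ray (Y α μ p q) r x‖ ^ 2 := by
    have hc : ContinuousOn (fun x => ‖ray (Y α μ p q) r x‖ ^ 2) (Icc (1 / 2 : ℝ) 2) := by
      have := hs.contY.mono (fun x (hx : x ∈ Icc (1 / 2 : ℝ) 2) =>
        lt_of_lt_of_le (by norm_num : (0 : ℝ) < 1 / 2) hx.1)
      fun_prop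
    have h3 : 0 < ∫ x in (1 / 2 : ℝ)..2, ‖ray (Y α μ p q) r x‖ ^ 2 := by
      refine intervalIntegral.integral_pos (by norm_num) hc (fun x _ => by positivity)
        ⟨1, by constructor <;> norm_num, ?_⟩
      rw [ray_one]
      positivity
    rw [intervalIntegral.integral_of_le (by norm_num)] at h3
    exact h3.trans_le (setIntegral_mono_set (hI _ (by norm_num))
      (ae_of_all _ fun x => by positivity) (ae_of_all _ fun x (hx : x ∈ Ioc _ _) => hx.1))
  set J := ∫ x in Ioi (1 / 2 : ℝ), ‖ray (Y α μ p q) r x‖ ^ 2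
  have hlim : Tendsto (fun a => |(rayd (Yd α μ p q) r a * conj (ray (Y α μ p q) r a)).im|)
      (𝓝[>] 0) (𝓝 0) := by
    have h4 := (tendsto_rayd_Yd hα μ p q r).mul
      ((Complex.continuous_conj.tendsto _).comp (tendsto_ray_Y hα μ p q r))
    have h5 := (((Complex.continuous_im.tendsto _).comp h4)).abs
    simpa [hp] using h5
  have hlow : ∀ᶠ a in 𝓝[>] (0 : ℝ), |Real.exp (2 * r) * μ.im| * J ≤
      |(rayd (Yd α μ p q) r a * conj (ray (Y α μ p q) r a)).im| := by
    filter_upwards [Ioo_mem_nhdsGT (by norm_num : (0 : ℝ) < 1 / 2)] with a ha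
    rw [← h.im_identity hα ha.1, abs_mul (Real.exp (2 * r) * μ.im)]
    refine mul_le_mul_of_nonneg_left (le_trans ?_ (le_abs_self _)) (abs_nonneg _)
    exact setIntegral_mono_set (hI _ ha.1) (ae_of_all _ fun x => by positivity)
      (ae_of_all _ fun x (hx : x ∈ Ioi _) => ha.2.trans hx)
  have := ge_of_tendsto hlim hlow
  have h6 : 0 < |Real.exp (2 * r) * μ.im| := abs_pos.2 (mul_ne_zero (Real.exp_pos _).ne' hμ)
  nlinarith

lemma Adm.exists_wedge (h : Adm α φ) (M : ℝ) :
    ∃ r : ℝ, ∀ μ w : ℂ, ‖μ‖ ≤ M → |w.im| < φ → r < w.re → w ∈ wedge α φ μ := by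
  have hk := h.kap_pos
  have h1 : Tendsto (fun r : ℝ => kap α φ / 2 * Real.exp (α * r)) atTop atTop :=
    (Real.tendsto_exp_atTop.comp (tendsto_id.const_mul_atTop h.pos)).const_mul_atTop (by positivity)
  obtain ⟨r, hr1, hr2⟩ := ((h1.eventually_gt_atTop M).and (eventually_gt_atTop 0)).exists
  refine ⟨r, fun μ w hμ hw1 hw2 => ⟨hw1, hr2.trans hw2, lt_of_le_of_lt hμ (hr1.trans ?_)⟩⟩
  have := h.pos
  gcongr

/-- For non-real `μ` there is a solution decaying along all rays of the sector. -/
theorem Adm.exists_decRay (h : Adm α φ) (hμ : μ.im ≠ 0) :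
    ∃ m : ℂ, ∀ w₀ : ℂ, |w₀.im| < φ → DecRay α μ 1 m w₀ := by
  obtain ⟨r, hr⟩ := h.exists_wedge ‖μ‖
  have hφ := h.phi_pos
  have hw1 : ((r + 1 : ℝ) : ℂ) ∈ wedge α φ μ := hr μ _ le_rfl (by simpa using hφ) (by simp)
  have hd := (h.weyl_spec hw1).2.1
  set u := weyl α μ ((r + 1 : ℝ) : ℂ)
  have hp : valZ α μ ((r + 1 : ℝ) : ℂ) u ≠ 0 :=
    hd.ne_zero h.pos hμ (by rw [Y_valZ h.pos]; exact one_ne_zero)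
  have hd1 := hd.smul (valZ α μ ((r + 1 : ℝ) : ℂ) u)⁻¹
  rw [inv_mul_cancel₀ hp] at hd1
  set m := (valZ α μ ((r + 1 : ℝ) : ℂ) u)⁻¹ * derZ α μ ((r + 1 : ℝ) : ℂ) u
  refine ⟨m, fun w₀ hw₀ => ?_⟩
  have hreal : ∀ x : ℝ, DecRay α μ 1 m x := by
    intro x
    have := hd1.add_real h.pos (Real.exp_pos (x - (r + 1)))
    rw [Real.log_exp] at this
    convert this using 1
    push_cast; ring
  set Ω : Set ℂ := Ioi r ×ℂ Ioo (-φ) φ with hΩ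
  have hΩw : Ω ⊆ wedge α φ μ := fun w hw => hr μ w le_rfl (abs_lt.2 hw.2) hw.1
  have hΩo : IsOpen Ω := isOpen_Ioi.reProdIm isOpen_Ioo
  have hΩc : IsPreconnected Ω := by
    have : Convex ℝ Ω :=
      ((convex_Ioi r).linear_preimage reLm).inter ((convex_Ioo (-φ) φ).linear_preimage imLm)
    exact this.isPreconnected
  have dY : Differentiable ℂ (Y α μ 1 m) := fun w => (hasDerivAt_Y h.pos μ 1 m w).differentiableAt
  have dYd : Differentiable ℂ (Yd α μ 1 m) := fun w =>
    (hasDerivAt_Yd h.pos μ 1 m w).differentiableAt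
  have a1 : AnalyticOnNhd ℂ (Yd α μ 1 m) Ω := dYd.differentiableOn.analyticOnNhd hΩo
  have a2 : AnalyticOnNhd ℂ (fun w => weyl α μ w * Y α μ 1 m w) Ω :=
    (((h.differentiableOn_weyl μ).mono hΩw).mul dY.differentiableOn).analyticOnNhd hΩo
  have hz : ((r + 1 : ℝ) : ℂ) ∈ Ω := ⟨by simp, by simpa using hφ⟩
  have heq := a1.eqOn_of_preconnected_of_frequently_eq a2 hΩc hz (by
    have ht : Tendsto (fun x : ℝ => (x : ℂ)) (𝓝[≠] (r + 1)) (𝓝[≠] ((r + 1 : ℝ) : ℂ)) := by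
      refine tendsto_nhdsWithin_iff.2 ⟨(Complex.continuous_ofReal.tendsto _).mono_left
        nhdsWithin_le_nhds, ?_⟩
      filter_upwards [self_mem_nhdsWithin] with x hx
      exact fun h => hx (ofReal_injective h)
    refine ht.frequently (Eventually.frequently ?_)
    have : Ioi r ∈ 𝓝 (r + 1) := Ioi_mem_nhds (by linarith)
    filter_upwards [mem_nhdsWithin_of_mem_nhds this] with x hx
    exact (h.decRay_iff (hΩw ⟨hx, by simpa using hφ⟩)).1 (hreal x))
  set t := r + 1 - w₀.re
  have hw : w₀ + Real.log (Real.exp t) ∈ Ω := by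
    rw [Real.log_exp]
    refine ⟨?_, ?_⟩
    · simp [t]
    · simpa [abs_lt] using hw₀
  have h1 := (h.decRay_iff (m := m) (hΩw hw)).2 (heq hw)
  have h2 := h1.add_real h.pos (Real.exp_pos (-t))
  convert h2 using 1
  simp only [Real.log_exp]
  push_cast; ring

end PowerPotential

namespace PowerPotential

open Complex Filter Topology ComplexConjugate

variable {α φ : ℝ} {μ p q m w w₀ : ℂ}

/-- The Cauchy-Schwarz inequality for the bilinear pairing. -/
lemma norm_integral_mul_le {ν : Measure ℝ} {f g : ℝ → ℂ} (hf : AEStronglyMeasurable f ν)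
    (hg : AEStronglyMeasurable g ν) (hf2 : Integrable (fun x => ‖f x‖ ^ 2) ν)
    (hg2 : Integrable (fun x => ‖g x‖ ^ 2) ν) :
    ∫ x, ‖f x * g x‖ ∂ν ≤ √(∫ x, ‖f x‖ ^ 2 ∂ν) * √(∫ x, ‖g x‖ ^ 2 ∂ν) := by
  have h1 : MemLp (fun x => ‖f x‖) (ENNReal.ofReal 2) ν := by
    rw [ENNReal.ofReal_ofNat]
    exact ((memLp_two_iff_integrable_sq_norm hf).2 hf2).norm
  have h2 : MemLp (fun x => ‖g x‖) (ENNReal.ofReal 2) ν := by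
    rw [ENNReal.ofReal_ofNat]
    exact ((memLp_two_iff_integrable_sq_norm hg).2 hg2).norm
  have := integral_mul_le_Lp_mul_Lq_of_nonneg (μ := ν) (p := 2) (q := 2)
    (by rw [Real.holderConjugate_iff]; norm_num)
    (ae_of_all _ fun x => norm_nonneg (f x)) (ae_of_all _ fun x => norm_nonneg (g x)) h1 h2
  simp only [norm_mul, Real.sqrt_eq_rpow]
  simpa using this

lemma tendsto_integral_Ioi_zero {f : ℝ → ℝ} (hf : IntegrableOn f (Ioi 0)) :
    Tendsto (fun a => ∫ x in Ioi a, f x) (𝓝[>] 0) (𝓝 (∫ x in Ioi 0, f x)) := by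
  have h1 : ∀ a > (0 : ℝ), ∫ x in Ioi a, f x = ∫ x in Ioi 0, (Ioi a).indicator f x := by
    intro a ha
    rw [setIntegral_indicator measurableSet_Ioi, Ioi_inter_Ioi, sup_eq_right.2 ha.le]
  have h2 : Tendsto (fun a => ∫ x in Ioi 0, (Ioi a).indicator f x) (𝓝[>] 0)
      (𝓝 (∫ x in Ioi 0, f x)) := by
    refine tendsto_integral_filter_of_dominated_convergence (fun x => ‖f x‖) ?_ ?_ hf.norm ?_
    · exact Eventually.of_forall fun a => hf.aestronglyMeasurable.indicator measurableSet_Ioi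
    · exact Eventually.of_forall fun a => ae_of_all _ fun x => norm_indicator_le_norm_self _ _
    · refine (ae_restrict_iff' measurableSet_Ioi).2 (ae_of_all _ fun x hx => ?_)
      refine tendsto_const_nhds.congr' ?_
      filter_upwards [Ioo_mem_nhdsGT (show (0 : ℝ) < x from hx)] with a ha
      rw [indicator_of_mem (show x ∈ Ioi a from ha.2)]
  refine h2.congr' ?_
  filter_upwards [self_mem_nhdsWithin] with a ha
  exact (h1 a ha).symm

lemma integrableOn_Ioi_zero {y : ℝ → ℂ} {p : ℂ} (hc : ContinuousOn y (Ioi 0))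
    (hp : Tendsto y (𝓝[>] 0) (𝓝 p)) (h : ∀ a > 0, IntegrableOn (fun x => ‖y x‖ ^ 2) (Ioi a)) :
    IntegrableOn (fun x => ‖y x‖ ^ 2) (Ioi 0) := by
  have h1 : ∀ᶠ x in 𝓝[>] (0 : ℝ), ‖y x‖ < ‖p‖ + 1 := hp.norm.eventually_lt_const (by simp)
  obtain ⟨δ, hδ, hsub⟩ := (mem_nhdsGT_iff_exists_Ioo_subset).1 h1
  have hδ0 : (0 : ℝ) < δ := hδ
  have hc2 : ContinuousOn (fun x => ‖y x‖ ^ 2) (Ioi 0) := by fun_prop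
  have h2 : IntegrableOn (fun x => ‖y x‖ ^ 2) (Ioo 0 δ) := by
    refine IntegrableOn.of_bound (by simp)
      ((hc2.mono Ioo_subset_Ioi_self).aestronglyMeasurable measurableSet_Ioo) ((‖p‖ + 1) ^ 2) ?_
    refine (ae_restrict_iff' measurableSet_Ioo).2 (ae_of_all _ fun x hx => ?_)
    rw [Real.norm_of_nonneg (by positivity)]
    have : ‖y x‖ < ‖p‖ + 1 := hsub hx
    gcongr
  refine (h2.union (h (δ / 2) (by positivity))).mono_set fun x hx => ?_
  rcases lt_or_ge x δ with hxd | hxd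
  · exact Or.inl ⟨hx, hxd⟩
  · exact Or.inr (by simp only [mem_Ioi]; linarith)

/-- Energy bounds up to the origin. -/
lemma Sol.energy_zero (hα : 0 < α) (hα2 : α < 2) {c lam p' e : ℂ} {y y' : ℝ → ℂ}
    (h : Sol (pot α c lam) y y') (hd : Decays (pot α c lam) y y')
    (hp : Tendsto y (𝓝[>] 0) (𝓝 p)) (hp' : Tendsto y' (𝓝[>] 0) (𝓝 p')) {k K M : ℝ}
    (hk : 0 < k) (hM : 1 ≤ M) (he : ‖e‖ ≤ 1) (hke : k ≤ e.re) (hec : 0 ≤ (e * c).re)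
    (hel : k * M ≤ -(e * lam).re) (hK : 4 * ‖c‖ + ‖lam‖ ≤ K * M) :
    ‖p'‖ ≤ 2 * (1 + K ^ 2) / k * √M * ‖p‖ ∧ IntegrableOn (fun x => ‖y x‖ ^ 2) (Ioi 0) ∧
      k * M * ∫ x in Ioi 0, ‖y x‖ ^ 2 ≤ ‖p'‖ * ‖p‖ := by
  have hInt : ∀ a > 0, IntegrableOn (fun x => ‖y x‖ ^ 2) (Ioi a) :=
    fun a ha => hd.sq_integrable h ha
  have hI := integrableOn_Ioi_zero h.contY hp hInt
  have hen : ∀ a > 0, k * (∫ x in Ioi a, ‖y' x‖ ^ 2) + k * M * (∫ x in Ioi a, ‖y x‖ ^ 2) ≤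
      ‖y' a‖ * ‖y a‖ := by
    intro a ha
    refine hd.energy_le h ha he hke fun x hx => ?_
    have hx0 : 0 < x := lt_trans ha hx
    have e1 : (e * pot α c lam x).re = (e * c).re * x ^ α - (e * lam).re := by
      unfold pot
      rw [mul_sub, ← mul_assoc, sub_re, re_mul_ofReal]
    rw [e1]
    have := Real.rpow_pos_of_pos hx0 α
    nlinarith
  have hM0 : 0 < M := by linarith
  have hs1 : 1 / √M ≤ 1 := by
    rw [div_le_one (by positivity)]
    exact Real.one_le_sqrt.2 hM
  have hK0 : 0 ≤ K := by
    have : 0 ≤ K * M := le_trans (by positivity) hK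
    exact nonneg_of_mul_nonneg_left this hM0
  have hder : ∀ a ∈ Ioo (0 : ℝ) 1, ‖y' a‖ ≤ 2 * (1 + K ^ 2) / k * √M * ‖y a‖ := by
    intro a ha
    have hle : a ≤ a + 1 / √M := by
      have : 0 < 1 / √M := by positivity
      linarith
    have hsub : ∀ g : ℝ → ℂ, IntegrableOn (fun x => ‖g x‖ ^ 2) (Ioi a) →
        ∫ x in a..a + 1 / √M, ‖g x‖ ^ 2 ≤ ∫ x in Ioi a, ‖g x‖ ^ 2 := by
      intro g hg
      rw [intervalIntegral.integral_of_le hle]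
      exact setIntegral_mono_set hg (ae_of_all _ fun x => by positivity)
        (ae_of_all _ fun x (hx : x ∈ Ioc _ _) => hx.1)
    have i1 : 0 ≤ ∫ x in Ioi a, ‖y' x‖ ^ 2 := integral_nonneg fun x => by positivity
    have i2 : 0 ≤ ∫ x in Ioi a, ‖y x‖ ^ 2 := integral_nonneg fun x => by positivity
    have j1 := hsub y' (hd a ha.1).1
    have j2 := hsub y (hInt a ha.1)
    have hena := hen a ha.1
    have hkM : 0 < k * M := by positivity
    refine h.norm_deriv_le ha.1 hM0 hK0 hk (fun x hx => ?_) ?_ ?_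
    · have hx0 : 0 < x := lt_of_lt_of_le ha.1 hx.1
      have hx2 : x ≤ 2 := by linarith [hx.2, ha.2]
      have h4 : x ^ α ≤ 4 := by
        calc x ^ α ≤ 2 ^ α := Real.rpow_le_rpow hx0.le hx2 hα.le
          _ ≤ 2 ^ (2 : ℝ) := Real.rpow_le_rpow_of_exponent_le (by norm_num) hα2.le
          _ = 4 := by norm_num
      unfold pot
      refine (norm_sub_le _ _).trans (le_trans ?_ hK)
      rw [norm_mul, Complex.norm_real, Real.norm_of_nonneg (by positivity)]
      nlinarith [norm_nonneg c]
    · nlinarith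
    · nlinarith
  refine ⟨?_, hI, ?_⟩
  · refine le_of_tendsto_of_tendsto hp'.norm (hp.norm.const_mul _) ?_
    filter_upwards [Ioo_mem_nhdsGT one_pos] with a ha using hder a ha
  · refine le_of_tendsto_of_tendsto ((tendsto_integral_Ioi_zero hI).const_mul (k * M))
      (hp'.norm.mul hp.norm) ?_
    filter_upwards [self_mem_nhdsWithin] with a ha
    have i1 : 0 ≤ ∫ x in Ioi a, ‖y' x‖ ^ 2 := integral_nonneg fun x => by positivity
    have := hen a ha
    nlinarith

lemma DecRay.energy_zero (hα : 0 < α) (hα2 : α < 2) (h : DecRay α μ p q w₀) {e : ℂ} {k K M : ℝ}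
    (hk : 0 < k) (hM : 1 ≤ M) (he : ‖e‖ ≤ 1) (hke : k ≤ e.re)
    (hec : 0 ≤ (e * exp ((α + 2) * w₀)).re) (hel : k * M ≤ -(e * (exp (2 * w₀) * μ)).re)
    (hK : 4 * ‖exp ((α + 2) * w₀)‖ + ‖exp (2 * w₀) * μ‖ ≤ K * M) :
    ‖q * exp w₀‖ ≤ 2 * (1 + K ^ 2) / k * √M * ‖p‖ ∧
      IntegrableOn (fun x => ‖ray (Y α μ p q) w₀ x‖ ^ 2) (Ioi 0) ∧
      k * M * ∫ x in Ioi 0, ‖ray (Y α μ p q) w₀ x‖ ^ 2 ≤ ‖q * exp w₀‖ * ‖p‖ :=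
  (sol_ray hα μ p q w₀).energy_zero hα hα2 h (tendsto_ray_Y hα μ p q w₀)
    (tendsto_rayd_Yd hα μ p q w₀) hk hM he hke hec hel hK

lemma DecRay.sq_integrable (hα : 0 < α) (h : DecRay α μ p q w₀) :
    IntegrableOn (fun x => ‖ray (Y α μ p q) w₀ x‖ ^ 2) (Ioi 0) :=
  integrableOn_Ioi_zero (sol_ray hα μ p q w₀).contY (tendsto_ray_Y hα μ p q w₀)
    fun _ ha => Decays.sq_integrable (sol_ray hα μ p q w₀) h ha

/-- The bound for the Weyl coefficient at the origin. -/
lemma DecRay.norm_coeff_le (hα : 0 < α) (hα2 : α < 2) (h : DecRay α μ 1 m 0) (hμ : μ.im ≠ 0)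
    {M : ℝ} (hM : 1 ≤ M) (hμM : ‖μ‖ ≤ M) : ‖m‖ * |μ.im| ≤ 208 * M * √M := by
  have hi : 0 < |μ.im| := abs_pos.2 hμ
  have hM0 : 0 < M := by linarith
  obtain ⟨σ, hσ, hσi⟩ : ∃ σ : ℝ, |σ| = 1 ∧ σ * μ.im = |μ.im| := by
    rcases lt_or_gt_of_ne hμ with h0 | h0
    · exact ⟨-1, by simp, by rw [abs_of_neg h0]; ring⟩
    · exact ⟨1, by simp, by rw [abs_of_pos h0]; ring⟩
  have him : |μ.im| ≤ M := (abs_im_le_norm μ).trans hμM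
  have hre : |μ.re| ≤ M := (abs_re_le_norm μ).trans hμM
  set k := |μ.im| / (4 * M) with hk
  have hk0 : 0 < k := by positivity
  have hk1 : k * (4 * M) = |μ.im| := by rw [hk]; field_simp
  have hk4 : k ≤ 1 / 4 := by nlinarith
  have h1 := h.energy_zero hα hα2 (e := ⟨k, σ / 2⟩) (k := k) (K := 5) (M := M) hk0 hM ?_ le_rfl
    (by simpa using hk0.le) ?_ ?_
  · have h2 := h1.1
    simp only [Complex.exp_zero, mul_one, norm_one] at h2
    have h3 : 2 * (1 + (5 : ℝ) ^ 2) / k * √M * |μ.im| = 208 * M * √M := by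
      rw [← hk1]; field_simp; norm_num
    rw [← h3]
    gcongr
  · refine (norm_le_abs_re_add_abs_im _).trans ?_
    simp only [abs_of_pos hk0, abs_div, hσ, abs_two]
    linarith
  · simp only [mul_zero, Complex.exp_zero, one_mul, mul_re]
    have := (abs_le.1 hre).2
    nlinarith
  · simp only [mul_zero, Complex.exp_zero, one_mul, norm_one]
    linarith

end PowerPotential

namespace PowerPotential

open Complex Filter Topology ComplexConjugate

variable {α φ ξ : ℝ} {μ p q m w w₀ : ℂ}

/-- The growth exponent at `Re w = ξ`. -/
noncomputable def omg (α ξ : ℝ) : ℝ := Real.exp ((α + 2) * (ξ + 1) / 2)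

lemma one_le_omg (hα : 0 < α) (hξ : 0 < ξ) : 1 ≤ omg α ξ := Real.one_le_exp (by positivity)

lemma add_one_le_omg (hα : 0 < α) (hξ : 0 < ξ) : ξ + 1 ≤ omg α ξ := by
  have := Real.add_one_le_exp ((α + 2) * (ξ + 1) / 2)
  unfold omg
  nlinarith

lemma omg_sq : omg α ξ ^ 2 = Real.exp ((α + 2) * (ξ + 1)) := by
  rw [omg, ← Real.exp_nat_mul]; congr 1; push_cast; ring

lemma cosh_sqrt_size_le (hα : 0 < α) (hξ : 0 < ξ) (hμ : ‖μ‖ ≤ Real.exp (α * ξ)) {x : ℝ}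
    (hx : x ≤ ξ + 1) : Real.cosh √(size α ‖μ‖ x) ≤ Real.exp (2 * omg α ξ) := by
  have h1 : size α ‖μ‖ x ≤ (2 * omg α ξ) ^ 2 := by
    refine (size_mono hα (norm_nonneg _) le_rfl hx).trans ?_
    rw [mul_pow, omg_sq]
    unfold size
    have h2 : ‖μ‖ * Real.exp (2 * (ξ + 1)) ≤ Real.exp ((α + 2) * (ξ + 1)) := by
      calc ‖μ‖ * Real.exp (2 * (ξ + 1)) ≤ Real.exp (α * ξ) * Real.exp (2 * (ξ + 1)) := by gcongr
        _ = Real.exp (α * ξ + 2 * (ξ + 1)) := by rw [Real.exp_add]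
        _ ≤ _ := Real.exp_le_exp.2 (by nlinarith)
    have := Real.exp_pos ((α + 2) * (ξ + 1))
    linarith
  have h3 : √(size α ‖μ‖ x) ≤ 2 * omg α ξ := Real.sqrt_le_iff.2
    ⟨by linarith [one_le_omg hα hξ], h1⟩
  refine le_trans ?_ (Real.exp_le_exp.2 h3)
  rw [Real.cosh_eq]
  have := Real.exp_le_exp.2 (show -√(size α ‖μ‖ x) ≤ √(size α ‖μ‖ x) by
    linarith [Real.sqrt_nonneg (size α ‖μ‖ x)])
  linarith

lemma norm_G_le_exp (hα : 0 < α) (hξ : 0 < ξ) (hμ : ‖μ‖ ≤ Real.exp (α * ξ)) {e : ℕ} (he : e ≤ 1)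
    (hw : w.re ≤ ξ) : ‖G α e μ w‖ ≤ Real.exp (3 * omg α ξ) := by
  refine (norm_G_le hα μ w).trans ?_
  have h1 : (e : ℝ) ≤ 1 := by exact_mod_cast he
  have h0 : (0 : ℝ) ≤ e := by positivity
  have := add_one_le_omg hα hξ
  calc _ ≤ Real.exp (omg α ξ) * Real.exp (2 * omg α ξ) := by
        gcongr
        · nlinarith
        · exact cosh_sqrt_size_le hα hξ hμ (by linarith)
    _ = _ := by rw [← Real.exp_add]; ring_nf

lemma norm_Gd_le_exp (hα : 0 < α) (hξ : 0 < ξ) (hμ : ‖μ‖ ≤ Real.exp (α * ξ)) {e : ℕ} (he : e ≤ 1)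
    (hw : w.re ≤ ξ) : ‖Gd α e μ w‖ ≤ Real.exp (3 * omg α ξ) := by
  refine (norm_Gd_le hα μ w).trans ?_
  have h1 : (e : ℝ) ≤ 1 := by exact_mod_cast he
  have h0 : (0 : ℝ) ≤ e := by positivity
  have := add_one_le_omg hα hξ
  calc _ ≤ Real.exp (omg α ξ) * Real.exp (2 * omg α ξ) := by
        gcongr
        · nlinarith
        · exact cosh_sqrt_size_le hα hξ hμ (by linarith)
    _ = _ := by rw [← Real.exp_add]; ring_nf

/-- The constant in the growth bounds. -/
noncomputable def bigA (α φ : ℝ) : ℝ := 520 / kap α φ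

lemma Adm.one_le_bigA (h : Adm α φ) : 1 ≤ bigA α φ := by
  rw [bigA, le_div_iff₀ h.kap_pos]
  linarith [kap_le_one (α := α) (φ := φ)]

lemma norm_le_of_mem_wedge (hw : w ∈ wedge α φ μ) : ‖μ‖ ≤ Real.exp (α * w.re) := by
  have := Real.exp_pos (α * w.re)
  nlinarith [hw.2.2, kap_le_one (α := α) (φ := φ)]

lemma Adm.norm_weyl_le (h : Adm α φ) (hw : w ∈ wedge α φ μ) :
    ‖weyl α μ w‖ ≤ bigA α φ * Real.exp (omg α w.re) := by
  refine (h.weyl_spec hw).2.2.trans ?_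
  have hA := h.one_le_bigA
  have hα := h.pos
  unfold weylBound
  rw [← bigA]
  gcongr
  have h1 : Real.exp ((α + 2) * w.re / 2) ≤ omg α w.re := by unfold omg; gcongr; linarith
  have h2 := Real.add_one_le_exp (omg α w.re)
  have := Real.log_le_sub_one_of_pos (Real.exp_pos ((α + 2) * w.re / 2))
  rw [Real.log_exp] at this
  linarith

lemma Adm.norm_valZ_le (h : Adm α φ) (hw : w ∈ wedge α φ μ) :
    ‖valZ α μ w (weyl α μ w)‖ ≤ 2 * bigA α φ * Real.exp (4 * omg α w.re) ∧
    ‖derZ α μ w (weyl α μ w)‖ ≤ 2 * bigA α φ * Real.exp (4 * omg α w.re) := by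
  have hα := h.pos
  have hA := h.one_le_bigA
  have hξ := hw.2.1
  have hμ := norm_le_of_mem_wedge hw
  have hu := h.norm_weyl_le hw
  have h1 : ‖exp (-w)‖ ≤ 1 := by
    rw [Complex.norm_exp, neg_re]; exact Real.exp_le_one_iff.2 (by linarith)
  set E := Real.exp (omg α w.re) with hE
  have e3 : Real.exp (3 * omg α w.re) = E ^ 3 := by rw [hE, ← Real.exp_nat_mul]; norm_num
  have e4 : Real.exp (4 * omg α w.re) = E ^ 4 := by rw [hE, ← Real.exp_nat_mul]; norm_num
  have hE1 : 1 ≤ E := Real.one_le_exp (by linarith [one_le_omg hα hξ])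
  have hE34 : E ^ 3 ≤ bigA α φ * E ^ 4 := by
    have : E ^ 3 ≤ E ^ 4 := pow_le_pow_right₀ hE1 (by norm_num)
    have : 0 < E ^ 4 := by positivity
    nlinarith
  have key : ∀ a b : ℂ, ‖a‖ ≤ E ^ 3 → ‖b‖ ≤ E ^ 3 →
      ‖exp (-w)‖ * (‖a‖ + ‖weyl α μ w‖ * ‖b‖) ≤ 2 * bigA α φ * E ^ 4 := by
    intro a b ha hb
    calc _ ≤ 1 * (E ^ 3 + (bigA α φ * E) * E ^ 3) := by gcongr
      _ ≤ _ := by linarith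
  have g := fun (e : ℕ) (he : e ≤ 1) => norm_G_le_exp (w := w) hα hξ hμ he le_rfl
  have gd := fun (e : ℕ) (he : e ≤ 1) => norm_Gd_le_exp (w := w) hα hξ hμ he le_rfl
  rw [e3] at g gd
  rw [e4]
  constructor
  · refine le_trans ?_ (key _ _ (gd 1 le_rfl) (g 1 le_rfl))
    unfold valZ
    rw [norm_mul, ← norm_mul (weyl α μ w)]
    gcongr
    exact norm_sub_le _ _
  · refine le_trans ?_ (key _ _ (gd 0 zero_le_one) (g 0 zero_le_one))
    unfold derZ
    rw [norm_mul, ← norm_mul (weyl α μ w), add_comm]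
    gcongr
    exact norm_sub_le _ _

/-- The decaying solution normalised at `w`. -/
noncomputable def nsol (α : ℝ) (μ w : ℂ) : ℂ → ℂ :=
  Y α μ (valZ α μ w (weyl α μ w)) (derZ α μ w (weyl α μ w))

lemma Adm.norm_nsol_le (h : Adm α φ) (hw : w ∈ wedge α φ μ) {z : ℂ} (hz : z.re ≤ w.re) :
    ‖nsol α μ w z‖ ≤ 4 * bigA α φ * Real.exp (7 * omg α w.re) := by
  obtain ⟨h1, h2⟩ := h.norm_valZ_le hw
  have hA := h.one_le_bigA
  have h3 := norm_G_le_exp (e := 0) h.pos hw.2.1 (norm_le_of_mem_wedge hw) zero_le_one hz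
  have h4 := norm_G_le_exp (e := 1) h.pos hw.2.1 (norm_le_of_mem_wedge hw) le_rfl hz
  have e : Real.exp (7 * omg α w.re) =
      Real.exp (4 * omg α w.re) * Real.exp (3 * omg α w.re) := by
    rw [← Real.exp_add]; ring_nf
  unfold nsol Y
  refine (norm_add_le _ _).trans ?_
  rw [norm_mul, norm_mul, e]
  calc _ ≤ 2 * bigA α φ * Real.exp (4 * omg α w.re) * Real.exp (3 * omg α w.re) +
        2 * bigA α φ * Real.exp (4 * omg α w.re) * Real.exp (3 * omg α w.re) := by gcongr
    _ = _ := by ring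

lemma Adm.decRay_nsol (h : Adm α φ) {R : ℝ} (hw : w₀ + R ∈ wedge α φ μ) :
    DecRay α μ (valZ α μ (w₀ + R) (weyl α μ (w₀ + R))) (derZ α μ (w₀ + R) (weyl α μ (w₀ + R)))
      w₀ := by
  have := (h.weyl_spec hw).2.1.add_real h.pos (Real.exp_pos (-R))
  rw [Real.log_exp] at this
  convert this using 1
  push_cast; ring

lemma Adm.integral_nsol_tail_le (h : Adm α φ) (hw : w ∈ wedge α φ μ) :
    ∫ x in Ioi 1, ‖ray (nsol α μ w) w x‖ ^ 2 ≤ 4 / kap α φ * ‖weyl α μ w‖ := by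
  have hC := h.coercive hw
  have hd := (h.weyl_spec hw).2.1
  have hs := sol_ray h.pos μ (valZ α μ w (weyl α μ w)) (derZ α μ w (weyl α μ w)) w
  have hk := h.kap_pos
  have h1 := Decays.energy_le hs hd one_pos (k := kap α φ / 4) (N := kap α φ / 4) hC.he hC.re_e
    (fun x hx => by
      have := hC.re_M x (le_of_lt hx)
      have := hC.hM
      nlinarith)
  rw [ray_one, rayd_one, Y_valZ h.pos, Yd_valZ h.pos, norm_one, mul_one] at h1
  have h2 : 0 ≤ ∫ x in Ioi (1 : ℝ), ‖rayd (Yd α μ (valZ α μ w (weyl α μ w))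
      (derZ α μ w (weyl α μ w))) w x‖ ^ 2 := integral_nonneg fun x => by positivity
  unfold nsol
  rw [div_mul_eq_mul_div, le_div_iff₀ hk]
  nlinarith

lemma Adm.integral_nsol_le (h : Adm α φ) {R : ℝ} (hw : w₀ + R ∈ wedge α φ μ) :
    ∫ x in Ioi 0, ‖ray (nsol α μ (w₀ + R)) w₀ x‖ ^ 2 ≤
      Real.exp (-w₀.re) * (17 * bigA α φ ^ 2) * Real.exp (15 * omg α (w₀ + R).re) := by
  have hA := h.one_le_bigA
  have hI := (h.decRay_nsol hw).sq_integrable h.pos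
  change IntegrableOn (fun x => ‖ray (nsol α μ (w₀ + R)) w₀ x‖ ^ 2) (Ioi 0) at hI
  have hre : (w₀ + R).re = w₀.re + R := by simp
  have hER := Real.exp_pos R
  set ω := omg α (w₀ + R).re with hω
  have hω1 : 1 ≤ ω := one_le_omg h.pos hw.2.1
  have hRω : Real.exp R ≤ Real.exp (-w₀.re) * Real.exp ω := by
    rw [← Real.exp_add]
    have := add_one_le_omg h.pos hw.2.1
    rw [hre] at this
    rw [hω, hre]
    gcongr
    linarith
  have hsplit : ∫ x in Ioi 0, ‖ray (nsol α μ (w₀ + R)) w₀ x‖ ^ 2 =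
      (∫ x in Ioc 0 (Real.exp R), ‖ray (nsol α μ (w₀ + R)) w₀ x‖ ^ 2) +
      ∫ x in Ioi (Real.exp R), ‖ray (nsol α μ (w₀ + R)) w₀ x‖ ^ 2 := by
    rw [← setIntegral_union (Ioc_disjoint_Ioi le_rfl) measurableSet_Ioi
      (hI.mono_set Ioc_subset_Ioi_self) (hI.mono_set (Ioi_subset_Ioi hER.le)),
      Ioc_union_Ioi_eq_Ioi hER.le]
  have h1 : ∫ x in Ioc 0 (Real.exp R), ‖ray (nsol α μ (w₀ + R)) w₀ x‖ ^ 2 ≤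
      16 * bigA α φ ^ 2 * Real.exp (14 * ω) * Real.exp R := by
    have := norm_setIntegral_le_of_norm_le_const (μ := volume) (s := Ioc 0 (Real.exp R))
      (f := fun x => ‖ray (nsol α μ (w₀ + R)) w₀ x‖ ^ 2)
      (C := 16 * bigA α φ ^ 2 * Real.exp (14 * ω)) (by simp) (fun x hx => by
        have hz : ((Real.log x : ℂ) + w₀).re ≤ (w₀ + R).re := by
          rw [hre, add_re, ofReal_re]
          have := Real.log_le_log hx.1 hx.2
          rw [Real.log_exp] at this
          linarith
        have h3 := h.norm_nsol_le hw hz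
        rw [Real.norm_of_nonneg (by positivity)]
        have e : 16 * bigA α φ ^ 2 * Real.exp (14 * ω) =
            (4 * bigA α φ * Real.exp (7 * ω)) ^ 2 := by
          rw [mul_pow, mul_pow, ← Real.exp_nat_mul]; push_cast; ring_nf
        rw [e]
        unfold ray
        gcongr)
    simp only [Real.volume_real_Ioc_of_le hER.le, sub_zero] at this
    exact (le_abs_self _).trans this
  have h2 : ∫ x in Ioi (Real.exp R), ‖ray (nsol α μ (w₀ + R)) w₀ x‖ ^ 2 ≤
      Real.exp R * (bigA α φ ^ 2 * Real.exp ω) := by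
    have h3 := integral_comp_mul_left_Ioi (fun x => ‖ray (nsol α μ (w₀ + R)) w₀ x‖ ^ 2) 1 hER
    have h4 : ∫ x in Ioi 1, ‖ray (nsol α μ (w₀ + R)) w₀ (Real.exp R * x)‖ ^ 2 =
        ∫ x in Ioi 1, ‖ray (nsol α μ (w₀ + R)) (w₀ + R) x‖ ^ 2 := by
      refine setIntegral_congr_fun measurableSet_Ioi fun x hx => ?_
      have hx0 : (0 : ℝ) < x := lt_trans one_pos hx
      have := ray_add_real (nsol α μ (w₀ + R)) w₀ hER hx0
      rw [Real.log_exp] at this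
      simp only [this]
    rw [h4, mul_one, smul_eq_mul, eq_inv_mul_iff_mul_eq₀ hER.ne'] at h3
    rw [← h3]
    have h5 := h.integral_nsol_tail_le hw
    have h6 := h.norm_weyl_le hw
    have h7 : 4 / kap α φ ≤ bigA α φ := by
      unfold bigA; have := h.kap_pos; gcongr; norm_num
    have := h.kap_pos
    gcongr
    calc _ ≤ bigA α φ * (bigA α φ * Real.exp ω) := by
          refine h5.trans ?_
          gcongr
      _ = _ := by ring
  rw [hsplit]
  set E := Real.exp ω with hE
  have hE1 : 1 ≤ E := Real.one_le_exp (by linarith)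
  have e14 : Real.exp (14 * ω) = E ^ 14 := by rw [hE, ← Real.exp_nat_mul]; norm_num
  have e15 : Real.exp (15 * ω) = E ^ 15 := by rw [hE, ← Real.exp_nat_mul]; norm_num
  rw [e14] at h1
  rw [e15]
  have hE14 : E ≤ E ^ 14 := by
    simpa using pow_le_pow_right₀ hE1 (by norm_num : 1 ≤ 14)
  calc _ ≤ 16 * bigA α φ ^ 2 * E ^ 14 * Real.exp R + Real.exp R * (bigA α φ ^ 2 * E) :=
        add_le_add h1 h2
    _ ≤ 16 * bigA α φ ^ 2 * E ^ 14 * Real.exp R + Real.exp R * (bigA α φ ^ 2 * E ^ 14) := by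
        gcongr
    _ = 17 * bigA α φ ^ 2 * E ^ 14 * Real.exp R := by ring
    _ ≤ 17 * bigA α φ ^ 2 * E ^ 14 * (Real.exp (-w₀.re) * E) := by gcongr
    _ = _ := by ring

lemma Adm.norm_Y_mul_im_le (h : Adm α φ) (hw : w ∈ wedge α φ μ) (hμ : μ.im ≠ 0)
    (hm : DecRay α μ 1 m 0) :
    ‖Y α μ 1 m w‖ * |μ.im| ≤ 1250 * Real.exp (4 * omg α w.re) := by
  set ω := omg α w.re with hω
  have hω1 : 1 ≤ ω := one_le_omg h.pos hw.2.1
  have h1 := norm_G_le_exp (e := 0) h.pos hw.2.1 (norm_le_of_mem_wedge hw) zero_le_one le_rfl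
  have h2 := norm_G_le_exp (e := 1) h.pos hw.2.1 (norm_le_of_mem_wedge hw) le_rfl le_rfl
  have hμω : ‖μ‖ ≤ ω ^ 2 := by
    refine (norm_le_of_mem_wedge hw).trans ?_
    rw [hω, omg_sq]
    have := h.pos; have := hw.2.1
    exact Real.exp_le_exp.2 (by nlinarith)
  have h3 := hm.norm_coeff_le h.pos h.lt_two hμ (one_le_pow₀ hω1) hμω
  rw [Real.sqrt_sq (by linarith)] at h3
  have h4 : |μ.im| ≤ ω ^ 2 := (abs_im_le_norm μ).trans hμω
  have h5 : ω ^ 3 / (3 : ℕ).factorial ≤ Real.exp ω :=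
    Real.pow_div_factorial_le_exp (x := ω) (by linarith) 3
  have h6 : ω ^ 2 / (2 : ℕ).factorial ≤ Real.exp ω :=
    Real.pow_div_factorial_le_exp (x := ω) (by linarith) 2
  simp only [Nat.factorial] at h5 h6
  norm_num at h5 h6
  have h7 : ‖Y α μ 1 m w‖ ≤ (1 + ‖m‖) * Real.exp (3 * ω) := by
    unfold Y
    refine (norm_add_le _ _).trans ?_
    rw [one_mul, norm_mul, add_mul, one_mul]
    gcongr
  have e4 : Real.exp (4 * ω) = Real.exp (3 * ω) * Real.exp ω := by
    rw [← Real.exp_add]; ring_nf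
  have hE := Real.exp_pos (3 * ω)
  calc ‖Y α μ 1 m w‖ * |μ.im| ≤ ((1 + ‖m‖) * Real.exp (3 * ω)) * |μ.im| := by gcongr
    _ = Real.exp (3 * ω) * (|μ.im| + ‖m‖ * |μ.im|) := by ring
    _ ≤ Real.exp (3 * ω) * (1250 * Real.exp ω) := by
        gcongr
        nlinarith
    _ = _ := by rw [e4]; ring

end PowerPotential

namespace PowerPotential
open Complex Filter Topology ComplexConjugate

/-- The quotient of two holomorphic functions, extended by derivatives at zeros of the
denominator. -/
noncomputable def hquot (N D : ℂ → ℂ) (z : ℂ) : ℂ :=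
  open Classical in if D z = 0 then deriv N z / deriv D z else N z / D z

lemma deriv_ne_zero_of_le_im {D : ℂ → ℂ} {a : ℂ} {k : ℝ} (hk : 0 < k)
    (hD : DifferentiableAt ℂ D a) (h : ∀ᶠ z in 𝓝 a, k * |z.im| ≤ ‖D z‖) (ha : D a = 0) :
    deriv D a ≠ 0 ∧ a.im = 0 := by
  have hi : a.im = 0 := by
    have := h.self_of_nhds
    rw [ha, norm_zero] at this
    have h2 : |a.im| ≤ 0 := by nlinarith [abs_nonneg a.im]
    simpa using h2
  refine ⟨fun h0 => ?_, hi⟩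
  have hd := hD.hasDerivAt
  rw [h0] at hd
  have hlo := hasDerivAt_iff_isLittleO.1 hd
  simp only [ha, sub_zero, smul_zero] at hlo
  have h1 := hlo.def (half_pos hk)
  have ht : Tendsto (fun t : ℝ => a + t * I) (𝓝[>] 0) (𝓝 a) := by
    have : Continuous (fun t : ℝ => a + t * I) := by fun_prop
    have := (this.tendsto 0).mono_left (nhdsWithin_le_nhds (s := Ioi 0))
    simpa using this
  obtain ⟨t, ht1, ht2, ht0⟩ := ((ht.eventually h1).and ((ht.eventually h).and
    self_mem_nhdsWithin)).exists
  have ht0 : 0 < t := ht0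
  simp [hi, abs_of_pos ht0] at ht1 ht2
  nlinarith

lemma differentiableAt_hquot {N D : ℂ → ℂ} {Ω : Set ℂ} (hΩ : IsOpen Ω)
    (hN : DifferentiableOn ℂ N Ω) (hD : DifferentiableOn ℂ D Ω) {k : ℝ} (hk : 0 < k)
    (hle : ∀ z ∈ Ω, k * |z.im| ≤ ‖D z‖) (hz : ∀ z ∈ Ω, D z = 0 → N z = 0) {a : ℂ} (ha : a ∈ Ω) :
    DifferentiableAt ℂ (hquot N D) a := by
  have hΩa : Ω ∈ 𝓝 a := hΩ.mem_nhds ha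
  have hDa := hD.differentiableAt hΩa
  have hNa := hN.differentiableAt hΩa
  by_cases h0 : D a = 0
  · have h1 := (deriv_ne_zero_of_le_im hk hDa (by filter_upwards [hΩa] using hle) h0).1
    have hN' := ((differentiableOn_dslope hΩa).2 hN).differentiableAt hΩa
    have hD' := ((differentiableOn_dslope hΩa).2 hD).differentiableAt hΩa
    have h2 : dslope D a a ≠ 0 := by rwa [dslope_same]
    have h3 := hD'.continuousAt.eventually_ne h2
    refine (hN'.div hD' h2).congr_of_eventuallyEq ?_
    filter_upwards [h3] with z hz3
    by_cases hza : z = a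
    · subst hza
      simp [hquot, h0, dslope_same]
    · have e1 : (z - a) * dslope D a z = D z := by
        have := sub_smul_dslope D a z
        simpa [h0] using this
      have e2 : (z - a) * dslope N a z = N z := by
        have := sub_smul_dslope N a z
        simpa [hz a ha h0] using this
      have hza' : z - a ≠ 0 := sub_ne_zero.2 hza
      have h4 : D z ≠ 0 := by rw [← e1]; exact mul_ne_zero hza' hz3
      simp only [hquot, h4, if_false, Pi.div_apply]
      rw [← e1, ← e2, mul_div_mul_left _ _ hza']
  · refine (hNa.div hDa h0).congr_of_eventuallyEq ?_
    filter_upwards [hDa.continuousAt.eventually_ne h0] with z hz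
    simp [hquot, hz]

lemma hquot_mul {N D : ℂ → ℂ} {z : ℂ} (hz : D z = 0 → N z = 0) : hquot N D z * D z = N z := by
  unfold hquot
  split_ifs with h
  · rw [h, hz h, mul_zero]
  · field_simp

lemma dense_im_ne_zero : Dense {z : ℂ | z.im ≠ 0} := by
  intro a
  have ht : Tendsto (fun t : ℝ => a + t * I) (𝓝[≠] (-a.im)) (𝓝 (a + ((-a.im : ℝ) : ℂ) * I)) := by
    have : Continuous (fun t : ℝ => a + t * I) := by fun_prop
    exact (this.tendsto _).mono_left nhdsWithin_le_nhds
  by_cases h : a.im = 0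
  · rw [h] at ht
    simp only [neg_zero, ofReal_zero, zero_mul, add_zero] at ht
    refine mem_closure_of_tendsto ht ?_
    filter_upwards [self_mem_nhdsWithin] with t ht
    simpa [h] using ht
  · exact subset_closure h

/-- Gluing of compatible quotients into an entire function. -/
lemma exists_entire_quotient {ι : Type*} {N D : ι → ℂ → ℂ} {Ω : ι → Set ℂ} {k : ι → ℝ}
    (hΩ : ∀ i, IsOpen (Ω i)) (hcov : ∀ z, ∃ i, z ∈ Ω i)
    (hN : ∀ i, DifferentiableOn ℂ (N i) (Ω i)) (hD : ∀ i, DifferentiableOn ℂ (D i) (Ω i))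
    (hk : ∀ i, 0 < k i) (hle : ∀ i, ∀ z ∈ Ω i, k i * |z.im| ≤ ‖D i z‖)
    (hz : ∀ i, ∀ z ∈ Ω i, D i z = 0 → N i z = 0)
    (hcomp : ∀ i j, ∀ z ∈ Ω i, z ∈ Ω j → N i z * D j z = N j z * D i z) :
    ∃ F : ℂ → ℂ, Differentiable ℂ F ∧ ∀ i, ∀ z ∈ Ω i, F z * D i z = N i z := by
  have hd : ∀ i, ∀ z ∈ Ω i, DifferentiableAt ℂ (hquot (N i) (D i)) z := fun i z hzi =>
    differentiableAt_hquot (hΩ i) (hN i) (hD i) (hk i) (hle i) (hz i) hzi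
  have hagree : ∀ i j, ∀ z ∈ Ω i, z ∈ Ω j →
      hquot (N i) (D i) z = hquot (N j) (D j) z := by
    intro i j z hzi hzj
    have h1 : ∀ z ∈ Ω i ∩ Ω j, z.im ≠ 0 → hquot (N i) (D i) z = hquot (N j) (D j) z := by
      rintro z ⟨hzi, hzj⟩ him
      have hne : ∀ i, z ∈ Ω i → D i z ≠ 0 := by
        intro i hi h0
        have := hle i z hi
        rw [h0, norm_zero] at this
        have := mul_pos (hk i) (abs_pos.2 him)
        linarith
      simp only [hquot, hne i hzi, hne j hzj, if_false]
      rw [div_eq_div_iff (hne i hzi) (hne j hzj)]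
      exact hcomp i j z hzi hzj
    have hne : (𝓝[{z : ℂ | z.im ≠ 0}] z).NeBot :=
      mem_closure_iff_nhdsWithin_neBot.1 (dense_im_ne_zero z)
    have l1 := (hd i z hzi).continuousAt.tendsto.mono_left
      (nhdsWithin_le_nhds (s := {z : ℂ | z.im ≠ 0}))
    have l2 := (hd j z hzj).continuousAt.tendsto.mono_left
      (nhdsWithin_le_nhds (s := {z : ℂ | z.im ≠ 0}))
    refine tendsto_nhds_unique l1 (l2.congr' ?_)
    filter_upwards [self_mem_nhdsWithin, mem_nhdsWithin_of_mem_nhds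
      (((hΩ i).inter (hΩ j)).mem_nhds ⟨hzi, hzj⟩)] with x hx1 hx2
    exact (h1 x hx2 hx1).symm
  choose n hn using hcov
  refine ⟨fun z => hquot (N (n z)) (D (n z)) z, fun z => ?_, fun i z hzi => ?_⟩
  · refine (hd (n z) z (hn z)).congr_of_eventuallyEq ?_
    filter_upwards [(hΩ (n z)).mem_nhds (hn z)] with x hx
    exact hagree _ _ x (hn x) hx
  · simp only
    rw [hagree (n z) i z (hn z) hzi]
    exact hquot_mul (hz i z hzi)

/-- Removal of a factor `1 / |Im z|` in a growth bound. -/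
lemma norm_le_of_im_mul_le {F : ℂ → ℂ} (hF : Differentiable ℂ F) {g : ℝ → ℝ} (hg : Monotone g)
    (h : ∀ z, ‖F z‖ * |z.im| ≤ g ‖z‖) (a : ℂ) : ‖F a‖ ≤ g (‖a‖ + 2) := by
  rcases le_or_gt 1 |a.im| with h1 | h1
  · calc ‖F a‖ ≤ ‖F a‖ * |a.im| := le_mul_of_one_le_right (norm_nonneg _) h1
      _ ≤ g ‖a‖ := h a
      _ ≤ _ := hg (by linarith)
  set b : ℂ := (a.re : ℂ)
  set H : ℂ → ℂ := fun z => F z * ((z - b) ^ 2 - 4) with hH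
  have hHd : Differentiable ℂ H := by
    simp only [hH]; fun_prop
  have hab : a ∈ closure (Metric.ball b 2) := by
    refine subset_closure ?_
    rw [Metric.mem_ball, dist_eq]
    have : a - b = (a.im : ℂ) * I := by
      apply Complex.ext <;> simp [b]
    rw [this]
    simp
    linarith
  have h2 : ‖H a‖ ≤ 4 * g (‖a‖ + 2) := by
    refine norm_le_of_forall_mem_frontier_norm_le Metric.isBounded_ball hHd.diffContOnCl ?_ hab
    intro z hz
    rw [frontier_ball b two_ne_zero, Metric.mem_sphere, dist_eq] at hz
    have e1 : ‖(z - b) ^ 2 - 4‖ = 4 * |z.im| := by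
      have e0 : ‖z - b‖ ^ 2 = 4 := by rw [hz]; norm_num
      rw [← normSq_eq_norm_sq, normSq_apply] at e0
      have him : (z - b).im = z.im := by simp [b]
      have : ‖(z - b) ^ 2 - 4‖ ^ 2 = (4 * |z.im|) ^ 2 := by
        rw [← normSq_eq_norm_sq, normSq_apply, mul_pow, sq_abs, ← him]
        have r1 : ((z - b) ^ 2 - 4).re = (z - b).re ^ 2 - (z - b).im ^ 2 - 4 := by
          simp [pow_two]
        have r2 : ((z - b) ^ 2 - 4).im = 2 * (z - b).re * (z - b).im := by
          simp [pow_two]; ring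
        rw [r1, r2]
        have : (z - b).re ^ 2 = 4 - (z - b).im ^ 2 := by linarith
        linear_combination ((z - b).re ^ 2 + (z - b).im ^ 2 - 4) * this
      exact (pow_left_inj₀ (norm_nonneg _) (by positivity) two_ne_zero).1 this
    have e2 : ‖z‖ ≤ ‖a‖ + 2 := by
      have e3 : ‖b‖ ≤ ‖a‖ := by simp only [b, norm_real]; exact abs_re_le_norm a
      calc ‖z‖ = ‖b + (z - b)‖ := by ring_nf
        _ ≤ ‖b‖ + ‖z - b‖ := norm_add_le _ _
        _ ≤ _ := by rw [hz]; linarith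
    calc ‖H z‖ = 4 * (‖F z‖ * |z.im|) := by simp only [hH, norm_mul, e1]; ring
      _ ≤ 4 * g ‖z‖ := by linarith [h z]
      _ ≤ _ := by linarith [hg e2]
  have h3 : 4 ≤ ‖(a - b) ^ 2 - 4‖ := by
    have : (a - b) ^ 2 - 4 = ((-(a.im ^ 2 + 4) : ℝ) : ℂ) := by
      have : a - b = (a.im : ℂ) * I := by apply Complex.ext <;> simp [b]
      rw [this, mul_pow, I_sq]; push_cast; ring
    rw [this, norm_real, norm_neg, Real.norm_eq_abs, abs_of_pos (by positivity)]
    nlinarith [sq_nonneg a.im]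
  simp only [hH, norm_mul] at h2
  nlinarith [norm_nonneg (F a)]

end PowerPotential

namespace PowerPotential
open Complex Filter Topology ComplexConjugate

variable {α φ : ℝ} {μ p q m w w₀ : ℂ} {f : ℝ → ℂ}

/-- The order of growth of the generating function. -/
noncomputable def ord (α : ℝ) : ℝ := (α + 2) / (2 * α)

lemma Adm.differentiableOn_valZ (h : Adm α φ) (h1 : |w.im| < φ) (h2 : 0 < w.re) :
    DifferentiableOn ℂ (fun μ => valZ α μ w (weyl α μ w))
      (Metric.ball 0 (kap α φ / 2 * Real.exp (α * w.re))) := by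
  have hw := h.differentiableOn_weyl_param h1 h2
  have e1 := (differentiable_G_param (e := 1) h.pos w).differentiableOn
    (s := Metric.ball 0 (kap α φ / 2 * Real.exp (α * w.re)))
  have e2 := (differentiable_Gd_param (e := 1) h.pos w).differentiableOn
    (s := Metric.ball 0 (kap α φ / 2 * Real.exp (α * w.re)))
  exact (e2.sub (hw.mul e1)).const_mul _

lemma Adm.differentiableOn_derZ (h : Adm α φ) (h1 : |w.im| < φ) (h2 : 0 < w.re) :
    DifferentiableOn ℂ (fun μ => derZ α μ w (weyl α μ w))
      (Metric.ball 0 (kap α φ / 2 * Real.exp (α * w.re))) := by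
  have hw := h.differentiableOn_weyl_param h1 h2
  have e1 := (differentiable_G_param (e := 0) h.pos w).differentiableOn
    (s := Metric.ball 0 (kap α φ / 2 * Real.exp (α * w.re)))
  have e2 := (differentiable_Gd_param (e := 0) h.pos w).differentiableOn
    (s := Metric.ball 0 (kap α φ / 2 * Real.exp (α * w.re)))
  exact ((hw.mul e1).sub e2).const_mul _

lemma Adm.differentiableOn_nsol (h : Adm α φ) (h1 : |w.im| < φ) (h2 : 0 < w.re) (z : ℂ) :
    DifferentiableOn ℂ (fun μ => nsol α μ w z)
      (Metric.ball 0 (kap α φ / 2 * Real.exp (α * w.re))) := by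
  have e1 := (differentiable_G_param (e := 0) h.pos z).differentiableOn
    (s := Metric.ball 0 (kap α φ / 2 * Real.exp (α * w.re)))
  have e2 := (differentiable_G_param (e := 1) h.pos z).differentiableOn
    (s := Metric.ball 0 (kap α φ / 2 * Real.exp (α * w.re)))
  exact ((h.differentiableOn_valZ h1 h2).mul e1).add ((h.differentiableOn_derZ h1 h2).mul e2)

lemma aestronglyMeasurable_ray_Y (hα : 0 < α) :
    AEStronglyMeasurable (ray (Y α μ p q) w₀) (volume.restrict (Ioi 0)) :=
  (sol_ray hα μ p q w₀).contY.aestronglyMeasurable measurableSet_Ioi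

lemma integrableOn_mul_ray (hα : 0 < α) (hf : AEStronglyMeasurable f (volume.restrict (Ioi 0)))
    (hf2 : IntegrableOn (fun x => ‖f x‖ ^ 2) (Ioi 0)) (hd : DecRay α μ p q w₀) :
    IntegrableOn (fun x => f x * ray (Y α μ p q) w₀ x) (Ioi 0) := by
  have h1 := (memLp_two_iff_integrable_sq_norm hf).2 hf2
  have h2 := (memLp_two_iff_integrable_sq_norm (aestronglyMeasurable_ray_Y hα)).2
    (hd.sq_integrable hα)
  exact h1.integrable_mul h2

lemma norm_integral_mul_ray_le (hα : 0 < α)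
    (hf : AEStronglyMeasurable f (volume.restrict (Ioi 0)))
    (hf2 : IntegrableOn (fun x => ‖f x‖ ^ 2) (Ioi 0)) (hd : DecRay α μ p q w₀) {s : Set ℝ}
    (hs0 : s ⊆ Ioi 0) :
    ‖∫ x in s, f x * ray (Y α μ p q) w₀ x‖ ≤ √(∫ x in Ioi 0, ‖f x‖ ^ 2) *
      √(∫ x in Ioi 0, ‖ray (Y α μ p q) w₀ x‖ ^ 2) := by
  refine (norm_integral_le_integral_norm _).trans ?_
  refine le_trans ?_ (norm_integral_mul_le hf (aestronglyMeasurable_ray_Y hα) hf2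
    (hd.sq_integrable hα))
  exact setIntegral_mono_set (integrableOn_mul_ray hα hf hf2 hd).norm
    (ae_of_all _ fun x => norm_nonneg _) (Eventually.of_forall hs0)

lemma Adm.differentiableOn_integral_nsol (h : Adm α φ) {R : ℝ} (h1 : |(w₀ + R).im| < φ)
    (h2 : 0 < (w₀ + R).re) (hf : AEStronglyMeasurable f (volume.restrict (Ioi 0)))
    (hf2 : IntegrableOn (fun x => ‖f x‖ ^ 2) (Ioi 0)) :
    DifferentiableOn ℂ (fun μ => ∫ x in Ioi 0, f x * ray (nsol α μ (w₀ + R)) w₀ x)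
      (Metric.ball 0 (kap α φ / 2 * Real.exp (α * (w₀ + R).re))) := by
  set w := w₀ + (R : ℂ) with hw
  have hwm : ∀ μ ∈ Metric.ball (0 : ℂ) (kap α φ / 2 * Real.exp (α * w.re)), w ∈ wedge α φ μ :=
    fun μ hμ => ⟨h1, h2, by simpa using hμ⟩
  refine differentiableOn_of_tendsto_of_bounded Metric.isOpen_ball
    (F := fun (n : ℕ) μ => ∫ x in Ioc (0 : ℝ) n, f x * ray (nsol α μ w) w₀ x) (fun n => ?_) ?_ ?_
  · refine differentiableOn_integral_of_bounded Metric.isOpen_ball (fun z hz => ?_) ?_ ?_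
    · exact (hf.mono_set Ioc_subset_Ioi_self).mul
        ((aestronglyMeasurable_ray_Y h.pos).mono_set Ioc_subset_Ioi_self)
    · exact ae_of_all _ fun x => (h.differentiableOn_nsol h1 h2 _).const_mul _
    · intro z hz
      set ξ := max w.re (Real.log n + w₀.re) with hξ
      have hξ0 : 0 < ξ := lt_max_of_lt_left h2
      set B := 2 * bigA α φ * Real.exp (4 * omg α w.re) * Real.exp (3 * omg α ξ) * 2
      refine ⟨1, one_pos, fun x => ‖f x‖ * B, ?_, ?_⟩
      · refine Integrable.mul_const ?_ _
        have hm := (memLp_two_iff_integrable_sq_norm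
          (hf.mono_set (show Ioc (0 : ℝ) n ⊆ Ioi 0 from Ioc_subset_Ioi_self))).2
          (IntegrableOn.mono_set hf2 Ioc_subset_Ioi_self)
        exact (hm.integrable one_le_two).norm
      · refine (ae_restrict_iff' measurableSet_Ioc).2 (ae_of_all _ fun x hx v hv hvb => ?_)
        have hwv := hwm v hvb
        obtain ⟨b1, b2⟩ := h.norm_valZ_le hwv
        have hv : ‖v‖ ≤ Real.exp (α * ξ) := (norm_le_of_mem_wedge hwv).trans
          (Real.exp_le_exp.2 (mul_le_mul_of_nonneg_left (le_max_left _ _) h.pos.le))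
        have hre : ((Real.log x : ℂ) + w₀).re ≤ ξ := by
          refine le_trans ?_ (le_max_right _ _)
          simp only [add_re, ofReal_re]
          linarith [Real.log_le_log hx.1 hx.2]
        have b3 := norm_G_le_exp (e := 0) h.pos hξ0 hv zero_le_one hre
        have b4 := norm_G_le_exp (e := 1) h.pos hξ0 hv le_rfl hre
        rw [norm_mul]
        refine mul_le_mul_of_nonneg_left ?_ (norm_nonneg _)
        unfold ray nsol Y
        refine (norm_add_le _ _).trans ?_
        rw [norm_mul, norm_mul]
        have hA := h.one_le_bigA
        calc _ ≤ 2 * bigA α φ * Real.exp (4 * omg α w.re) * Real.exp (3 * omg α ξ) +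
            2 * bigA α φ * Real.exp (4 * omg α w.re) * Real.exp (3 * omg α ξ) := by gcongr
          _ = B := by ring
  · intro z hz
    refine ⟨1, one_pos, √(∫ x in Ioi 0, ‖f x‖ ^ 2) * √(Real.exp (-w₀.re) * (17 * bigA α φ ^ 2) *
      Real.exp (15 * omg α w.re)), fun n v _ hv => ?_⟩
    refine (norm_integral_mul_ray_le h.pos hf hf2 (h.decRay_nsol (hwm v hv))
      Ioc_subset_Ioi_self).trans ?_
    gcongr
    exact h.integral_nsol_le (hwm v hv)
  · intro z hz
    have hi := integrableOn_mul_ray h.pos hf hf2 (h.decRay_nsol (hwm z hz))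
    have := intervalIntegral_tendsto_integral_Ioi 0 hi tendsto_natCast_atTop_atTop
    refine this.congr fun n => ?_
    rw [intervalIntegral.integral_of_le (Nat.cast_nonneg n)]
    rfl

lemma integral_mul_ray_smul (s : ℂ) : ∫ x in Ioi 0, f x * ray (Y α μ (s * p) (s * q)) w₀ x =
    s * ∫ x in Ioi 0, f x * ray (Y α μ p q) w₀ x := by
  rw [← integral_const_mul]
  congr 1 with x
  simp only [ray, Y_smul]; ring

lemma DecRay.integral_comm (hα : 0 < α) {p' q' : ℂ} (h : DecRay α μ p q w₀)
    (h' : DecRay α μ p' q' w₀) :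
    (∫ x in Ioi 0, f x * ray (Y α μ p q) w₀ x) * p' =
      (∫ x in Ioi 0, f x * ray (Y α μ p' q') w₀ x) * p := by
  have := h.unique hα h'
  rw [mul_comm, mul_comm _ p, ← integral_mul_ray_smul, ← integral_mul_ray_smul,
    mul_comm p' p, mul_comm p' q, this]

lemma Adm.im_le_norm_valZ (h : Adm α φ) (hw : w ∈ wedge α φ μ) :
    (1250 * Real.exp (4 * omg α w.re))⁻¹ * |μ.im| ≤ ‖valZ α μ w (weyl α μ w)‖ := by
  by_cases hμ : μ.im = 0
  · simp [hμ]
  obtain ⟨m, hm⟩ := h.exists_decRay hμ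
  have h0 : DecRay α μ 1 m 0 := hm 0 (by simpa using h.phi_pos)
  have h1 := h.norm_Y_mul_im_le hw hμ h0
  have h2 := (h.weyl_spec hw).2.1.unique h.pos (hm w hw.1)
  have h3 := Y_valZ (μ := μ) (w := w) h.pos (weyl α μ w)
  rw [mul_one] at h2
  have h4 : valZ α μ w (weyl α μ w) * Y α μ 1 m w = 1 := by
    rw [← Y_smul, mul_one, h2, h3]
  have h5 : ‖valZ α μ w (weyl α μ w)‖ * ‖Y α μ 1 m w‖ = 1 := by
    rw [← norm_mul, h4, norm_one]
  rw [inv_mul_le_iff₀ (by positivity)]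
  calc |μ.im| = ‖valZ α μ w (weyl α μ w)‖ * ‖Y α μ 1 m w‖ * |μ.im| := by rw [h5, one_mul]
    _ = (‖Y α μ 1 m w‖ * |μ.im|) * ‖valZ α μ w (weyl α μ w)‖ := by ring
    _ ≤ _ := by gcongr

/-- The point at which the decaying solution is normalised in the growth bound. -/
lemma Adm.exists_normalisation (h : Adm α φ) (hw₀ : |w₀.im| < φ) :
    ∃ B > 0, ∀ μ : ℂ, ∃ R : ℝ, w₀ + R ∈ wedge α φ μ ∧
      omg α (w₀ + R).re ≤ B * (1 + ‖μ‖) ^ ord α := by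
  have hk := h.kap_pos
  have hk1 := kap_le_one (α := α) (φ := φ)
  have hα := h.pos
  refine ⟨Real.exp ((α + 2) / 2) * (4 / kap α φ) ^ ord α, by positivity, fun μ => ?_⟩
  set x := Real.log (4 / kap α φ * (1 + ‖μ‖)) / α
  have hx1 : 1 < 4 / kap α φ * (1 + ‖μ‖) := by
    have : 4 ≤ 4 / kap α φ := by rw [le_div_iff₀ hk]; linarith
    nlinarith [norm_nonneg μ]
  have hx0 : 0 < x := div_pos (Real.log_pos hx1) hα
  have hre : (w₀ + ((x - w₀.re : ℝ) : ℂ)).re = x := by simp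
  have hex : α * x = Real.log (4 / kap α φ * (1 + ‖μ‖)) := by simp only [x]; field_simp
  refine ⟨x - w₀.re, ⟨by simpa using hw₀, by rwa [hre], ?_⟩, ?_⟩
  · rw [hre, hex, Real.exp_log (by linarith)]
    field_simp
    linarith [norm_nonneg μ]
  · rw [hre, omg, mul_assoc, ← Real.mul_rpow (by positivity) (by positivity),
      Real.rpow_def_of_pos (by linarith), ← Real.exp_add, ← hex]
    refine Real.exp_le_exp.2 (le_of_eq ?_)
    rw [ord]; field_simp; ring

/-- The generating function of a functional vanishing on all eigenfunctions is entire, of finite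
order. -/
theorem Adm.exists_generating (h : Adm α φ) (hw₀ : |w₀.im| < φ)
    (hf : AEStronglyMeasurable f (volume.restrict (Ioi 0)))
    (hf2 : IntegrableOn (fun x => ‖f x‖ ^ 2) (Ioi 0))
    (horth : ∀ μ q, DecRay α μ 0 q w₀ → ∫ x in Ioi 0, f x * ray (Y α μ 0 q) w₀ x = 0) :
    ∃ F : ℂ → ℂ, Differentiable ℂ F ∧
      (∃ C > 0, ∀ μ, ‖F μ‖ ≤ C * Real.exp (C * (1 + ‖μ‖) ^ ord α)) ∧
      ∀ μ m, DecRay α μ 1 m w₀ → F μ = ∫ x in Ioi 0, f x * ray (Y α μ 1 m) w₀ x := by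
  obtain ⟨B, hB, hBR⟩ := h.exists_normalisation hw₀
  let ι := {R : ℝ // 0 < (w₀ + R).re}
  have him : ∀ R : ℝ, |(w₀ + R).im| < φ := fun R => by simpa using hw₀
  have hwm : ∀ i : ι, ∀ μ ∈ Metric.ball (0 : ℂ) (kap α φ / 2 * Real.exp (α * (w₀ + i.1).re)),
      w₀ + i.1 ∈ wedge α φ μ := fun i μ hμ => ⟨him _, i.2, by simpa using hμ⟩
  obtain ⟨F, hF, hFN⟩ := exists_entire_quotient (ι := ι)
    (N := fun i μ => ∫ x in Ioi 0, f x * ray (nsol α μ (w₀ + i.1)) w₀ x)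
    (D := fun i μ => valZ α μ (w₀ + i.1) (weyl α μ (w₀ + i.1)))
    (Ω := fun i => Metric.ball 0 (kap α φ / 2 * Real.exp (α * (w₀ + i.1).re)))
    (k := fun i => (1250 * Real.exp (4 * omg α (w₀ + i.1).re))⁻¹)
    (fun i => Metric.isOpen_ball)
    (fun z => by
      obtain ⟨R, hR, -⟩ := hBR z
      exact ⟨⟨R, hR.2.1⟩, by simpa using hR.2.2⟩)
    (fun i => h.differentiableOn_integral_nsol (him _) i.2 hf hf2)
    (fun i => h.differentiableOn_valZ (him _) i.2) (fun i => by positivity)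
    (fun i z hz => h.im_le_norm_valZ (hwm i z hz))
    (fun i z hz h0 => by
      have hd := h.decRay_nsol (hwm i z hz)
      simp only [nsol]
      rw [h0] at hd ⊢
      exact horth _ _ hd)
    (fun i j z hi hj => (h.decRay_nsol (hwm i z hi)).integral_comm h.pos
      (h.decRay_nsol (hwm j z hj)))
  have hFN' : ∀ (R : ℝ) μ, w₀ + R ∈ wedge α φ μ → F μ * valZ α μ (w₀ + R) (weyl α μ (w₀ + R)) =
      ∫ x in Ioi 0, f x * ray (nsol α μ (w₀ + R)) w₀ x := fun R μ hR =>
    hFN ⟨R, hR.2.1⟩ μ (by simpa using hR.2.2)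
  refine ⟨F, hF, ?_, ?_⟩
  · set A := 1250 * (√(∫ x in Ioi 0, ‖f x‖ ^ 2) * √(Real.exp (-w₀.re) * (17 * bigA α φ ^ 2)))
      with hA
    have hA0 : 0 ≤ A := by positivity
    have hord : 0 < ord α := by have := h.pos; unfold ord; positivity
    have hb : ∀ z, ‖F z‖ * |z.im| ≤ A * Real.exp (12 * B * (1 + max ‖z‖ 0) ^ ord α) := by
      intro z
      rw [max_eq_left (norm_nonneg z)]
      obtain ⟨R, hR, hRo⟩ := hBR z
      set ω := omg α (w₀ + R).re
      have h1 := h.im_le_norm_valZ hR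
      have h2 : ‖F z‖ * ‖valZ α z (w₀ + R) (weyl α z (w₀ + R))‖ ≤
          √(∫ x in Ioi 0, ‖f x‖ ^ 2) * √(Real.exp (-w₀.re) * (17 * bigA α φ ^ 2) *
            Real.exp (15 * ω)) := by
        rw [← norm_mul, hFN' R z hR]
        refine (norm_integral_mul_ray_le h.pos hf hf2 (h.decRay_nsol hR) Subset.rfl).trans ?_
        gcongr
        exact h.integral_nsol_le hR
      have h3 : √(Real.exp (15 * ω)) ≤ Real.exp (8 * ω) := by
        rw [← Real.exp_half]
        refine Real.exp_le_exp.2 ?_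
        have : 0 < ω := Real.exp_pos _
        linarith
      rw [Real.sqrt_mul (by positivity)] at h2
      rw [inv_mul_le_iff₀ (by positivity)] at h1
      calc ‖F z‖ * |z.im| ≤ ‖F z‖ * (1250 * Real.exp (4 * ω) *
            ‖valZ α z (w₀ + R) (weyl α z (w₀ + R))‖) := by gcongr
        _ = 1250 * Real.exp (4 * ω) * (‖F z‖ * ‖valZ α z (w₀ + R) (weyl α z (w₀ + R))‖) := by ring
        _ ≤ 1250 * Real.exp (4 * ω) * (√(∫ x in Ioi 0, ‖f x‖ ^ 2) *
            (√(Real.exp (-w₀.re) * (17 * bigA α φ ^ 2)) * Real.exp (8 * ω))) := by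
          refine mul_le_mul_of_nonneg_left (h2.trans ?_) (by positivity)
          gcongr
        _ = A * (Real.exp (4 * ω) * Real.exp (8 * ω)) := by rw [hA]; ring
        _ = A * Real.exp (12 * ω) := by rw [← Real.exp_add]; ring_nf
        _ ≤ _ := by
          refine mul_le_mul_of_nonneg_left (Real.exp_le_exp.2 ?_) hA0
          linarith
    have hmono : Monotone fun x : ℝ => A * Real.exp (12 * B * (1 + max x 0) ^ ord α) := by
      intro x y hxy
      simp only
      have : (0 : ℝ) ≤ max x 0 := le_max_right _ _
      gcongr
    have hfin := norm_le_of_im_mul_le hF hmono hb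
    refine ⟨max A 1 + 12 * B * 3 ^ ord α, by positivity, fun μ => (hfin μ).trans ?_⟩
    have h0 := norm_nonneg μ
    rw [max_eq_left (by linarith)]
    have h1 : (1 + (‖μ‖ + 2)) ^ ord α ≤ 3 ^ ord α * (1 + ‖μ‖) ^ ord α := by
      rw [← Real.mul_rpow (by norm_num) (by linarith)]
      gcongr
      linarith
    refine mul_le_mul ?_ (Real.exp_le_exp.2 ?_) (Real.exp_pos _).le (by positivity)
    · exact (le_max_left _ _).trans (by linarith [show 0 < 12 * B * 3 ^ ord α by positivity])
    · calc 12 * B * (1 + (‖μ‖ + 2)) ^ ord α ≤ 12 * B * (3 ^ ord α * (1 + ‖μ‖) ^ ord α) := by gcongr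
        _ = (12 * B * 3 ^ ord α) * (1 + ‖μ‖) ^ ord α := by ring
        _ ≤ _ := by
          gcongr
          linarith [show 0 < max A 1 by positivity]
  · intro μ m hm
    obtain ⟨R, hR, -⟩ := hBR μ
    have h1 := hFN' R μ hR
    have hd := h.decRay_nsol hR
    have h2 := hd.integral_comm (f := f) h.pos hm
    have h3 : valZ α μ (w₀ + R) (weyl α μ (w₀ + R)) ≠ 0 := by
      intro h0
      have h4 := hd.unique h.pos hm
      rw [h0, zero_mul, mul_one] at h4
      have h5 := Y_valZ (μ := μ) (w := w₀ + R) h.pos (weyl α μ (w₀ + R))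
      rw [h0, ← h4] at h5
      simp [Y] at h5
    rw [mul_one] at h2
    refine mul_right_cancel₀ h3 ?_
    rw [h1, ← h2]
    rfl

end PowerPotential

namespace PowerPotential
open Complex Filter Topology ComplexConjugate

lemma norm_comp_exp_le_of_strip {Φ : ℂ → ℂ} (hΦ : Differentiable ℂ Φ) {a b o C B : ℝ} (ho : 0 < o)
    (hC : 0 < C) (hord : ∀ z, ‖Φ z‖ ≤ C * Real.exp (C * (1 + ‖z‖) ^ o))
    (hab : (b - a) * o < Real.pi)
    (ha : ∀ z : ℂ, z.im = a → ‖Φ (exp z)‖ ≤ B) (hb : ∀ z : ℂ, z.im = b → ‖Φ (exp z)‖ ≤ B)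
    {z : ℂ} (hza : a ≤ z.im) (hzb : z.im ≤ b) : ‖Φ (exp z)‖ ≤ B := by
  rcases eq_or_lt_of_le (hza.trans hzb) with hE | hlt
  · exact ha z (le_antisymm (hzb.trans hE.ge) hza)
  refine PhragmenLindelof.horizontal_strip (f := fun z => Φ (exp z)) (a := a) (b := b)
    (hΦ.comp differentiable_exp).diffContOnCl ⟨o, ?_, C * 2 ^ o, ?_⟩ ha hb hza hzb
  · rw [lt_div_iff₀ (by linarith)]
    linarith
  · refine Asymptotics.IsBigO.of_bound C (Eventually.of_forall fun z => ?_)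
    rw [Real.norm_eq_abs, abs_of_pos (Real.exp_pos _)]
    refine (hord _).trans ?_
    rw [mul_assoc C (2 ^ o)]
    refine mul_le_mul_of_nonneg_left (Real.exp_le_exp.2 (mul_le_mul_of_nonneg_left ?_ hC.le)) hC.le
    rw [norm_exp, mul_comm o, Real.exp_mul, ← Real.mul_rpow (by norm_num) (Real.exp_pos _).le]
    gcongr
    have h1 : 1 ≤ Real.exp |z.re| := Real.one_le_exp (abs_nonneg _)
    have h2 : Real.exp z.re ≤ Real.exp |z.re| := Real.exp_le_exp.2 (le_abs_self _)
    linarith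

/-- An entire function of finite order which decays outside a sector, and is bounded on a ray
cutting the sector into small parts, vanishes. -/
theorem eq_zero_of_sectors {Φ : ℂ → ℂ} (hΦ : Differentiable ℂ Φ) {o C θ η t C' B : ℝ} (ho : 0 < o)
    (hC : 0 < C) (hord : ∀ z, ‖Φ z‖ ≤ C * Real.exp (C * (1 + ‖z‖) ^ o))
    (hθη : θ + η ≤ 2 * Real.pi - η)
    (hout : ∀ z : ℂ, 0 ≤ z.re → θ + η ≤ z.im → z.im ≤ 2 * Real.pi - η →
      ‖Φ (exp z)‖ ≤ C' * Real.exp (-z.re / 4))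
    (ho1 : (t + η) * o < Real.pi)
    (ho2 : (θ + η - t) * o < Real.pi)
    (ht : ∀ z : ℂ, 0 ≤ z.re → z.im = t → ‖Φ (exp z)‖ ≤ B) (z : ℂ) : Φ z = 0 := by
  obtain ⟨B₀, hB₀⟩ := (isCompact_closedBall (0 : ℂ) 1).exists_bound_of_continuousOn
    hΦ.continuous.continuousOn
  have hC'0 : 0 ≤ C' := by
    have := (norm_nonneg _).trans (hout ((θ + η : ℝ) * I) (by simp) (by simp) (by simpa using hθη))
    simpa using this
  set A := max B₀ (max B C')
  have hin : ∀ z : ℂ, z.re ≤ 0 → ‖Φ (exp z)‖ ≤ A := fun z hz =>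
    (hB₀ _ (by simpa [norm_exp] using hz)).trans (le_max_left _ _)
  have hout' : ∀ z : ℂ, θ + η ≤ z.im → z.im ≤ 2 * Real.pi - η → ‖Φ (exp z)‖ ≤ A := by
    intro z h1 h2
    rcases le_total z.re 0 with h0 | h0
    · exact hin z h0
    · refine (hout z h0 h1 h2).trans (le_trans ?_ ((le_max_right _ _).trans (le_max_right _ _)))
      exact mul_le_of_le_one_right hC'0 (Real.exp_le_one_iff.2 (by linarith))
  have ht' : ∀ z : ℂ, z.im = t → ‖Φ (exp z)‖ ≤ A := by
    intro z h1
    rcases le_total z.re 0 with h0 | h0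
    · exact hin z h0
    · exact (ht z h0 h1).trans ((le_max_left _ _).trans (le_max_right _ _))
  have hneg : ∀ z : ℂ, z.im = -η → ‖Φ (exp z)‖ ≤ A := by
    intro z h1
    have := hout' (z + 2 * Real.pi * I) (by simp [h1]; linarith) (by simp [h1])
    rwa [exp_periodic] at this
  have hall : ∀ z : ℂ, -η ≤ z.im → z.im ≤ 2 * Real.pi - η → ‖Φ (exp z)‖ ≤ A := by
    intro z h1 h2
    rcases le_total z.im t with h3 | h3
    · exact norm_comp_exp_le_of_strip hΦ ho hC hord (a := -η) (b := t) (by linarith) hneg ht' h1 h3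
    rcases le_total z.im (θ + η) with h4 | h4
    · exact norm_comp_exp_le_of_strip hΦ ho hC hord (a := t) (b := θ + η) (by linarith) ht'
        (fun z hz => hout' z hz.ge (hz.le.trans hθη)) h3 h4
    · exact hout' z h4 h2
  have hbd : ∀ z, ‖Φ z‖ ≤ A := by
    intro z
    by_cases hz : z = 0
    · exact (hB₀ z (by simp [hz])).trans (le_max_left _ _)
    have hx : ∃ n : ℤ, -η ≤ z.arg + n * (2 * Real.pi) ∧ z.arg + n * (2 * Real.pi) ≤
        2 * Real.pi - η := by
      have := existsUnique_add_zsmul_mem_Ico Real.two_pi_pos z.arg (-η)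
      obtain ⟨n, ⟨hn1, hn2⟩, -⟩ := this
      refine ⟨n, by simpa using hn1, ?_⟩
      simp only [zsmul_eq_mul] at hn2
      linarith
    obtain ⟨n, hn1, hn2⟩ := hx
    have h3 := hall (log z + n * (2 * Real.pi * I)) (by simpa [log_im] using hn1)
      (by simpa [log_im] using hn2)
    rwa [exp_periodic.int_mul n, exp_log hz] at h3
  have hconst : ∀ z w, Φ z = Φ w := fun z w =>
    hΦ.apply_eq_apply_of_bounded ((isBounded_iff_forall_norm_le (s := range Φ)).2
      ⟨A, by rintro _ ⟨x, rfl⟩; exact hbd x⟩) z w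
  have hlim : ‖Φ z‖ ≤ 0 := by
    have h1 : Tendsto (fun x : ℝ => C' * Real.exp (-x / 4)) atTop (𝓝 (C' * 0)) := by
      refine Tendsto.const_mul _ (Real.tendsto_exp_atBot.comp ?_)
      exact (tendsto_neg_atTop_atBot).atBot_div_const (by norm_num)
    rw [mul_zero] at h1
    refine ge_of_tendsto h1 ?_
    filter_upwards [eventually_ge_atTop 0] with x hx
    have := hout (x + (θ + η : ℝ) * I) (by simpa using hx) (by simp) (by simpa using hθη)
    rw [hconst z (exp (x + (θ + η : ℝ) * I))]
    simpa using this
  simpa using hlim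

end PowerPotential

namespace PowerPotential
open Complex Filter Topology ComplexConjugate

variable {α φ θ η : ℝ} {μ p q m w w₀ z : ℂ} {f : ℝ → ℂ}

lemma sin_le_sin_of_mem {a x : ℝ} (ha : 0 < a) (h1 : a ≤ x) (h2 : x ≤ Real.pi - a) :
    Real.sin a ≤ Real.sin x := by
  rcases le_total x (Real.pi / 2) with h | h
  · exact Real.sin_le_sin_of_le_of_le_pi_div_two (by linarith [Real.pi_pos]) h h1
  · rw [← Real.sin_pi_sub x]
    exact Real.sin_le_sin_of_le_of_le_pi_div_two (by linarith [Real.pi_pos]) (by linarith)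
      (by linarith)

lemma exists_rotation {β : ℝ} (hθ : 0 ≤ θ) (hη : 0 < η) (hθη : θ + η ≤ Real.pi)
    (h1 : θ + η ≤ β) (h2 : β ≤ 2 * Real.pi - η) :
    ∃ ω : ℝ, Real.sin (η / 2) ≤ Real.cos ω ∧ 0 ≤ Real.cos (ω + θ) ∧
      Real.sin (η / 2) ≤ -Real.cos (ω + β) := by
  have hpi := Real.pi_pos
  rcases le_total β (Real.pi + θ / 2) with h | h
  · refine ⟨Real.pi / 2 - (θ + η / 2), ?_, ?_, ?_⟩
    · rw [Real.cos_pi_div_two_sub]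
      exact sin_le_sin_of_mem (by linarith) (by linarith) (by linarith)
    · rw [show Real.pi / 2 - (θ + η / 2) + θ = Real.pi / 2 - η / 2 by ring, Real.cos_pi_div_two_sub]
      exact Real.sin_nonneg_of_nonneg_of_le_pi (by linarith) (by linarith)
    · rw [show Real.pi / 2 - (θ + η / 2) + β = (β - θ - η / 2) + Real.pi / 2 by ring,
        Real.cos_add_pi_div_two, neg_neg]
      exact sin_le_sin_of_mem (by linarith) (by linarith) (by linarith)
  · refine ⟨-(Real.pi / 2 - η / 2), ?_, ?_, ?_⟩
    · rw [Real.cos_neg, Real.cos_pi_div_two_sub]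
    · rw [show -(Real.pi / 2 - η / 2) + θ = -(Real.pi / 2 - (θ + η / 2)) by ring, Real.cos_neg,
        Real.cos_pi_div_two_sub]
      exact Real.sin_nonneg_of_nonneg_of_le_pi (by linarith) (by linarith)
    · rw [show -(Real.pi / 2 - η / 2) + β = (β + η / 2 - Real.pi) + Real.pi / 2 by ring,
        Real.cos_add_pi_div_two, neg_neg]
      exact sin_le_sin_of_mem (by linarith) (by linarith) (by linarith)

/-- The data of the outer sector: `(α + 2) Im w₀ = θ`. -/
structure Outer (α θ η : ℝ) (w₀ : ℂ) : Prop where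
  pos : 0 < α
  lt_two : α < 2
  im_eq : (α + 2) * w₀.im = θ
  nonneg : 0 ≤ θ
  eta_pos : 0 < η
  le_pi : θ + η ≤ Real.pi

/-- The spectral parameters in the outer sector. -/
def outerSet (θ η : ℝ) : Set ℂ := {z | 0 ≤ z.re ∧ θ + η ≤ z.im ∧ z.im ≤ 2 * Real.pi - η}

lemma Outer.sin_pos (h : Outer α θ η w₀) : 0 < Real.sin (η / 2) :=
  Real.sin_pos_of_pos_of_lt_pi (by linarith [h.eta_pos])
    (by linarith [h.eta_pos, h.nonneg, h.le_pi])

lemma exp_mul_exp_re (ω : ℝ) (z : ℂ) :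
    (exp (ω * I) * exp z).re = Real.exp z.re * Real.cos (ω + z.im) := by
  rw [← Complex.exp_add, exp_re]
  simp

lemma Outer.exists_rot (h : Outer α θ η w₀) (hz : z ∈ outerSet θ η) :
    ∃ e : ℂ, ‖e‖ ≤ 1 ∧ Real.sin (η / 2) ≤ e.re ∧ 0 ≤ (e * exp ((α + 2) * w₀)).re ∧
      Real.sin (η / 2) * Real.exp z.re ≤ -(e * exp z).re := by
  obtain ⟨ω, h1, h2, h3⟩ := exists_rotation h.nonneg h.eta_pos h.le_pi hz.2.1 hz.2.2
  have him : ((α + 2) * w₀).im = θ := by rw [← h.im_eq]; simp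
  refine ⟨exp (ω * I), by simp, by simpa [exp_ofReal_mul_I_re] using h1, ?_, ?_⟩
  · rw [exp_mul_exp_re, him]; positivity
  · rw [exp_mul_exp_re]
    have := Real.exp_pos z.re
    nlinarith

/-- Ratio of the moduli of the potential in the outer sector. -/
noncomputable def outK (α : ℝ) (w₀ : ℂ) : ℝ := 4 * ‖exp ((α + 2) * w₀)‖ + 1

/-- The constant in the derivative bound at the origin in the outer sector. -/
noncomputable def outC (α η : ℝ) (w₀ : ℂ) : ℝ := 2 * (1 + outK α w₀ ^ 2) / Real.sin (η / 2)

lemma outK_bound (hz : 0 ≤ z.re) : 4 * ‖exp ((α + 2) * w₀)‖ + ‖exp z‖ ≤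
    outK α w₀ * Real.exp z.re := by
  have h1 : 1 ≤ Real.exp z.re := Real.one_le_exp hz
  rw [norm_exp z, outK]
  nlinarith [norm_nonneg (exp ((α + 2) * w₀))]

lemma Outer.outC_pos (h : Outer α θ η w₀) : 0 < outC α η w₀ := by
  have := h.sin_pos
  unfold outC; positivity

lemma DecRay.outer (h : Outer α θ η w₀) (hd : DecRay α μ p q w₀) (hz : z ∈ outerSet θ η)
    (hμ : exp (2 * w₀) * μ = exp z) :
    ‖q * exp w₀‖ ≤ outC α η w₀ * Real.exp (z.re / 2) * ‖p‖ ∧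
      ∫ x in Ioi 0, ‖ray (Y α μ p q) w₀ x‖ ^ 2 ≤
        outC α η w₀ / Real.sin (η / 2) * Real.exp (-z.re / 2) * ‖p‖ ^ 2 := by
  obtain ⟨e, he, hke, hec, hel⟩ := h.exists_rot hz
  have hs := h.sin_pos
  obtain ⟨h1, h2, h3⟩ := hd.energy_zero h.pos h.lt_two (k := Real.sin (η / 2))
    (M := Real.exp z.re) (K := outK α w₀) hs (Real.one_le_exp hz.1) he hke hec
    (by rwa [hμ]) (by rw [hμ]; exact outK_bound hz.1)
  rw [← Real.exp_half] at h1
  refine ⟨h1, ?_⟩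
  have h4 : ‖q * exp w₀‖ * ‖p‖ ≤ outC α η w₀ * Real.exp (z.re / 2) * ‖p‖ * ‖p‖ := by
    gcongr
    exact h1
  have h5 := h3.trans h4
  have e1 : Real.exp (z.re / 2) = Real.exp (-z.re / 2) * Real.exp z.re := by
    rw [← Real.exp_add]; ring_nf
  have e0 := Real.exp_pos z.re
  rw [← le_div_iff₀' (by positivity)] at h5
  refine h5.trans (le_of_eq ?_)
  rw [e1]; field_simp

lemma Adm.exists_decRay_outer (ha : Adm α φ) (hw₀ : |w₀.im| < φ) (h : Outer α θ η w₀)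
    (hz : z ∈ outerSet θ η) (hμ : exp (2 * w₀) * μ = exp z) : ∃ m, DecRay α μ 1 m w₀ := by
  obtain ⟨B, hB, hBR⟩ := ha.exists_normalisation hw₀
  obtain ⟨R, hR, -⟩ := hBR μ
  have hd := ha.decRay_nsol hR
  set p := valZ α μ (w₀ + R) (weyl α μ (w₀ + R)) with hp
  set q := derZ α μ (w₀ + R) (weyl α μ (w₀ + R)) with hq
  have hp0 : p ≠ 0 := by
    intro h0
    rw [h0] at hd
    have h1 := (hd.outer h hz hμ).1
    rw [norm_zero, mul_zero] at h1
    have h2 : q = 0 := by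
      have := norm_le_zero_iff.1 h1
      simpa using this
    have h3 := Y_valZ (μ := μ) (w := w₀ + R) h.pos (weyl α μ (w₀ + R))
    rw [← hp, ← hq, h0, h2] at h3
    simp [Y] at h3
  have := hd.smul p⁻¹
  rw [inv_mul_cancel₀ hp0] at this
  exact ⟨_, this⟩

lemma Outer.norm_integral_le (h : Outer α θ η w₀)
    (hf : AEStronglyMeasurable f (volume.restrict (Ioi 0)))
    (hf2 : IntegrableOn (fun x => ‖f x‖ ^ 2) (Ioi 0)) (hd : DecRay α μ 1 m w₀)
    (hz : z ∈ outerSet θ η) (hμ : exp (2 * w₀) * μ = exp z) :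
    ‖∫ x in Ioi 0, f x * ray (Y α μ 1 m) w₀ x‖ ≤
      √(∫ x in Ioi 0, ‖f x‖ ^ 2) * √(outC α η w₀ / Real.sin (η / 2)) * Real.exp (-z.re / 4) := by
  refine (norm_integral_mul_ray_le h.pos hf hf2 hd Subset.rfl).trans ?_
  rw [mul_assoc]
  gcongr
  have h2 := (hd.outer h hz hμ).2
  rw [norm_one, one_pow, mul_one] at h2
  refine (Real.sqrt_le_sqrt h2).trans (le_of_eq ?_)
  rw [Real.sqrt_mul (div_nonneg h.outC_pos.le h.sin_pos.le), ← Real.exp_half]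
  ring_nf

end PowerPotential

namespace PowerPotential
open Complex Filter Topology ComplexConjugate

variable {α φ θ η : ℝ} {μ p q m w w₀ z : ℂ} {f : ℝ → ℂ} {Q y y' : ℝ → ℂ}

lemma Decays.re_energy_ge (h : Sol Q y y') (hd : Decays Q y y') {a : ℝ} (ha : 0 < a) {e : ℂ}
    {k N : ℝ} (hk : k ≤ e.re) (hN : ∀ x > a, N ≤ (e * Q x).re) :
    k * (∫ x in Ioi a, ‖y' x‖ ^ 2) + N * (∫ x in Ioi a, ‖y x‖ ^ 2) ≤
      -(e * (y' a * conj (y a))).re := by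
  rw [← Decays.re_energy_tail h hd ha e, ← integral_const_mul, ← integral_const_mul,
    ← integral_add ((hd a ha).1.const_mul k) ((Decays.sq_integrable h hd ha).const_mul N)]
  refine setIntegral_mono_on (((hd a ha).1.const_mul k).add
    ((Decays.sq_integrable h hd ha).const_mul N)) (Decays.re_density_integrable h hd ha e)
    measurableSet_Ioi fun x hx => ?_
  have := hN x hx
  gcongr

lemma Decays.norm_sq_le (h : Sol Q y y') (hd : Decays Q y y') {a r : ℝ} (ha : 0 < a) (hr : 0 < r) :
    r * ‖y a‖ ^ 2 ≤ (∫ x in Ioi a, ‖y' x‖ ^ 2) + r ^ 2 * ∫ x in Ioi a, ‖y x‖ ^ 2 := by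
  have c1 := h.contY.mono (Ioi_subset_Ioi ha.le)
  have c2 := h.contY'.mono (Ioi_subset_Ioi ha.le)
  have i1 := (hd a ha).1
  have i2 := Decays.sq_integrable h hd ha
  have hder : ∀ x ∈ Ici a, HasDerivAt (fun x => y x * conj (y x))
      (y' x * conj (y x) + y x * conj (y' x)) x := fun x hx =>
    (h.d1 x (lt_of_lt_of_le ha hx)).mul (h.d1 x (lt_of_lt_of_le ha hx)).star
  have hInt : IntegrableOn (fun x => y' x * conj (y x) + y x * conj (y' x)) (Ioi a) := by
    refine Integrable.mono' (i1.add i2) ?_ (ae_of_all _ fun x => ?_)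
    · refine ContinuousOn.aestronglyMeasurable ?_ measurableSet_Ioi
      exact (c2.mul (continuous_conj.comp_continuousOn c1)).add
        (c1.mul (continuous_conj.comp_continuousOn c2))
    · refine (norm_add_le _ _).trans ?_
      simp only [norm_mul, RCLike.norm_conj, Pi.add_apply]
      nlinarith [sq_nonneg (‖y x‖ - ‖y' x‖)]
  have hInt2 : IntegrableOn (fun x => y x * conj (y x)) (Ioi a) := by
    refine Integrable.mono' i2 ?_ (ae_of_all _ fun x => ?_)
    · exact (c1.mul (continuous_conj.comp_continuousOn c1)).aestronglyMeasurable measurableSet_Ioi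
    · simp only [norm_mul, RCLike.norm_conj, ← sq, le_refl]
  have hlim := tendsto_zero_of_hasDerivAt_of_integrableOn_Ioi
    (fun x hx => hder x (Ioi_subset_Ici_self hx)) hInt hInt2
  have key := integral_Ioi_of_hasDerivAt_of_tendsto' hder hInt hlim
  have h1 : ‖y a‖ ^ 2 = ‖∫ x in Ioi a, (y' x * conj (y x) + y x * conj (y' x))‖ := by
    rw [key, zero_sub, norm_neg, norm_mul, RCLike.norm_conj, sq]
  have h2 : r * ‖y a‖ ^ 2 ≤ ∫ x in Ioi a, (‖y' x‖ ^ 2 + r ^ 2 * ‖y x‖ ^ 2) := by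
    rw [h1, ← Real.norm_of_nonneg hr.le, ← norm_real, ← norm_mul, ← integral_const_mul,
      norm_real, Real.norm_of_nonneg hr.le]
    refine norm_integral_le_of_norm_le (i1.add (i2.const_mul _)) (ae_of_all _ fun x => ?_)
    rw [norm_mul, norm_real, Real.norm_of_nonneg hr.le]
    have : ‖y' x * conj (y x) + y x * conj (y' x)‖ ≤ 2 * ‖y x‖ * ‖y' x‖ := by
      refine (norm_add_le _ _).trans ?_
      simp only [norm_mul, RCLike.norm_conj]
      linarith
    have h3 := mul_le_mul_of_nonneg_left this hr.le
    nlinarith [sq_nonneg (r * ‖y x‖ - ‖y' x‖)]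
  rwa [integral_add i1 (i2.const_mul _), integral_const_mul] at h2

/-- The bound for the series solutions on `(0, x]`. -/
noncomputable def serB (α : ℝ) (μ : ℂ) (X : ℝ) : ℝ :=
  (1 + Real.exp X) * Real.cosh √(size α ‖μ‖ X)

lemma norm_Y_le (hα : 0 < α) {X : ℝ} (hX : w.re ≤ X) (hp : ‖p‖ ≤ 1) (hq : ‖q‖ ≤ 1) :
    ‖Y α μ p q w‖ ≤ serB α μ X := by
  have h0 := norm_G_le (e := 0) hα μ w
  have h1 := norm_G_le (e := 1) hα μ w
  have hc : Real.cosh √(size α ‖μ‖ w.re) ≤ Real.cosh √(size α ‖μ‖ X) := by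
    rw [Real.cosh_le_cosh, abs_of_nonneg (Real.sqrt_nonneg _), abs_of_nonneg (Real.sqrt_nonneg _)]
    exact Real.sqrt_le_sqrt (size_mono hα (norm_nonneg _) le_rfl hX)
  have hc0 : 0 ≤ Real.cosh √(size α ‖μ‖ w.re) := (Real.cosh_pos _).le
  unfold Y serB
  refine (norm_add_le _ _).trans ?_
  rw [norm_mul, norm_mul, add_mul]
  simp only [Nat.cast_zero, zero_mul, Real.exp_zero, Nat.cast_one, one_mul] at h0 h1
  refine add_le_add ?_ ?_
  · refine mul_le_mul hp (h0.trans hc) (norm_nonneg _) zero_le_one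
  · calc ‖q‖ * ‖G α 1 μ w‖ ≤ 1 * (Real.exp w.re * Real.cosh √(size α ‖μ‖ w.re)) := by gcongr
      _ ≤ _ := by rw [one_mul]; gcongr

lemma norm_ray_Y_le (hα : 0 < α) {x ξ : ℝ} (hξ : 0 < ξ) (hx : ξ ≤ x) (hp : ‖p‖ ≤ 1)
    (hq : ‖q‖ ≤ 1) : ‖ray (Y α μ p q) w₀ ξ‖ ≤ serB α μ (Real.log x + w₀.re) := by
  refine norm_Y_le hα ?_ hp hq
  simp only [add_re, ofReal_re]
  linarith [Real.log_le_log hξ hx]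

lemma serB_le {μ : ℂ} {X : ℝ} : serB α μ X ≤ (1 + Real.exp X) *
    Real.exp (√(Real.exp ((α + 2) * X) + Real.exp (2 * X)) * (1 + ‖μ‖) ^ (1 / 2 : ℝ)) := by
  unfold serB
  gcongr
  have h1 : √(size α ‖μ‖ X) ≤
      √(Real.exp ((α + 2) * X) + Real.exp (2 * X)) * (1 + ‖μ‖) ^ (1 / 2 : ℝ) := by
    rw [← Real.sqrt_eq_rpow, ← Real.sqrt_mul (by positivity)]
    refine Real.sqrt_le_sqrt ?_
    unfold size
    have := norm_nonneg μ
    have := Real.exp_pos ((α + 2) * X)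
    have := Real.exp_pos (2 * X)
    nlinarith [mul_nonneg (norm_nonneg μ) (Real.exp_pos ((α + 2) * X)).le]
  refine le_trans ?_ (Real.exp_le_exp.2 h1)
  rw [Real.cosh_eq]
  have : Real.exp (-√(size α ‖μ‖ X)) ≤ Real.exp √(size α ‖μ‖ X) :=
    Real.exp_le_exp.2 (by linarith [Real.sqrt_nonneg (size α ‖μ‖ X)])
  linarith

lemma exists_order_scale {F : ℂ → ℂ} {o C : ℝ} (ho : 0 < o) (hC : 0 < C)
    (h : ∀ μ, ‖F μ‖ ≤ C * Real.exp (C * (1 + ‖μ‖) ^ o)) (b : ℂ) :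
    ∃ C' > 0, ∀ μ, ‖F (b * μ)‖ ≤ C' * Real.exp (C' * (1 + ‖μ‖) ^ o) := by
  have hb1 : 1 ≤ (1 + ‖b‖) ^ o := Real.one_le_rpow (by linarith [norm_nonneg b]) ho.le
  refine ⟨C * (1 + ‖b‖) ^ o, by positivity, fun μ => (h _).trans ?_⟩
  have h1 : (1 + ‖b * μ‖) ^ o ≤ (1 + ‖b‖) ^ o * (1 + ‖μ‖) ^ o := by
    rw [← Real.mul_rpow (by positivity) (by positivity)]
    gcongr
    rw [norm_mul]
    nlinarith [norm_nonneg b, norm_nonneg μ]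
  refine mul_le_mul (le_mul_of_one_le_right hC.le hb1) (Real.exp_le_exp.2 ?_) (Real.exp_pos _).le
    (by positivity)
  rw [mul_assoc]
  gcongr

end PowerPotential

namespace PowerPotential
open Complex Filter Topology ComplexConjugate

variable {α φ θ η : ℝ} {μ p q m w w₀ z : ℂ} {f : ℝ → ℂ} {Q y y' : ℝ → ℂ}

lemma wronskian_ray (hα : 0 < α) (μ p q p' q' w₀ : ℂ) {x : ℝ} (hx : 0 < x) :
    ray (Y α μ p q) w₀ x * rayd (Yd α μ p' q') w₀ x -
      rayd (Yd α μ p q) w₀ x * ray (Y α μ p' q') w₀ x = (p * q' - q * p') * exp w₀ := by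
  have h := wronskian_Y hα μ p q p' q' (Real.log x + w₀)
  have hx0 : (x : ℂ) ≠ 0 := by exact_mod_cast hx.ne'
  have h2 : exp (Real.log x + w₀) = x * exp w₀ := by
    rw [Complex.exp_add, ← ofReal_exp, Real.exp_log hx]
  rw [h2] at h
  unfold ray rayd
  field_simp
  linear_combination h

lemma integrableOn_sq_ray_Ioc (hα : 0 < α) (x : ℝ) (hp : ‖p‖ ≤ 1) (hq : ‖q‖ ≤ 1) :
    IntegrableOn (fun ξ => ‖ray (Y α μ p q) w₀ ξ‖ ^ 2) (Ioc 0 x) := by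
  refine Integrable.mono' (g := fun _ => serB α μ (Real.log x + w₀.re) ^ 2)
    (integrableOn_const measure_Ioc_lt_top.ne) ?_ ?_
  · exact (((aestronglyMeasurable_ray_Y hα).mono_set Ioc_subset_Ioi_self).norm.pow 2)
  · refine (ae_restrict_mem measurableSet_Ioc).mono fun ξ hξ => ?_
    rw [norm_pow, norm_norm]
    gcongr
    exact norm_ray_Y_le hα hξ.1 hξ.2 hp hq

lemma sine_energy_le (hα : 0 < α) {e : ℂ} {k N x : ℝ} (hx : 0 < x) (hk : 0 ≤ k) (he : k ≤ e.re)
    (hN : ∀ x > 0, N ≤ (e * rayPot α μ w₀ x).re) :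
    N * (∫ ξ in Ioc 0 x, ‖ray (Y α μ 0 1) w₀ ξ‖ ^ 2) ≤
      (e * (rayd (Yd α μ 0 1) w₀ x * conj (ray (Y α μ 0 1) w₀ x))).re := by
  have hs := sol_ray hα μ 0 1 w₀
  set s := ray (Y α μ 0 1) w₀
  set s' := rayd (Yd α μ 0 1) w₀
  have hlim : Tendsto (fun a => (e * (s' x * conj (s x))).re - (e * (s' a * conj (s a))).re)
      (𝓝[>] 0) (𝓝 ((e * (s' x * conj (s x))).re)) := by
    have h1 := tendsto_ray_Y hα μ 0 1 w₀
    have h2 := tendsto_rayd_Yd hα μ 0 1 w₀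
    have h3 : Tendsto (fun a => (e * (s' a * conj (s a))).re) (𝓝[>] 0) (𝓝 0) := by
      have := (continuous_re.tendsto _).comp
        ((h2.mul ((continuous_conj.tendsto _).comp h1)).const_mul e)
      rw [map_zero, mul_zero, mul_zero, zero_re] at this
      exact this
    simpa only [sub_zero] using tendsto_const_nhds.sub h3
  have hInt : IntegrableOn (fun ξ => ‖s ξ‖ ^ 2) (uIcc 0 x) := by
    rw [uIcc_of_le hx.le, integrableOn_Icc_iff_integrableOn_Ioc]
    exact integrableOn_sq_ray_Ioc hα x (by simp) (by simp)
  have hlim2 : Tendsto (fun a => N * ∫ ξ in a..x, ‖s ξ‖ ^ 2) (𝓝[>] 0)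
      (𝓝 (N * ∫ ξ in Ioc 0 x, ‖s ξ‖ ^ 2)) := by
    refine Tendsto.const_mul N ?_
    have h1 := intervalIntegral.continuousOn_primitive_interval_left hInt 0 left_mem_uIcc
    rw [← intervalIntegral.integral_of_le hx.le]
    refine h1.tendsto.mono_left ?_
    rw [uIcc_of_le hx.le, nhdsWithin_Icc_eq_nhdsGE hx]
    exact nhdsWithin_mono _ Ioi_subset_Ici_self
  refine le_of_tendsto_of_tendsto hlim2 hlim ?_
  filter_upwards [Ioo_mem_nhdsGT hx] with a ha
  rw [← hs.re_energy_interval ha.1 ha.2.le e, ← intervalIntegral.integral_const_mul]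
  have hsub : Icc a x ⊆ Ioi 0 := fun t ht => ha.1.trans_le ht.1
  have c1 := hs.contY.mono hsub
  have c2 := hs.contY'.mono hsub
  have c3 := hs.cont.mono hsub
  refine intervalIntegral.integral_mono_on ha.2.le ?_ ?_ fun t ht => ?_
  · exact (ContinuousOn.intervalIntegrable_of_Icc ha.2.le
      (continuousOn_const.mul (c1.norm.pow 2)))
  · refine ContinuousOn.intervalIntegrable_of_Icc ha.2.le ?_
    exact (continuousOn_const.mul (c2.norm.pow 2)).add
      ((continuous_re.comp_continuousOn (continuousOn_const.mul c3)).mul (c1.norm.pow 2))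
  · have := hN t (hsub ht)
    have h4 : 0 ≤ e.re * ‖s' t‖ ^ 2 := by have := hk.trans he; positivity
    nlinarith [sq_nonneg ‖s t‖]

lemma Outer.le_re_rayPot (_h : Outer α θ η w₀) {e : ℂ}
    (he : 0 ≤ (e * exp ((α + 2) * w₀)).re) (hμ : exp (2 * w₀) * μ = exp z) {x : ℝ} (hx : 0 < x)
    {N : ℝ} (hN : N ≤ -(e * exp z).re) : N ≤ (e * rayPot α μ w₀ x).re := by
  unfold rayPot pot
  rw [hμ, mul_sub, sub_re, ← mul_assoc, re_mul_ofReal]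
  have := mul_nonneg he (Real.rpow_nonneg hx.le α)
  linarith

/-- Off the diagonal, the two factors of the Green kernel are small in the outer sector. -/
lemma Outer.green_le (h : Outer α θ η w₀) (hd : DecRay α μ 1 m w₀)
    (hz : z ∈ outerSet θ η) (hμ : exp (2 * w₀) * μ = exp z) {x : ℝ} (hx : 0 < x) :
    ‖ray (Y α μ 1 m) w₀ x‖ * √(∫ ξ in Ioc 0 x, ‖ray (Y α μ 0 1) w₀ ξ‖ ^ 2) ≤
      ‖exp w₀‖ / Real.sin (η / 2) * Real.exp (-z.re / 4) ∧
    ‖ray (Y α μ 0 1) w₀ x‖ * √(∫ ξ in Ioi x, ‖ray (Y α μ 1 m) w₀ ξ‖ ^ 2) ≤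
      ‖exp w₀‖ / Real.sin (η / 2) * Real.exp (-z.re / 4) := by
  have hk := h.sin_pos
  set k := Real.sin (η / 2)
  obtain ⟨e, he1, he2, he3, he4⟩ := h.exists_rot hz
  set r := Real.exp (z.re / 2) with hr
  have hr1 : 1 ≤ r := Real.one_le_exp (by linarith [hz.1])
  have hM : Real.exp z.re = r ^ 2 := by rw [hr, ← Real.exp_nat_mul]; congr 1; push_cast; ring
  rw [hM] at he4
  have hN : ∀ x > 0, k * r ^ 2 ≤ (e * rayPot α μ w₀ x).re := fun x hx =>
    h.le_re_rayPot he3 hμ hx he4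
  have hA := sine_energy_le (μ := μ) (w₀ := w₀) h.pos hx hk.le he2 hN
  have hsol := sol_ray h.pos μ 1 m w₀
  have hB := Decays.re_energy_ge hsol hd hx he2 (fun t ht => hN t (hx.trans ht))
  have hD := Decays.norm_sq_le hsol hd hx (zero_lt_one.trans_le hr1)
  have hW := wronskian_ray h.pos μ 1 m 0 1 w₀ hx
  have hA0 : 0 ≤ ∫ ξ in Ioc 0 x, ‖ray (Y α μ 0 1) w₀ ξ‖ ^ 2 :=
    integral_nonneg fun _ => by positivity
  have hB0 : 0 ≤ ∫ ξ in Ioi x, ‖ray (Y α μ 1 m) w₀ ξ‖ ^ 2 :=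
    integral_nonneg fun _ => by positivity
  have hD0 : 0 ≤ ∫ ξ in Ioi x, ‖rayd (Yd α μ 1 m) w₀ ξ‖ ^ 2 :=
    integral_nonneg fun _ => by positivity
  set A := ∫ ξ in Ioc 0 x, ‖ray (Y α μ 0 1) w₀ ξ‖ ^ 2
  set B := ∫ ξ in Ioi x, ‖ray (Y α μ 1 m) w₀ ξ‖ ^ 2
  set D := ∫ ξ in Ioi x, ‖rayd (Yd α μ 1 m) w₀ ξ‖ ^ 2
  set y := ray (Y α μ 1 m) w₀ x
  set y' := rayd (Yd α μ 1 m) w₀ x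
  set s := ray (Y α μ 0 1) w₀ x
  set s' := rayd (Yd α μ 0 1) w₀ x
  simp only [mul_one, mul_zero, sub_zero, one_mul] at hW
  have hid : (e * (s' * conj s)).re * ‖y‖ ^ 2 + -(e * (y' * conj y)).re * ‖s‖ ^ 2 ≤
      ‖exp w₀‖ * (‖y‖ * ‖s‖) := by
    have h1 : (e * (s' * conj s)) * (‖y‖ ^ 2 : ℝ) - (e * (y' * conj y)) * (‖s‖ ^ 2 : ℝ) =
        e * (conj s * conj y) * exp w₀ := by
      have e1 : ((‖y‖ ^ 2 : ℝ) : ℂ) = y * conj y := by rw [mul_conj, normSq_eq_norm_sq]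
      have e2 : ((‖s‖ ^ 2 : ℝ) : ℂ) = s * conj s := by rw [mul_conj, normSq_eq_norm_sq]
      rw [e1, e2, ← hW]; ring
    have h2 := congrArg re h1
    rw [sub_re, re_mul_ofReal, re_mul_ofReal] at h2
    have h3 := re_le_norm (e * (conj s * conj y) * exp w₀)
    simp only [norm_mul, RCLike.norm_conj] at h3
    have h4 : ‖e‖ * (‖s‖ * ‖y‖) * ‖exp w₀‖ ≤ 1 * (‖s‖ * ‖y‖) * ‖exp w₀‖ := by gcongr
    nlinarith
  have hW0 := norm_nonneg (exp w₀)
  set W := ‖exp w₀‖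
  have hq0 : 0 ≤ ‖y‖ * ‖s‖ := by positivity
  have hsum : k * r ^ 2 * (A * ‖y‖ ^ 2 + B * ‖s‖ ^ 2) ≤ W * (‖y‖ * ‖s‖) := by
    have h1 := mul_le_mul_of_nonneg_right hA (sq_nonneg ‖y‖)
    have h2 := mul_le_mul_of_nonneg_right hB (sq_nonneg ‖s‖)
    have h3 : 0 ≤ k * D * ‖s‖ ^ 2 := by positivity
    nlinarith
  have hq : k * r * (‖y‖ * ‖s‖) ≤ W := by
    rcases hq0.eq_or_lt with h0 | h0
    · rw [← h0, mul_zero]; exact hW0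
    have h1 := mul_le_mul_of_nonneg_right hA (sq_nonneg ‖y‖)
    have h2 := mul_le_mul_of_nonneg_right hB (sq_nonneg ‖s‖)
    have h3 := mul_le_mul_of_nonneg_right (mul_le_mul_of_nonneg_left hD hk.le) (sq_nonneg ‖s‖)
    have h4 : 0 ≤ k * r ^ 2 * A * ‖y‖ ^ 2 := by positivity
    have h5 : k * r * (‖y‖ * ‖s‖) * (‖y‖ * ‖s‖) ≤ W * (‖y‖ * ‖s‖) := by nlinarith
    exact le_of_mul_le_mul_right h5 h0
  have hfin : k ^ 2 * r * (A * ‖y‖ ^ 2 + B * ‖s‖ ^ 2) ≤ W ^ 2 := by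
    have h1 : k ^ 2 * r ^ 3 * (A * ‖y‖ ^ 2 + B * ‖s‖ ^ 2) ≤ W ^ 2 := by
      calc k ^ 2 * r ^ 3 * (A * ‖y‖ ^ 2 + B * ‖s‖ ^ 2)
          = k * r * (k * r ^ 2 * (A * ‖y‖ ^ 2 + B * ‖s‖ ^ 2)) := by ring
        _ ≤ k * r * (W * (‖y‖ * ‖s‖)) := by gcongr
        _ = W * (k * r * (‖y‖ * ‖s‖)) := by ring
        _ ≤ W * W := by gcongr
        _ = W ^ 2 := by ring
    refine le_trans ?_ h1
    have : r ≤ r ^ 3 := le_self_pow₀ hr1 (by norm_num)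
    gcongr
  have hexp : Real.exp (-z.re / 4) = √r⁻¹ := by
    rw [hr, ← Real.exp_neg, ← Real.exp_half]; congr 1; ring
  have hlast : ∀ a b : ℝ, 0 ≤ a → 0 ≤ b → k ^ 2 * r * (b * a ^ 2) ≤ W ^ 2 →
      a * √b ≤ W / k * Real.exp (-z.re / 4) := by
    intro a b ha hb hab
    rw [hexp, ← Real.sqrt_sq ha, ← Real.sqrt_mul (sq_nonneg a), ← Real.sqrt_sq (div_nonneg hW0 hk.le),
      ← Real.sqrt_mul (sq_nonneg _)]
    refine Real.sqrt_le_sqrt ?_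
    have : 0 < r := zero_lt_one.trans_le hr1
    rw [div_pow, ← div_eq_mul_inv, div_div, le_div_iff₀ (by positivity)]
    linarith
  refine ⟨hlast _ _ (norm_nonneg _) hA0 (le_trans ?_ hfin),
    hlast _ _ (norm_nonneg _) hB0 (le_trans ?_ hfin)⟩
  · gcongr; exact le_add_of_nonneg_right (by positivity)
  · gcongr; exact le_add_of_nonneg_left (by positivity)

end PowerPotential

namespace PowerPotential
open Complex Filter Topology ComplexConjugate

variable {α φ θ η : ℝ} {μ p q m w w₀ z : ℂ} {f : ℝ → ℂ}

lemma ae_zero_of_wronskian {c s c' s' : ℝ → ℂ} {W : ℂ} (hW0 : W ≠ 0)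
    (hc : ∀ x > 0, HasDerivAt c (c' x) x) (hs : ∀ x > 0, HasDerivAt s (s' x) x)
    (hW : ∀ x > 0, c x * s' x - c' x * s x = W)
    (hfc : ∀ x, IntegrableOn (fun ξ => f ξ * c ξ) (Ioc 0 x))
    (hfs : ∀ x, IntegrableOn (fun ξ => f ξ * s ξ) (Ioc 0 x))
    (h : ∀ x > 0, c x * (∫ ξ in Ioc 0 x, f ξ * s ξ) = s x * ∫ ξ in Ioc 0 x, f ξ * c ξ) :
    ∀ᵐ x, x ∈ Ioi (0 : ℝ) → f x = 0 := by
  suffices H : ∀ n : ℕ, ∀ᵐ x, x ∈ Ioo (0 : ℝ) n → f x = 0 by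
    filter_upwards [ae_all_iff.2 H] with x hx hx0
    obtain ⟨n, hn⟩ := exists_nat_gt x
    exact hx n ⟨hx0, hn⟩
  intro n
  have hn : (0 : ℝ) ≤ n := n.cast_nonneg
  have i1 : IntervalIntegrable (fun ξ => f ξ * c ξ) volume 0 n :=
    (intervalIntegrable_iff_integrableOn_Ioc_of_le hn).2 (hfc n)
  have i2 : IntervalIntegrable (fun ξ => f ξ * s ξ) volume 0 n :=
    (intervalIntegrable_iff_integrableOn_Ioc_of_le hn).2 (hfs n)
  set A : ℝ → ℂ := fun x => ∫ ξ in (0 : ℝ)..x, f ξ * s ξ with hA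
  set B : ℝ → ℂ := fun x => ∫ ξ in (0 : ℝ)..x, f ξ * c ξ with hB
  have hsub : Ioo (0 : ℝ) n ⊆ uIcc 0 n := by rw [uIcc_of_le hn]; exact Ioo_subset_Icc_self
  have hdA : ∀ᵐ x, x ∈ Ioo (0 : ℝ) n → HasDerivAt A (f x * s x) x := by
    filter_upwards [i2.ae_hasDerivAt_integral] with x hx hxn
    exact hx (hsub hxn) 0 left_mem_uIcc
  have hdB : ∀ᵐ x, x ∈ Ioo (0 : ℝ) n → HasDerivAt B (f x * c x) x := by
    filter_upwards [i1.ae_hasDerivAt_integral] with x hx hxn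
    exact hx (hsub hxn) 0 left_mem_uIcc
  have hAB : ∀ x > 0, c x * A x - s x * B x = 0 := fun x hx => by
    simp only [hA, hB, intervalIntegral.integral_of_le hx.le, h x hx, sub_self]
  have hAB0 : ∀ᵐ x, x ∈ Ioo (0 : ℝ) n → A x = 0 ∧ B x = 0 := by
    filter_upwards [hdA, hdB] with x h1 h2 hx
    have hd := ((hc x hx.1).mul (h1 hx)).sub ((hs x hx.1).mul (h2 hx))
    have hd0 : HasDerivAt (c * A - s * B) 0 x := by
      refine (hasDerivAt_const x (0 : ℂ)).congr_of_eventuallyEq ?_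
      filter_upwards [Ioi_mem_nhds hx.1] with t ht
      exact hAB t ht
    have h3 := hd.unique hd0
    have h4 := hAB x hx.1
    have h5 := hW x hx.1
    constructor
    · refine (mul_eq_zero.1 (?_ : W * A x = 0)).resolve_left hW0
      rw [← h5]; linear_combination s' x * h4 - s x * h3
    · refine (mul_eq_zero.1 (?_ : W * B x = 0)).resolve_left hW0
      rw [← h5]; linear_combination c' x * h4 - c x * h3
  have hcont : ∀ {g : ℝ → ℂ}, IntervalIntegrable g volume 0 n →
      ContinuousOn (fun x => ∫ ξ in (0 : ℝ)..x, g ξ) (Ioo 0 n) := fun {g} hg =>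
    (intervalIntegral.continuousOn_primitive_interval (a := 0) (b := n) (by
      rw [uIcc_of_le hn, integrableOn_Icc_iff_integrableOn_Ioc]
      exact (intervalIntegrable_iff_integrableOn_Ioc_of_le hn).1 hg)).mono hsub
  have hA0 : EqOn A (fun _ => 0) (Ioo 0 n) := Measure.eqOn_open_of_ae_eq (μ := volume)
    ((ae_restrict_iff' measurableSet_Ioo).2 (hAB0.mono fun x hx hxn => (hx hxn).1)) isOpen_Ioo
    (hcont i2) continuousOn_const
  have hB0 : EqOn B (fun _ => 0) (Ioo 0 n) := Measure.eqOn_open_of_ae_eq (μ := volume)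
    ((ae_restrict_iff' measurableSet_Ioo).2 (hAB0.mono fun x hx hxn => (hx hxn).2)) isOpen_Ioo
    (hcont i1) continuousOn_const
  filter_upwards [hdA, hdB] with x h1 h2 hx
  have e1 : f x * s x = 0 := (h1 hx).unique ((hasDerivAt_const x (0 : ℂ)).congr_of_eventuallyEq
    (hA0.eventuallyEq_of_mem (Ioo_mem_nhds hx.1 hx.2)))
  have e2 : f x * c x = 0 := (h2 hx).unique ((hasDerivAt_const x (0 : ℂ)).congr_of_eventuallyEq
    (hB0.eventuallyEq_of_mem (Ioo_mem_nhds hx.1 hx.2)))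
  refine (mul_eq_zero.1 (?_ : W * f x = 0)).resolve_left hW0
  rw [← hW x hx.1]; linear_combination s' x * e2 - c' x * e1

/-- The Volterra kernel of the initial value problem. -/
noncomputable def volt (α : ℝ) (μ w₀ : ℂ) (x ξ : ℝ) : ℂ :=
  ray (Y α μ 1 0) w₀ x * ray (Y α μ 0 1) w₀ ξ - ray (Y α μ 0 1) w₀ x * ray (Y α μ 1 0) w₀ ξ

lemma norm_volt_le (hα : 0 < α) {x ξ : ℝ} (hξ : ξ ∈ Ioc 0 x) :
    ‖volt α μ w₀ x ξ‖ ≤ 2 * serB α μ (Real.log x + w₀.re) ^ 2 := by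
  have hx := hξ.1.trans_le hξ.2
  have h1 : ∀ t ∈ Ioc 0 x, ‖ray (Y α μ 1 0) w₀ t‖ ≤ serB α μ (Real.log x + w₀.re) := fun t ht =>
    norm_ray_Y_le hα ht.1 ht.2 (by simp) (by simp)
  have h2 : ∀ t ∈ Ioc 0 x, ‖ray (Y α μ 0 1) w₀ t‖ ≤ serB α μ (Real.log x + w₀.re) := fun t ht =>
    norm_ray_Y_le hα ht.1 ht.2 (by simp) (by simp)
  have hb := (norm_nonneg _).trans (h1 ξ hξ)
  unfold volt
  refine (norm_sub_le _ _).trans ?_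
  rw [norm_mul, norm_mul, two_mul, sq]
  have hxx : x ∈ Ioc 0 x := ⟨hx, le_rfl⟩
  exact add_le_add (mul_le_mul (h1 x hxx) (h2 ξ hξ) (norm_nonneg _) hb)
    (mul_le_mul (h2 x hxx) (h1 ξ hξ) (norm_nonneg _) hb)

lemma serB_le_of_norm_le {X r : ℝ} (h : ‖μ‖ ≤ r) : serB α μ X ≤ (1 + Real.exp X) *
    Real.exp (√(Real.exp ((α + 2) * X) + Real.exp (2 * X)) * (1 + r) ^ (1 / 2 : ℝ)) := by
  refine serB_le.trans ?_
  gcongr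

lemma integrableOn_Ioc_of_sq (hf : AEStronglyMeasurable f (volume.restrict (Ioi 0)))
    (hf2 : IntegrableOn (fun x => ‖f x‖ ^ 2) (Ioi 0)) (x : ℝ) : IntegrableOn f (Ioc 0 x) := by
  have : Fact (volume (Ioc 0 x) < ⊤) := ⟨measure_Ioc_lt_top⟩
  have h1 := ((memLp_two_iff_integrable_sq_norm hf).2 hf2).mono_measure
    (Measure.restrict_mono (Ioc_subset_Ioi_self : Ioc (0 : ℝ) x ⊆ Ioi 0) le_rfl)
  exact h1.integrable (by norm_num)

lemma serB_nonneg (α : ℝ) (μ : ℂ) (X : ℝ) : 0 ≤ serB α μ X := by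
  unfold serB; positivity

lemma continuousOn_volt (hα : 0 < α) (x : ℝ) : ContinuousOn (volt α μ w₀ x) (Ioi 0) :=
  (continuousOn_const.mul (sol_ray hα μ 0 1 w₀).contY).sub
    (continuousOn_const.mul (sol_ray hα μ 1 0 w₀).contY)

lemma differentiable_volt (hα : 0 < α) (x ξ : ℝ) :
    Differentiable ℂ fun μ => volt α μ w₀ x ξ := by
  have h : ∀ (p q : ℂ) (t : ℝ), Differentiable ℂ fun μ => ray (Y α μ p q) w₀ t := fun p q t =>
    ((differentiable_G_param hα _).const_mul p).add ((differentiable_G_param hα _).const_mul q)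
  exact ((h _ _ _).mul (h _ _ _)).sub ((h _ _ _).mul (h _ _ _))

lemma differentiable_integral_volt (hα : 0 < α) (x : ℝ)
    (hf : IntegrableOn f (Ioc 0 x)) :
    Differentiable ℂ fun μ => ∫ ξ in Ioc 0 x, f ξ * volt α μ w₀ x ξ := by
  rw [← differentiableOn_univ]
  refine differentiableOn_integral_of_bounded isOpen_univ (fun μ _ => ?_)
    (ae_of_all _ fun ξ => ((differentiable_volt hα x ξ).const_mul _).differentiableOn) ?_
  · exact hf.aestronglyMeasurable.mul (((continuousOn_volt hα x).mono
      Ioc_subset_Ioi_self).aestronglyMeasurable measurableSet_Ioc)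
  · intro μ _
    set X := Real.log x + w₀.re
    refine ⟨1, one_pos, fun ξ => ‖f ξ‖ * (2 * ((1 + Real.exp X) *
      Real.exp (√(Real.exp ((α + 2) * X) + Real.exp (2 * X)) *
        (1 + (‖μ‖ + 1)) ^ (1 / 2 : ℝ))) ^ 2), hf.norm.mul_const _, ?_⟩
    refine (ae_restrict_mem measurableSet_Ioc).mono fun ξ hξ ν hν _ => ?_
    rw [norm_mul]
    refine mul_le_mul_of_nonneg_left ((norm_volt_le hα hξ).trans ?_) (norm_nonneg _)
    have h0 := serB_nonneg α ν X
    gcongr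
    refine serB_le_of_norm_le ?_
    have h1 := norm_sub_norm_le ν μ
    rw [Metric.mem_ball, dist_eq_norm] at hν
    linarith

lemma exists_order_integral_volt (hα : 0 < α) (x : ℝ) (w₀ : ℂ) (hf : IntegrableOn f (Ioc 0 x)) :
    ∃ C > 0, ∀ μ, ‖∫ ξ in Ioc 0 x, f ξ * volt α μ w₀ x ξ‖ ≤
      C * Real.exp (C * (1 + ‖μ‖) ^ (1 / 2 : ℝ)) := by
  set X := Real.log x + w₀.re
  set S := √(Real.exp ((α + 2) * X) + Real.exp (2 * X))
  have hN0 : 0 ≤ ∫ ξ in Ioc 0 x, ‖f ξ‖ := integral_nonneg fun _ => norm_nonneg _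
  set N := ∫ ξ in Ioc 0 x, ‖f ξ‖
  set C := (N + 1) * (2 * (1 + Real.exp X) ^ 2) + 2 * S with hC
  have hS0 : 0 ≤ S := Real.sqrt_nonneg _
  have hC0 : 0 < (N + 1) * (2 * (1 + Real.exp X) ^ 2) := by positivity
  refine ⟨C, by positivity, fun μ => ?_⟩
  have h1 : ‖∫ ξ in Ioc 0 x, f ξ * volt α μ w₀ x ξ‖ ≤ N * (2 * serB α μ X ^ 2) := by
    rw [← integral_mul_const]
    refine norm_integral_le_of_norm_le (hf.norm.mul_const _) ?_
    refine (ae_restrict_mem measurableSet_Ioc).mono fun ξ hξ => ?_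
    rw [norm_mul]
    exact mul_le_mul_of_nonneg_left (norm_volt_le hα hξ) (norm_nonneg _)
  refine h1.trans ?_
  have h0 := serB_nonneg α μ X
  calc N * (2 * serB α μ X ^ 2)
      ≤ N * (2 * ((1 + Real.exp X) * Real.exp (S * (1 + ‖μ‖) ^ (1 / 2 : ℝ))) ^ 2) := by
        gcongr; exact serB_le
    _ = (N * (2 * (1 + Real.exp X) ^ 2)) * Real.exp (2 * S * (1 + ‖μ‖) ^ (1 / 2 : ℝ)) := by
        rw [mul_pow, ← Real.exp_nat_mul]; push_cast
        rw [← mul_assoc (2 : ℝ) S]; ring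
    _ ≤ C * Real.exp (C * (1 + ‖μ‖) ^ (1 / 2 : ℝ)) := by
        gcongr
        · rw [hC]; nlinarith [sq_nonneg (1 + Real.exp X)]
        · rw [hC]; linarith

lemma volt_eq (m : ℂ) (x ξ : ℝ) : volt α μ w₀ x ξ =
    ray (Y α μ 1 m) w₀ x * ray (Y α μ 0 1) w₀ ξ - ray (Y α μ 0 1) w₀ x * ray (Y α μ 1 m) w₀ ξ := by
  unfold volt ray Y
  ring

lemma integrableOn_mul_ray_Ioc (hα : 0 < α) {x : ℝ} (hf : IntegrableOn f (Ioc 0 x))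
    (hp : ‖p‖ ≤ 1) (hq : ‖q‖ ≤ 1) :
    IntegrableOn (fun ξ => f ξ * ray (Y α μ p q) w₀ ξ) (Ioc 0 x) := by
  refine Integrable.mono' (hf.norm.mul_const (serB α μ (Real.log x + w₀.re)))
    (hf.aestronglyMeasurable.mul
      ((aestronglyMeasurable_ray_Y hα).mono_set Ioc_subset_Ioi_self)) ?_
  refine (ae_restrict_mem measurableSet_Ioc).mono fun ξ hξ => ?_
  rw [norm_mul]
  exact mul_le_mul_of_nonneg_left (norm_ray_Y_le hα hξ.1 hξ.2 hp hq) (norm_nonneg _)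

/-- The Volterra transform is small in the outer sector if the generating function vanishes. -/
lemma Outer.norm_integral_volt_le (h : Outer α θ η w₀)
    (hf : AEStronglyMeasurable f (volume.restrict (Ioi 0)))
    (hf2 : IntegrableOn (fun x => ‖f x‖ ^ 2) (Ioi 0)) (hd : DecRay α μ 1 m w₀)
    (hz : z ∈ outerSet θ η) (hμ : exp (2 * w₀) * μ = exp z) {x : ℝ} (hx : 0 < x)
    (h0 : ∫ ξ in Ioi 0, f ξ * ray (Y α μ 1 m) w₀ ξ = 0) :
    ‖∫ ξ in Ioc 0 x, f ξ * volt α μ w₀ x ξ‖ ≤ 2 * √(∫ x in Ioi 0, ‖f x‖ ^ 2) *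
      (‖exp w₀‖ / Real.sin (η / 2)) * Real.exp (-z.re / 4) := by
  have hα := h.pos
  have hg := h.green_le hd hz hμ hx
  have iy := integrableOn_mul_ray hα hf hf2 hd
  have is := integrableOn_mul_ray_Ioc (μ := μ) (w₀ := w₀) (p := 0) (q := 1) hα
    (integrableOn_Ioc_of_sq hf hf2 x) (by simp) (by simp)
  have hsplit : ∫ ξ in Ioc 0 x, f ξ * ray (Y α μ 1 m) w₀ ξ =
      -∫ ξ in Ioi x, f ξ * ray (Y α μ 1 m) w₀ ξ := by
    have h1 := setIntegral_union (μ := volume) (Ioc_disjoint_Ioi_same (a := (0 : ℝ)) (b := x))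
      measurableSet_Ioi (iy.mono_set Ioc_subset_Ioi_self) (iy.mono_set (Ioi_subset_Ioi hx.le))
    rw [Ioc_union_Ioi_eq_Ioi hx.le, h0] at h1
    exact eq_neg_of_add_eq_zero_left h1.symm
  have hE : ∫ ξ in Ioc 0 x, f ξ * volt α μ w₀ x ξ =
      ray (Y α μ 1 m) w₀ x * (∫ ξ in Ioc 0 x, f ξ * ray (Y α μ 0 1) w₀ ξ) +
      ray (Y α μ 0 1) w₀ x * ∫ ξ in Ioi x, f ξ * ray (Y α μ 1 m) w₀ ξ := by
    rw [← neg_neg (∫ ξ in Ioi x, f ξ * ray (Y α μ 1 m) w₀ ξ), ← hsplit, mul_neg, ← sub_eq_add_neg,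
      ← integral_const_mul, ← integral_const_mul, ← integral_sub (is.const_mul _)
        ((iy.mono_set Ioc_subset_Ioi_self).const_mul _)]
    refine setIntegral_congr_fun measurableSet_Ioc fun ξ _ => ?_
    simp only [volt_eq m]
    ring
  have hcs : ∀ {S : Set ℝ} {p q : ℂ}, S ⊆ Ioi 0 →
      IntegrableOn (fun ξ => ‖ray (Y α μ p q) w₀ ξ‖ ^ 2) S →
      ‖∫ ξ in S, f ξ * ray (Y α μ p q) w₀ ξ‖ ≤ √(∫ x in Ioi 0, ‖f x‖ ^ 2) *
        √(∫ ξ in S, ‖ray (Y α μ p q) w₀ ξ‖ ^ 2) := by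
    intro S p q hS hi
    refine (norm_integral_le_integral_norm _).trans ((norm_integral_mul_le (hf.mono_set hS)
      ((aestronglyMeasurable_ray_Y hα).mono_set hS) (hf2.mono_set hS) hi).trans ?_)
    refine mul_le_mul_of_nonneg_right (Real.sqrt_le_sqrt ?_) (Real.sqrt_nonneg _)
    exact setIntegral_mono_set hf2 (ae_of_all _ fun x => by positivity) (Eventually.of_forall hS)
  have c1 := hcs (p := 0) (q := 1) Ioc_subset_Ioi_self
    (integrableOn_sq_ray_Ioc hα x (by simp) (by simp))
  have c2 := hcs (Ioi_subset_Ioi hx.le) ((hd.sq_integrable hα).mono_set (Ioi_subset_Ioi hx.le))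
  rw [hE]
  refine (norm_add_le _ _).trans ?_
  rw [norm_mul, norm_mul]
  have hN := Real.sqrt_nonneg (∫ x in Ioi 0, ‖f x‖ ^ 2)
  have d1 := mul_le_mul_of_nonneg_left c1 (norm_nonneg (ray (Y α μ 1 m) w₀ x))
  have d2 := mul_le_mul_of_nonneg_left c2 (norm_nonneg (ray (Y α μ 0 1) w₀ x))
  have g1 := mul_le_mul_of_nonneg_left hg.1 hN
  have g2 := mul_le_mul_of_nonneg_left hg.2 hN
  linarith

/-- If the generating function of `f` vanishes in the outer sector, then `f` vanishes. -/
theorem Outer.ae_zero (ha : Adm α φ) (hw₀ : |w₀.im| < φ) (h : Outer α θ η w₀)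
    (hη : η < Real.pi) (hf : AEStronglyMeasurable f (volume.restrict (Ioi 0)))
    (hf2 : IntegrableOn (fun x => ‖f x‖ ^ 2) (Ioi 0))
    (h0 : ∀ μ m, DecRay α μ 1 m w₀ → ∫ ξ in Ioi 0, f ξ * ray (Y α μ 1 m) w₀ ξ = 0) :
    ∀ᵐ x, x ∈ Ioi (0 : ℝ) → f x = 0 := by
  have hα := h.pos
  have hInt := integrableOn_Ioc_of_sq hf hf2
  have hE : ∀ x > 0, ∀ μ, ∫ ξ in Ioc 0 x, f ξ * volt α μ w₀ x ξ = 0 := by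
    intro x hx μ
    obtain ⟨C, hC, hord⟩ := exists_order_integral_volt hα x w₀ (hInt x)
    obtain ⟨C', hC', hord'⟩ := exists_order_scale (by norm_num) hC hord (exp (-(2 * w₀)))
    have hpi := Real.pi_pos
    have hinv : ∀ z, exp (2 * w₀) * (exp (-(2 * w₀)) * z) = z := fun z => by
      rw [← mul_assoc, ← Complex.exp_add, add_neg_cancel, Complex.exp_zero, one_mul]
    have hout : ∀ z ∈ outerSet θ η,
        ‖∫ ξ in Ioc 0 x, f ξ * volt α (exp (-(2 * w₀)) * exp z) w₀ x ξ‖ ≤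
        2 * √(∫ x in Ioi 0, ‖f x‖ ^ 2) *
      (‖exp w₀‖ / Real.sin (η / 2)) * Real.exp (-z.re / 4) := by
      intro z hz
      obtain ⟨m, hm⟩ := ha.exists_decRay_outer hw₀ h hz (hinv (exp z))
      exact h.norm_integral_volt_le hf hf2 hm hz (hinv (exp z)) hx (h0 _ _ hm)
    have key := eq_zero_of_sectors (Φ := fun z => ∫ ξ in Ioc 0 x,
        f ξ * volt α (exp (-(2 * w₀)) * z) w₀ x ξ) (θ := θ) (η := η) (t := -η)
      (B := 2 * √(∫ x in Ioi 0, ‖f x‖ ^ 2) * (‖exp w₀‖ / Real.sin (η / 2)))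
      ((differentiable_integral_volt hα x (hInt x)).comp (differentiable_id.const_mul _))
      (o := 1 / 2) (by norm_num) hC' hord' (by linarith [h.eta_pos, h.le_pi, h.nonneg])
      (fun z h1 h2 h3 => hout z ⟨h1, h2, h3⟩) (by linarith)
      (by linarith [h.eta_pos, h.le_pi, h.nonneg]) ?_ (exp (2 * w₀) * μ)
    · simp only [← mul_assoc, ← Complex.exp_add, neg_add_cancel, Complex.exp_zero, one_mul] at key
      simpa only [one_mul] using key
    · intro z hz1 hz2
      have h1 := hout (z + 2 * Real.pi * I) ⟨by simpa using hz1, by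
        simp [hz2]; linarith [h.eta_pos, h.le_pi, h.nonneg], by simp [hz2]⟩
      rw [Complex.exp_periodic] at h1
      refine h1.trans (mul_le_of_le_one_right ?_ ?_)
      · have := h.sin_pos; positivity
      · rw [Real.exp_le_one_iff]
        simp; linarith
  refine ae_zero_of_wronskian (c := ray (Y α 0 1 0) w₀) (s := ray (Y α 0 0 1) w₀)
    (Complex.exp_ne_zero w₀) (sol_ray hα 0 1 0 w₀).d1 (sol_ray hα 0 0 1 w₀).d1
    (fun x hx => by simpa using wronskian_ray hα 0 1 0 0 1 w₀ hx)
    (fun x => integrableOn_mul_ray_Ioc hα (hInt x) (by simp) (by simp))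
    (fun x => integrableOn_mul_ray_Ioc hα (hInt x) (by simp) (by simp)) fun x hx => ?_
  have h1 := hE x hx 0
  rw [← sub_eq_zero, ← integral_const_mul, ← integral_const_mul, ← integral_sub]
  · refine Eq.trans ?_ h1
    refine setIntegral_congr_fun measurableSet_Ioc fun ξ _ => ?_
    simp only [volt]; ring
  · exact (integrableOn_mul_ray_Ioc hα (hInt x) (by simp) (by simp)).const_mul _
  · exact (integrableOn_mul_ray_Ioc hα (hInt x) (by simp) (by simp)).const_mul _

end PowerPotential

namespace PowerPotential
open Complex Filter Topology ComplexConjugate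

variable {α φ θ η : ℝ} {μ p q m w w₀ z : ℂ} {f : ℝ → ℂ}

/-- Completeness criterion: it suffices to bound the decaying solutions, normalised at the origin,
along a single ray of spectral parameters. -/
theorem Outer.ae_zero_of_ray_bound (ha : Adm α φ) (hw₀ : |w₀.im| < φ) (h : Outer α θ η w₀)
    (hη : η < Real.pi) (hf : AEStronglyMeasurable f (volume.restrict (Ioi 0)))
    (hf2 : IntegrableOn (fun x => ‖f x‖ ^ 2) (Ioi 0))
    (horth : ∀ μ q, DecRay α μ 0 q w₀ → ∫ x in Ioi 0, f x * ray (Y α μ 0 q) w₀ x = 0)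
    {t X B : ℝ} (ho1 : (t + η) * ord α < Real.pi) (ho2 : (θ + η - t) * ord α < Real.pi)
    (ht : ∀ z : ℂ, X ≤ z.re → z.im = t → ∃ m, DecRay α (exp (-(2 * w₀)) * exp z) 1 m w₀ ∧
      ∫ x in Ioi 0, ‖ray (Y α (exp (-(2 * w₀)) * exp z) 1 m) w₀ x‖ ^ 2 ≤ B) :
    ∀ᵐ x, x ∈ Ioi (0 : ℝ) → f x = 0 := by
  have hα := h.pos
  have ho : 0 < ord α := by unfold ord; positivity
  obtain ⟨F, hF, ⟨C, hC, hord⟩, hFeq⟩ := ha.exists_generating hw₀ hf hf2 horth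
  obtain ⟨C', hC', hord'⟩ := exists_order_scale ho hC hord (exp (-(2 * w₀)))
  have hinv : ∀ z, exp (2 * w₀) * (exp (-(2 * w₀)) * z) = z := fun z => by
    rw [← mul_assoc, ← Complex.exp_add, add_neg_cancel, Complex.exp_zero, one_mul]
  obtain ⟨B', hB'⟩ := (isCompact_Icc (a := (0 : ℝ)) (b := X)).exists_bound_of_continuousOn
    (f := fun r : ℝ => F (exp (-(2 * w₀)) * exp (r + t * I)))
    (hF.continuous.comp (by fun_prop)).continuousOn
  have key : ∀ z, F (exp (-(2 * w₀)) * z) = 0 := by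
    refine eq_zero_of_sectors (θ := θ) (η := η) (t := t)
      (C' := √(∫ x in Ioi 0, ‖f x‖ ^ 2) * √(outC α η w₀ / Real.sin (η / 2)))
      (B := max (√(∫ x in Ioi 0, ‖f x‖ ^ 2) * √B) B')
      (hF.comp (differentiable_id.const_mul _)) ho hC' hord'
      (by linarith [h.eta_pos, h.le_pi, h.nonneg]) (fun z h1 h2 h3 => ?_) ho1 ho2
      fun z h1 h2 => ?_
    · obtain ⟨m, hm⟩ := ha.exists_decRay_outer hw₀ h ⟨h1, h2, h3⟩ (hinv (exp z))
      rw [hFeq _ _ hm]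
      exact h.norm_integral_le hf hf2 hm ⟨h1, h2, h3⟩ (hinv _)
    · rcases le_total z.re X with h3 | h3
      · refine le_max_of_le_right ?_
        have := hB' z.re ⟨h1, h3⟩
        rwa [← h2, re_add_im] at this
      obtain ⟨m, hm, hB⟩ := ht z h3 h2
      rw [hFeq _ _ hm]
      refine le_max_of_le_left ?_
      refine (norm_integral_mul_ray_le hα hf hf2 hm Subset.rfl).trans ?_
      gcongr
  refine h.ae_zero ha hw₀ hη hf hf2 fun μ m hm => ?_
  rw [← hFeq _ _ hm]
  have := key (exp (2 * w₀) * μ)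
  rwa [← mul_assoc, ← Complex.exp_add, neg_add_cancel, Complex.exp_zero, one_mul] at this

/-- Completeness below the order threshold. -/
theorem Outer.ae_zero_of_lt (ha : Adm α φ) (hw₀ : |w₀.im| < φ) (h : Outer α θ η w₀)
    (hη : η < Real.pi) (hf : AEStronglyMeasurable f (volume.restrict (Ioi 0)))
    (hf2 : IntegrableOn (fun x => ‖f x‖ ^ 2) (Ioi 0))
    (horth : ∀ μ q, DecRay α μ 0 q w₀ → ∫ x in Ioi 0, f x * ray (Y α μ 0 q) w₀ x = 0)
    (ho : (θ + 2 * η) * ord α < Real.pi) : ∀ᵐ x, x ∈ Ioi (0 : ℝ) → f x = 0 := by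
  have hpi := Real.pi_pos
  refine h.ae_zero_of_ray_bound ha hw₀ hη hf hf2 horth (t := -η) (X := 0)
    (B := outC α η w₀ / Real.sin (η / 2)) (by simpa using hpi)
    (by rwa [show θ + η - -η = θ + 2 * η by ring]) fun z h1 h2 => ?_
  have hz : z + 2 * Real.pi * I ∈ outerSet θ η := ⟨by simpa using h1, by
    simp [h2]; linarith [h.eta_pos, h.le_pi, h.nonneg], by simp [h2]⟩
  have hinv : exp (2 * w₀) * (exp (-(2 * w₀)) * exp z) = exp (z + 2 * Real.pi * I) := by
    rw [← mul_assoc, ← Complex.exp_add, add_neg_cancel, Complex.exp_zero, one_mul,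
      Complex.exp_periodic]
  obtain ⟨m, hm⟩ := ha.exists_decRay_outer hw₀ h hz hinv
  refine ⟨m, hm, ?_⟩
  have h3 := (hm.outer h hz hinv).2
  rw [norm_one, one_pow, mul_one] at h3
  refine h3.trans (mul_le_of_le_one_right (div_nonneg h.outC_pos.le h.sin_pos.le) ?_)
  rw [Real.exp_le_one_iff]
  simp; linarith

end PowerPotential

namespace PowerPotential
open Complex Filter Topology ComplexConjugate

variable {α τ ℓ k K : ℝ} {m v e : ℂ} {Q y y' : ℝ → ℂ}

/-- Finite energy solutions of a coercive equation have controlled logarithmic derivative. -/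
lemma Decays.norm_deriv_le (h : Sol Q y y') (hd : Decays Q y y') {a M : ℝ} (ha : 0 < a)
    (hM : 0 < M) (hK : 0 ≤ K) (hk : 0 < k) (he : ‖e‖ ≤ 1) (hke : k ≤ e.re)
    (hN : ∀ x > a, k * M ≤ (e * Q x).re) (hQ : ∀ x ∈ Icc a (a + 1 / √M), ‖Q x‖ ≤ K * M) :
    ‖y' a‖ ≤ 2 * (1 + K ^ 2) / k * √M * ‖y a‖ := by
  have hle : a ≤ a + 1 / √M := by
    have : 0 < 1 / √M := by positivity
    linarith
  have hsub : ∀ g : ℝ → ℂ, IntegrableOn (fun x => ‖g x‖ ^ 2) (Ioi a) →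
      ∫ x in a..a + 1 / √M, ‖g x‖ ^ 2 ≤ ∫ x in Ioi a, ‖g x‖ ^ 2 := by
    intro g hg
    rw [intervalIntegral.integral_of_le hle]
    exact setIntegral_mono_set hg (ae_of_all _ fun x => by positivity)
      (ae_of_all _ fun x (hx : x ∈ Ioc _ _) => hx.1)
  have i1 : 0 ≤ ∫ x in Ioi a, ‖y' x‖ ^ 2 := integral_nonneg fun x => by positivity
  have i2 : 0 ≤ ∫ x in Ioi a, ‖y x‖ ^ 2 := integral_nonneg fun x => by positivity
  have j1 := hsub y' (hd a ha).1
  have j2 := hsub y (Decays.sq_integrable h hd ha)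
  have hen := Decays.energy_le h hd ha he hke hN
  have hkM : 0 < k * M := by positivity
  refine h.norm_deriv_le ha hM hK hk hQ ?_ ?_ <;> nlinarith

/-- The large parameter attached to the scale `ℓ`. -/
noncomputable def lrg (α ℓ : ℝ) : ℝ := Real.exp ((α + 2) * ℓ / 2)

/-- The spectral parameter of argument `τ` at the scale `ℓ`. -/
noncomputable def spec (α τ ℓ : ℝ) : ℂ := exp (α * ℓ + τ * I)

/-- The rescaled potential, in the logarithmic variable. -/
noncomputable def symb (α τ : ℝ) (v : ℂ) : ℂ := exp ((α + 2) * v) - exp (2 * v + τ * I)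

/-- The rescaled logarithmic derivative. -/
noncomputable def ratio (α τ ℓ : ℝ) (m v : ℂ) : ℂ :=
  Yd α (spec α τ ℓ) 1 m (v + ℓ) / (lrg α ℓ * Y α (spec α τ ℓ) 1 m (v + ℓ))

lemma lrg_pos : 0 < lrg α ℓ := Real.exp_pos _

lemma one_le_lrg (hα : 0 < α) (hℓ : 0 ≤ ℓ) : 1 ≤ lrg α ℓ := Real.one_le_exp (by positivity)

lemma lrg_sq : ((lrg α ℓ : ℝ) : ℂ) ^ 2 = exp ((α + 2) * ℓ) := by
  unfold lrg
  rw [ofReal_exp, ← Complex.exp_nat_mul]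
  congr 1
  push_cast; ring

lemma rayPot_spec (x : ℝ) : rayPot α (spec α τ ℓ) (v + ℓ) x = ((lrg α ℓ ^ 2 : ℝ) : ℂ) *
    (exp ((α + 2) * v) * ((x ^ α : ℝ) : ℂ) - exp (2 * v + τ * I)) := by
  unfold rayPot pot spec
  rw [ofReal_pow, lrg_sq, ← Complex.exp_add, mul_sub, ← mul_assoc, ← Complex.exp_add,
    ← Complex.exp_add]
  ring_nf

lemma symb_spec : exp (2 * (v + ℓ)) * (exp (α * (v + ℓ)) - spec α τ ℓ) =
    ((lrg α ℓ : ℝ) : ℂ) ^ 2 * symb α τ v := by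
  unfold symb spec
  rw [lrg_sq, mul_sub, mul_sub, ← Complex.exp_add, ← Complex.exp_add, ← Complex.exp_add,
    ← Complex.exp_add]
  ring_nf

/-- The rotated equation on the ray through `exp v` is coercive beyond `exp v`. -/
structure Coer (α τ : ℝ) (v e : ℂ) (k : ℝ) : Prop where
  norm_le : ‖e‖ ≤ 1
  le_re : k ≤ e.re
  lead : 0 ≤ (e * exp ((α + 2) * v)).re
  le_symb : k ≤ (e * symb α τ v).re

lemma Coer.le_rayPot (hα : 0 < α) (h : Coer α τ v e k) {x : ℝ} (hx : 1 ≤ x) :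
    k * lrg α ℓ ^ 2 ≤ (e * rayPot α (spec α τ ℓ) (v + ℓ) x).re := by
  have h1 : e * rayPot α (spec α τ ℓ) (v + ℓ) x = ((lrg α ℓ ^ 2 : ℝ) : ℂ) *
      (e * symb α τ v + ((x ^ α - 1 : ℝ) : ℂ) * (e * exp ((α + 2) * v))) := by
    rw [rayPot_spec, symb]; push_cast; ring
  rw [h1, re_ofReal_mul, add_re, re_ofReal_mul]
  have := h.le_symb
  have := mul_nonneg (sub_nonneg.2 (Real.one_le_rpow hx hα.le)) h.lead
  have := sq_nonneg (lrg α ℓ)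
  nlinarith

lemma Coer.ratio_bounds (hα : 0 < α) (hα2 : α < 2) (h : Coer α τ v e k) (hk : 0 < k) (hℓ : 0 ≤ ℓ)
    (hK : 4 * ‖exp ((α + 2) * v)‖ + ‖exp (2 * v)‖ ≤ K)
    (hd : DecRay α (spec α τ ℓ) 1 m (v + ℓ)) :
    Y α (spec α τ ℓ) 1 m (v + ℓ) ≠ 0 ∧ ‖ratio α τ ℓ m v‖ ≤ 2 * (1 + K ^ 2) / k ∧
      k ≤ -(e * ratio α τ ℓ m v).re := by
  have hs := sol_ray hα (spec α τ ℓ) 1 m (v + ℓ)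
  have hL := one_le_lrg hα hℓ
  have hL0 : 0 < lrg α ℓ := lrg_pos
  have hK0 : 0 ≤ K := le_trans (by positivity) hK
  have hsq : √(lrg α ℓ ^ 2) = lrg α ℓ := Real.sqrt_sq hL0.le
  have h1 := Decays.norm_deriv_le hs hd one_pos (M := lrg α ℓ ^ 2) (K := K) (k := k) (by positivity)
    hK0 hk h.norm_le h.le_re (fun x hx => h.le_rayPot hα (le_of_lt hx)) ?_
  · have h2 := Decays.re_energy_ge hs hd one_pos h.le_re
      (fun x hx => h.le_rayPot hα (ℓ := ℓ) (le_of_lt hx))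
    have h3 := Decays.norm_sq_le hs hd one_pos hL0
    rw [hsq] at h1
    rw [ray_one, rayd_one] at h1 h2
    rw [ray_one] at h3
    have hne : Y α (spec α τ ℓ) 1 m (v + ℓ) ≠ 0 := by
      intro h0
      rw [h0, norm_zero, mul_zero] at h1
      have h4 := wronskian_Y hα (spec α τ ℓ) 1 m 0 1 (v + ℓ)
      rw [h0, norm_le_zero_iff.1 h1] at h4
      simp only [zero_mul, sub_zero, mul_one, mul_zero, one_mul] at h4
      exact Complex.exp_ne_zero _ h4.symm
    refine ⟨hne, ?_, ?_⟩
    · have hn : 0 < ‖Y α (spec α τ ℓ) 1 m (v + ℓ)‖ := norm_pos_iff.2 hne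
      unfold ratio
      rw [norm_div, norm_mul, Complex.norm_real, Real.norm_of_nonneg hL0.le,
        div_le_iff₀ (by positivity), ← mul_assoc]
      exact h1
    · set yy := Y α (spec α τ ℓ) 1 m (v + ℓ)
      have hn : 0 < ‖yy‖ := norm_pos_iff.2 hne
      have e1 : e * (Yd α (spec α τ ℓ) 1 m (v + ℓ) * conj yy) =
          ((lrg α ℓ * ‖yy‖ ^ 2 : ℝ) : ℂ) * (e * ratio α τ ℓ m v) := by
        unfold ratio
        push_cast
        rw [← Complex.mul_conj']
        have : (lrg α ℓ : ℂ) ≠ 0 := by exact_mod_cast hL0.ne'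
        change _ = (_ * (yy * _)) * (e * (_ / (_ * yy)))
        field_simp
      rw [e1, re_ofReal_mul] at h2
      have h4 : k * (lrg α ℓ * ‖yy‖ ^ 2) ≤
          (lrg α ℓ * ‖yy‖ ^ 2) * -(e * ratio α τ ℓ m v).re := by nlinarith
      rw [mul_comm k] at h4
      exact le_of_mul_le_mul_left h4 (by positivity)
  · intro x hx
    rw [hsq] at hx
    have hx0 : 0 < x := lt_of_lt_of_le one_pos hx.1
    have hx2 : x ≤ 2 := by
      have : 1 / lrg α ℓ ≤ 1 := by rw [div_le_one hL0]; exact hL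
      linarith [hx.2]
    have h4 : x ^ α ≤ 4 := by
      calc x ^ α ≤ 2 ^ α := Real.rpow_le_rpow hx0.le hx2 hα.le
        _ ≤ 2 ^ (2 : ℝ) := Real.rpow_le_rpow_of_exponent_le (by norm_num) hα2.le
        _ = 4 := by norm_num
    rw [rayPot_spec, norm_mul, Complex.norm_real, Real.norm_of_nonneg (by positivity), mul_comm]
    refine mul_le_mul_of_nonneg_right (le_trans ?_ hK) (by positivity)
    refine (norm_sub_le _ _).trans ?_
    rw [norm_mul, Complex.norm_real, Real.norm_of_nonneg (by positivity), Complex.exp_add (2 * v),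
      norm_mul, Complex.norm_exp_ofReal_mul_I, mul_one]
    nlinarith [norm_nonneg (exp ((α + 2) * v))]

end PowerPotential

namespace PowerPotential
open Complex Filter Topology ComplexConjugate

variable {α τ φ ℓ k K : ℝ} {m v e T U q : ℂ}

/-- Points at which some rotation makes the equation coercive. -/
def coerSet (α τ φ : ℝ) : Set ℂ := {v | |v.im| < φ ∧ ∃ e : ℂ, 0 < e.re ∧
  0 < (e * exp ((α + 2) * v)).re ∧ 0 < (e * symb α τ v).re}

lemma continuous_symb : Continuous (symb α τ) := by unfold symb; fun_prop

lemma isOpen_coerSet : IsOpen (coerSet α τ φ) := by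
  have : coerSet α τ φ = {v | |v.im| < φ} ∩ ⋃ e ∈ {e : ℂ | 0 < e.re},
      ({v | 0 < (e * exp ((α + 2) * v)).re} ∩ {v | 0 < (e * symb α τ v).re}) := by
    ext v
    simp only [coerSet, mem_ofPred_eq, mem_inter_iff, mem_iUnion, exists_prop]
  rw [this]
  have h := continuous_symb (α := α) (τ := τ)
  refine (isOpen_lt (by fun_prop) continuous_const).inter (isOpen_biUnion fun e _ => ?_)
  exact (isOpen_lt continuous_const (by fun_prop)).inter (isOpen_lt continuous_const (by fun_prop))

lemma exists_uniform_coer {s : Set ℂ} (hs : IsCompact s) (hsub : s ⊆ coerSet α τ φ) :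
    ∃ k > 0, ∀ v ∈ s, ∃ e, Coer α τ v e k := by
  have hcs := continuous_symb (α := α) (τ := τ)
  refine hs.induction_on (p := fun s => ∃ k > 0, ∀ v ∈ s, ∃ e, Coer α τ v e k)
    ⟨1, one_pos, by simp⟩ (fun s t hst ⟨k, hk, h⟩ => ⟨k, hk, fun v hv => h v (hst hv)⟩)
    (fun s t ⟨k, hk, h⟩ ⟨k', hk', h'⟩ => ⟨min k k', lt_min hk hk', ?_⟩) fun v hv => ?_
  · rintro v (hv | hv)
    · obtain ⟨e, he⟩ := h v hv
      exact ⟨e, he.norm_le, (min_le_left _ _).trans he.le_re, he.lead,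
        (min_le_left _ _).trans he.le_symb⟩
    · obtain ⟨e, he⟩ := h' v hv
      exact ⟨e, he.norm_le, (min_le_right _ _).trans he.le_re, he.lead,
        (min_le_right _ _).trans he.le_symb⟩
  · obtain ⟨-, e, h1, h2, h3⟩ := hsub hv
    have hn : 0 < ‖e‖ := h1.trans_le ((le_abs_self _).trans (abs_re_le_norm e))
    have hre : ∀ z : ℂ, ((((‖e‖⁻¹ : ℝ) : ℂ) * e) * z).re = ‖e‖⁻¹ * (e * z).re := fun z => by
      rw [mul_assoc, re_ofReal_mul]
    have hc : ContinuousAt (fun u => (e * symb α τ u).re) v := by fun_prop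
    have hc2 : ContinuousAt (fun u => (e * exp ((α + 2) * u)).re) v := by fun_prop
    refine ⟨{u | (e * symb α τ v).re / 2 < (e * symb α τ u).re ∧
      0 < (e * exp ((α + 2) * u)).re}, mem_nhdsWithin_of_mem_nhds
        ((hc.eventually_const_lt (half_lt_self h3)).and (hc2.eventually_const_lt h2)),
      min (‖e‖⁻¹ * e.re) (‖e‖⁻¹ * ((e * symb α τ v).re / 2)), ?_, fun u hu =>
        ⟨((‖e‖⁻¹ : ℝ) : ℂ) * e, ?_, ?_, ?_, ?_⟩⟩
    · exact lt_min (by positivity) (by positivity)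
    · rw [norm_mul, Complex.norm_real, norm_inv, norm_norm, inv_mul_cancel₀ hn.ne']
    · rw [re_ofReal_mul]; exact min_le_left _ _
    · rw [hre]; have := hu.2; positivity
    · rw [hre]
      exact (min_le_right _ _).trans (mul_le_mul_of_nonneg_left hu.1.le (by positivity))

/-- Selecting the branch of the square root by coercivity. -/
lemma norm_add_le_of_branch (hk : 0 < k) (hT : T ^ 2 = q) (hre : 0 ≤ T.re) (he : ‖e‖ ≤ 1)
    (hke : k ≤ e.re) (hq : k ≤ (e * q).re) (hU : k ≤ -(e * U).re) :
    k * ‖U + T‖ ≤ ‖U ^ 2 - q‖ := by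
  have h1 : 0 ≤ (e * T).re := by
    by_contra! h
    rw [← hT, pow_two] at hq
    simp only [mul_re, mul_im] at h hq
    have ha : 0 < e.re := by linarith
    nlinarith [mul_nonneg hre hre, sq_nonneg T.im, mul_nonneg ha.le (sq_nonneg T.im),
      mul_nonneg ha.le (sq_nonneg T.re),
      mul_nonneg hre (show 0 ≤ e.im * T.im - e.re * T.re by linarith)]
  have h2 : k ≤ ‖T - U‖ := by
    calc k ≤ (e * (T - U)).re := by rw [mul_sub, sub_re]; linarith
      _ ≤ ‖e * (T - U)‖ := re_le_norm _
      _ ≤ ‖T - U‖ := by rw [norm_mul]; exact mul_le_of_le_one_left (norm_nonneg _) he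
  calc k * ‖U + T‖ ≤ ‖T - U‖ * ‖U + T‖ := by gcongr
    _ = ‖U ^ 2 - q‖ := by rw [← norm_mul, ← norm_neg, ← hT]; congr 1; ring

lemma hasDerivAt_ratio (hα : 0 < α) (h : Y α (spec α τ ℓ) 1 m (v + ℓ) ≠ 0) :
    HasDerivAt (ratio α τ ℓ m) (ratio α τ ℓ m v +
      lrg α ℓ * (symb α τ v - ratio α τ ℓ m v ^ 2)) v := by
  have hL : (lrg α ℓ : ℂ) ≠ 0 := by exact_mod_cast (lrg_pos (α := α) (ℓ := ℓ)).ne'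
  have h1 := (hasDerivAt_Yd hα (spec α τ ℓ) 1 m (v + ℓ)).comp_add_const v (ℓ : ℂ)
  have h2 := ((hasDerivAt_Y hα (spec α τ ℓ) 1 m (v + ℓ)).comp_add_const v (ℓ : ℂ)).const_mul
    (lrg α ℓ : ℂ)
  refine (h1.div h2 (mul_ne_zero hL h)).congr_deriv ?_
  rw [symb_spec]
  unfold ratio
  field_simp
  ring

/-- Uniform semiclassical approximation of decaying solutions on compact coercive sets. -/
theorem exists_wkb (hα : 0 < α) (hα2 : α < 2) {s : Set ℂ} (hs : IsCompact s)
    (hsub : s ⊆ coerSet α τ φ) : ∃ C > 0, ∀ ℓ ≥ 0, ∀ m,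
    (∀ w₀ : ℂ, |w₀.im| < φ → DecRay α (spec α τ ℓ) 1 m w₀) → ∀ v ∈ s,
      ‖Yd α (spec α τ ℓ) 1 m (v + ℓ)‖ ≤ C * lrg α ℓ * ‖Y α (spec α τ ℓ) 1 m (v + ℓ)‖ ∧
      ∀ T : ℂ, T ^ 2 = symb α τ v → 0 ≤ T.re →
      ‖Yd α (spec α τ ℓ) 1 m (v + ℓ) + lrg α ℓ * T * Y α (spec α τ ℓ) 1 m (v + ℓ)‖ ≤
        C * ‖Y α (spec α τ ℓ) 1 m (v + ℓ)‖ := by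
  obtain ⟨δ, hδ, hδs⟩ := hs.exists_cthickening_subset_open isOpen_coerSet hsub
  have hcomp : IsCompact (Metric.cthickening δ s) := hs.cthickening
  obtain ⟨k, hk, hcoer⟩ := exists_uniform_coer hcomp hδs
  obtain ⟨K, hK⟩ := hcomp.exists_bound_of_continuousOn
    (f := fun v : ℂ => 4 * ‖exp ((α + 2) * v)‖ + ‖exp (2 * v)‖) (by fun_prop)
  set B := 2 * (1 + K ^ 2) / k with hB
  have hB0 : 0 < B := by positivity
  refine ⟨B + (B / δ + B) / k, by positivity, fun ℓ hℓ m hd v hv => ?_⟩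
  have hL0 := lrg_pos (α := α) (ℓ := ℓ)
  have hmain : ∀ u ∈ Metric.cthickening δ s, ∃ e, Coer α τ u e k ∧
      Y α (spec α τ ℓ) 1 m (u + ℓ) ≠ 0 ∧ ‖ratio α τ ℓ m u‖ ≤ B ∧
      k ≤ -(e * ratio α τ ℓ m u).re := by
    intro u hu
    obtain ⟨e, he⟩ := hcoer u hu
    have := hK u hu
    rw [Real.norm_of_nonneg (by positivity)] at this
    exact ⟨e, he, he.ratio_bounds hα hα2 hk hℓ this (hd _ (by simpa using (hδs hu).1))⟩
  have hball : Metric.closedBall v δ ⊆ Metric.cthickening δ s :=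
    Metric.closedBall_subset_cthickening hv δ
  obtain ⟨e, he, hne, hb, hkU⟩ := hmain v (Metric.self_subset_cthickening s hv)
  have hdiff : DifferentiableOn ℂ (ratio α τ ℓ m) (Metric.closedBall v δ) := fun u hu => by
    obtain ⟨_, _, hne, _⟩ := hmain u (hball hu)
    exact (hasDerivAt_ratio hα hne).differentiableAt.differentiableWithinAt
  have hcauchy := Complex.norm_deriv_le_of_forall_mem_sphere_norm_le hδ
    (hdiff.diffContOnCl_ball Subset.rfl) fun u hu => by
      obtain ⟨_, _, _, hb, _⟩ := hmain u (hball (Metric.sphere_subset_closedBall hu))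
      exact hb
  rw [(hasDerivAt_ratio hα hne).deriv] at hcauchy
  have hsq : lrg α ℓ * ‖ratio α τ ℓ m v ^ 2 - symb α τ v‖ ≤ B / δ + B := by
    calc lrg α ℓ * ‖ratio α τ ℓ m v ^ 2 - symb α τ v‖
        = ‖(lrg α ℓ : ℂ) * (symb α τ v - ratio α τ ℓ m v ^ 2)‖ := by
          rw [norm_mul, Complex.norm_real, Real.norm_of_nonneg hL0.le, norm_sub_rev]
      _ = ‖ratio α τ ℓ m v + lrg α ℓ * (symb α τ v - ratio α τ ℓ m v ^ 2) -
          ratio α τ ℓ m v‖ := by congr 1; ring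
      _ ≤ B / δ + B := (norm_sub_le _ _).trans (add_le_add hcauchy hb)
  have hYd : Yd α (spec α τ ℓ) 1 m (v + ℓ) =
      lrg α ℓ * ratio α τ ℓ m v * Y α (spec α τ ℓ) 1 m (v + ℓ) := by
    have hL : (lrg α ℓ : ℂ) ≠ 0 := by exact_mod_cast hL0.ne'
    unfold ratio
    field_simp
  have hBk : 0 ≤ (B / δ + B) / k := by positivity
  rw [hYd]
  refine ⟨?_, fun T hT hre => ?_⟩
  · rw [norm_mul, norm_mul, Complex.norm_real, Real.norm_of_nonneg hL0.le, mul_comm (lrg α ℓ)]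
    gcongr
    linarith
  · have h1 := norm_add_le_of_branch hk hT hre he.norm_le he.le_re he.le_symb hkU
    rw [← add_mul, ← mul_add, norm_mul, norm_mul, Complex.norm_real, Real.norm_of_nonneg hL0.le]
    refine mul_le_mul_of_nonneg_right ?_ (norm_nonneg _)
    have h2 : k * (lrg α ℓ * ‖ratio α τ ℓ m v + T‖) ≤ B / δ + B := by nlinarith
    rw [mul_comm, ← le_div_iff₀ hk] at h2
    linarith

end PowerPotential

namespace PowerPotential
open Complex Filter Topology ComplexConjugate

/-- The square root with cut along the ray opposite to `ω ^ 2`. -/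
noncomputable def rot (ω X : ℂ) : ℂ := ω * (X / ω ^ 2) ^ (1 / 2 : ℂ)

/-- Rotation selecting the square root on the closed lower half plane. -/
noncomputable def omL : ℂ := exp (-(Real.pi / 4 : ℝ) * I)

/-- Rotation selecting the square root on the closed upper half plane. -/
noncomputable def omU : ℂ := exp ((Real.pi / 4 : ℝ) * I)

variable {ω X W z : ℂ} {s : ℝ}

lemma cpow_half_sq (W : ℂ) : (W ^ (1 / 2 : ℂ)) ^ 2 = W := by
  rw [← Complex.cpow_nat_mul]; norm_num

lemma rot_sq (hω : ω ≠ 0) : rot ω X ^ 2 = X := by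
  unfold rot
  rw [mul_pow, cpow_half_sq]
  field_simp

lemma norm_rot_sq (hω : ω ≠ 0) : ‖rot ω X‖ ^ 2 = ‖X‖ := by rw [← norm_pow, rot_sq hω]

lemma omL_sq : omL ^ 2 = -I := by
  unfold omL
  rw [← Complex.exp_nat_mul, ← Complex.exp_neg_pi_div_two_mul_I]
  congr 1; push_cast; ring

lemma omU_sq : omU ^ 2 = I := by
  unfold omU
  rw [← Complex.exp_nat_mul]
  refine Eq.trans ?_ Complex.exp_pi_div_two_mul_I
  congr 1; push_cast; ring

lemma omL_ne : omL ≠ 0 := Complex.exp_ne_zero _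
lemma omU_ne : omU ≠ 0 := Complex.exp_ne_zero _

lemma div_omL_re : (X / omL ^ 2).re = -X.im := by
  rw [omL_sq, div_neg, div_I]; simp

lemma div_omU_re : (X / omU ^ 2).re = X.im := by
  rw [omU_sq, div_I]; simp

lemma continuousOn_cpow_half : ContinuousOn (fun W : ℂ => W ^ (1 / 2 : ℂ)) {W | 0 ≤ W.re} := by
  intro W hW
  by_cases h0 : W = 0
  · subst h0
    have := (Complex.continuousAt_cpow_zero_of_re_pos (z := (1 / 2 : ℂ)) (by norm_num))
    exact (this.comp₂ continuousAt_id continuousAt_const).continuousWithinAt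
  · refine (continuousAt_cpow_const (a := W) ?_).continuousWithinAt
    by_cases h1 : 0 < W.re
    · exact Or.inl h1
    · refine Or.inr fun h2 => h0 (Complex.ext ?_ h2)
      exact le_antisymm (not_lt.1 h1) hW

lemma continuousOn_rot : ContinuousOn (rot ω) {X | 0 ≤ (X / ω ^ 2).re} := by
  unfold rot
  refine continuousOn_const.mul (continuousOn_cpow_half.comp (by fun_prop) fun X hX => hX)

lemma differentiableAt_rot (h : 0 < (X / ω ^ 2).re) : DifferentiableAt ℂ (rot ω) X := by
  unfold rot
  refine DifferentiableAt.const_mul ?_ _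
  have h1 : DifferentiableAt ℂ (fun W : ℂ => W ^ (1 / 2 : ℂ)) (X / ω ^ 2) :=
    differentiableAt_id.cpow_const (Or.inl h)
  exact DifferentiableAt.comp (g := fun W : ℂ => W ^ (1 / 2 : ℂ)) X h1 (by fun_prop)

lemma cpow_half_sector (h : 0 ≤ W.re) : |(W ^ (1 / 2 : ℂ)).im| ≤ (W ^ (1 / 2 : ℂ)).re := by
  have h1 := congrArg Complex.re (cpow_half_sq W)
  rw [pow_two, mul_re] at h1
  have h2 : 0 ≤ (W ^ (1 / 2 : ℂ)).re := by
    by_cases h0 : W = 0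
    · subst h0; simp
    rw [Complex.cpow_def_of_ne_zero h0, Complex.exp_re]
    refine mul_nonneg (Real.exp_pos _).le (Real.cos_nonneg_of_mem_Icc ?_)
    have h3 : (Complex.log W * (1 / 2)).im = W.arg / 2 := by
      rw [show (1 / 2 : ℂ) = ((1 / 2 : ℝ) : ℂ) by push_cast; ring, im_mul_ofReal, log_im]; ring
    rw [h3]
    constructor <;> linarith [neg_pi_lt_arg W, arg_le_pi W]
  exact abs_le_of_sq_le_sq (by nlinarith [h]) h2

lemma omL_eq : omL = ⟨√2 / 2, -(√2 / 2)⟩ := by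
  unfold omL
  apply Complex.ext <;> rw [← ofReal_neg] <;>
    simp only [exp_ofReal_mul_I_re, exp_ofReal_mul_I_im, Real.cos_neg, Real.sin_neg,
      Real.cos_pi_div_four, Real.sin_pi_div_four]

lemma omU_eq : omU = ⟨√2 / 2, √2 / 2⟩ := by
  unfold omU
  apply Complex.ext <;>
    simp only [exp_ofReal_mul_I_re, exp_ofReal_mul_I_im,
      Real.cos_pi_div_four, Real.sin_pi_div_four]

lemma rot_omL_quadrant (h : X.im ≤ 0) : 0 ≤ (rot omL X).re ∧ (rot omL X).im ≤ 0 := by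
  have h1 := abs_le.1 (cpow_half_sector (W := X / omL ^ 2) (by rw [div_omL_re]; linarith))
  have h2 : 0 ≤ √2 / 2 := by positivity
  unfold rot
  set W := (X / omL ^ 2) ^ (1 / 2 : ℂ)
  rw [omL_eq, mul_re, mul_im]
  constructor <;> nlinarith

lemma rot_omU_quadrant (h : 0 ≤ X.im) : 0 ≤ (rot omU X).re ∧ 0 ≤ (rot omU X).im := by
  have h1 := abs_le.1 (cpow_half_sector (W := X / omU ^ 2) (by rw [div_omU_re]; linarith))
  have h2 : 0 ≤ √2 / 2 := by positivity
  unfold rot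
  set W := (X / omU ^ 2) ^ (1 / 2 : ℂ)
  rw [omU_eq, mul_re, mul_im]
  constructor <;> nlinarith

lemma eq_sqrt_of_sq (hs : 0 ≤ s) (hz : z ^ 2 = s) (h : 0 ≤ z.re) : z = √s := by
  have h1 : (z - √s) * (z + √s) = 0 := by
    have : ((√s : ℝ) : ℂ) ^ 2 = s := by rw [← ofReal_pow, Real.sq_sqrt hs]
    linear_combination hz - this
  rcases mul_eq_zero.1 h1 with h2 | h2
  · exact sub_eq_zero.1 h2
  · have h3 : z = -√s := eq_neg_of_add_eq_zero_left h2
    rw [h3] at h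
    simp only [neg_re, ofReal_re] at h
    have : √s = 0 := le_antisymm (by linarith) (Real.sqrt_nonneg s)
    rw [h3, this]; simp

lemma eq_I_mul_sqrt_of_sq (hs : 0 ≤ s) (hz : z ^ 2 = -s) (h : 0 ≤ z.im) : z = I * √s := by
  have h1 := eq_sqrt_of_sq hs (z := -I * z) (by rw [mul_pow, hz]; simp) (by simpa using h)
  rw [← h1, ← mul_assoc]; simp

lemma eq_neg_I_mul_sqrt_of_sq (hs : 0 ≤ s) (hz : z ^ 2 = -s) (h : z.im ≤ 0) : z = -I * √s := by
  have h1 := eq_sqrt_of_sq hs (z := I * z) (by rw [mul_pow, hz]; simp) (by simpa using h)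
  rw [← h1, ← mul_assoc]; simp

/-- Growth bound along a segment from an approximate first order equation. -/
lemma norm_le_exp_of_approx {y y' S : ℝ → ℂ} {a b C : ℝ} (hab : a ≤ b)
    (hy : ∀ s ∈ Icc a b, HasDerivAt y (y' s) s) (hS : ContinuousOn S (Icc a b))
    (h : ∀ s ∈ Icc a b, ‖y' s + S s * y s‖ ≤ C * ‖y s‖) :
    ‖y b‖ ≤ ‖y a‖ * Real.exp (-(∫ s in a..b, S s).re + C * (b - a)) := by
  set S' : ℝ → ℂ := IccExtend hab ((Icc a b).domRestrict S) with hS'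
  have hc : Continuous S' := (continuousOn_iff_continuous_domRestrict.1 hS).Icc_extend'
  have heq : ∀ s ∈ Icc a b, S' s = S s := fun s hs => IccExtend_of_mem hab _ hs
  set P : ℝ → ℂ := fun s => ∫ r in a..s, S' r with hP
  have hPd : ∀ s, HasDerivAt P (S' s) s := fun s =>
    intervalIntegral.integral_hasDerivAt_right (hc.intervalIntegrable _ _)
      (hc.stronglyMeasurableAtFilter _ _) hc.continuousAt
  have hd : ∀ s ∈ Icc a b, HasDerivAt (fun s => y s * exp (P s))
      ((y' s + S s * y s) * exp (P s)) s := fun s hs => by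
    refine ((hy s hs).mul (hPd s).cexp).congr_deriv ?_
    rw [heq s hs]; ring
  have hg := norm_le_gronwallBound_of_norm_deriv_right_le (f := fun s => y s * exp (P s))
    (K := C) (ε := 0) (δ := ‖y a‖)
    (fun s hs => (hd s hs).continuousAt.continuousWithinAt)
    (fun s hs => (hd s (Ico_subset_Icc_self hs)).hasDerivWithinAt) (by simp [hP])
    (fun s hs => by
      rw [norm_mul, norm_mul, add_zero, ← mul_assoc]
      exact mul_le_mul_of_nonneg_right (h s (Ico_subset_Icc_self hs)) (norm_nonneg _))
    b (right_mem_Icc.2 hab)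
  rw [gronwallBound_ε0] at hg
  have hPb : P b = ∫ s in a..b, S s := intervalIntegral.integral_congr fun s hs =>
    heq s (by rwa [uIcc_of_le hab] at hs)
  rw [hPb, norm_mul, Complex.norm_exp] at hg
  rw [Real.exp_add, Real.exp_neg, mul_comm _⁻¹, ← mul_assoc, ← div_eq_mul_inv,
    le_div_iff₀ (Real.exp_pos _)]
  exact hg

end PowerPotential

namespace PowerPotential
open Complex Filter Topology ComplexConjugate

variable {α τ φ φ₀ ℓ x : ℝ} {ω v T : ℂ}

/-- Admissible angles: `φ₀` is the angle of the ray, `τ` the argument of the spectral parameter. -/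
structure Geo (α φ φ₀ τ : ℝ) : Prop where
  adm : Adm α φ
  tau_pos : 0 < τ
  tau_lt : τ < α * φ₀
  phi_lt : φ₀ < φ

namespace Geo

lemma phi_pos (h : Geo α φ φ₀ τ) : 0 < φ₀ := by
  have := h.adm.pos
  by_contra! h1
  nlinarith [h.tau_pos, h.tau_lt]

lemma theta_lt (h : Geo α φ φ₀ τ) : (α + 2) * φ₀ < Real.pi := by
  have := h.adm.pos
  nlinarith [h.phi_lt, h.adm.phi_lt]

lemma t_lt (h : Geo α φ φ₀ τ) : τ + 2 * φ₀ < (α + 2) * φ₀ := by linarith [h.tau_lt]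

lemma tau_lt_pi (h : Geo α φ φ₀ τ) : τ < Real.pi := by linarith [h.t_lt, h.theta_lt, h.phi_pos]

lemma sin_theta_pos (h : Geo α φ φ₀ τ) : 0 < Real.sin ((α + 2) * φ₀) :=
  Real.sin_pos_of_pos_of_lt_pi (by have := h.adm.pos; have := h.phi_pos; positivity) h.theta_lt

lemma sin_t_pos (h : Geo α φ φ₀ τ) : 0 < Real.sin (τ + 2 * φ₀) :=
  Real.sin_pos_of_pos_of_lt_pi (by linarith [h.phi_pos, h.tau_pos]) (h.t_lt.trans h.theta_lt)

lemma sin_tau_pos (h : Geo α φ φ₀ τ) : 0 < Real.sin (τ / 2) :=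
  Real.sin_pos_of_pos_of_lt_pi (by linarith [h.tau_pos]) (by linarith [h.tau_lt_pi, h.tau_pos])

lemma div_lt (h : Geo α φ φ₀ τ) : τ / α < φ₀ := by
  rw [div_lt_iff₀ h.adm.pos, mul_comm]; exact h.tau_lt

lemma div_pos (h : Geo α φ φ₀ τ) : 0 < τ / α := _root_.div_pos h.tau_pos h.adm.pos

end Geo

lemma rotated_symb (ψ : ℝ) : exp (ψ * I) * symb α τ v =
    exp ((α + 2) * v + ψ * I) - exp (2 * v + (τ + ψ : ℝ) * I) := by
  unfold symb
  rw [mul_sub, ← Complex.exp_add, ← Complex.exp_add]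
  push_cast
  ring_nf

lemma Geo.real_mem (h : Geo α φ φ₀ τ) (x : ℝ) : (x : ℂ) ∈ coerSet α τ φ := by
  have hs := h.sin_tau_pos
  have e1 : Real.cos (Real.pi / 2 - τ / 2) = Real.sin (τ / 2) := Real.cos_pi_div_two_sub _
  have e2 : Real.cos (τ + (Real.pi / 2 - τ / 2)) = -Real.sin (τ / 2) := by
    rw [← Real.cos_add_pi_div_two]; congr 1; ring
  refine ⟨by simpa using h.adm.phi_pos, exp ((Real.pi / 2 - τ / 2 : ℝ) * I), ?_, ?_, ?_⟩
  · rw [exp_ofReal_mul_I_re, e1]; exact hs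
  · rw [← Complex.exp_add, exp_re]
    have : (((Real.pi / 2 - τ / 2 : ℝ) : ℂ) * I + (α + 2) * (x : ℂ)).im = Real.pi / 2 - τ / 2 := by
      simp
    rw [this, e1]
    positivity
  · rw [rotated_symb, sub_re, exp_re, exp_re]
    have h1 : ((α + 2) * (x : ℂ) + ((Real.pi / 2 - τ / 2 : ℝ) : ℂ) * I).im =
      Real.pi / 2 - τ / 2 := by simp
    have h2 : (2 * (x : ℂ) + ((τ + (Real.pi / 2 - τ / 2) : ℝ) : ℂ) * I).im =
      τ + (Real.pi / 2 - τ / 2) := by simp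
    rw [h1, h2, e1, e2, mul_neg, sub_neg_eq_add]
    positivity

lemma Geo.vertical_mem (h : Geo α φ φ₀ τ) {L ψ : ℝ} (h0 : 0 ≤ ψ) (h1 : ψ ≤ φ₀)
    (hL : 1 < Real.exp (α * L) * Real.cos ((α + 2) * φ₀ / 2)) :
    (L + ψ * I : ℂ) ∈ coerSet α τ φ := by
  have hα := h.adm.pos
  have hθ := h.theta_lt
  have hle : (α + 2) * ψ ≤ (α + 2) * φ₀ := by gcongr
  have hp : 0 ≤ (α + 2) * ψ := by positivity
  have hcos : Real.cos ((α + 2) * φ₀ / 2) ≤ Real.cos ((α + 2) * ψ / 2) :=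
    Real.cos_le_cos_of_nonneg_of_le_pi (by linarith) (by linarith) (by linarith)
  have hc0 : 0 < Real.cos ((α + 2) * φ₀ / 2) := pos_of_mul_pos_right
    (zero_lt_one.trans hL) (Real.exp_pos _).le
  have hcp := hc0.trans_le hcos
  refine ⟨by simpa [abs_of_nonneg h0] using h1.trans_lt h.phi_lt,
    exp ((-((α + 2) * ψ / 2) : ℝ) * I), ?_, ?_, ?_⟩
  · rw [exp_ofReal_mul_I_re, Real.cos_neg]; exact hcp
  · rw [← Complex.exp_add, exp_re]
    have : (((-((α + 2) * ψ / 2) : ℝ) : ℂ) * I + (α + 2) * (L + ψ * I : ℂ)).im =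
        (α + 2) * ψ / 2 := by simp; ring
    rw [this]
    positivity
  · rw [rotated_symb, sub_re, exp_re]
    have h2 : ((α + 2) * (L + ψ * I : ℂ) + ((-((α + 2) * ψ / 2) : ℝ) : ℂ) * I).im =
      (α + 2) * ψ / 2 := by simp; ring
    have h3 : ((α + 2) * (L + ψ * I : ℂ) + ((-((α + 2) * ψ / 2) : ℝ) : ℂ) * I).re =
      α * L + 2 * L := by simp; ring
    have h4 : (exp (2 * (L + ψ * I : ℂ) + ((τ + -((α + 2) * ψ / 2) : ℝ) : ℂ) * I)).re ≤
        Real.exp (2 * L) := by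
      refine (re_le_norm _).trans_eq ?_
      rw [Complex.norm_exp]; simp
    rw [h2, h3, Real.exp_add]
    have h5 : 1 < Real.exp (α * L) * Real.cos ((α + 2) * ψ / 2) :=
      hL.trans_le (mul_le_mul_of_nonneg_left hcos (Real.exp_pos _).le)
    nlinarith [Real.exp_pos (2 * L)]

lemma Geo.top_mem (h : Geo α φ φ₀ τ)
    (hx : Real.sin (τ + 2 * φ₀) < Real.exp (α * x) * Real.sin ((α + 2) * φ₀)) :
    (x + φ₀ * I : ℂ) ∈ coerSet α τ φ := by
  have hs := h.sin_theta_pos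
  have c1 : ContinuousAt (fun ε : ℝ => Real.sin ((α + 2) * φ₀) + ε * Real.cos ((α + 2) * φ₀)) 0 := by
    fun_prop
  have c2 : ContinuousAt (fun ε : ℝ => Real.exp (α * x) * (Real.sin ((α + 2) * φ₀) +
    ε * Real.cos ((α + 2) * φ₀)) - (Real.sin (τ + 2 * φ₀) + ε * Real.cos (τ + 2 * φ₀))) 0 := by
    fun_prop
  have e1 := (c1.eventually_const_lt (u := 0) (by simpa using hs)).filter_mono
    (nhdsWithin_le_nhds (s := Ioi 0))
  have e2 := (c2.eventually_const_lt (u := 0) (by simpa using hx)).filter_mono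
    (nhdsWithin_le_nhds (s := Ioi 0))
  obtain ⟨ε, ⟨hε1, hε2⟩, hε⟩ := ((e1.and e2).and self_mem_nhdsWithin).exists
  have r1 : ((α + 2) * (x + φ₀ * I : ℂ)).re = α * x + 2 * x := by simp; ring
  have i1 : ((α + 2) * (x + φ₀ * I : ℂ)).im = (α + 2) * φ₀ := by simp
  have r2 : (2 * (x + φ₀ * I : ℂ) + τ * I).re = 2 * x := by simp
  have i2 : (2 * (x + φ₀ * I : ℂ) + τ * I).im = τ + 2 * φ₀ := by simp; ring
  refine ⟨by simpa [abs_of_nonneg h.phi_pos.le] using h.phi_lt, ⟨ε, -1⟩, hε, ?_, ?_⟩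
  · rw [mul_re, exp_re, exp_im, r1, i1]
    have := Real.exp_pos (α * x + 2 * x)
    dsimp only
    nlinarith
  · unfold symb
    rw [mul_re, sub_re, sub_im, exp_re, exp_im, exp_re, exp_im, r1, i1, r2, i2, Real.exp_add]
    have := Real.exp_pos (2 * x)
    dsimp only
    have := mul_pos this hε2
    linarith

/-- On the coercive set the square roots of the symbol avoid the imaginary axis. -/
lemma re_ne_zero_of_mem (hv : v ∈ coerSet α τ φ) (hT : T ^ 2 = symb α τ v) : T.re ≠ 0 := by
  intro h0
  obtain ⟨-, e, he, -, h1⟩ := hv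
  rw [← hT, pow_two] at h1
  simp only [mul_re, mul_im, h0] at h1
  nlinarith [mul_nonneg he.le (sq_nonneg T.im)]

/-- The phase: a square root of the symbol. -/
noncomputable def phase (α τ : ℝ) (ω v : ℂ) : ℂ :=
  exp (v + (τ / 2 : ℝ) * I) * rot ω (exp (α * v - τ * I) - 1)

lemma phase_sq (hω : ω ≠ 0) : phase α τ ω v ^ 2 = symb α τ v := by
  unfold phase symb
  rw [mul_pow, rot_sq hω, ← Complex.exp_nat_mul, mul_sub, ← Complex.exp_add]
  push_cast
  ring_nf

lemma norm_phase_le (hα : 0 < α) (hω : ω ≠ 0) (hv : v.re ≤ 0) :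
    ‖phase α τ ω v‖ ≤ 2 * Real.exp v.re := by
  have h1 : ‖rot ω (exp (α * v - τ * I) - 1)‖ ≤ 2 := by
    have h2 := norm_rot_sq (ω := ω) (X := exp (α * v - τ * I) - 1) hω
    have h3 : ‖exp (α * v - τ * I) - 1‖ ≤ 2 := by
      refine (norm_sub_le _ _).trans ?_
      rw [Complex.norm_exp, norm_one]
      have : Real.exp (α * v - τ * I : ℂ).re ≤ 1 := by
        rw [Real.exp_le_one_iff]; simp; nlinarith
      linarith
    nlinarith [norm_nonneg (rot ω (exp (α * v - τ * I) - 1))]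
  unfold phase
  rw [norm_mul, Complex.norm_exp, mul_comm 2]
  simp only [add_re, re_ofReal_mul, I_re, mul_zero, add_zero]
  gcongr

lemma phase_arg_im :
    (exp (α * v - τ * I) - 1).im = Real.exp (α * v.re) * Real.sin (α * v.im - τ) := by
  rw [sub_im, exp_im]; simp

/-- The closed strip below the turning point. -/
def stripL (α τ : ℝ) : Set ℂ := {v | 0 ≤ v.im ∧ v.im ≤ τ / α}

/-- The closed strip above the turning point. -/
def stripU (α τ φ₀ : ℝ) : Set ℂ := {v | τ / α ≤ v.im ∧ v.im ≤ φ₀}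

namespace Geo

lemma im_L (h : Geo α φ φ₀ τ) (hv : v ∈ stripL α τ) : (exp (α * v - τ * I) - 1).im ≤ 0 := by
  have hα := h.adm.pos
  have h2 := (le_div_iff₀ hα).1 hv.2
  have h1 := mul_nonneg hα.le hv.1
  rw [phase_arg_im]
  refine mul_nonpos_of_nonneg_of_nonpos (Real.exp_pos _).le
    (Real.sin_nonpos_of_nonpos_of_neg_pi_le (by linarith) (by linarith [h.tau_lt_pi]))

lemma im_U (h : Geo α φ φ₀ τ) (hv : v ∈ stripU α τ φ₀) : 0 ≤ (exp (α * v - τ * I) - 1).im := by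
  have hα := h.adm.pos
  have h1 := (div_le_iff₀ hα).1 hv.1
  have h2 := mul_le_mul_of_nonneg_left hv.2 hα.le
  rw [phase_arg_im]
  refine mul_nonneg (Real.exp_pos _).le
    (Real.sin_nonneg_of_nonneg_of_le_pi (by linarith)
      (by linarith [h.theta_lt, h.phi_pos, h.tau_pos]))

lemma continuousOn_L (h : Geo α φ φ₀ τ) : ContinuousOn (phase α τ omL) (stripL α τ) := by
  unfold phase
  refine ContinuousOn.mul (by fun_prop) (continuousOn_rot.comp (by fun_prop) fun v hv => ?_)
  change 0 ≤ (_ / omL ^ 2).re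
  rw [div_omL_re]; linarith [h.im_L hv]

lemma continuousOn_U (h : Geo α φ φ₀ τ) : ContinuousOn (phase α τ omU) (stripU α τ φ₀) := by
  unfold phase
  refine ContinuousOn.mul (by fun_prop) (continuousOn_rot.comp (by fun_prop) fun v hv => ?_)
  change 0 ≤ (_ / omU ^ 2).re
  rw [div_omU_re]; linarith [h.im_U hv]

lemma differentiableAt_L (h : Geo α φ φ₀ τ) (h1 : 0 < v.im) (h2 : v.im < τ / α) :
    DifferentiableAt ℂ (phase α τ omL) v := by
  have hα := h.adm.pos
  have h3 := (lt_div_iff₀ hα).1 h2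
  have h4 := mul_pos hα h1
  unfold phase
  refine DifferentiableAt.mul (by fun_prop) (DifferentiableAt.comp (g := rot omL) v
    (differentiableAt_rot ?_) (by fun_prop))
  rw [div_omL_re, phase_arg_im, ← mul_neg]
  refine mul_pos (Real.exp_pos _) (neg_pos.2
    (Real.sin_neg_of_neg_of_neg_pi_lt (by linarith) (by linarith [h.tau_lt_pi])))

lemma differentiableAt_U (h : Geo α φ φ₀ τ) (h1 : τ / α < v.im) (h2 : v.im < φ₀) :
    DifferentiableAt ℂ (phase α τ omU) v := by
  have hα := h.adm.pos
  have h3 := (div_lt_iff₀ hα).1 h1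
  have h4 := mul_lt_mul_of_pos_left h2 hα
  unfold phase
  refine DifferentiableAt.mul (by fun_prop) (DifferentiableAt.comp (g := rot omU) v
    (differentiableAt_rot ?_) (by fun_prop))
  rw [div_omU_re, phase_arg_im]
  refine mul_pos (Real.exp_pos _) (Real.sin_pos_of_pos_of_lt_pi (by linarith)
      (by linarith [h.theta_lt, h.phi_pos, h.tau_pos]))

lemma re_phase_real (h : Geo α φ φ₀ τ) (x : ℝ) : 0 ≤ (phase α τ omL x).re := by
  have h1 := rot_omL_quadrant (h.im_L (v := x) ⟨by simp, by simpa using h.div_pos.le⟩)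
  unfold phase
  rw [Complex.exp_add, mul_assoc, ← ofReal_exp, re_ofReal_mul, mul_re, exp_ofReal_mul_I_re,
    exp_ofReal_mul_I_im]
  have h2 : 0 ≤ Real.cos (τ / 2) :=
    Real.cos_nonneg_of_mem_Icc ⟨by linarith [h.tau_pos, Real.pi_pos], by linarith [h.tau_lt_pi]⟩
  have h3 := mul_nonneg h2 h1.1
  have h4 := mul_nonneg h.sin_tau_pos.le (neg_nonneg.2 h1.2)
  exact mul_nonneg (Real.exp_pos _).le (by linarith)

end Geo

lemma phase_middle (hα : 0 < α) : phase α τ ω (x + (τ / α : ℝ) * I) =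
    ((Real.exp x : ℝ) : ℂ) * (exp ((τ * ord α : ℝ) * I) * rot ω ((Real.exp (α * x) - 1 : ℝ) : ℂ)) := by
  unfold phase
  rw [← mul_assoc, ofReal_exp, ← Complex.exp_add]
  have hα0 : (α : ℂ) ≠ 0 := by exact_mod_cast hα.ne'
  congr 2
  · unfold ord; push_cast; field_simp; ring
  · push_cast; congr 2; field_simp; ring

lemma phase_middle_eq (hα : 0 < α) (hx : 0 ≤ x) :
    phase α τ omL (x + (τ / α : ℝ) * I) = phase α τ omU (x + (τ / α : ℝ) * I) := by
  have h1 : 0 ≤ Real.exp (α * x) - 1 := by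
    linarith [Real.one_le_exp (show 0 ≤ α * x by positivity)]
  rw [phase_middle hα, phase_middle hα,
    eq_sqrt_of_sq h1 (rot_sq omL_ne) (rot_omL_quadrant (ofReal_im _).le).1,
    eq_sqrt_of_sq h1 (rot_sq omU_ne) (rot_omU_quadrant (ofReal_im _).ge).1]

lemma phase_middle_sub (hα : 0 < α) (hx : x ≤ 0) :
    (phase α τ omL (x + (τ / α : ℝ) * I) - phase α τ omU (x + (τ / α : ℝ) * I)).re =
      2 * Real.sin (τ * ord α) * (√(1 - Real.exp x ^ α) * Real.exp x) := by
  have hexp : Real.exp x ^ α = Real.exp (α * x) := by rw [← Real.exp_mul, mul_comm]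
  have h1 : 0 ≤ 1 - Real.exp (α * x) := by
    have : Real.exp (α * x) ≤ 1 := by rw [Real.exp_le_one_iff]; nlinarith
    linarith
  have e : ((Real.exp (α * x) - 1 : ℝ) : ℂ) = -((1 - Real.exp (α * x) : ℝ) : ℂ) := by
    push_cast; ring
  rw [phase_middle hα, phase_middle hα,
    eq_neg_I_mul_sqrt_of_sq h1 ((rot_sq omL_ne).trans e) (rot_omL_quadrant (ofReal_im _).le).2,
    eq_I_mul_sqrt_of_sq h1 ((rot_sq omU_ne).trans e) (rot_omU_quadrant (ofReal_im _).ge).2, hexp,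
    ← mul_sub, re_ofReal_mul, ← mul_sub, mul_re, exp_ofReal_mul_I_im]
  simp
  ring

lemma phase_top : phase α τ ω (x + φ₀ * I) = ((Real.exp x : ℝ) : ℂ) *
    (exp (((τ + 2 * φ₀) / 2 : ℝ) * I) *
      rot ω (((Real.exp x ^ α : ℝ) : ℂ) * exp ((α * φ₀ - τ : ℝ) * I) - 1)) := by
  have hexp : Real.exp x ^ α = Real.exp (α * x) := by rw [← Real.exp_mul, mul_comm]
  unfold phase
  rw [hexp, ofReal_exp, ofReal_exp, ← Complex.exp_add, ← mul_assoc, ← Complex.exp_add]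
  congr 2
  · push_cast; ring
  · push_cast; congr 2; ring

end PowerPotential

namespace PowerPotential
open Complex Filter Topology ComplexConjugate

variable {α τ φ φ₀ ℓ x β M L b : ℝ} {ω v T : ℂ}

/-- The phase along a ray, in the radial variable and up to a constant factor. -/
noncomputable def tint (α β ξ : ℝ) : ℂ := rot omU (((ξ ^ α : ℝ) : ℂ) * exp (β * I) - 1)

/-- The integral controlling the jump of the phase at the turning point. -/
noncomputable def kap0 (α : ℝ) : ℝ := ∫ ξ in (0 : ℝ)..1, √(1 - ξ ^ α)

/-- The exponential growth rate of decaying solutions at radius `Z` on the ray of angle `φ₀`. -/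
noncomputable def expo (α φ₀ τ Z : ℝ) : ℝ := -(2 * Real.sin (τ * ord α) * kap0 α) -
  (exp (((τ + 2 * φ₀) / 2 : ℝ) * I) * ∫ ξ in (0 : ℝ)..Z, tint α (α * φ₀ - τ) ξ).re

lemma tint_im (x : ℝ) : (((x ^ α : ℝ) : ℂ) * exp (β * I) - 1).im = x ^ α * Real.sin β := by
  rw [sub_im, im_ofReal_mul, exp_ofReal_mul_I_im]; simp

lemma continuousOn_tint (hα : 0 < α) (h0 : 0 ≤ β) (h1 : β ≤ Real.pi) :
    ContinuousOn (tint α β) (Ici 0) := by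
  have hc : Continuous fun ξ : ℝ => ξ ^ α := Real.continuous_rpow_const hα.le
  unfold tint
  refine continuousOn_rot.comp (by fun_prop) fun ξ (hξ : 0 ≤ ξ) => ?_
  change 0 ≤ (_ / omU ^ 2).re
  rw [div_omU_re, tint_im]
  exact mul_nonneg (Real.rpow_nonneg hξ _) (Real.sin_nonneg_of_nonneg_of_le_pi h0 h1)

lemma norm_tint_le {ξ C : ℝ} (h0 : 0 ≤ ξ) (hC : 1 + ξ ^ α ≤ C) : ‖tint α β ξ‖ ≤ C := by
  have h2 := norm_rot_sq (ω := omU) (X := ((ξ ^ α : ℝ) : ℂ) * exp (β * I) - 1) omU_ne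
  have h3 : ‖((ξ ^ α : ℝ) : ℂ) * exp (β * I) - 1‖ ≤ C := by
    refine (norm_sub_le _ _).trans ?_
    rw [norm_mul, norm_exp_ofReal_mul_I, norm_one, Complex.norm_real,
      Real.norm_of_nonneg (Real.rpow_nonneg h0 _)]
    linarith
  have h4 := Real.rpow_nonneg h0 α
  unfold tint
  nlinarith [norm_nonneg (rot omU (((ξ ^ α : ℝ) : ℂ) * exp (β * I) - 1))]

lemma rect_integral {f : ℂ → ℂ} {a b c d : ℝ} (hcd : c ≤ d)
    (hc : ContinuousOn f {v | c ≤ v.im ∧ v.im ≤ d})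
    (hd : ∀ v : ℂ, c < v.im → v.im < d → DifferentiableAt ℂ f v) :
    (∫ x in a..b, f (x + c * I)) + I * (∫ y in c..d, f (b + y * I)) =
      (∫ x in a..b, f (x + d * I)) + I * ∫ y in c..d, f (a + y * I) := by
  have := Complex.integral_boundary_rect_eq_zero_of_continuousOn_of_differentiableOn f
    (a + c * I) (b + d * I) (hc.mono fun v hv => by
      have h2 := hv.2
      simp only [add_im, ofReal_im, im_ofReal_mul, I_im, mul_one, zero_add, uIcc_of_le hcd] at h2
      exact h2) fun v hv => (by
      have h2 := hv.2
      simp only [add_im, ofReal_im, im_ofReal_mul, I_im, mul_one, zero_add, min_eq_left hcd,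
        max_eq_right hcd] at h2
      exact (hd v h2.1 h2.2).differentiableWithinAt)
  simp only [add_im, ofReal_im, im_ofReal_mul, I_im, mul_one, zero_add, add_re, ofReal_re,
    re_ofReal_mul, I_re, mul_zero, add_zero, smul_eq_mul] at this
  linear_combination this

lemma integral_exp_subst {f : ℝ → ℂ} (hf : ContinuousOn f (Ici 0)) (a b : ℝ) :
    ∫ x in a..b, ((Real.exp x : ℝ) : ℂ) * f (Real.exp x) =
      ∫ ξ in Real.exp a..Real.exp b, f ξ := by
  have := intervalIntegral.integral_deriv_smul_comp' (a := a) (b := b) (f := Real.exp)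
    (f' := Real.exp) (g := f) (fun x _ => Real.hasDerivAt_exp x) Real.continuous_exp.continuousOn
    (hf.mono (by rintro _ ⟨x, -, rfl⟩; exact (Real.exp_pos x).le))
  rw [← this]
  simp

/-- The contour integral of the phase along the path through large real values. -/
noncomputable def contour (α φ₀ τ M L b : ℝ) : ℂ :=
  (∫ x in -M..L, phase α τ omL x) + I * (∫ y in (0 : ℝ)..τ / α, phase α τ omL (L + y * I)) +
    I * (∫ y in τ / α..φ₀, phase α τ omU (L + y * I)) - ∫ x in b..L, phase α τ omU (x + φ₀ * I)

namespace Geo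

lemma beta_nonneg (h : Geo α φ φ₀ τ) : 0 ≤ α * φ₀ - τ := by linarith [h.tau_lt]
lemma beta_le_pi (h : Geo α φ φ₀ τ) : α * φ₀ - τ ≤ Real.pi := by
  linarith [h.theta_lt, h.phi_pos, h.tau_pos]

lemma integrable_line_U (h : Geo α φ φ₀ τ) {d : ℝ} (h1 : τ / α ≤ d) (h2 : d ≤ φ₀) (a b : ℝ) :
    IntervalIntegrable (fun x : ℝ => phase α τ omU (x + d * I)) volume a b := by
  refine ContinuousOn.intervalIntegrable (h.continuousOn_U.comp (by fun_prop) fun x _ => ?_)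
  simpa [stripU] using ⟨h1, h2⟩

lemma integrable_line_L (h : Geo α φ φ₀ τ) {d : ℝ} (h1 : 0 ≤ d) (h2 : d ≤ τ / α) (a b : ℝ) :
    IntervalIntegrable (fun x : ℝ => phase α τ omL (x + d * I)) volume a b := by
  refine ContinuousOn.intervalIntegrable (h.continuousOn_L.comp (by fun_prop) fun x _ => ?_)
  simpa [stripL] using ⟨h1, h2⟩

lemma contour_eq (h : Geo α φ φ₀ τ) (hM : 0 ≤ M) (hL : 0 ≤ L) :
    contour α φ₀ τ M L b =
      (∫ x in -M..0, (phase α τ omL (x + (τ / α : ℝ) * I) -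
        phase α τ omU (x + (τ / α : ℝ) * I))) +
      (∫ x in -M..b, phase α τ omU (x + φ₀ * I)) +
      I * (∫ y in (0 : ℝ)..τ / α, phase α τ omL (-M + y * I)) +
      I * ∫ y in τ / α..φ₀, phase α τ omU (-M + y * I) := by
  have hα := h.adm.pos
  have r1 := rect_integral (a := -M) (b := L) h.div_pos.le h.continuousOn_L
    fun v => h.differentiableAt_L
  have r2 := rect_integral (a := -M) (b := L) h.div_lt.le h.continuousOn_U
    fun v => h.differentiableAt_U
  have s1 := intervalIntegral.integral_add_adjacent_intervals
    (h.integrable_line_L h.div_pos.le le_rfl (-M) 0) (h.integrable_line_L h.div_pos.le le_rfl 0 L)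
  have s2 := intervalIntegral.integral_add_adjacent_intervals
    (h.integrable_line_U le_rfl h.div_lt.le (-M) 0) (h.integrable_line_U le_rfl h.div_lt.le 0 L)
  have s3 := intervalIntegral.integral_add_adjacent_intervals
    (h.integrable_line_U h.div_lt.le le_rfl (-M) b) (h.integrable_line_U h.div_lt.le le_rfl b L)
  have s4 : ∫ x in (0 : ℝ)..L, phase α τ omL (x + (τ / α : ℝ) * I) =
      ∫ x in (0 : ℝ)..L, phase α τ omU (x + (τ / α : ℝ) * I) := by
    refine intervalIntegral.integral_congr fun x hx => ?_
    rw [uIcc_of_le hL] at hx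
    exact phase_middle_eq hα hx.1
  have s5 := intervalIntegral.integral_sub
    (h.integrable_line_L h.div_pos.le le_rfl (-M) 0) (h.integrable_line_U le_rfl h.div_lt.le (-M) 0)
  rw [s5]
  unfold contour
  simp only [ofReal_zero, zero_mul, add_zero, ofReal_neg] at r1 r2
  linear_combination r1 + r2 - s1 + s2 - s3 + s4

lemma contour_re (h : Geo α φ φ₀ τ) (hM : 0 ≤ M) (hL : 0 ≤ L) :
    -(contour α φ₀ τ M L b).re ≤
      expo α φ₀ τ (Real.exp b) + (4 + 4 * φ₀) * Real.exp (-M) := by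
  have hα := h.adm.pos
  have hφ := h.phi_pos
  set ε := Real.exp (-M) with hε
  have hε0 : 0 < ε := Real.exp_pos _
  have hε1 : ε ≤ 1 := Real.exp_le_one_iff.2 (by linarith)
  have hrp : ∀ ξ : ℝ, 0 ≤ ξ → ξ ≤ 1 → ξ ^ α ≤ 1 := fun ξ h0 h1 => Real.rpow_le_one h0 h1 hα.le
  have b1 : ‖I * ∫ y in (0 : ℝ)..τ / α, phase α τ omL (-M + y * I)‖ ≤ 2 * ε * φ₀ := by
    rw [norm_mul, norm_I, one_mul]
    refine (intervalIntegral.norm_integral_le_of_norm_le_const (C := 2 * ε) fun y _ => ?_).trans ?_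
    · refine (norm_phase_le hα omL_ne ?_).trans_eq ?_ <;> simp [hε, hM]
    · rw [sub_zero, abs_of_pos h.div_pos]
      have := h.div_lt
      gcongr
  have b2 : ‖I * ∫ y in τ / α..φ₀, phase α τ omU (-M + y * I)‖ ≤ 2 * ε * φ₀ := by
    rw [norm_mul, norm_I, one_mul]
    refine (intervalIntegral.norm_integral_le_of_norm_le_const (C := 2 * ε) fun y _ => ?_).trans ?_
    · refine (norm_phase_le hα omU_ne ?_).trans_eq ?_ <;> simp [hε, hM]
    · rw [abs_of_pos (by linarith [h.div_lt])]
      have := h.div_pos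
      gcongr
      linarith
  have hcs : Continuous fun ξ : ℝ => √(1 - ξ ^ α) := by
    have : Continuous fun ξ : ℝ => ξ ^ α := Real.continuous_rpow_const hα.le
    fun_prop
  have m1 : (∫ x in -M..0, (phase α τ omL (x + (τ / α : ℝ) * I) -
        phase α τ omU (x + (τ / α : ℝ) * I))).re =
      2 * Real.sin (τ * ord α) * ∫ ξ in ε..1, √(1 - ξ ^ α) := by
    have i := (h.integrable_line_L h.div_pos.le le_rfl (-M) 0).sub
      (h.integrable_line_U le_rfl h.div_lt.le (-M) 0)
    have hre := Complex.reCLM.intervalIntegral_comp_comm i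
    simp only [Complex.reCLM_apply] at hre
    rw [← hre]
    rw [intervalIntegral.integral_congr (g := fun x => 2 * Real.sin (τ * ord α) *
      (√(1 - Real.exp x ^ α) * Real.exp x)) fun x hx => by
        rw [uIcc_of_le (by linarith)] at hx
        exact phase_middle_sub hα hx.2, intervalIntegral.integral_const_mul]
    have := intervalIntegral.integral_comp_mul_deriv (a := -M) (b := 0) (f := Real.exp)
      (f' := Real.exp) (fun x _ => Real.hasDerivAt_exp x) Real.continuous_exp.continuousOn hcs
    rw [Real.exp_zero] at this
    rw [← this]
    rfl
  have m2 : kap0 α - ε ≤ ∫ ξ in ε..1, √(1 - ξ ^ α) ∧ ∫ ξ in ε..1, √(1 - ξ ^ α) ≤ kap0 α := by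
    have s := intervalIntegral.integral_add_adjacent_intervals (hcs.intervalIntegrable 0 ε)
      (hcs.intervalIntegrable (μ := volume) ε 1)
    have s0 : 0 ≤ ∫ ξ in (0 : ℝ)..ε, √(1 - ξ ^ α) :=
      intervalIntegral.integral_nonneg hε0.le fun _ _ => Real.sqrt_nonneg _
    have s1 : ∫ ξ in (0 : ℝ)..ε, √(1 - ξ ^ α) ≤ ε := by
      have := intervalIntegral.integral_mono_on hε0.le (hcs.intervalIntegrable 0 ε)
        (intervalIntegrable_const (μ := volume) (c := (1 : ℝ))) fun x hx => by
          rw [Real.sqrt_le_one]; linarith [Real.rpow_nonneg hx.1 α]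
      simpa using this
    unfold kap0
    constructor <;> linarith
  have hct := continuousOn_tint hα h.beta_nonneg h.beta_le_pi
  have m3 : ∫ x in -M..b, phase α τ omU (x + φ₀ * I) =
      exp (((τ + 2 * φ₀) / 2 : ℝ) * I) * ∫ ξ in ε..Real.exp b, tint α (α * φ₀ - τ) ξ := by
    rw [← integral_exp_subst hct, ← intervalIntegral.integral_const_mul]
    refine intervalIntegral.integral_congr fun x _ => ?_
    simp only [phase_top, tint]
    ring
  have hii : ∀ a c : ℝ, 0 ≤ a → 0 ≤ c → IntervalIntegrable (tint α (α * φ₀ - τ)) volume a c :=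
    fun a c ha hc => (hct.mono fun x hx => le_trans (le_min ha hc) hx.1).intervalIntegrable
  have m4 := intervalIntegral.integral_add_adjacent_intervals (hii 0 ε le_rfl hε0.le)
    (hii ε (Real.exp b) hε0.le (Real.exp_pos _).le)
  have m5 : ‖exp (((τ + 2 * φ₀) / 2 : ℝ) * I) * ∫ ξ in (0 : ℝ)..ε, tint α (α * φ₀ - τ) ξ‖ ≤
      2 * ε := by
    rw [norm_mul, norm_exp_ofReal_mul_I, one_mul]
    refine (intervalIntegral.norm_integral_le_of_norm_le_const (C := 2) fun y hy => ?_).trans_eq ?_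
    · rw [uIoc_of_le hε0.le] at hy
      exact norm_tint_le hy.1.le (by linarith [hrp y hy.1.le (hy.2.trans hε1)])
    · rw [sub_zero, abs_of_pos hε0]
  rw [h.contour_eq hM hL, add_re, add_re, add_re, m1, m3]
  unfold expo
  rw [← m4, mul_add, add_re]
  have k1 := neg_le_of_abs_le ((abs_re_le_norm _).trans b1)
  have k2 := neg_le_of_abs_le ((abs_re_le_norm _).trans b2)
  have k3 := le_of_abs_le ((abs_re_le_norm _).trans m5)
  have k4 := abs_le.1 (Real.abs_sin_le_one (τ * ord α))
  have k5 : Real.sin (τ * ord α) * (kap0 α - ∫ ξ in ε..1, √(1 - ξ ^ α)) ≤ ε := by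
    have := m2.1
    have := m2.2
    nlinarith
  linarith

end Geo

end PowerPotential

namespace PowerPotential
open Complex Filter Topology ComplexConjugate

variable {α φ φ₀ τ ℓ : ℝ} {m : ℂ}

lemma rpow_le_four (hα : 0 < α) (hα2 : α < 2) {x : ℝ} (h0 : 0 ≤ x) (h : x ≤ 2) : x ^ α ≤ 4 := by
  calc x ^ α ≤ 2 ^ α := Real.rpow_le_rpow h0 h hα.le
    _ ≤ 2 ^ (2 : ℝ) := Real.rpow_le_rpow_of_exponent_le (by norm_num) hα2.le
    _ = 4 := by norm_num

/-- Logarithmic derivative bound on the real ray near the origin. -/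
lemma Geo.origin_deriv (h : Geo α φ φ₀ τ) (hℓ : 0 ≤ ℓ) (hd : DecRay α (spec α τ ℓ) 1 m ℓ)
    {a : ℝ} (ha : a ∈ Ioc (0 : ℝ) 1) :
    ‖rayd (Yd α (spec α τ ℓ) 1 m) ℓ a‖ ≤
      2 * (1 + 5 ^ 2) / Real.sin (τ / 2) * lrg α ℓ * ‖ray (Y α (spec α τ ℓ) 1 m) ℓ a‖ := by
  have hL0 : 0 < lrg α ℓ := lrg_pos
  have hL := one_le_lrg h.adm.pos hℓ
  have hsq : √(lrg α ℓ ^ 2) = lrg α ℓ := Real.sqrt_sq hL0.le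
  have hk := h.sin_tau_pos
  have hQ : ∀ x, rayPot α (spec α τ ℓ) ℓ x = ((lrg α ℓ ^ 2 : ℝ) : ℂ) *
      (((x ^ α : ℝ) : ℂ) - exp (τ * I)) := fun x => by
    have := rayPot_spec (α := α) (τ := τ) (ℓ := ℓ) (v := 0) x
    simpa using this
  have he : (exp ((Real.pi / 2 - τ / 2 : ℝ) * I)).re = Real.sin (τ / 2) := by
    rw [Complex.exp_ofReal_mul_I_re, Real.cos_pi_div_two_sub]
  have he2 : (exp ((Real.pi / 2 - τ / 2 : ℝ) * I) * exp (τ * I)).re = -Real.sin (τ / 2) := by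
    rw [← Complex.exp_add, show ((Real.pi / 2 - τ / 2 : ℝ) : ℂ) * I + τ * I =
      ((τ / 2 + Real.pi / 2 : ℝ) : ℂ) * I by push_cast; ring, Complex.exp_ofReal_mul_I_re,
      Real.cos_add_pi_div_two]
  have := Decays.norm_deriv_le (sol_ray h.adm.pos (spec α τ ℓ) 1 m ℓ) hd ha.1
    (M := lrg α ℓ ^ 2) (K := 5) (k := Real.sin (τ / 2))
    (e := exp ((Real.pi / 2 - τ / 2 : ℝ) * I)) (by positivity) (by norm_num) hk
    (Complex.norm_exp_ofReal_mul_I _).le he.ge ?_ ?_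
  · rwa [hsq] at this
  · intro x hx
    have hx0 : 0 ≤ x ^ α := Real.rpow_nonneg (ha.1.trans hx).le _
    rw [hQ, mul_left_comm, re_ofReal_mul, mul_sub, sub_re, mul_comm (exp _) ((x ^ α : ℝ) : ℂ),
      re_ofReal_mul, he, he2, mul_comm]
    refine mul_le_mul_of_nonneg_left ?_ (by positivity)
    nlinarith
  · intro x hx
    rw [hsq] at hx
    have hx0 : 0 < x := lt_of_lt_of_le ha.1 hx.1
    have hx2 : x ≤ 2 := by
      have : 1 / lrg α ℓ ≤ 1 := by rw [div_le_one hL0]; exact hL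
      linarith [hx.2, ha.2]
    rw [hQ, norm_mul, Complex.norm_real, Real.norm_of_nonneg (by positivity), mul_comm]
    refine mul_le_mul_of_nonneg_right ?_ (by positivity)
    refine (norm_sub_le _ _).trans ?_
    rw [Complex.norm_real, Real.norm_of_nonneg (by positivity), Complex.norm_exp_ofReal_mul_I]
    linarith [rpow_le_four h.adm.pos h.adm.lt_two hx0.le hx2]

/-- Growth bound on the real ray near the origin, and bound on the slope at the origin. -/
lemma Geo.origin_bounds (h : Geo α φ φ₀ τ) : ∃ K > 0, ∀ ℓ ≥ 0, ∀ m,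
    DecRay α (spec α τ ℓ) 1 m ℓ → ‖m * exp ℓ‖ ≤ K * lrg α ℓ ∧
      ∀ M ≥ 0, ‖Y α (spec α τ ℓ) 1 m ((-M : ℝ) + ℓ)‖ ≤
        Real.exp (K * lrg α ℓ * Real.exp (-M)) := by
  have hk := h.sin_tau_pos
  set K := 2 * (1 + 5 ^ 2) / Real.sin (τ / 2)
  have hK : 0 < K := by positivity
  refine ⟨K, hK, fun ℓ hℓ m hd => ?_⟩
  have hα := h.adm.pos
  have hL0 : 0 < lrg α ℓ := lrg_pos
  have hy := tendsto_ray_Y hα (spec α τ ℓ) 1 m ℓ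
  have hy' := tendsto_rayd_Yd hα (spec α τ ℓ) 1 m ℓ
  have hs := sol_ray hα (spec α τ ℓ) 1 m ℓ
  have hmem : ∀ a ∈ Ioc (0 : ℝ) 1, ∀ᶠ x in 𝓝[>] (0 : ℝ), x ∈ Ioc (0 : ℝ) a := fun a ha =>
    Ioc_mem_nhdsGT ha.1
  refine ⟨?_, fun M hM => ?_⟩
  · have := le_of_tendsto_of_tendsto hy'.norm (hy.norm.const_mul (K * lrg α ℓ))
      ((hmem 1 (by simp)).mono fun x hx => h.origin_deriv hℓ hd hx)
    simpa using this
  · set a := Real.exp (-M)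
    have ha : a ∈ Ioc (0 : ℝ) 1 := ⟨Real.exp_pos _, Real.exp_le_one_iff.2 (by linarith)⟩
    have e1 : Y α (spec α τ ℓ) 1 m ((-M : ℝ) + ℓ) = ray (Y α (spec α τ ℓ) 1 m) ℓ a := by
      simp [ray, a]
    rw [e1]
    have hlim : Tendsto (fun ε => ‖ray (Y α (spec α τ ℓ) 1 m) ℓ ε‖ *
        Real.exp (K * lrg α ℓ * a)) (𝓝[>] 0) (𝓝 (Real.exp (K * lrg α ℓ * a))) := by
      simpa using hy.norm.mul_const (Real.exp (K * lrg α ℓ * a))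
    refine ge_of_tendsto hlim ((hmem a ha).mono fun ε hε => ?_)
    have := norm_le_exp_of_approx (S := fun _ => 0) (C := K * lrg α ℓ) hε.2
      (fun s hs' => hs.d1 s (hε.1.trans_le hs'.1)) continuousOn_const (fun s hs' => by
        rw [zero_mul, add_zero]
        exact h.origin_deriv hℓ hd ⟨hε.1.trans_le hs'.1, hs'.2.trans ha.2⟩)
    refine this.trans (mul_le_mul_of_nonneg_left (Real.exp_le_exp.2 ?_) (norm_nonneg _))
    simp only [intervalIntegral.integral_zero, zero_re, neg_zero, zero_add]
    exact mul_le_mul_of_nonneg_left (by linarith [hε.1]) (by positivity)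

/-- One segment of the path along which the solution is controlled. -/
lemma norm_Y_segment (hα : 0 < α) {μ p d : ℂ} {a b C Λ : ℝ} (hab : a ≤ b) (hd : ‖d‖ = 1)
    {T : ℝ → ℂ} (hT : ContinuousOn T (Icc a b))
    (h : ∀ s ∈ Icc a b, ‖Yd α μ 1 m (p + s * d) + Λ * T s * Y α μ 1 m (p + s * d)‖ ≤
      C * ‖Y α μ 1 m (p + s * d)‖) :
    ‖Y α μ 1 m (p + b * d)‖ ≤ ‖Y α μ 1 m (p + a * d)‖ *
      Real.exp (-(Λ * (d * ∫ s in a..b, T s).re) + C * (b - a)) := by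
  have := norm_le_exp_of_approx (y := fun s : ℝ => Y α μ 1 m (p + s * d))
    (y' := fun s : ℝ => d * Yd α μ 1 m (p + s * d)) (S := fun s => Λ * d * T s) (C := C) hab
    (fun s _ => ?_) (by fun_prop) (fun s hs => ?_)
  · rw [intervalIntegral.integral_const_mul, mul_assoc, re_ofReal_mul] at this
    exact this
  · have h1 : HasDerivAt (fun s : ℝ => p + (s : ℂ) * d) d s := by
      simpa using ((hasDerivAt_id s).ofReal_comp.mul_const d).const_add p
    exact ((hasDerivAt_Y hα μ 1 m (p + s * d)).comp s h1).congr_deriv (mul_comm _ _)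
  · have := h s hs
    rw [show d * Yd α μ 1 m (p + s * d) + Λ * d * T s * Y α μ 1 m (p + s * d) =
      d * (Yd α μ 1 m (p + s * d) + Λ * T s * Y α μ 1 m (p + s * d)) by ring, norm_mul, hd,
      one_mul]
    exact this

lemma re_nonneg_of_ne {T : ℝ → ℂ} {a b x : ℝ} (hT : ContinuousOn T (Icc a b))
    (hne : ∀ s ∈ Icc a b, (T s).re ≠ 0) (hx : x ∈ Icc a b) (h : 0 ≤ (T x).re) :
    ∀ s ∈ Icc a b, 0 ≤ (T s).re := by
  intro s hs
  by_contra! h0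
  obtain ⟨u, hu, hu0⟩ := isPreconnected_Icc.intermediate_value hs hx
    (f := fun s => (T s).re) (continuous_re.comp_continuousOn hT) (mem_Icc.2 ⟨h0.le, h⟩)
  exact hne u hu hu0

/-- Positivity of the real part of the phase along the path. -/
lemma Geo.re_phase_nonneg (h : Geo α φ φ₀ τ) {L b : ℝ} (hL : 0 ≤ L)
    (hL1 : 1 < Real.exp (α * L) * Real.cos ((α + 2) * φ₀ / 2)) (hbL : b ≤ L)
    (hb : Real.sin (τ + 2 * φ₀) < Real.exp (α * b) * Real.sin ((α + 2) * φ₀)) :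
    (∀ y ∈ Icc 0 (τ / α), 0 ≤ (phase α τ omL (L + y * I)).re) ∧
    (∀ y ∈ Icc (τ / α) φ₀, 0 ≤ (phase α τ omU (L + y * I)).re) ∧
    ∀ x ∈ Icc b L, 0 ≤ (phase α τ omU (x + φ₀ * I)).re := by
  have hα := h.adm.pos
  have hd := h.div_pos
  have hd2 := h.div_lt
  have h1 : ∀ y ∈ Icc 0 (τ / α), 0 ≤ (phase α τ omL (L + y * I)).re := by
    refine re_nonneg_of_ne (h.continuousOn_L.comp (by fun_prop) fun y hy => ?_) (fun y hy => ?_)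
      (x := 0) ⟨le_rfl, hd.le⟩ (by simpa using h.re_phase_real L)
    · simpa [stripL] using hy
    · exact re_ne_zero_of_mem (h.vertical_mem hy.1 (hy.2.trans hd2.le) hL1) (phase_sq omL_ne)
  have h2 : ∀ y ∈ Icc (τ / α) φ₀, 0 ≤ (phase α τ omU (L + y * I)).re := by
    refine re_nonneg_of_ne (h.continuousOn_U.comp (by fun_prop) fun y hy => ?_) (fun y hy => ?_)
      (x := τ / α) ⟨le_rfl, hd2.le⟩ ?_
    · simpa [stripU] using hy
    · exact re_ne_zero_of_mem (h.vertical_mem (hd.le.trans hy.1) hy.2 hL1) (phase_sq omU_ne)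
    · rw [← phase_middle_eq hα hL]
      exact h1 _ ⟨hd.le, le_rfl⟩
  refine ⟨h1, h2, ?_⟩
  refine re_nonneg_of_ne (h.continuousOn_U.comp (by fun_prop) fun y hy => ?_) (fun x hx => ?_)
    (x := L) ⟨hbL, le_rfl⟩ (h2 φ₀ ⟨hd2.le, le_rfl⟩)
  · simpa [stripU] using hd2.le
  · refine re_ne_zero_of_mem (h.top_mem (hb.trans_le ?_)) (phase_sq omU_ne)
    refine mul_le_mul_of_nonneg_right (Real.exp_le_exp.2 ?_) h.sin_theta_pos.le
    exact mul_le_mul_of_nonneg_left hx.1 hα.le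

/-- The subdominant solution, normalised at the origin, evaluated on the boundary ray. -/
theorem Geo.growth (h : Geo α φ φ₀ τ) {b ε : ℝ} (hε : 0 < ε)
    (hb : Real.sin (τ + 2 * φ₀) < Real.exp (α * b) * Real.sin ((α + 2) * φ₀)) :
    ∃ C > 0, ∀ ℓ ≥ 0, ∀ m, (∀ w₀ : ℂ, |w₀.im| < φ → DecRay α (spec α τ ℓ) 1 m w₀) →
      ‖Y α (spec α τ ℓ) 1 m (b + φ₀ * I + ℓ)‖ ≤
        Real.exp (lrg α ℓ * (expo α φ₀ τ (Real.exp b) + ε) + C) ∧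
      ‖Yd α (spec α τ ℓ) 1 m (b + φ₀ * I + ℓ)‖ ≤
        C * lrg α ℓ * ‖Y α (spec α τ ℓ) 1 m (b + φ₀ * I + ℓ)‖ ∧
      ‖m * exp ℓ‖ ≤ C * lrg α ℓ := by
  have hα := h.adm.pos
  have hd := h.div_pos
  have hd2 := h.div_lt
  have hφ := h.phi_pos
  obtain ⟨K, hK, hor⟩ := h.origin_bounds
  obtain ⟨M, hM, hMε⟩ : ∃ M : ℝ, 0 ≤ M ∧ (K + (4 + 4 * φ₀)) * Real.exp (-M) ≤ ε := by
    have h1 : Tendsto (fun M : ℝ => (K + (4 + 4 * φ₀)) * Real.exp (-M)) atTop (𝓝 0) := by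
      simpa using (Real.tendsto_exp_neg_atTop_nhds_zero).const_mul (K + (4 + 4 * φ₀))
    exact ((eventually_ge_atTop 0).and (h1.eventually_le_const hε)).exists
  have hcos : 0 < Real.cos ((α + 2) * φ₀ / 2) :=
    Real.cos_pos_of_mem_Ioo ⟨by nlinarith [Real.pi_pos], by linarith [h.theta_lt]⟩
  obtain ⟨L, hL, hbL, hL1⟩ : ∃ L : ℝ, 0 ≤ L ∧ b ≤ L ∧
      1 < Real.exp (α * L) * Real.cos ((α + 2) * φ₀ / 2) := by
    have h1 : Tendsto (fun L : ℝ => Real.exp (α * L) * Real.cos ((α + 2) * φ₀ / 2)) atTop atTop :=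
      (Real.tendsto_exp_atTop.comp (tendsto_id.const_mul_atTop hα)).atTop_mul_const hcos
    exact ((eventually_ge_atTop 0).and
      ((eventually_ge_atTop b).and (h1.eventually_gt_atTop 1))).exists
  obtain ⟨p1, p2, p3⟩ := h.re_phase_nonneg hL hL1 hbL hb
  set s : Set ℂ := (fun x : ℝ => (x : ℂ)) '' Icc (-M) L ∪
    ((fun y : ℝ => (L + y * I : ℂ)) '' Icc 0 φ₀ ∪ (fun x : ℝ => (x + φ₀ * I : ℂ)) '' Icc b L)
  have hsc : IsCompact s := (isCompact_Icc.image (by fun_prop)).union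
    ((isCompact_Icc.image (by fun_prop)).union (isCompact_Icc.image (by fun_prop)))
  have hsub : s ⊆ coerSet α τ φ := by
    rintro _ (⟨x, -, rfl⟩ | ⟨y, hy, rfl⟩ | ⟨x, hx, rfl⟩)
    · exact h.real_mem x
    · exact h.vertical_mem hy.1 hy.2 hL1
    · refine h.top_mem (hb.trans_le ?_)
      refine mul_le_mul_of_nonneg_right (Real.exp_le_exp.2 ?_) h.sin_theta_pos.le
      exact mul_le_mul_of_nonneg_left hx.1 hα.le
  obtain ⟨C, hC, hwkb⟩ := exists_wkb hα h.adm.lt_two hsc hsub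
  have mem1 : ∀ x ∈ Icc (-M) L, (x : ℂ) ∈ s := fun x hx => Or.inl ⟨x, hx, rfl⟩
  have mem2 : ∀ y ∈ Icc 0 φ₀, (L + y * I : ℂ) ∈ s := fun y hy => Or.inr (Or.inl ⟨y, hy, rfl⟩)
  have mem3 : ∀ x ∈ Icc b L, (x + φ₀ * I : ℂ) ∈ s := fun x hx => Or.inr (Or.inr ⟨x, hx, rfl⟩)
  have hlen : 0 ≤ C * ((L + M) + τ / α + (φ₀ - τ / α) + (L - b)) :=
    mul_nonneg hC.le (by linarith)
  refine ⟨C * ((L + M) + τ / α + (φ₀ - τ / α) + (L - b)) + C + K, by positivity,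
    fun ℓ hℓ m hdec => ?_⟩
  have hL0 : 0 < lrg α ℓ := lrg_pos
  obtain ⟨hm, hY0⟩ := hor ℓ hℓ m (hdec ℓ (by simpa using hφ.trans h.phi_lt))
  have hw := hwkb ℓ hℓ m hdec
  refine ⟨?_, ?_, ?_⟩
  · set F := Y α (spec α τ ℓ) 1 m
    set Λ := lrg α ℓ
    have s1 : ‖F (L + ℓ)‖ ≤ ‖F ((-M : ℝ) + ℓ)‖ * Real.exp
        (-(Λ * (1 * ∫ x in -M..L, phase α τ omL x).re) + C * (L - -M)) := by
      have := norm_Y_segment (m := m) hα (μ := spec α τ ℓ) (p := ℓ) (d := 1) (a := -M) (b := L)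
        (C := C) (Λ := Λ) (T := fun x => phase α τ omL x) (by linarith) (by simp)
        (h.continuousOn_L.comp (by fun_prop) fun x _ => by simpa [stripL] using hd.le)
        (fun x hx => by
          have := (hw _ (mem1 x hx)).2 _ (phase_sq omL_ne) (h.re_phase_real x)
          rwa [mul_one, add_comm (ℓ : ℂ)])
      simpa only [mul_one, add_comm (ℓ : ℂ)] using this
    have s2 : ‖F (L + (τ / α : ℝ) * I + ℓ)‖ ≤ ‖F (L + ℓ)‖ * Real.exp
        (-(Λ * (I * ∫ y in (0 : ℝ)..τ / α, phase α τ omL (L + y * I)).re) + C * (τ / α - 0)) := by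
      have := norm_Y_segment (m := m) hα (μ := spec α τ ℓ) (p := L + ℓ) (d := I) (a := 0)
        (b := τ / α) (C := C) (Λ := Λ) (T := fun y => phase α τ omL (L + y * I)) hd.le (by simp)
        (h.continuousOn_L.comp (by fun_prop) fun x hx => by simpa [stripL] using hx)
        (fun x hx => by
          have := (hw _ (mem2 x ⟨hx.1, hx.2.trans hd2.le⟩)).2 _ (phase_sq omL_ne) (p1 x hx)
          rwa [add_right_comm (L : ℂ)])
      simpa only [ofReal_zero, zero_mul, add_zero, add_right_comm (L : ℂ) ℓ] using this
    have s3 : ‖F (L + φ₀ * I + ℓ)‖ ≤ ‖F (L + (τ / α : ℝ) * I + ℓ)‖ * Real.exp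
        (-(Λ * (I * ∫ y in τ / α..φ₀, phase α τ omU (L + y * I)).re) + C * (φ₀ - τ / α)) := by
      have := norm_Y_segment (m := m) hα (μ := spec α τ ℓ) (p := L + ℓ) (d := I) (a := τ / α)
        (b := φ₀) (C := C) (Λ := Λ) (T := fun y => phase α τ omU (L + y * I)) hd2.le (by simp)
        (h.continuousOn_U.comp (by fun_prop) fun x hx => by simpa [stripU] using hx)
        (fun x hx => by
          have := (hw _ (mem2 x ⟨hd.le.trans hx.1, hx.2⟩)).2 _ (phase_sq omU_ne) (p2 x hx)
          rwa [add_right_comm (L : ℂ)])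
      simpa only [add_right_comm (L : ℂ) ℓ] using this
    have s4 : ‖F (b + φ₀ * I + ℓ)‖ ≤ ‖F (L + φ₀ * I + ℓ)‖ * Real.exp
        (-(Λ * (-1 * ∫ x in b..L, phase α τ omU (x + φ₀ * I)).re) + C * (-b - -L)) := by
      have e1 : ∀ x : ℝ, (φ₀ * I + ℓ + x * -1 : ℂ) = ((-x : ℝ) : ℂ) + φ₀ * I + ℓ := fun x => by
        push_cast; ring
      have := norm_Y_segment (m := m) hα (μ := spec α τ ℓ) (p := φ₀ * I + ℓ) (d := -1) (a := -L)
        (b := -b) (C := C) (Λ := Λ) (T := fun x => phase α τ omU ((-x : ℝ) + φ₀ * I))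
        (by linarith) (by simp)
        (h.continuousOn_U.comp (by fun_prop) fun x hx => by simpa [stripU] using hd2.le)
        (fun x hx => by
          have hx' : -x ∈ Icc b L := ⟨by linarith [hx.2], by linarith [hx.1]⟩
          have := (hw _ (mem3 (-x) hx')).2 _ (phase_sq omU_ne) (p3 (-x) hx')
          rwa [e1])
      rw [intervalIntegral.integral_comp_neg
        (f := fun x : ℝ => phase α τ omU ((x : ℝ) + φ₀ * I))] at this
      simpa only [e1, neg_neg] using this
    have s0 := hY0 M hM
    have hcon := h.contour_re (b := b) hM hL
    have e2 : -(Λ * (contour α φ₀ τ M L b).re) =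
        -(Λ * (1 * ∫ x in -M..L, phase α τ omL x).re) +
        -(Λ * (I * ∫ y in (0 : ℝ)..τ / α, phase α τ omL (L + y * I)).re) +
        -(Λ * (I * ∫ y in τ / α..φ₀, phase α τ omU (L + y * I)).re) +
        -(Λ * (-1 * ∫ x in b..L, phase α τ omU (x + φ₀ * I)).re) := by
      unfold contour
      rw [sub_re, add_re, add_re, one_mul, neg_one_mul, neg_re]
      ring
    have hchain := s4.trans (mul_le_mul_of_nonneg_right (s3.trans (mul_le_mul_of_nonneg_right
      (s2.trans (mul_le_mul_of_nonneg_right (s1.trans (mul_le_mul_of_nonneg_right s0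
        (Real.exp_pos _).le)) (Real.exp_pos _).le)) (Real.exp_pos _).le)) (Real.exp_pos _).le)
    rw [← Real.exp_add, ← Real.exp_add, ← Real.exp_add, ← Real.exp_add] at hchain
    refine hchain.trans (Real.exp_le_exp.2 ?_)
    have h5 := mul_le_mul_of_nonneg_left hcon hL0.le
    have h6 := mul_le_mul_of_nonneg_left hMε hL0.le
    have h7 : K * Λ * Real.exp (-M) = Λ * (K * Real.exp (-M)) := by ring
    have hCK : 0 ≤ C + K := by positivity
    rw [h7]
    have h8 : Λ * -(contour α φ₀ τ M L b).re = -(Λ * (contour α φ₀ τ M L b).re) := by ring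
    rw [h8, e2] at h5
    linarith
  · have := (hw _ (mem3 b ⟨le_rfl, hbL⟩)).1
    refine this.trans (mul_le_mul_of_nonneg_right (mul_le_mul_of_nonneg_right ?_ hL0.le)
      (norm_nonneg _))
    linarith
  · exact hm.trans (mul_le_mul_of_nonneg_right (by linarith) hL0.le)

end PowerPotential

namespace PowerPotential
open Complex Filter Topology ComplexConjugate

variable {α φ φ₀ τ ℓ : ℝ} {m e : ℂ} {Q y y' : ℝ → ℂ}

/-- Backward Gronwall bound for a second order equation. -/
lemma Sol.norm_le_backward (h : Sol Q y y') {a b N x : ℝ} (ha : 0 < a) (hN : 0 ≤ N)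
    (hQ : ∀ x ∈ Icc a b, ‖Q x‖ ≤ N ^ 2) (hx : x ∈ Icc a b) :
    max (N * ‖y x‖) ‖y' x‖ ≤ max (N * ‖y b‖) ‖y' b‖ * Real.exp (N * (b - a)) := by
  have hab : a ≤ b := hx.1.trans hx.2
  have hnorm : ∀ x, ‖((N : ℂ) * y x, y' x)‖ = max (N * ‖y x‖) ‖y' x‖ := fun x => by
    rw [Prod.norm_def, norm_mul, Complex.norm_real, Real.norm_of_nonneg hN]
  set V : ℝ → ℂ × ℂ := fun s => ((N : ℂ) * y (-s), y' (-s)) with hV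
  have hd : ∀ s ∈ Icc (-b) (-a),
      HasDerivAt V (-((N : ℂ) * y' (-s)), -(Q (-s) * y (-s))) s := fun s hs => by
    have hs0 : 0 < -s := by linarith [hs.2]
    have h1 := (h.d1 _ hs0).scomp s (hasDerivAt_neg s)
    have h2 := (h.d2 _ hs0).scomp s (hasDerivAt_neg s)
    refine ((h1.const_mul (N : ℂ)).prodMk h2).congr_deriv ?_
    simp
  have hg := norm_le_gronwallBound_of_norm_deriv_right_le (f := V) (K := N) (ε := 0)
    (δ := max (N * ‖y b‖) ‖y' b‖) (a := -b) (b := -a)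
    (fun s hs => (hd s hs).continuousAt.continuousWithinAt)
    (fun s hs => (hd s (Ico_subset_Icc_self hs)).hasDerivWithinAt)
    (by simp only [hV, hnorm, neg_neg]; exact le_rfl)
    (fun s hs => ?_) (-x) ⟨by linarith [hx.2], by linarith [hx.1]⟩
  · simp only [hV, neg_neg, hnorm, gronwallBound_ε0] at hg
    refine hg.trans (mul_le_mul_of_nonneg_left (Real.exp_le_exp.2 ?_)
      ((norm_nonneg _).trans (le_max_right _ _)))
    exact mul_le_mul_of_nonneg_left (by linarith [hx.1]) hN
  · simp only [hV, hnorm, add_zero, Prod.norm_def, norm_neg, norm_mul, Complex.norm_real,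
      Real.norm_of_nonneg hN]
    refine max_le (mul_le_mul_of_nonneg_left (le_max_right _ _) hN) ?_
    have := hQ (-s) ⟨by linarith [hs.2], by linarith [hs.1]⟩
    calc ‖Q (-s)‖ * ‖y (-s)‖ ≤ N ^ 2 * ‖y (-s)‖ :=
          mul_le_mul_of_nonneg_right this (norm_nonneg _)
      _ = N * (N * ‖y (-s)‖) := by ring
      _ ≤ _ := mul_le_mul_of_nonneg_left (le_max_left _ _) hN

/-- Energy bound on an interval where the imaginary part of the potential has a sign. -/
lemma Sol.integral_sq_le (h : Sol Q y y') {a b N : ℝ} (ha : 0 < a) (hab : a ≤ b)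
    (hN : ∀ x ∈ Icc a b, N ≤ (I * Q x).re) :
    N * ∫ x in a..b, ‖y x‖ ^ 2 ≤ ‖y' b‖ * ‖y b‖ + ‖y' a‖ * ‖y a‖ := by
  have hsub : Icc a b ⊆ Ioi 0 := fun x hx => lt_of_lt_of_le ha hx.1
  have hcy := h.contY.mono hsub
  have hcQ := h.cont.mono hsub
  have h1 := h.re_energy_interval ha hab I
  simp only [I_re, zero_mul, zero_add] at h1
  have h2 : ∫ x in a..b, N * ‖y x‖ ^ 2 ≤ ∫ x in a..b, (I * Q x).re * ‖y x‖ ^ 2 := by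
    refine intervalIntegral.integral_mono_on hab ?_ ?_ fun x hx =>
      mul_le_mul_of_nonneg_right (hN x hx) (by positivity)
    · exact ContinuousOn.intervalIntegrable_of_Icc hab (by fun_prop)
    · exact ContinuousOn.intervalIntegrable_of_Icc hab
        ((continuous_re.comp_continuousOn (continuousOn_const.mul hcQ)).mul (by fun_prop))
  rw [intervalIntegral.integral_const_mul, h1] at h2
  have h3 : ∀ x, |(I * (y' x * conj (y x))).re| ≤ ‖y' x‖ * ‖y x‖ := fun x => by
    refine (abs_re_le_norm _).trans_eq ?_
    rw [norm_mul, norm_mul, norm_I, one_mul, Complex.norm_conj]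
  have := (le_abs_self _).trans (h3 b)
  have := (neg_le_abs _).trans (h3 a)
  linarith

/-- Gluing the bounds in the coercive region, near the turning point and near the origin. -/
lemma Decays.integral_le_pieces (h : Sol Q y y') (hd : Decays Q y y') {s r k κ Λ N C G : ℝ}
    (hs : 0 < s) (hsr : s ≤ r) (hr : r ≤ 1) (hk : 0 < k) (hκ : 0 < κ) (hΛ : 0 < Λ) (hN : 0 < N)
    (he : ‖e‖ ≤ 1) (hke : k ≤ e.re) (htail : ∀ x > 1, k * Λ ^ 2 ≤ (e * Q x).re)
    (hC : ‖y' 1‖ ≤ C * Λ * ‖y 1‖) (hCG : C ≤ G) (hNG : N ≤ G)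
    (hmid : ∀ x ∈ Icc r 1, ‖Q x‖ ≤ (N * Λ) ^ 2)
    (hin : ∀ x ∈ Icc s r, κ * Λ ^ 2 ≤ (I * Q x).re) {D : ℝ}
    (hD : ‖y 1‖ * Real.exp (N * Λ * (1 - r)) ≤ D) :
    ∫ x in Ioi s, ‖y x‖ ^ 2 ≤ G / k * D ^ 2 / Λ + (G / N * D) ^ 2 +
      G ^ 2 / N / κ * D ^ 2 / Λ + (‖y' s‖ * ‖y s‖) / (κ * Λ ^ 2) := by
  have hG : 0 < G := hN.trans_le hNG
  have hy1 : ‖y 1‖ ≤ D := by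
    refine le_trans ?_ hD
    exact le_mul_of_one_le_right (norm_nonneg _) (Real.one_le_exp (by
      have : 0 ≤ 1 - r := by linarith
      positivity))
  have hD0 : 0 ≤ D := (norm_nonneg _).trans hy1
  have hr0 : 0 < r := hs.trans_le hsr
  have hInt := Decays.sq_integrable h hd hs
  have hInt1 := Decays.sq_integrable h hd one_pos
  have hsplit : ∫ x in Ioi s, ‖y x‖ ^ 2 = (∫ x in s..r, ‖y x‖ ^ 2) + (∫ x in r..1, ‖y x‖ ^ 2) +
      ∫ x in Ioi 1, ‖y x‖ ^ 2 := by
    have hsub : ∀ a b : ℝ, s ≤ a → a ≤ b →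
        IntervalIntegrable (fun x => ‖y x‖ ^ 2) volume a b := fun a b ha hab => by
      rw [intervalIntegrable_iff_integrableOn_Ioc_of_le hab]
      exact hInt.mono_set fun x hx => lt_of_le_of_lt ha hx.1
    rw [intervalIntegral.integral_add_adjacent_intervals (hsub s r le_rfl hsr) (hsub r 1 hsr hr),
      intervalIntegral.integral_of_le (hsr.trans hr), ← setIntegral_union
        (Ioc_disjoint_Ioi_same) measurableSet_Ioi
        (hInt.mono_set Ioc_subset_Ioi_self) hInt1, Ioc_union_Ioi_eq_Ioi (hsr.trans hr)]
  have hback : ∀ x ∈ Icc r 1, max (N * Λ * ‖y x‖) ‖y' x‖ ≤ G * Λ * D := fun x hx => by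
    refine (h.norm_le_backward hr0 (by positivity) hmid hx).trans ?_
    have h1 : max (N * Λ * ‖y 1‖) ‖y' 1‖ ≤ G * Λ * ‖y 1‖ :=
      max_le (by gcongr) (hC.trans (by gcongr))
    calc _ ≤ G * Λ * ‖y 1‖ * Real.exp (N * Λ * (1 - r)) := by gcongr
      _ = G * Λ * (‖y 1‖ * Real.exp (N * Λ * (1 - r))) := by ring
      _ ≤ _ := by gcongr
  have hyx : ∀ x ∈ Icc r 1, ‖y x‖ ≤ G / N * D := fun x hx => by
    have h1 : N * Λ * ‖y x‖ ≤ N * Λ * (G / N * D) := by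
      refine (le_max_left _ _).trans ((hback x hx).trans_eq ?_)
      field_simp
    exact le_of_mul_le_mul_left h1 (by positivity)
  have htl : ∫ x in Ioi 1, ‖y x‖ ^ 2 ≤ G / k * D ^ 2 / Λ := by
    have h1 := Decays.energy_le h hd one_pos he hke htail
    have h2 : 0 ≤ ∫ x in Ioi 1, ‖y' x‖ ^ 2 := integral_nonneg fun x => by positivity
    have h3 : k * Λ ^ 2 * ∫ x in Ioi 1, ‖y x‖ ^ 2 ≤ k * Λ ^ 2 * (G / k * D ^ 2 / Λ) := by
      calc _ ≤ ‖y' 1‖ * ‖y 1‖ := by nlinarith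
        _ ≤ (G * Λ * D) * D := by
          gcongr
          exact (le_max_right _ _).trans (hback 1 ⟨hr, le_rfl⟩)
        _ = _ := by field_simp
    exact le_of_mul_le_mul_left h3 (by positivity)
  have hmd : ∫ x in r..1, ‖y x‖ ^ 2 ≤ (G / N * D) ^ 2 := by
    have h1 := intervalIntegral.norm_integral_le_of_norm_le_const (a := r) (b := 1)
      (f := fun x => ‖y x‖ ^ 2) (C := (G / N * D) ^ 2) fun x hx => by
        rw [uIoc_of_le hr] at hx
        rw [norm_pow, norm_norm]
        exact pow_le_pow_left₀ (norm_nonneg _) (hyx x ⟨hx.1.le, hx.2⟩) 2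
    refine (le_abs_self _).trans (h1.trans ?_)
    rw [abs_of_nonneg (by linarith)]
    exact mul_le_of_le_one_right (by positivity) (by linarith)
  have hinn : ∫ x in s..r, ‖y x‖ ^ 2 ≤
      G ^ 2 / N / κ * D ^ 2 / Λ + (‖y' s‖ * ‖y s‖) / (κ * Λ ^ 2) := by
    have h1 := h.integral_sq_le hs hsr hin
    have h2 : ‖y' r‖ * ‖y r‖ ≤ (G * Λ * D) * (G / N * D) := by
      gcongr
      · exact (le_max_right _ _).trans (hback r ⟨le_rfl, hr⟩)
      · exact hyx r ⟨le_rfl, hr⟩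
    have h3 : κ * Λ ^ 2 * ∫ x in s..r, ‖y x‖ ^ 2 ≤ κ * Λ ^ 2 *
        (G ^ 2 / N / κ * D ^ 2 / Λ + (‖y' s‖ * ‖y s‖) / (κ * Λ ^ 2)) := by
      refine (h1.trans (add_le_add_left h2 _)).trans_eq ?_
      field_simp
    exact le_of_mul_le_mul_left h3 (by positivity)
  linarith

end PowerPotential

namespace PowerPotential
open Complex Filter Topology ComplexConjugate

variable {α φ φ₀ τ ℓ : ℝ} {m e : ℂ}

/-- The turning radius on the ray of angle `φ₀`. -/
noncomputable def turn (α φ₀ τ : ℝ) : ℝ :=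
  (Real.sin (τ + 2 * φ₀) / Real.sin ((α + 2) * φ₀)) ^ (1 / α)

lemma Geo.turn_pos (h : Geo α φ φ₀ τ) : 0 < turn α φ₀ τ :=
  Real.rpow_pos_of_pos (_root_.div_pos h.sin_t_pos h.sin_theta_pos) _

lemma Geo.turn_rpow (h : Geo α φ φ₀ τ) :
    turn α φ₀ τ ^ α = Real.sin (τ + 2 * φ₀) / Real.sin ((α + 2) * φ₀) := by
  unfold turn
  rw [← Real.rpow_mul (_root_.div_pos h.sin_t_pos h.sin_theta_pos).le,
    one_div_mul_cancel h.adm.pos.ne', Real.rpow_one]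

lemma Geo.continuousAt_expo (h : Geo α φ φ₀ τ) {Z : ℝ} (hZ : 0 < Z) :
    ContinuousAt (expo α φ₀ τ) Z := by
  have hc : Continuous fun x : ℝ => tint α (α * φ₀ - τ) (max x 0) :=
    (continuousOn_tint h.adm.pos h.beta_nonneg h.beta_le_pi).comp_continuous (by fun_prop)
      fun x => mem_Ici.2 (le_max_right _ _)
  have hp := intervalIntegral.continuous_primitive (μ := volume)
    (fun a b => hc.intervalIntegrable a b) 0
  have h1 : ContinuousAt (fun Z : ℝ => -(2 * Real.sin (τ * ord α) * kap0 α) -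
      (exp (((τ + 2 * φ₀) / 2 : ℝ) * I) *
        ∫ ξ in (0 : ℝ)..Z, tint α (α * φ₀ - τ) (max ξ 0)).re) Z := by fun_prop
  refine h1.congr ?_
  filter_upwards [lt_mem_nhds hZ] with x hx
  unfold expo
  congr 3
  refine intervalIntegral.integral_congr fun s hs => ?_
  rw [uIcc_of_le hx.le] at hs
  simp only [max_eq_left hs.1]

lemma rayPot_top (b : ℝ) (x : ℝ) : rayPot α (spec α τ ℓ) (b + φ₀ * I + ℓ) x =
    ((lrg α ℓ ^ 2 : ℝ) : ℂ) * (((Real.exp ((α + 2) * b) * x ^ α : ℝ) : ℂ) *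
      exp (((α + 2) * φ₀ : ℝ) * I) -
      ((Real.exp (2 * b) : ℝ) : ℂ) * exp ((τ + 2 * φ₀ : ℝ) * I)) := by
  have h1 : exp ((α + 2) * (b + φ₀ * I)) = ((Real.exp ((α + 2) * b) : ℝ) : ℂ) *
      exp (((α + 2) * φ₀ : ℝ) * I) := by
    rw [ofReal_exp, ← Complex.exp_add]; congr 1; push_cast; ring
  have h2 : exp (2 * (b + φ₀ * I) + τ * I) = ((Real.exp (2 * b) : ℝ) : ℂ) *
      exp ((τ + 2 * φ₀ : ℝ) * I) := by
    rw [ofReal_exp, ← Complex.exp_add]; congr 1; push_cast; ring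
  rw [rayPot_spec, h1, h2]
  push_cast
  ring

lemma norm_rayPot_top_le {b x : ℝ} (h0 : 0 ≤ x) (h1 : x ≤ 1) (hα : 0 < α) :
    ‖rayPot α (spec α τ ℓ) (b + φ₀ * I + ℓ) x‖ ≤
      lrg α ℓ ^ 2 * (Real.exp ((α + 2) * b) + Real.exp (2 * b)) := by
  rw [rayPot_top, norm_mul, Complex.norm_real, Real.norm_of_nonneg (by positivity)]
  refine mul_le_mul_of_nonneg_left ((norm_sub_le _ _).trans ?_) (by positivity)
  rw [norm_mul, norm_mul, Complex.norm_exp_ofReal_mul_I, Complex.norm_exp_ofReal_mul_I, mul_one,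
    mul_one, Complex.norm_real, Complex.norm_real, Real.norm_of_nonneg (by positivity),
    Real.norm_of_nonneg (by positivity)]
  exact add_le_add_left (mul_le_of_le_one_right (by positivity) (Real.rpow_le_one h0 h1 hα.le)) _

lemma re_I_mul_rayPot_top (b x : ℝ) :
    (I * rayPot α (spec α τ ℓ) (b + φ₀ * I + ℓ) x).re = lrg α ℓ ^ 2 *
      (Real.exp (2 * b) * Real.sin (τ + 2 * φ₀) -
        Real.exp ((α + 2) * b) * x ^ α * Real.sin ((α + 2) * φ₀)) := by
  rw [rayPot_top, I_mul_re, im_ofReal_mul, sub_im, im_ofReal_mul, im_ofReal_mul,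
    Complex.exp_ofReal_mul_I_im, Complex.exp_ofReal_mul_I_im]
  ring

set_option maxHeartbeats 800000 in
/-- If the growth rate at the turning radius is negative, then the normalised decaying solutions
on the boundary ray are square integrable, uniformly. -/
theorem Geo.integral_bound (h : Geo α φ φ₀ τ) (hneg : expo α φ₀ τ (turn α φ₀ τ) < 0) :
    ∃ b B : ℝ, ∀ ℓ ≥ 0, ∀ m, (∀ w₀ : ℂ, |w₀.im| < φ → DecRay α (spec α τ ℓ) 1 m w₀) →
      ∫ x in Ioi 0, ‖ray (Y α (spec α τ ℓ) 1 m) (b + φ₀ * I + ℓ) x‖ ^ 2 ≤ B / lrg α ℓ := by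
  have hα := h.adm.pos
  have hZ := h.turn_pos
  have hsθ := h.sin_theta_pos
  have hst := h.sin_t_pos
  have hφ := h.phi_pos
  set Z := turn α φ₀ τ
  set β := Real.log Z + 1
  set N := Real.exp ((α + 2) * β) + Real.exp (2 * β) + 1
  have hN : 1 ≤ N := by
    have := Real.exp_pos ((α + 2) * β)
    have := Real.exp_pos (2 * β)
    linarith
  set σ := -(expo α φ₀ τ Z) / 2 with hσd
  have hσ : 0 < σ := by linarith
  obtain ⟨δ, hδ0, hδ1, hδ⟩ : ∃ δ : ℝ, 0 < δ ∧ δ ≤ 1 ∧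
      expo α φ₀ τ (Real.exp (Real.log Z + δ)) + δ + 2 * N * δ ≤ -σ := by
    have hc : ContinuousAt (fun δ : ℝ => expo α φ₀ τ (Real.exp (Real.log Z + δ)) + δ + 2 * N * δ)
        0 := by
      have h1 : ContinuousAt (fun δ : ℝ => expo α φ₀ τ (Real.exp (Real.log Z + δ))) 0 := by
        refine ContinuousAt.comp (g := expo α φ₀ τ) (h.continuousAt_expo (Real.exp_pos _)) ?_
        fun_prop
      fun_prop
    have h2 : expo α φ₀ τ (Real.exp (Real.log Z + 0)) + 0 + 2 * N * 0 < -σ := by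
      rw [add_zero, add_zero, mul_zero, add_zero, Real.exp_log hZ]; linarith
    have h3 := (hc.eventually_lt_const h2).filter_mono (nhdsWithin_le_nhds (s := Ioi 0))
    obtain ⟨δ, h4, h5⟩ := (h3.and (Ioc_mem_nhdsGT one_pos)).exists
    exact ⟨δ, h5.1, h5.2, h4.le⟩
  set b := Real.log Z + δ with hb
  set r := Real.exp (-(2 * δ)) with hr
  have hr1 : r ≤ 1 := Real.exp_le_one_iff.2 (by linarith)
  have hr0 : 0 < r := Real.exp_pos _
  have hr2 : 1 - r ≤ 2 * δ := by linarith [Real.add_one_le_exp (-(2 * δ))]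
  have heb : Real.exp (α * b) * Real.sin ((α + 2) * φ₀) =
      Real.exp (α * δ) * Real.sin (τ + 2 * φ₀) := by
    have h1 : Real.exp (α * b) = Z ^ α * Real.exp (α * δ) := by
      rw [Real.rpow_def_of_pos hZ, ← Real.exp_add, hb]; ring_nf
    rw [h1, h.turn_rpow, mul_right_comm, div_mul_cancel₀ _ hsθ.ne', mul_comm]
  have hbt : Real.sin (τ + 2 * φ₀) < Real.exp (α * b) * Real.sin ((α + 2) * φ₀) := by
    rw [heb]
    exact lt_mul_of_one_lt_left hst (Real.one_lt_exp_iff.2 (by positivity))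
  obtain ⟨C, hC, hgr⟩ := h.growth hδ0 hbt
  obtain ⟨k, hk, hco⟩ := exists_uniform_coer (isCompact_singleton (x := (b + φ₀ * I : ℂ)))
    (singleton_subset_iff.2 (h.top_mem hbt))
  obtain ⟨e, he⟩ := hco _ rfl
  set κ := Real.exp (2 * b) * Real.sin (τ + 2 * φ₀) * (1 - Real.exp (-(α * δ))) with hκd
  have hκ : 0 < κ := by
    have : Real.exp (-(α * δ)) < 1 := Real.exp_lt_one_iff.2 (by
      have : 0 < α * δ := by positivity
      linarith)
    have : 0 < 1 - Real.exp (-(α * δ)) := by linarith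
    positivity
  set G := max C N with hG
  have hN0 : 0 < N := by linarith
  have hG0 : 0 < G := hN0.trans_le (le_max_right _ _)
  refine ⟨b, G / k * Real.exp (2 * C) + (G / N) ^ 2 * (Real.exp (2 * C) / (2 * σ)) +
    G ^ 2 / N / κ * Real.exp (2 * C) + C * Real.exp b / κ, fun ℓ hℓ m hdec => ?_⟩
  obtain ⟨g1, g2, g3⟩ := hgr ℓ hℓ m hdec
  set Λ := lrg α ℓ
  have hΛ : 0 < Λ := lrg_pos
  have hw : |(b + φ₀ * I + ℓ : ℂ).im| < φ := by simpa [abs_of_pos hφ] using h.phi_lt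
  have hd := hdec _ hw
  have hs := sol_ray hα (spec α τ ℓ) 1 m (b + φ₀ * I + ℓ)
  set y := ray (Y α (spec α τ ℓ) 1 m) (b + φ₀ * I + ℓ) with hy
  set y' := rayd (Yd α (spec α τ ℓ) 1 m) (b + φ₀ * I + ℓ) with hy'
  have y1 : y 1 = Y α (spec α τ ℓ) 1 m (b + φ₀ * I + ℓ) := ray_one _ _
  have y1' : y' 1 = Yd α (spec α τ ℓ) 1 m (b + φ₀ * I + ℓ) := rayd_one _ _
  rw [← y1, ← y1'] at g2
  rw [← y1] at g1
  set D := Real.exp (-(σ * Λ) + C) with hDd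
  have hD : ‖y 1‖ * Real.exp (N * Λ * (1 - r)) ≤ D := by
    refine (mul_le_mul_of_nonneg_right g1 (Real.exp_pos _).le).trans ?_
    rw [← Real.exp_add]
    refine Real.exp_le_exp.2 ?_
    have h1 : N * Λ * (1 - r) ≤ N * Λ * (2 * δ) :=
      mul_le_mul_of_nonneg_left hr2 (by positivity)
    have h2 := mul_le_mul_of_nonneg_left hδ hΛ.le
    linarith
  have hDsq : D ^ 2 = Real.exp (2 * C) * Real.exp (-(2 * σ * Λ)) := by
    rw [hDd, ← Real.exp_nat_mul, ← Real.exp_add]; congr 1; push_cast; ring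
  have hD1 : D ^ 2 ≤ Real.exp (2 * C) := by
    rw [hDsq]
    refine mul_le_of_le_one_right (Real.exp_pos _).le (Real.exp_le_one_iff.2 ?_)
    have : 0 < 2 * σ * Λ := by positivity
    linarith
  have hD2 : D ^ 2 ≤ Real.exp (2 * C) / (2 * σ) / Λ := by
    rw [hDsq, Real.exp_neg, div_div, ← div_eq_mul_inv]
    refine div_le_div_of_nonneg_left (Real.exp_pos _).le (by positivity) ?_
    linarith [Real.add_one_le_exp (2 * σ * Λ)]
  have hmid : ∀ x ∈ Icc r 1, ‖rayPot α (spec α τ ℓ) (b + φ₀ * I + ℓ) x‖ ≤ (N * Λ) ^ 2 := by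
    intro x hx
    refine (norm_rayPot_top_le (hr0.le.trans hx.1) hx.2 hα).trans ?_
    have hbβ : b ≤ β := by linarith
    have h1 : Real.exp ((α + 2) * b) + Real.exp (2 * b) ≤ N := by
      have h2 : Real.exp ((α + 2) * b) ≤ Real.exp ((α + 2) * β) :=
        Real.exp_le_exp.2 (mul_le_mul_of_nonneg_left hbβ (by linarith))
      have h3 : Real.exp (2 * b) ≤ Real.exp (2 * β) := Real.exp_le_exp.2 (by linarith)
      linarith
    rw [mul_pow, mul_comm]
    refine mul_le_mul_of_nonneg_right (h1.trans ?_) (by positivity)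
    nlinarith
  have hin : ∀ x, 0 ≤ x → x ≤ r →
      κ * Λ ^ 2 ≤ (I * rayPot α (spec α τ ℓ) (b + φ₀ * I + ℓ) x).re := by
    intro x hx0 hxr
    rw [re_I_mul_rayPot_top, mul_comm]
    refine mul_le_mul_of_nonneg_left ?_ (by positivity)
    have h1 : x ^ α ≤ Real.exp (-(2 * α * δ)) := by
      refine (Real.rpow_le_rpow hx0 hxr hα.le).trans_eq ?_
      rw [hr, ← Real.exp_mul]; ring_nf
    have h2 : Real.exp ((α + 2) * b) * x ^ α * Real.sin ((α + 2) * φ₀) =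
        Real.exp (2 * b) * x ^ α * (Real.exp (α * b) * Real.sin ((α + 2) * φ₀)) := by
      rw [show (α + 2) * b = 2 * b + α * b by ring, Real.exp_add]; ring
    rw [h2, heb]
    have h3 : Real.exp (-(2 * α * δ)) * Real.exp (α * δ) = Real.exp (-(α * δ)) := by
      rw [← Real.exp_add]; ring_nf
    have h4 : x ^ α * Real.exp (α * δ) ≤ Real.exp (-(α * δ)) := by
      rw [← h3]; gcongr
    have h5 := mul_le_mul_of_nonneg_left h4
      (by positivity : 0 ≤ Real.exp (2 * b) * Real.sin (τ + 2 * φ₀))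
    rw [hκd]
    linarith
  have hbound : ∀ s ∈ Ioc 0 r, ∫ x in Ioi s, ‖y x‖ ^ 2 ≤ G / k * D ^ 2 / Λ + (G / N * D) ^ 2 +
      G ^ 2 / N / κ * D ^ 2 / Λ + (‖y' s‖ * ‖y s‖) / (κ * Λ ^ 2) := fun s hs' =>
    Decays.integral_le_pieces hs hd hs'.1 hs'.2 hr1 hk hκ hΛ hN0 he.norm_le he.le_re
      (fun x hx => he.le_rayPot hα (le_of_lt hx)) g2 (le_max_left _ _) (le_max_right _ _) hmid
      (fun x hx => hin x (hs'.1.le.trans hx.1) hx.2) hD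
  have hlim := (((tendsto_rayd_Yd hα (spec α τ ℓ) 1 m (b + φ₀ * I + ℓ)).norm.mul
    (tendsto_ray_Y hα (spec α τ ℓ) 1 m (b + φ₀ * I + ℓ)).norm).div_const (κ * Λ ^ 2)).const_add
      (G / k * D ^ 2 / Λ + (G / N * D) ^ 2 + G ^ 2 / N / κ * D ^ 2 / Λ)
  have hfin := le_of_tendsto_of_tendsto (tendsto_integral_Ioi_zero (hd.sq_integrable hα)) hlim
    ((show ∀ᶠ s in 𝓝[>] (0 : ℝ), s ∈ Ioc 0 r from Ioc_mem_nhdsGT hr0).mono hbound)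
  refine hfin.trans ?_
  have hm : ‖m * exp (b + φ₀ * I + ℓ)‖ * ‖(1 : ℂ)‖ ≤ C * Real.exp b * Λ := by
    have h1 : ‖m * exp (b + φ₀ * I + ℓ)‖ = Real.exp b * ‖m * exp ℓ‖ := by
      rw [norm_mul, norm_mul, Complex.norm_exp, Complex.norm_exp]
      simp [Real.exp_add]; ring
    rw [h1, norm_one, mul_one]
    exact (mul_le_mul_of_nonneg_left g3 (Real.exp_pos b).le).trans_eq (by ring)
  have t1 : G / k * D ^ 2 / Λ ≤ G / k * Real.exp (2 * C) / Λ := by gcongr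
  have t2 : (G / N * D) ^ 2 ≤ (G / N) ^ 2 * (Real.exp (2 * C) / (2 * σ)) / Λ := by
    rw [mul_pow, mul_div_assoc]; gcongr
  have t3 : G ^ 2 / N / κ * D ^ 2 / Λ ≤ G ^ 2 / N / κ * Real.exp (2 * C) / Λ := by gcongr
  have t4 : ‖m * exp (b + φ₀ * I + ℓ)‖ * ‖(1 : ℂ)‖ / (κ * Λ ^ 2) ≤ C * Real.exp b / κ / Λ := by
    calc _ ≤ C * Real.exp b * Λ / (κ * Λ ^ 2) := by gcongr
      _ = _ := by field_simp
  rw [add_div, add_div, add_div]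
  linarith

end PowerPotential

namespace PowerPotential
open Complex Filter Topology ComplexConjugate

variable {α φ φ₀ τ θ t ℓ : ℝ} {m e w₀ : ℂ}

/-- The uniform bound on the original ray. -/
theorem Geo.ray_bound (h : Geo α φ φ₀ τ) (hneg : expo α φ₀ τ (turn α φ₀ τ) < 0)
    (hw : w₀.im = φ₀) : ∃ X B : ℝ, ∀ z : ℂ, X ≤ z.re → z.im = τ + 2 * φ₀ →
      ∃ m, DecRay α (exp (-(2 * w₀)) * exp z) 1 m w₀ ∧
        ∫ x in Ioi 0, ‖ray (Y α (exp (-(2 * w₀)) * exp z) 1 m) w₀ x‖ ^ 2 ≤ B := by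
  obtain ⟨b, B, hB⟩ := h.integral_bound hneg
  have hα := h.adm.pos
  refine ⟨2 * w₀.re, Real.exp (b - w₀.re) * |B|, fun z hz1 hz2 => ?_⟩
  set ℓ := (z.re - 2 * w₀.re) / α with hℓd
  have hℓ : 0 ≤ ℓ := div_nonneg (by linarith) hα.le
  have hμ : exp (-(2 * w₀)) * exp z = spec α τ ℓ := by
    unfold spec
    rw [← Complex.exp_add]
    have h1 : α * ℓ = z.re - 2 * w₀.re := by rw [hℓd]; field_simp
    congr 1
    refine Complex.ext ?_ ?_
    · simp only [add_re, neg_re, re_ofReal_mul, ofReal_re, I_re, mul_zero, add_zero, h1]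
      simp; ring
    · simp [hz2, hw]
  have him : (spec α τ ℓ).im ≠ 0 := by
    have h1 : (spec α τ ℓ).im = Real.exp (α * ℓ) * Real.sin τ := by
      unfold spec; rw [Complex.exp_im]; simp
    rw [h1]
    exact (mul_pos (Real.exp_pos _) (Real.sin_pos_of_pos_of_lt_pi h.tau_pos h.tau_lt_pi)).ne'
  obtain ⟨m, hm⟩ := h.adm.exists_decRay him
  have hφ : |w₀.im| < φ := by rw [hw, abs_of_pos h.phi_pos]; exact h.phi_lt
  refine ⟨m, by rw [hμ]; exact hm w₀ hφ, ?_⟩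
  rw [hμ]
  set F := Y α (spec α τ ℓ) 1 m
  set T := Real.exp (b + ℓ - w₀.re) with hT
  have hT0 : 0 < T := Real.exp_pos _
  have hwT : (b + φ₀ * I + ℓ : ℂ) = w₀ + Real.log T := by
    rw [hT, Real.log_exp, ← hw]
    refine Complex.ext ?_ ?_
    · simp
    · simp
  have h1 : ∫ x in Ioi 0, ‖ray F (b + φ₀ * I + ℓ) x‖ ^ 2 =
      T⁻¹ * ∫ x in Ioi 0, ‖ray F w₀ x‖ ^ 2 := by
    have h2 := integral_comp_mul_left_Ioi (fun x => ‖ray F w₀ x‖ ^ 2) 0 hT0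
    rw [mul_zero, smul_eq_mul] at h2
    rw [← h2]
    refine setIntegral_congr_fun measurableSet_Ioi fun x hx => ?_
    simp only [hwT, ray_add_real F w₀ hT0 hx]
  have h3 := hB ℓ hℓ m hm
  rw [h1, inv_mul_le_iff₀ hT0] at h3
  refine h3.trans ?_
  have h4 : Real.exp ℓ ≤ lrg α ℓ := Real.exp_le_exp.2 (by nlinarith)
  have h5 : T = Real.exp (b - w₀.re) * Real.exp ℓ := by rw [hT, ← Real.exp_add]; ring_nf
  rw [h5, mul_assoc]
  refine mul_le_mul_of_nonneg_left ?_ (Real.exp_pos _).le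
  rw [← mul_div_assoc, div_le_iff₀ lrg_pos, mul_comm]
  calc B * Real.exp ℓ ≤ |B| * Real.exp ℓ :=
        mul_le_mul_of_nonneg_right (le_abs_self _) (Real.exp_pos _).le
    _ ≤ _ := mul_le_mul_of_nonneg_left h4 (abs_nonneg _)

/-- A globally continuous function agreeing with the square root on the right half plane. -/
noncomputable def halfRoot (W : ℂ) : ℂ := ((max W.re 0 : ℝ) + W.im * I : ℂ) ^ (1 / 2 : ℂ)

lemma continuous_halfRoot : Continuous halfRoot :=
  continuousOn_cpow_half.comp_continuous (by fun_prop) fun W => by simp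

/-- The rescaled integral of the phase up to the turning radius. -/
noncomputable def phaseInt (α q β : ℝ) : ℂ :=
  ∫ s in (0 : ℝ)..1, omU * halfRoot ((((q * s ^ α : ℝ) : ℂ) * exp (β * I) - 1) / omU ^ 2)

lemma continuous_phaseInt (hα : 0 < α) : Continuous fun p : ℝ × ℝ => phaseInt α p.1 p.2 := by
  unfold phaseInt
  refine intervalIntegral.continuous_parametric_intervalIntegral_of_continuous' ?_ 0 1
  have hc : Continuous fun ξ : ℝ => ξ ^ α := Real.continuous_rpow_const hα.le
  have hr := continuous_halfRoot
  unfold Function.uncurry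
  fun_prop

lemma integral_tint {β q : ℝ} (h0 : 0 ≤ β) (h1 : β ≤ Real.pi) (hq : 0 < q) (hα : 0 < α) :
    ∫ ξ in (0 : ℝ)..q ^ (1 / α), tint α β ξ = ((q ^ (1 / α) : ℝ) : ℂ) * phaseInt α q β := by
  have h2 := intervalIntegral.smul_integral_comp_mul_left (a := 0) (b := 1) (tint α β) (q ^ (1 / α))
  rw [mul_zero, mul_one] at h2
  rw [← h2, real_smul, phaseInt]
  congr 1
  refine intervalIntegral.integral_congr fun s hs => ?_
  rw [uIcc_of_le zero_le_one] at hs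
  have h3 : (q ^ (1 / α) * s) ^ α = q * s ^ α := by
    rw [Real.mul_rpow (by positivity) hs.1, ← Real.rpow_mul hq.le, one_div_mul_cancel hα.ne',
      Real.rpow_one]
  simp only [tint, h3, rot, halfRoot, div_omU_re]
  have h4 : 0 ≤ (((q * s ^ α : ℝ) : ℂ) * exp (β * I) - 1).im := by
    rw [sub_im, im_ofReal_mul, exp_ofReal_mul_I_im, one_im, sub_zero]
    exact mul_nonneg (mul_nonneg hq.le (Real.rpow_nonneg hs.1 _))
      (Real.sin_nonneg_of_nonneg_of_le_pi h0 h1)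
  rw [max_eq_left h4, ← div_omU_re, re_add_im]

/-- The growth rate at the turning radius, as a function of the two angles. -/
noncomputable def rate (α θ t : ℝ) : ℝ :=
  -(2 * Real.sin ((t - 2 * θ / (α + 2)) * ord α) * kap0 α) -
    (exp ((t / 2 : ℝ) * I) * ((((Real.sin t / Real.sin θ) ^ (1 / α) : ℝ) : ℂ) *
      phaseInt α (Real.sin t / Real.sin θ) (θ - t))).re

lemma continuousAt_rate (hα : 0 < α) (h1 : 0 < Real.sin θ) (h2 : 0 < Real.sin t) :
    ContinuousAt (fun p : ℝ × ℝ => rate α p.1 p.2) (θ, t) := by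
  have hq : ContinuousAt (fun p : ℝ × ℝ => Real.sin p.2 / Real.sin p.1) (θ, t) :=
    ContinuousAt.div (by fun_prop) (by fun_prop) h1.ne'
  have hr : ContinuousAt (fun p : ℝ × ℝ => (Real.sin p.2 / Real.sin p.1) ^ (1 / α)) (θ, t) :=
    hq.rpow_const (Or.inl (_root_.div_pos h2 h1).ne')
  have hk : ContinuousAt (fun p : ℝ × ℝ => phaseInt α (Real.sin p.2 / Real.sin p.1) (p.1 - p.2))
      (θ, t) := by
    have h3 : ContinuousAt (fun p : ℝ × ℝ => (Real.sin p.2 / Real.sin p.1, p.1 - p.2)) (θ, t) :=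
      hq.prodMk (by fun_prop)
    have h4 := continuous_phaseInt hα
    generalize phaseInt α = K at h4 ⊢
    have h5 : Continuous fun p : ℝ × ℝ => K p.1 p.2 := h4
    exact h5.continuousAt.comp' h3
  have hr' := continuous_ofReal.continuousAt.comp hr
  unfold rate
  refine ContinuousAt.sub (by fun_prop) (continuous_re.continuousAt.comp ?_)
  exact ContinuousAt.mul (by fun_prop) (hr'.mul hk)

lemma Geo.expo_eq_rate (h : Geo α φ φ₀ τ) :
    expo α φ₀ τ (turn α φ₀ τ) = rate α ((α + 2) * φ₀) (τ + 2 * φ₀) := by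
  have hα := h.adm.pos
  unfold expo turn rate
  rw [integral_tint h.beta_nonneg h.beta_le_pi (_root_.div_pos h.sin_t_pos h.sin_theta_pos) hα,
    show τ + 2 * φ₀ - 2 * ((α + 2) * φ₀) / (α + 2) = τ by field_simp; ring,
    show (α + 2) * φ₀ - (τ + 2 * φ₀) = α * φ₀ - τ by ring]

end PowerPotential

namespace PowerPotential
open Complex Filter Topology ComplexConjugate

variable {α φ φ₀ τ θ t θ₀ : ℝ} {m e w₀ : ℂ}

lemma t0_mul_ord (hα : 0 < α) : t0 α * ord α = Real.pi := by
  unfold t0 ord; field_simp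

lemma ord_pos (hα : 0 < α) : 0 < ord α := by unfold ord; positivity

lemma mul_ord_lt_pi (hα : 0 < α) (h : t < t0 α) : t * ord α < Real.pi := by
  rw [← t0_mul_ord hα]; exact mul_lt_mul_of_pos_right h (ord_pos hα)

lemma t0_pos (hα : 0 < α) : 0 < t0 α := by
  unfold t0; have := Real.pi_pos; positivity

lemma t0_lt_pi (hα : 0 < α) (hα2 : α < 2) : t0 α < Real.pi := by
  unfold t0
  rw [div_lt_iff₀ (by linarith)]
  nlinarith [Real.pi_pos]

lemma pi_mul_lt_two_t0 (hα : 0 < α) (hα2 : α < 2) : Real.pi * α < 2 * t0 α := by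
  unfold t0
  rw [← mul_div_assoc, lt_div_iff₀ (by linarith)]
  nlinarith [Real.pi_pos, mul_pos Real.pi_pos hα]

lemma kap0_pos (hα : 0 < α) : 0 < kap0 α := by
  have hc : Continuous fun ξ : ℝ => √(1 - ξ ^ α) := by
    have : Continuous fun ξ : ℝ => ξ ^ α := Real.continuous_rpow_const hα.le
    fun_prop
  refine intervalIntegral.intervalIntegral_pos_of_pos_on (hc.intervalIntegrable _ _)
    (fun x hx => Real.sqrt_pos.2 ?_) one_pos
  linarith [Real.rpow_lt_one hx.1.le hx.2 hα]

lemma tint_sq (ξ : ℝ) : tint α t ξ ^ 2 = ((ξ ^ α : ℝ) : ℂ) * exp (t * I) - 1 := rot_sq omU_ne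

lemma tint_zero_right (hα : 0 < α) : tint α t 0 = I := by
  have h := eq_I_mul_sqrt_of_sq (s := 1) (z := tint α t 0) zero_le_one
    (by rw [tint_sq, Real.zero_rpow hα.ne']; simp)
    (rot_omU_quadrant (by rw [tint_im, Real.zero_rpow hα.ne', zero_mul])).2
  simpa using h

/-- The function `ρ` of the statement is the growth rate along the critical direction. -/
lemma rate_t0_eq {r : ℝ} (hα : 0 < α) (hα2 : α < 2)
    (hθ : θ ∈ Ico (t0 α) (min Real.pi (Real.pi * α)))
    (hr : ∀ g : ℝ → ℂ, ContinuousOn g (Icc 0 (Z0 α θ)) →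
      (∀ t ∈ Icc (0 : ℝ) (Z0 α θ), g t ^ 2 = exp (I * (θ : ℂ)) * ((t ^ α : ℝ) : ℂ)
          - exp (I * ((t0 α : ℝ) : ℂ))) →
      g 0 = -I * exp (I * ((t0 α / 2 : ℝ) : ℂ)) →
      r = (∫ t in (0 : ℝ)..(Z0 α θ), g t).re
        - 2 * Real.sin (θ / α) * ∫ ξ in (0 : ℝ)..1, √(1 - ξ ^ α)) :
    r = rate α θ (t0 α) := by
  have hp := t0_pos hα
  have hθπ : θ < Real.pi := hθ.2.trans_le (min_le_left _ _)
  have hs : 0 < Real.sin θ := Real.sin_pos_of_pos_of_lt_pi (hp.trans_le hθ.1) hθπ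
  have hs0 : 0 < Real.sin (t0 α) := Real.sin_pos_of_pos_of_lt_pi hp (t0_lt_pi hα hα2)
  have hβ0 : 0 ≤ θ - t0 α := by linarith [hθ.1]
  have hβ1 : θ - t0 α ≤ Real.pi := by linarith
  have h1 := hr (fun x => -exp (I * ((t0 α / 2 : ℝ) : ℂ)) * tint α (θ - t0 α) x)
    (continuousOn_const.mul ((continuousOn_tint hα hβ0 hβ1).mono fun x hx => hx.1))
    (fun x _ => by
      have e1 : exp (I * ((t0 α / 2 : ℝ) : ℂ)) ^ 2 = exp (I * ((t0 α : ℝ) : ℂ)) := by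
        rw [← Complex.exp_nat_mul]; congr 1; push_cast; ring
      have e2 : exp (I * (θ : ℂ)) =
          exp (I * ((t0 α : ℝ) : ℂ)) * exp (((θ - t0 α : ℝ) : ℂ) * I) := by
        rw [← Complex.exp_add]; congr 1; push_cast; ring
      rw [mul_pow, neg_sq, e1, tint_sq, e2]; ring)
    (by rw [tint_zero_right hα]; ring)
  rw [h1, rate, intervalIntegral.integral_const_mul, Z0,
    integral_tint hβ0 hβ1 (_root_.div_pos hs0 hs) hα]
  have h2 : Real.sin ((t0 α - 2 * θ / (α + 2)) * ord α) = Real.sin (θ / α) := by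
    rw [sub_mul, t0_mul_ord hα, show 2 * θ / (α + 2) * ord α = θ / α by unfold ord; field_simp,
      Real.sin_pi_sub]
  rw [h2, mul_comm I, neg_mul, neg_re, kap0]
  ring

lemma rate_t0_t0_neg (hα : 0 < α) (hα2 : α < 2) : rate α (t0 α) (t0 α) < 0 := by
  have hp := t0_pos hα
  have hπ := t0_lt_pi hα hα2
  have hs0 : 0 < Real.sin (t0 α) := Real.sin_pos_of_pos_of_lt_pi hp hπ
  have h1 : phaseInt α 1 0 = I * kap0 α := by
    have h2 := integral_tint (β := 0) (q := 1) le_rfl Real.pi_pos.le one_pos hα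
    rw [Real.one_rpow, ofReal_one, one_mul] at h2
    rw [← h2, kap0, ← intervalIntegral.integral_ofReal, ← intervalIntegral.integral_const_mul]
    refine intervalIntegral.integral_congr fun ξ hξ => ?_
    rw [uIcc_of_le zero_le_one] at hξ
    refine eq_I_mul_sqrt_of_sq (by linarith [Real.rpow_le_one hξ.1 hξ.2 hα.le]) ?_
      (rot_omU_quadrant (by rw [tint_im, Real.sin_zero, mul_zero])).2
    rw [tint_sq]; simp
  have h3 : Real.sin ((t0 α - 2 * t0 α / (α + 2)) * ord α) = Real.sin (t0 α / 2) := by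
    rw [show (t0 α - 2 * t0 α / (α + 2)) * ord α = t0 α / 2 by unfold ord; field_simp; ring]
  unfold rate
  rw [h3, div_self hs0.ne', Real.one_rpow, sub_self, h1]
  have h4 : 0 < Real.sin (t0 α / 2) := Real.sin_pos_of_pos_of_lt_pi (by linarith) (by linarith)
  have h5 : (exp ((t0 α / 2 : ℝ) * I) * (((1 : ℝ) : ℂ) * (I * kap0 α))).re =
      -(Real.sin (t0 α / 2) * kap0 α) := by
    rw [show exp ((t0 α / 2 : ℝ) * I) * (((1 : ℝ) : ℂ) * (I * kap0 α)) =
      (kap0 α : ℂ) * (exp ((t0 α / 2 : ℝ) * I) * I) by push_cast; ring, re_ofReal_mul, mul_I_re,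
      exp_ofReal_mul_I_im]; ring
  rw [h5]
  nlinarith [mul_pos h4 (kap0_pos hα)]

lemma continuousOn_rate_t0 (hα : 0 < α) (hα2 : α < 2) :
    ContinuousOn (fun θ => rate α θ (t0 α)) (Ico (t0 α) Real.pi) := fun θ hθ => by
  have h := continuousAt_rate (θ := θ) (t := t0 α) hα
    (Real.sin_pos_of_pos_of_lt_pi ((t0_pos hα).trans_le hθ.1) hθ.2)
    (Real.sin_pos_of_pos_of_lt_pi (t0_pos hα) (t0_lt_pi hα hα2))
  exact (h.comp' (f := fun θ : ℝ => (θ, t0 α)) (by fun_prop)).continuousWithinAt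

/-- The rate is negative up to its first zero. -/
lemma rate_t0_neg (hα : 0 < α) (hα2 : α < 2) (hπ : θ₀ ≤ Real.pi)
    (hne : ∀ θ ∈ Ioo (t0 α) θ₀, rate α θ (t0 α) ≠ 0) (hθ : θ ∈ Ico (t0 α) θ₀) :
    rate α θ (t0 α) < 0 := by
  by_contra! hcon
  have hc : ContinuousOn (fun θ => rate α θ (t0 α)) (Icc (t0 α) θ) :=
    (continuousOn_rate_t0 hα hα2).mono fun x hx => ⟨hx.1, hx.2.trans_lt (hθ.2.trans_le hπ)⟩
  obtain ⟨x, hx, hx0⟩ := intermediate_value_Icc hθ.1 hc ⟨(rate_t0_t0_neg hα hα2).le, hcon⟩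
  rcases hx.1.eq_or_lt with h | h
  · subst h; exact absurd hx0 (rate_t0_t0_neg hα hα2).ne
  · exact hne x ⟨h, hx.2.trans_lt hθ.2⟩ hx0

/-- The parameters of the contour argument exist when the rate is negative. -/
lemma exists_direction (hα : 0 < α) (hα2 : α < 2) (h0 : t0 α ≤ θ) (hπ : θ < Real.pi)
    (hπα : θ < Real.pi * α) (hneg : rate α θ (t0 α) < 0) :
    ∃ t η, 0 < η ∧ t < θ ∧ 2 * θ / (α + 2) < t ∧ t + η < t0 α ∧ θ + η - t < t0 α ∧
      θ + η ≤ Real.pi ∧ rate α θ t < 0 := by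
  have hp := t0_pos hα
  have hs : 0 < Real.sin θ := Real.sin_pos_of_pos_of_lt_pi (hp.trans_le h0) hπ
  have hs0 := Real.sin_pos_of_pos_of_lt_pi hp (t0_lt_pi hα hα2)
  have hc : ContinuousAt (fun t => rate α θ t) (t0 α) :=
    (continuousAt_rate hα hs hs0).comp' (f := fun t : ℝ => (θ, t)) (by fun_prop)
  have e1 : ∀ᶠ t in 𝓝[<] (t0 α), rate α θ t < 0 :=
    (hc.eventually_lt_const hneg).filter_mono nhdsWithin_le_nhds
  have e2 : ∀ᶠ t in 𝓝[<] (t0 α), 2 * θ / (α + 2) < t := by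
    refine (eventually_gt_nhds ?_).filter_mono nhdsWithin_le_nhds
    unfold t0
    exact div_lt_div_of_pos_right (by linarith) (by linarith)
  have e3 : ∀ᶠ t in 𝓝[<] (t0 α), θ + (t0 α - t) / 2 - t < t0 α := by
    refine Eventually.filter_mono nhdsWithin_le_nhds
      (ContinuousAt.eventually_lt (by fun_prop) (by fun_prop) ?_)
    linarith [pi_mul_lt_two_t0 hα hα2]
  have e4 : ∀ᶠ t in 𝓝[<] (t0 α), θ + (t0 α - t) / 2 < Real.pi := by
    refine Eventually.filter_mono nhdsWithin_le_nhds
      (ContinuousAt.eventually_lt (by fun_prop) (by fun_prop) ?_)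
    linarith
  obtain ⟨t, h1, h2, h3, h4, h5⟩ := (e1.and <| e2.and <| e3.and <| e4.and
    self_mem_nhdsWithin).exists
  have h6 : t < t0 α := h5
  exact ⟨t, (t0 α - t) / 2, by linarith, by linarith, h2, by linarith, h3, h4.le, h1⟩

end PowerPotential

namespace PowerPotential
open Complex Filter Topology ComplexConjugate

variable {α θ θ₀ : ℝ} {c lam μ q w₀ : ℂ} {y f : ℝ → ℂ}

/-- A function orthogonal to all eigenfunctions on the ray vanishes. -/
theorem ae_zero_of_orthogonal (hα : 0 < α) (hα2 : α < 2) (h0 : 0 ≤ θ) (hπ : θ < Real.pi)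
    (hw : (α + 2) * w₀.im = θ)
    (hθ : t0 α ≤ θ → θ < Real.pi * α ∧ rate α θ (t0 α) < 0)
    (hf : AEStronglyMeasurable f (volume.restrict (Ioi 0)))
    (hf2 : IntegrableOn (fun x => ‖f x‖ ^ 2) (Ioi 0))
    (horth : ∀ μ q, DecRay α μ 0 q w₀ → ∫ x in Ioi 0, f x * ray (Y α μ 0 q) w₀ x = 0) :
    ∀ᵐ x, x ∈ Ioi (0 : ℝ) → f x = 0 := by
  have hα' : 0 < α + 2 := by linarith
  have him : w₀.im = θ / (α + 2) := by rw [← hw]; field_simp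
  have ha : Adm α ((θ + Real.pi) / 2 / (α + 2)) :=
    ⟨hα, hα2, by have := Real.pi_pos; positivity, by rw [mul_div_cancel₀ _ hα'.ne']; linarith⟩
  have hlt : θ / (α + 2) < (θ + Real.pi) / 2 / (α + 2) :=
    div_lt_div_of_pos_right (by linarith) hα'
  have hw₀ : |w₀.im| < (θ + Real.pi) / 2 / (α + 2) := by
    rwa [him, abs_of_nonneg (by positivity)]
  rcases lt_or_ge θ (t0 α) with h | h
  · set η := min ((t0 α - θ) / 4) ((Real.pi - θ) / 2) with hη
    have hη0 : 0 < η := lt_min (by linarith) (by linarith)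
    have h1 : η ≤ (t0 α - θ) / 4 := min_le_left _ _
    have h2 : η ≤ (Real.pi - θ) / 2 := min_le_right _ _
    exact Outer.ae_zero_of_lt ha hw₀ ⟨hα, hα2, hw, h0, hη0, by linarith⟩ (by linarith) hf hf2
      horth (mul_ord_lt_pi hα (by linarith))
  · obtain ⟨hπα, hneg⟩ := hθ h
    obtain ⟨t, η, hη0, ht1, ht2, ht3, ht4, ht5, hr⟩ := exists_direction hα hα2 h hπ hπα hneg
    have e1 : 2 * (θ / (α + 2)) = 2 * θ / (α + 2) := by ring
    have e2 : (α + 2) * (θ / (α + 2)) = θ := mul_div_cancel₀ _ hα'.ne'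
    have hg : Geo α ((θ + Real.pi) / 2 / (α + 2)) (θ / (α + 2)) (t - 2 * (θ / (α + 2))) :=
      ⟨ha, by linarith, by linarith, hlt⟩
    have hneg' := hg.expo_eq_rate
    rw [e2, sub_add_cancel] at hneg'
    obtain ⟨X, B, hB⟩ := hg.ray_bound (hneg' ▸ hr) him
    rw [sub_add_cancel] at hB
    exact Outer.ae_zero_of_ray_bound ha hw₀ ⟨hα, hα2, hw, h0, hη0, ht5⟩
      (by linarith [t0_pos hα]) hf hf2 horth (mul_ord_lt_pi hα ht3) (mul_ord_lt_pi hα ht4) hB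

/-- The restriction to the ray of a decaying solution vanishing at the origin is an
eigenfunction. -/
lemma isEigenfunction_of_decRay (hα : 0 < α) (h : DecRay α μ 0 q w₀) (hq : q ≠ 0) :
    IsEigenfunction α (exp ((α + 2) * w₀)) (exp (2 * w₀) * μ)
      (fun x => if 0 < x then ray (Y α μ 0 q) w₀ x else 0) := by
  have hs := sol_ray hα μ 0 q w₀
  set F := ray (Y α μ 0 q) w₀ with hF
  set y : ℝ → ℂ := fun x => if 0 < x then F x else 0 with hy
  have hev : ∀ x > 0, y =ᶠ[𝓝 x] F := fun x hx => by
    filter_upwards [lt_mem_nhds hx] with z hz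
    simp [hy, hz]
  have hpos : ∀ x > 0, y x = F x := fun x hx => (hev x hx).self_of_nhds
  refine ⟨fun x hx => ?_, by simp [hy], ?_, ⟨rayd (Yd α μ 0 q) w₀, fun x hx => ?_, fun x hx => ?_⟩,
    ?_⟩
  · rcases (mem_Ici.1 hx).eq_or_lt with h0 | h0
    · subst h0
      have h1 : Tendsto y (𝓝[>] 0) (𝓝 (y 0)) := by
        rw [show y 0 = 0 by simp [hy]]
        refine (tendsto_ray_Y hα μ 0 q w₀).congr' ?_
        filter_upwards [self_mem_nhdsWithin] with z hz using (hpos z hz).symm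
      exact continuousWithinAt_Ioi_iff_Ici.1 h1
    · exact (((hs.d1 x h0).congr_of_eventuallyEq (hev x h0)).continuousAt).continuousWithinAt
  · by_contra! hcon
    have hd : ∀ x > 0, rayd (Yd α μ 0 q) w₀ x = 0 := fun x hx => by
      refine (hs.d1 x hx).unique ((hasDerivAt_const x (0 : ℂ)).congr_of_eventuallyEq ?_)
      filter_upwards [lt_mem_nhds hx] with z hz
      rw [← hpos z hz, hcon z (le_of_lt hz)]
    have h1 := tendsto_rayd_Yd hα μ 0 q w₀
    have h2 : Tendsto (rayd (Yd α μ 0 q) w₀) (𝓝[>] 0) (𝓝 0) :=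
      tendsto_const_nhds.congr' (by
        filter_upwards [self_mem_nhdsWithin] with z hz using (hd z hz).symm)
    exact mul_ne_zero hq (Complex.exp_ne_zero _) (tendsto_nhds_unique h1 h2)
  · exact (hs.d1 x hx).congr_of_eventuallyEq (hev x hx)
  · rw [hpos x hx]
    exact hs.d2 x hx
  · refine (h.sq_integrable hα).congr_fun (fun x hx => ?_) measurableSet_Ioi
    simp only [hpos x hx, hF]

lemma isEigenfunction_conj (h : IsEigenfunction α c lam y) :
    IsEigenfunction α (conj c) (conj lam) (fun x => conj (y x)) := by
  obtain ⟨h1, h2, ⟨x, hx, hx0⟩, ⟨y', h3, h4⟩, h5⟩ := h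
  refine ⟨continuous_conj.comp_continuousOn h1, by simp [h2], ⟨x, hx, by simpa using hx0⟩,
    ⟨fun x => conj (y' x), fun x hx => ?_, fun x hx => ?_⟩, by simpa using h5⟩
  · exact (h3 x hx).star
  · simpa using (h4 x hx).star

/-- Only the zero function is orthogonal to every eigenfunction. -/
def OrthTrivial (α : ℝ) (c : ℂ) : Prop :=
  ∀ f : ℝ → ℂ, AEStronglyMeasurable f (volume.restrict (Ioi 0)) →
    IntegrableOn (fun x => ‖f x‖ ^ 2) (Ioi 0) →
    (∀ lam y, IsEigenfunction α c lam y → ∫ x in Ioi 0, f x * y x = 0) →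
    ∀ᵐ x ∂(volume.restrict (Ioi (0 : ℝ))), f x = 0

lemma OrthTrivial.of_conj (h : OrthTrivial α (conj c)) : OrthTrivial α c := by
  intro f hf hf2 horth
  have h1 := h (fun x => conj (f x)) (continuous_conj.comp_aestronglyMeasurable hf)
    (by simpa using hf2) fun lam y hy => by
      have h2 := isEigenfunction_conj hy
      rw [conj_conj] at h2
      have h3 := congrArg conj (horth _ _ h2)
      rw [← integral_conj, map_zero] at h3
      simpa using h3
  filter_upwards [h1] with x hx
  simpa using hx

lemma OrthTrivial.complete (h : OrthTrivial α c) : EigenfunctionsComplete α c := by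
  unfold EigenfunctionsComplete
  rw [← Submodule.topologicalClosure_coe]
  refine (congrArg _ ?_).trans Submodule.top_coe
  rw [Submodule.topologicalClosure_eq_top_iff, Submodule.eq_bot_iff]
  intro G hG
  have hG2 := Lp.memLp G
  have h1 := h (fun x => conj (G x))
    (continuous_conj.comp_aestronglyMeasurable hG2.aestronglyMeasurable)
    (by
      have := (memLp_two_iff_integrable_sq_norm hG2.aestronglyMeasurable).1 hG2
      simpa [IntegrableOn] using this)
    fun lam y hy => by
      have hm : AEStronglyMeasurable y (volume.restrict (Ioi 0)) :=
        (hy.1.mono Ioi_subset_Ici_self).aestronglyMeasurable measurableSet_Ioi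
      have hy2 : MemLp y 2 (volume.restrict (Ioi 0)) :=
        (memLp_two_iff_integrable_sq_norm hm).2 hy.2.2.2.2
      have h2 : inner ℂ G (hy2.toLp y) = 0 := by
        refine Submodule.inner_left_of_mem_orthogonal (Submodule.subset_span ?_) hG
        exact ⟨lam, y, hy, hy2.coeFn_toLp⟩
      rw [L2.inner_def] at h2
      rw [← h2]
      refine integral_congr_ae ?_
      filter_upwards [hy2.coeFn_toLp] with x hx
      rw [RCLike.inner_apply, hx, mul_comm]
  refine Lp.eq_zero_iff_ae_eq_zero.2 ?_
  filter_upwards [h1] with x hx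
  simpa using hx

lemma orthTrivial_of_arg_nonneg (hα : 0 < α) (hα2 : α < 2) (hc : c ≠ 0) (h0 : 0 ≤ c.arg)
    (hπ : c.arg < Real.pi)
    (hθ : t0 α ≤ c.arg → c.arg < Real.pi * α ∧ rate α c.arg (t0 α) < 0) : OrthTrivial α c := by
  intro f hf hf2 horth
  have hα' : ((α + 2 : ℝ) : ℂ) ≠ 0 := by
    rw [Ne, ofReal_eq_zero]; linarith
  set w₀ : ℂ := log c / ((α + 2 : ℝ) : ℂ) with hw
  have hexp : exp ((α + 2) * w₀) = c := by
    rw [hw, show ((α : ℂ) + 2) = ((α + 2 : ℝ) : ℂ) by push_cast; rfl, mul_div_cancel₀ _ hα',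
      exp_log hc]
  have him : (α + 2) * w₀.im = c.arg := by
    rw [hw, div_ofReal_im, log_im, mul_div_cancel₀ _ (by linarith)]
  rw [ae_restrict_iff' measurableSet_Ioi]
  refine ae_zero_of_orthogonal hα hα2 h0 hπ him hθ hf hf2 fun μ q hq => ?_
  rcases eq_or_ne q 0 with rfl | hq0
  · simp [ray, Y]
  · have h1 := isEigenfunction_of_decRay hα hq hq0
    rw [hexp] at h1
    refine (setIntegral_congr_fun measurableSet_Ioi fun x hx => ?_).trans (horth _ _ h1)
    simp only [if_pos (mem_Ioi.1 hx)]

end PowerPotential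

/-- if `α ∈ (0,2)`, `c ≠ 0` and `|arg c| < θ₀(α)` where `θ₀(α)` is the unique
zero of `ρ_α` in `(t₀(α), min(π, πα))`, then the system of eigenfunctions of `𝓛_{c,α}` is
complete in `L²((0,∞),ℂ)`. -/
theorem stmt2 (α : ℝ) (hα0 : 0 < α) (hα2 : α < 2) (ρ : ℝ → ℝ) (θ₀ : ℝ)
    (hρ : ∀ θ ∈ Set.Ico (t0 α) (min Real.pi (Real.pi * α)), ∀ g : ℝ → ℂ,
      ContinuousOn g (Set.Icc 0 (Z0 α θ)) →
      (∀ t ∈ Set.Icc (0 : ℝ) (Z0 α θ),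
        g t ^ 2 = Complex.exp (Complex.I * (θ : ℂ)) * ((t ^ α : ℝ) : ℂ)
          - Complex.exp (Complex.I * ((t0 α : ℝ) : ℂ))) →
      g 0 = -Complex.I * Complex.exp (Complex.I * ((t0 α / 2 : ℝ) : ℂ)) →
      ρ θ = (∫ t in (0 : ℝ)..(Z0 α θ), g t).re
        - 2 * Real.sin (θ / α) * ∫ ξ in (0 : ℝ)..1, Real.sqrt (1 - ξ ^ α))
    (hθ₀ : θ₀ ∈ Set.Ioo (t0 α) (min Real.pi (Real.pi * α)) ∧ ρ θ₀ = 0 ∧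
      ∀ θ ∈ Set.Ioo (t0 α) (min Real.pi (Real.pi * α)), ρ θ = 0 → θ = θ₀)
    (c : ℂ) (hc : c ≠ 0) (harg : |c.arg| < θ₀) :
    EigenfunctionsComplete α c := by
  obtain ⟨⟨h1, h2⟩, -, huniq⟩ := hθ₀
  have hπ : θ₀ < Real.pi := h2.trans_le (min_le_left _ _)
  have hρ' : ∀ θ ∈ Ico (t0 α) (min Real.pi (Real.pi * α)),
      ρ θ = PowerPotential.rate α θ (t0 α) := fun θ hθ =>
    PowerPotential.rate_t0_eq hα0 hα2 hθ (hρ θ hθ)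
  have hneg : ∀ θ, t0 α ≤ θ → θ < θ₀ → θ < Real.pi * α ∧ PowerPotential.rate α θ (t0 α) < 0 :=
    fun θ ha hb => ⟨hb.trans (h2.trans_le (min_le_right _ _)),
      PowerPotential.rate_t0_neg hα0 hα2 hπ.le (fun x hx h0 => hx.2.ne
        (huniq x ⟨hx.1, hx.2.trans h2⟩
          ((hρ' x ⟨hx.1.le, hx.2.trans h2⟩).trans h0))) ⟨ha, hb⟩⟩
  refine PowerPotential.OrthTrivial.complete ?_
  rcases le_total 0 c.arg with h0 | h0
  · rw [abs_of_nonneg h0] at harg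
    exact PowerPotential.orthTrivial_of_arg_nonneg hα0 hα2 hc h0 (harg.trans hπ)
      fun h => hneg _ h harg
  · rw [abs_of_nonpos h0] at harg
    have hconj : (starRingEnd ℂ c).arg = -c.arg := by
      rw [Complex.arg_conj, if_neg (by linarith [Real.pi_pos])]
    refine PowerPotential.OrthTrivial.of_conj (PowerPotential.orthTrivial_of_arg_nonneg hα0 hα2
      (by simpa using hc) ?_ ?_ ?_)
    · rw [hconj]; linarith
    · rw [hconj]; linarith
    · rw [hconj]; exact fun h => hneg _ h harg
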